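/- Let g ≥ 2 and n ≥ 2, and let ρ ∈ HIT_n. Then every matrix ξ ∈ SL_n(ℝ) that commutes with ρ(γ) for every γ ∈ Γ_g satisfies ξ = I or ξ = −I; in other words, the centralizer of ρ(Γ_g) in SL_n(ℝ) is contained in {I, −I}. -/

import Mathlib

open Matrix MvPolynomial
open scoped commutatorElement

/-- `SL n K`: the special linear group of `n × n` matrices over `K`. -/
abbrev SL (n : ℕ) (K : Type) [CommRing K] := Matrix.SpecialLinearGroup (Fin n) K

/-- Topology on `SL n ℝ` induced from the space of matrices (the Euclidean topology). -/
instance (n : ℕ) (K : Type) [CommRing K] [TopologicalSpace K] :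
    TopologicalSpace (SL n K) :=
  TopologicalSpace.induced (fun A => (A : Matrix (Fin n) (Fin n) K)) inferInstance

/-- The relator `[a₁,b₁][a₂,b₂]⋯[a_g,b_g]` of the genus-`g` surface group;
`(i, false)` is the generator `aᵢ` and `(i, true)` is `bᵢ`. -/
def surfaceRelator (g : ℕ) : FreeGroup (Fin g × Bool) :=
  (List.ofFn fun i : Fin g =>
    ⁅FreeGroup.of (i, false), FreeGroup.of (i, true)⁆).prod

/-- The surface group `Γ_g` of genus `g`. -/
abbrev SurfaceGroup (g : ℕ) : Type :=
  PresentedGroup ({surfaceRelator g} : Set (FreeGroup (Fin g × Bool)))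

/-- The tuple `(ρ(a₁), ρ(b₁), …, ρ(a_g), ρ(b_g))` of matrices associated to a
representation `ρ : Γ_g → SL n ℝ`. -/
def repTuple {g n : ℕ} (ρ : SurfaceGroup g →* SL n ℝ) :
    (Fin g × Bool) → Matrix (Fin n) (Fin n) ℝ :=
  fun x => (ρ (PresentedGroup.of x) : Matrix (Fin n) (Fin n) ℝ)

/-- `Hom(Γ_g, SL_n(K))` as a subset of `K^{2g·n²}`: the `2g`-tuples of matrices of
determinant one whose product of commutators is the identity. -/
def RepVariety (g n : ℕ) (K : Type) [CommRing K] :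
    Set ((Fin g × Bool) → Matrix (Fin n) (Fin n) K) :=
  {A | (∀ x, (A x).det = 1) ∧
    (List.ofFn fun i : Fin g =>
      A (i, false) * A (i, true) * (A (i, false))⁻¹ * (A (i, true))⁻¹).prod = 1}

/-- `ρ₀ : Γ_g → SL₂(ℝ)` is discrete and faithful: injective with discrete image. -/
def IsDiscreteFaithful {g : ℕ} (ρ₀ : SurfaceGroup g →* SL 2 ℝ) : Prop :=
  Function.Injective ρ₀ ∧ DiscreteTopology (ρ₀.range : Subgroup (SL 2 ℝ))

/-- `j : SL₂(ℝ) → SL_n(ℝ)` is a continuous homomorphism acting irreducibly on `ℝⁿ`. -/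
def IsIrreducibleEmbedding (n : ℕ) (j : SL 2 ℝ →* SL n ℝ) : Prop :=
  Continuous j ∧
  ∀ W : Submodule ℝ (Fin n → ℝ),
    (∀ A : SL 2 ℝ, ∀ v ∈ W, (j A : Matrix (Fin n) (Fin n) ℝ).mulVec v ∈ W) →
    W = ⊥ ∨ W = ⊤

/-- A tuple in `ℝ^{2g·n²}` is a Teichmüller representation if it comes from `j ∘ ρ₀` with
`ρ₀` discrete and faithful and `j` continuous and irreducible. -/
def IsTeichmuller (g n : ℕ) (T : (Fin g × Bool) → Matrix (Fin n) (Fin n) ℝ) : Prop :=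
  ∃ (ρ₀ : SurfaceGroup g →* SL 2 ℝ) (j : SL 2 ℝ →* SL n ℝ),
    IsDiscreteFaithful ρ₀ ∧ IsIrreducibleEmbedding n j ∧
    T = repTuple (j.comp ρ₀)

/-- The Hitchin component: the connected component (Euclidean topology) of
`Hom(Γ_g, SL_n(ℝ))` containing the Teichmüller representation `T`. -/
def HIT (g n : ℕ) (T : (Fin g × Bool) → Matrix (Fin n) (Fin n) ℝ) :
    Set ((Fin g × Bool) → Matrix (Fin n) (Fin n) ℝ) :=
  connectedComponentIn (RepVariety g n ℝ) T

/-- A subgroup `H ≤ SL_n(ℝ)` is Zariski-dense in `SL_n(ℝ)`. -/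
def IsZariskiDense (n : ℕ) (H : Subgroup (SL n ℝ)) : Prop :=
  ∀ P : MvPolynomial (Fin n × Fin n) ℝ,
    (∀ h ∈ H, eval (fun p => (h : Matrix (Fin n) (Fin n) ℝ) p.1 p.2) P = 0) →
    ∀ A : SL n ℝ, eval (fun p => (A : Matrix (Fin n) (Fin n) ℝ) p.1 p.2) P = 0

/-- A subgroup `Γ ≤ SL_n(ℝ)` is strongly dense: every pair of noncommuting elements
generates a Zariski-dense subgroup. -/
def IsStronglyDense (n : ℕ) (Γ : Subgroup (SL n ℝ)) : Prop :=
  ∀ x ∈ Γ, ∀ y ∈ Γ, x * y ≠ y * x → IsZariskiDense n (Subgroup.closure {x, y})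

namespace Hit

/-! ## Module A : total positivity -/

abbrev Mat (n : ℕ) := Matrix (Fin n) (Fin n) ℝ

/-- Minor with row indices `f` and column indices `g`. -/
noncomputable def mnr {n k : ℕ} (v : Mat n) (f g : Fin k → Fin n) : ℝ := (v.submatrix f g).det

lemma mnr_perm_left {n k : ℕ} (v : Mat n) (f g : Fin k → Fin n) (σ : Equiv.Perm (Fin k)) :
    mnr v (f ∘ σ) g = (Equiv.Perm.sign σ : ℤ) * mnr v f g := by
  unfold mnr
  rw [← Matrix.det_permute]; rfl

lemma mnr_perm_right {n k : ℕ} (v : Mat n) (f g : Fin k → Fin n) (σ : Equiv.Perm (Fin k)) :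
    mnr v f (g ∘ σ) = (Equiv.Perm.sign σ : ℤ) * mnr v f g := by
  unfold mnr
  rw [← Matrix.det_permute']; rfl

lemma mnr_transpose {n k : ℕ} (v : Mat n) (f g : Fin k → Fin n) :
    mnr vᵀ f g = mnr v g f := by
  unfold mnr
  rw [← Matrix.det_transpose]; rfl

lemma mnr_not_inj_left {n k : ℕ} (v : Mat n) (f g : Fin k → Fin n) (hf : ¬ Function.Injective f) :
    mnr v f g = 0 := by
  simp only [Function.Injective, not_forall] at hf
  obtain ⟨a, b, hab, hne⟩ := hf
  exact Matrix.det_zero_of_row_eq hne (by ext j; simp [hab])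

lemma mnr_mul_all {n k : ℕ} (v w : Mat n) (f g : Fin k → Fin n) :
    mnr (v * w) f g = ∑ p : Fin k → Fin n, (∏ i, v (f i) (p i)) * mnr w p g := by
  unfold mnr
  have h : (v * w).submatrix f g = fun i => ∑ l, v (f i) l • (fun j => w l (g j)) := by
    ext i j
    simp [Matrix.mul_apply]
  rw [h]
  have := (Matrix.detRowAlternating (n := Fin k) (R := ℝ)).toMultilinearMap.map_sum
    (fun (i : Fin k) (l : Fin n) => v (f i) l • (fun j => w l (g j)))
  refine this.trans ?_
  refine Finset.sum_congr rfl fun p _ => ?_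
  have := (Matrix.detRowAlternating (n := Fin k) (R := ℝ)).toMultilinearMap.map_smul_univ
    (fun i => v (f i) (p i)) (fun i => (fun j => w (p i) (g j)))
  refine this.trans ?_
  simp only [smul_eq_mul]
  rfl

lemma exists_sort {n k : ℕ} (p : Fin k → Fin n) (hp : Function.Injective p) :
    ∃ (h : Fin k ↪o Fin n) (σ : Equiv.Perm (Fin k)), p = h ∘ σ := by
  have hm := Tuple.monotone_sort p
  have hs : StrictMono (p ∘ Tuple.sort p) :=
    hm.strictMono_of_injective (hp.comp (Tuple.sort p).injective)
  refine ⟨OrderEmbedding.ofStrictMono _ hs, (Tuple.sort p).symm, ?_⟩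
  ext i; simp

/-- Cauchy-Binet. -/
lemma mnr_mul {n k : ℕ} (v w : Mat n) (f g : Fin k → Fin n) :
    mnr (v * w) f g = ∑ h : Fin k ↪o Fin n, mnr v f h * mnr w h g := by
  classical
  rw [mnr_mul_all]
  have h1 : ∀ h : Fin k ↪o Fin n, mnr v f h * mnr w h g =
      ∑ σ : Equiv.Perm (Fin k), (∏ i, v (f i) (h (σ i))) * mnr w (h ∘ σ) g := by
    intro h
    have : mnr v f h = ∑ σ : Equiv.Perm (Fin k), (Equiv.Perm.sign σ : ℤ) * ∏ i, v (f i) (h (σ i)) := by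
      unfold mnr
      rw [← Matrix.det_transpose, Matrix.det_apply']
      rfl
    rw [this, Finset.sum_mul]
    refine Finset.sum_congr rfl fun σ _ => ?_
    rw [mnr_perm_left]; ring
  simp_rw [h1]
  rw [← Finset.sum_product']
  symm
  refine Finset.sum_of_injOn (fun x => x.1 ∘ x.2) ?_ (by simp) ?_ ?_
  · rintro ⟨h, σ⟩ _ ⟨h', σ'⟩ _ heq
    simp only at heq
    have hr : Set.range h = Set.range h' := by
      have := congrArg Set.range heq
      simpa [Set.range_comp] using this
    have hh : h = h' := by
      have := OrderEmbedding.range_inj.1 hr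
      exact this
    subst hh
    have : σ = σ' := by
      ext i
      have := congrFun heq i
      simp at this
      rw [this]
    rw [this]
  · intro p _ hp
    rw [mnr_not_inj_left, mul_zero]
    intro hinj
    obtain ⟨h, σ, rfl⟩ := exists_sort p hinj
    exact hp ⟨(h, σ), by simp, rfl⟩
  · intros; rfl

def TNN {n : ℕ} (v : Mat n) : Prop :=
  ∀ (k : ℕ) (f g : Fin k → Fin n), StrictMono f → StrictMono g → 0 ≤ mnr v f g

/-- Upper triangular unipotent. -/
def UU {n : ℕ} (v : Mat n) : Prop := (∀ i j, j < i → v i j = 0) ∧ ∀ i, v i i = 1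

def SP {n : ℕ} (v : Mat n) : Prop :=
  UU v ∧ ∀ (k : ℕ) (f g : Fin k → Fin n), StrictMono f → StrictMono g → f ≤ g → 0 < mnr v f g

lemma UU.one {n : ℕ} : UU (1 : Mat n) :=
  ⟨fun i j h => Matrix.one_apply_ne (ne_of_gt h), fun i => Matrix.one_apply_eq i⟩

lemma UU.mul {n : ℕ} {v w : Mat n} (hv : UU v) (hw : UU w) : UU (v * w) := by
  constructor
  · intro i j hij
    rw [Matrix.mul_apply]
    refine Finset.sum_eq_zero fun l _ => ?_
    rcases lt_or_ge l i with h | h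
    · rw [hv.1 _ _ h, zero_mul]
    · rw [hw.1 _ _ (lt_of_lt_of_le hij h), mul_zero]
  · intro i
    rw [Matrix.mul_apply, Finset.sum_eq_single i]
    · rw [hv.2, hw.2, mul_one]
    · intro l _ hl
      rcases lt_or_gt_of_ne hl with h | h
      · rw [hv.1 _ _ h, zero_mul]
      · rw [hw.1 _ _ h, mul_zero]
    · simp

lemma UU.blockTriangular {n : ℕ} {v : Mat n} (hv : UU v) : v.BlockTriangular id :=
  fun i j h => hv.1 i j h

lemma UU.det {n : ℕ} {v : Mat n} (hv : UU v) : v.det = 1 := by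
  rw [Matrix.det_of_isUpperTriangular hv.blockTriangular]
  simp [hv.2]

lemma mnr_upper_zero {n k : ℕ} {v : Mat n} (hv : ∀ i j, j < i → v i j = 0) (f g : Fin k → Fin n)
    (hf : StrictMono f) (hg : StrictMono g) (h : ¬ f ≤ g) : mnr v f g = 0 := by
  simp only [Pi.le_def, not_forall, not_le] at h
  obtain ⟨a, ha⟩ := h
  unfold mnr
  rw [Matrix.det_apply']
  refine Finset.sum_eq_zero fun σ _ => ?_
  have : ∃ i, i ≤ a ∧ a ≤ σ i := by
    by_contra hcon
    push Not at hcon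
    have hmap : ∀ i ∈ Finset.Iic a, σ i ∈ Finset.Iio a := by
      intro i hi; simp at hi ⊢; exact hcon i hi
    have := Finset.card_le_card_of_injOn σ hmap σ.injective.injOn
    simp at this
  obtain ⟨i, hi, hi'⟩ := this
  rw [Finset.prod_eq_zero (Finset.mem_univ i), mul_zero]
  simp only [Matrix.submatrix_apply]
  exact hv _ _ (lt_of_le_of_lt (hg.monotone hi) (lt_of_lt_of_le ha (hf.monotone hi')))

lemma UU.mnr_self {n k : ℕ} {v : Mat n} (hv : UU v) (f : Fin k → Fin n) (hf : StrictMono f) :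
    mnr v f f = 1 := by
  unfold mnr
  rw [Matrix.det_of_isUpperTriangular]
  · simp [hv.2]
  · intro i j hij
    exact hv.1 _ _ (hf hij)

lemma mnr_one {n : ℕ} (v : Mat n) (i j : Fin n) :
    mnr v (fun _ : Fin 1 => i) (fun _ => j) = v i j := by
  unfold mnr; simp

lemma strictMono_fin1 {n : ℕ} (i : Fin n) : StrictMono (fun _ : Fin 1 => i) := by
  intro a b h; omega

lemma TNN.entry {n : ℕ} {v : Mat n} (hv : TNN v) (i j : Fin n) : 0 ≤ v i j := by
  rw [← mnr_one v]; exact hv 1 _ _ (strictMono_fin1 i) (strictMono_fin1 j)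

lemma SP.entry {n : ℕ} {v : Mat n} (hv : SP v) (i j : Fin n) (h : i ≤ j) : 0 < v i j := by
  rw [← mnr_one v]; exact hv.2 1 _ _ (strictMono_fin1 i) (strictMono_fin1 j) (fun _ => h)

lemma SP.tnn {n : ℕ} {v : Mat n} (hv : SP v) : TNN v := by
  intro k f g hf hg
  by_cases h : f ≤ g
  · exact (hv.2 k f g hf hg h).le
  · rw [mnr_upper_zero hv.1.1 f g hf hg h]

lemma TNN.mul {n : ℕ} {v w : Mat n} (hv : TNN v) (hw : TNN w) : TNN (v * w) := by
  intro k f g hf hg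
  rw [mnr_mul]
  exact Finset.sum_nonneg fun h _ =>
    mul_nonneg (hv k f h hf h.strictMono) (hw k h g h.strictMono hg)

lemma TNN.mul_ge {n : ℕ} {v w : Mat n} (hv : TNN v) (hw : TNN w) {k : ℕ} (f h g : Fin k → Fin n)
    (hf : StrictMono f) (hh : StrictMono h) (hg : StrictMono g) :
    mnr v f h * mnr w h g ≤ mnr (v * w) f g := by
  rw [mnr_mul]
  exact Finset.single_le_sum (f := fun h : Fin k ↪o Fin n => mnr v f h * mnr w h g)
    (fun h _ => mul_nonneg (hv k f h hf h.strictMono) (hw k h g h.strictMono hg))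
    (Finset.mem_univ (OrderEmbedding.ofStrictMono h hh))

lemma TNN.one {n : ℕ} : TNN (1 : Mat n) := by
  intro k f g hf hg
  by_cases h : f ≤ g
  · by_cases h' : g ≤ f
    · obtain rfl : f = g := le_antisymm h h'
      rw [UU.one.mnr_self f hf]; norm_num
    · have := mnr_upper_zero (v := (1 : Mat n)) UU.one.1 g f hg hf h'
      rw [← mnr_transpose, Matrix.transpose_one] at this
      rw [this]
  · rw [mnr_upper_zero (v := (1 : Mat n)) UU.one.1 f g hf hg h]

lemma TNN.pow {n : ℕ} {v : Mat n} (hv : TNN v) (m : ℕ) : TNN (v ^ m) := by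
  induction m with
  | zero => simpa using TNN.one
  | succ m ih => rw [pow_succ]; exact ih.mul hv

lemma UU.pow {n : ℕ} {v : Mat n} (hv : UU v) (m : ℕ) : UU (v ^ m) := by
  induction m with
  | zero => simpa using UU.one
  | succ m ih => rw [pow_succ]; exact ih.mul hv

lemma SP.mul_tnn {n : ℕ} {v w : Mat n} (hv : SP v) (hw : TNN w) (hw' : UU w) : SP (v * w) := by
  refine ⟨hv.1.mul hw', fun k f g hf hg hfg => ?_⟩
  refine lt_of_lt_of_le ?_ (TNN.mul_ge hv.tnn hw f g g hf hg hg)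
  rw [hw'.mnr_self g hg, mul_one]; exact hv.2 k f g hf hg hfg

lemma SP.tnn_mul {n : ℕ} {v w : Mat n} (hv : SP v) (hw : TNN w) (hw' : UU w) : SP (w * v) := by
  refine ⟨hw'.mul hv.1, fun k f g hf hg hfg => ?_⟩
  refine lt_of_lt_of_le ?_ (TNN.mul_ge hw hv.tnn f f g hf hf hg)
  rw [hw'.mnr_self f hf, one_mul]; exact hv.2 k f g hf hg hfg

lemma SP.mul {n : ℕ} {v w : Mat n} (hv : SP v) (hw : SP w) : SP (v * w) :=
  hv.mul_tnn hw.tnn hw.1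

lemma TNN.transpose {n : ℕ} {v : Mat n} (hv : TNN v) : TNN vᵀ := by
  intro k f g hf hg
  rw [mnr_transpose]; exact hv k g f hg hf

lemma continuous_mnr {n k : ℕ} (f g : Fin k → Fin n) : Continuous fun v : Mat n => mnr v f g := by
  unfold mnr
  fun_prop

lemma isClosed_TNN {n : ℕ} : IsClosed {v : Mat n | TNN v} := by
  have : {v : Mat n | TNN v} = ⋂ (k : ℕ) (f : Fin k → Fin n) (g : Fin k → Fin n)
      (_ : StrictMono f) (_ : StrictMono g), {v | 0 ≤ mnr v f g} := by
    ext v; simp [TNN]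
  rw [this]
  refine isClosed_iInter fun k => isClosed_iInter fun f => isClosed_iInter fun g =>
    isClosed_iInter fun _ => isClosed_iInter fun _ => isClosed_le continuous_const (continuous_mnr f g)

end Hit

namespace Hit

lemma desn_unit {κ : Type} [Fintype κ] [DecidableEq κ] (A : Matrix (Fin 2) (Fin 2) ℝ)
    (B : Matrix (Fin 2) κ ℝ) (C : Matrix κ (Fin 2) ℝ) (D : Matrix κ κ ℝ) (hD : IsUnit D.det) :
    let F : Fin 2 → Fin 2 → ℝ := fun a b => (fromBlocks (A.submatrix (fun _ : Fin 1 => a) (fun _ : Fin 1 => b))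
      (B.submatrix (fun _ : Fin 1 => a) id) (C.submatrix id (fun _ : Fin 1 => b)) D).det
    (fromBlocks A B C D).det * D.det = F 0 0 * F 1 1 - F 0 1 * F 1 0 := by
  intro F
  have := D.invertibleOfIsUnitDet hD
  have hF : ∀ a b, F a b = D.det * (A - B * ⅟D * C) a b := by
    intro a b
    simp only [F]
    rw [Matrix.det_fromBlocks₂₂]
    congr 1
    rw [Matrix.det_unique]
    simp [Matrix.mul_apply]
  rw [Matrix.det_fromBlocks₂₂, Matrix.det_fin_two, hF, hF, hF, hF]
  ring

lemma desn_blocks {κ : Type} [Fintype κ] [DecidableEq κ] (A : Matrix (Fin 2) (Fin 2) ℝ)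
    (B : Matrix (Fin 2) κ ℝ) (C : Matrix κ (Fin 2) ℝ) (D : Matrix κ κ ℝ) :
    let F : Fin 2 → Fin 2 → ℝ := fun a b => (fromBlocks (A.submatrix (fun _ : Fin 1 => a) (fun _ : Fin 1 => b))
      (B.submatrix (fun _ : Fin 1 => a) id) (C.submatrix id (fun _ : Fin 1 => b)) D).det
    (fromBlocks A B C D).det * D.det = F 0 0 * F 1 1 - F 0 1 * F 1 0 := by
  have hdense : Dense {t : ℝ | (D + t • (1 : Matrix κ κ ℝ)).det ≠ 0} := by
    have hfin : {t : ℝ | (D + t • (1 : Matrix κ κ ℝ)).det = 0}.Finite := by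
      have hne : (-D).charpoly ≠ 0 := (Matrix.charpoly_monic _).ne_zero
      refine ((-D).charpoly.roots.toFinset.finite_toSet).subset fun t ht => ?_
      simp only [Finset.mem_coe, Multiset.mem_toFinset, Polynomial.mem_roots hne,
        Polynomial.IsRoot.def, Matrix.eval_charpoly]
      simp only [Set.mem_ofPred_eq] at ht
      rw [← ht]
      congr 1
      ext i j
      by_cases h : i = j
      · subst h; simp; ring
      · simp [h]
    have := hfin.countable.dense_compl ℝ
    exact this
  have key : (fun t : ℝ => (fromBlocks A B C (D + t • (1 : Matrix κ κ ℝ))).det * (D + t • (1 : Matrix κ κ ℝ)).det)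
    = fun t : ℝ => (let F : Fin 2 → Fin 2 → ℝ := fun a b => (fromBlocks (A.submatrix (fun _ : Fin 1 => a) (fun _ : Fin 1 => b))
      (B.submatrix (fun _ : Fin 1 => a) id) (C.submatrix id (fun _ : Fin 1 => b)) (D + t • (1 : Matrix κ κ ℝ))).det
      F 0 0 * F 1 1 - F 0 1 * F 1 0) := by
    refine Continuous.ext_on hdense ?_ ?_ ?_
    · refine Continuous.mul (Continuous.matrix_det ?_) (Continuous.matrix_det (by fun_prop))
      exact Continuous.matrix_fromBlocks continuous_const continuous_const continuous_const (by fun_prop)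
    · have hc : ∀ a b, Continuous fun t : ℝ => (fromBlocks (A.submatrix (fun _ : Fin 1 => a) (fun _ : Fin 1 => b))
        (B.submatrix (fun _ : Fin 1 => a) id) (C.submatrix id (fun _ : Fin 1 => b)) (D + t • (1 : Matrix κ κ ℝ))).det := by
        intro a b
        refine Continuous.matrix_det ?_
        exact Continuous.matrix_fromBlocks continuous_const continuous_const continuous_const (by fun_prop)
      exact ((hc 0 0).mul (hc 1 1)).sub ((hc 0 1).mul (hc 1 0))
    · intro t ht
      exact desn_unit A B C _ (isUnit_iff_ne_zero.2 ht)
  have := congrFun key 0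
  simpa using this

lemma mnr_cons1 {n m : ℕ} (v : Mat n) (r j : Fin n) (S K : Fin m → Fin n) :
    mnr v (Fin.cons r S : Fin (m+1) → Fin n) (Fin.cons j K : Fin (m+1) → Fin n)
      = (fromBlocks (v.submatrix (fun _ : Fin 1 => r) (fun _ : Fin 1 => j))
      (v.submatrix (fun _ : Fin 1 => r) K) (v.submatrix S (fun _ : Fin 1 => j)) (v.submatrix S K)).det := by
  unfold mnr
  rw [← Matrix.det_submatrix_equiv_self (finSumFinEquiv.trans (finCongr (add_comm 1 m)))]
  congr 1
  have h1 : ∀ a : Fin 1, (finCongr (add_comm 1 m)) (Fin.castAdd m a) = 0 := by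
    intro a; ext; simp
  have h2 : ∀ a : Fin m, (finCongr (add_comm 1 m)) (Fin.natAdd 1 a) = a.succ := by
    intro a; ext; simp
  ext (i | i) (j | j)
  · have e1 := h1 i
    have e2 := h1 j
    simp only [Equiv.trans_apply, submatrix_apply, finSumFinEquiv_apply_left, fromBlocks_apply₁₁, e1, e2]
    rfl
  · have e1 := h1 i
    simp only [Equiv.trans_apply, submatrix_apply, finSumFinEquiv_apply_left, finSumFinEquiv_apply_right,
      fromBlocks_apply₁₂, e1, h2]
    rfl
  · have e2 := h1 j
    simp only [Equiv.trans_apply, submatrix_apply, finSumFinEquiv_apply_left, finSumFinEquiv_apply_right,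
      fromBlocks_apply₂₁, e2, h2]
    rfl
  · simp only [Equiv.trans_apply, submatrix_apply, finSumFinEquiv_apply_right,
      fromBlocks_apply₂₂, h2]
    rfl

lemma mnr_cons2 {n m : ℕ} (v : Mat n) (r r' j j' : Fin n) (S K : Fin m → Fin n) :
    mnr v (Fin.cons r (Fin.cons r' S : Fin (m+1) → Fin n) : Fin (m+2) → Fin n)
      (Fin.cons j (Fin.cons j' K : Fin (m+1) → Fin n) : Fin (m+2) → Fin n)
      = (fromBlocks (v.submatrix ![r, r'] ![j, j'])
      (v.submatrix ![r, r'] K) (v.submatrix S ![j, j']) (v.submatrix S K)).det := by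
  unfold mnr
  rw [← Matrix.det_submatrix_equiv_self (finSumFinEquiv.trans (finCongr (add_comm 2 m)))]
  congr 1
  have h1 : (finCongr (add_comm 2 m)) (Fin.castAdd m 0) = 0 := by
    ext; simp
  have h1' : (finCongr (add_comm 2 m)) (Fin.castAdd m 1) = 1 := by
    ext; simp
  have h2 : ∀ a : Fin m, (finCongr (add_comm 2 m)) (Fin.natAdd 2 a) = a.succ.succ := by
    intro a; ext; simp
  have c1 : ∀ (x y : Fin n) (T : Fin m → Fin n),
    (Fin.cons x (Fin.cons y T : Fin (m+1) → Fin n) : Fin (m+2) → Fin n) 1 = y := fun x y T => rfl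
  ext (i | i) (j | j)
  · fin_cases i <;> fin_cases j <;> simp [h1, h1', h2, c1] <;> rfl
  · fin_cases i <;> simp [h1, h1', h2, c1] <;> rfl
  · fin_cases j <;> simp [h1, h1', h2, c1] <;> rfl
  · simp [h2]; rfl

lemma desn_cons {n m : ℕ} (v : Mat n) (r r' j j' : Fin n) (S K : Fin m → Fin n) :
    mnr v (Fin.cons r (Fin.cons r' S : Fin (m+1) → Fin n) : Fin (m+2) → Fin n)
      (Fin.cons j (Fin.cons j' K : Fin (m+1) → Fin n) : Fin (m+2) → Fin n) * mnr v S K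
     = mnr v (Fin.cons r S : Fin (m+1) → Fin n) (Fin.cons j K : Fin (m+1) → Fin n) *
       mnr v (Fin.cons r' S : Fin (m+1) → Fin n) (Fin.cons j' K : Fin (m+1) → Fin n) -
       mnr v (Fin.cons r S : Fin (m+1) → Fin n) (Fin.cons j' K : Fin (m+1) → Fin n) *
       mnr v (Fin.cons r' S : Fin (m+1) → Fin n) (Fin.cons j K : Fin (m+1) → Fin n) := by
  rw [mnr_cons2]
  have := desn_blocks (v.submatrix ![r, r'] ![j, j']) (v.submatrix ![r, r'] K) (v.submatrix S ![j, j']) (v.submatrix S K)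
  simp only at this
  refine this.trans ?_
  simp only [mnr_cons1]
  rfl

lemma mnr_insertNth {n m : ℕ} (v : Mat n) (a b : Fin (m+1)) (x y : Fin n) (S K : Fin m → Fin n) :
    mnr v (a.insertNth x S : Fin (m+1) → Fin n) (b.insertNth y K : Fin (m+1) → Fin n) = (-1) ^ (a : ℕ) * (-1) ^ (b : ℕ) *
    mnr v (Fin.cons x S : Fin (m+1) → Fin n) (Fin.cons y K : Fin (m+1) → Fin n) := by
  rw [← Fin.cons_comp_cycleRange x S a, ← Fin.cons_comp_cycleRange y K b, mnr_perm_left, mnr_perm_right,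
    Fin.sign_cycleRange, Fin.sign_cycleRange]
  push_cast
  ring

lemma cons_comp_decompose {n m : ℕ} (x : Fin n) (S : Fin m → Fin n) (σ : Equiv.Perm (Fin m)) :
    (Fin.cons x (S ∘ σ) : Fin (m+1) → Fin n) = (Fin.cons x S : Fin (m+1) → Fin n) ∘
      (Equiv.Perm.decomposeFin.symm (0, σ)) := by
  ext i
  refine Fin.cases ?_ (fun i => ?_) i
  · simp
  · simp

/-- Desnanot-Jacobi for adjacent positions. -/
lemma desn_adj {n m : ℕ} (v : Mat n) (a b : Fin (m+1)) (r r' j j' : Fin n) (S K : Fin m → Fin n) :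
    mnr v (a.succ.insertNth r' (a.insertNth r S : Fin (m+1) → Fin n) : Fin (m+2) → Fin n)
      (b.succ.insertNth j' (b.insertNth j K : Fin (m+1) → Fin n) : Fin (m+2) → Fin n) * mnr v S K
     = mnr v (a.insertNth r S : Fin (m+1) → Fin n) (b.insertNth j K : Fin (m+1) → Fin n) *
       mnr v (a.insertNth r' S : Fin (m+1) → Fin n) (b.insertNth j' K : Fin (m+1) → Fin n) -
       mnr v (a.insertNth r S : Fin (m+1) → Fin n) (b.insertNth j' K : Fin (m+1) → Fin n) *
       mnr v (a.insertNth r' S : Fin (m+1) → Fin n) (b.insertNth j K : Fin (m+1) → Fin n) := by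
  have h := desn_cons v r' r j' j S K
  rw [mnr_insertNth v a.succ b.succ]
  have e1 : (Fin.cons r' (a.insertNth r S : Fin (m+1) → Fin n) : Fin (m+2) → Fin n) =
    (Fin.cons r' (Fin.cons r S : Fin (m+1) → Fin n) : Fin (m+2) → Fin n) ∘ (Equiv.Perm.decomposeFin.symm (0, a.cycleRange)) := by
    rw [← Fin.cons_comp_cycleRange r S a, cons_comp_decompose]
  have e2 : (Fin.cons j' (b.insertNth j K : Fin (m+1) → Fin n) : Fin (m+2) → Fin n) =
    (Fin.cons j' (Fin.cons j K : Fin (m+1) → Fin n) : Fin (m+2) → Fin n) ∘ (Equiv.Perm.decomposeFin.symm (0, b.cycleRange)) := by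
    rw [← Fin.cons_comp_cycleRange j K b, cons_comp_decompose]
  rw [e1, e2, mnr_perm_left, mnr_perm_right, Equiv.Perm.decomposeFin.symm_sign, Equiv.Perm.decomposeFin.symm_sign,
    Fin.sign_cycleRange, Fin.sign_cycleRange]
  simp only [mnr_insertNth]
  simp only [if_true, one_mul]
  push_cast
  have s1 : ((-1 : ℝ) ^ (a : ℕ)) * (-1) ^ (a : ℕ) = 1 := by rw [← mul_pow]; simp
  have s2 : ((-1 : ℝ) ^ (b : ℕ)) * (-1) ^ (b : ℕ) = 1 := by rw [← mul_pow]; simp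
  rw [Fin.val_succ, Fin.val_succ, pow_succ, pow_succ]
  generalize (-1 : ℝ) ^ (a : ℕ) = α at *
  generalize (-1 : ℝ) ^ (b : ℕ) = β at *
  linear_combination (α * α * (β * β)) * h

end Hit

namespace Hit

lemma strictMono_update {n k : ℕ} {p : Fin k → Fin n} (hp : StrictMono p) (b : Fin k) (x : Fin n)
    (h1 : ∀ i < b, p i < x) (h2 : ∀ i, b < i → x < p i) : StrictMono (Function.update p b x) := by
  intro i j hij
  by_cases hi : i = b
  · subst hi
    rw [Function.update_self, Function.update_of_ne (ne_of_gt hij)]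
    exact h2 j hij
  · by_cases hj : j = b
    · subst hj
      rw [Function.update_self, Function.update_of_ne hi]
      exact h1 i hij
    · rw [Function.update_of_ne hi, Function.update_of_ne hj]
      exact hp hij

lemma strictMono_insertNth_succ {n m : ℕ} {p : Fin (m+1) → Fin n} (hp : StrictMono p) (a : Fin (m+1))
    (x : Fin n) (h1 : p a < x) (h2 : ∀ i, a < i → x < p i) :
    StrictMono (a.succ.insertNth x p : Fin (m+2) → Fin n) := by
  intro i j hij
  rcases Fin.eq_self_or_eq_succAbove a.succ i with rfl | ⟨i', rfl⟩ <;>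
  rcases Fin.eq_self_or_eq_succAbove a.succ j with rfl | ⟨j', rfl⟩
  · exact absurd hij (lt_irrefl _)
  · simp only [Fin.insertNth_apply_same, Fin.insertNth_apply_succAbove]
    apply h2
    rw [Fin.lt_succAbove_iff_le_castSucc] at hij
    exact hij
  · simp only [Fin.insertNth_apply_same, Fin.insertNth_apply_succAbove]
    rw [Fin.succAbove_lt_iff_castSucc_lt] at hij
    have : i' ≤ a := by
      rw [Fin.lt_def] at hij
      simp at hij
      rw [Fin.le_def]; omega
    exact lt_of_le_of_lt (hp.monotone this) h1
  · simp only [Fin.insertNth_apply_succAbove]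
    exact hp ((Fin.strictMono_succAbove _).lt_iff_lt.1 hij)

lemma path_induct {n k : ℕ} (f g : Fin k → Fin n) (hf : StrictMono f) (hg : StrictMono g) (hfg : f ≤ g)
    (Q : (Fin k → Fin n) → Prop) (h0 : Q f)
    (step : ∀ (p : Fin k → Fin n) (b : Fin k) (x : Fin n), StrictMono p → f ≤ p → (x : ℕ) = p b + 1 →
      StrictMono (Function.update p b x) → Function.update p b x ≤ g → Q p → Q (Function.update p b x)) : Q g := by
  suffices H : ∀ (d : ℕ) (p : Fin k → Fin n), StrictMono p → f ≤ p → p ≤ g → (∑ i, ((g i : ℕ) - p i)) = d → Q p → Q g from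
    H _ f hf le_rfl hfg rfl h0
  intro d
  induction d with
  | zero =>
    intro p hp hfp hpg hs hQ
    have : p = g := by
      ext i
      have := Finset.sum_eq_zero_iff.1 hs i (Finset.mem_univ _)
      have h2 : (p i : ℕ) ≤ g i := hpg i
      omega
    rwa [← this]
  | succ d ih =>
    intro p hp hfp hpg hs hQ
    have hne : (Finset.univ.filter fun i => p i < g i).Nonempty := by
      by_contra hcon
      rw [Finset.not_nonempty_iff_eq_empty, Finset.filter_eq_empty_iff] at hcon
      have : ∑ i, ((g i : ℕ) - p i) = 0 := by
        refine Finset.sum_eq_zero fun i _ => ?_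
        have := hcon (Finset.mem_univ i)
        rw [Fin.lt_def] at this; omega
      omega
    obtain ⟨b, hb, hmax⟩ := Finset.exists_max_image _ (fun i => i) hne
    simp only [Finset.mem_filter, Finset.mem_univ, true_and] at hb hmax
    have hb' : (p b : ℕ) < g b := hb
    let x : Fin n := ⟨p b + 1, by omega⟩
    have hxg : x ≤ g b := by rw [Fin.le_def]; exact hb'
    have hsm : StrictMono (Function.update p b x) := by
      apply strictMono_update hp
      · intro i hi
        have : (p i : ℕ) < p b := hp hi
        rw [Fin.lt_def]; simp [x]; omega
      · intro i hi
        have h1 : p i = g i := by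
          refine le_antisymm (hpg i) (not_lt.1 fun hcon => ?_)
          exact absurd (hmax i hcon) (not_le.2 hi)
        rw [h1]
        exact lt_of_le_of_lt hxg (hg hi)
    have hle : Function.update p b x ≤ g := by
      rw [update_le_iff]; exact ⟨hxg, fun j _ => hpg j⟩
    have hfp' : f ≤ Function.update p b x := by
      rw [le_update_iff]
      refine ⟨(hfp b).trans ?_, fun j _ => hfp j⟩
      rw [Fin.le_def]; simp [x]
    refine ih _ hsm hfp' hle ?_ (step p b x hp hfp rfl hsm hle hQ)
    have e1 := Finset.add_sum_erase Finset.univ (fun i => (g i : ℕ) - p i) (Finset.mem_univ b)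
    have e2 := Finset.add_sum_erase Finset.univ (fun i => (g i : ℕ) - Function.update p b x i) (Finset.mem_univ b)
    have e3 : ∑ i ∈ Finset.univ.erase b, ((g i : ℕ) - Function.update p b x i) =
      ∑ i ∈ Finset.univ.erase b, ((g i : ℕ) - p i) := by
      refine Finset.sum_congr rfl fun i hi => ?_
      rw [Function.update_of_ne (Finset.ne_of_mem_erase hi)]
    simp only [Function.update_self, x] at e1 e2 e3
    simp only [x]
    omega

lemma mnr_step {n k : ℕ} {v : Mat n} (hv : UU v) (p : Fin k → Fin n) (b : Fin k) (x : Fin n)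
    (hp : StrictMono p) (hx : (x : ℕ) = p b + 1) (hs : StrictMono (Function.update p b x)) :
    mnr v p (Function.update p b x) = v (p b) x := by
  unfold mnr
  rw [Matrix.det_of_isUpperTriangular]
  · rw [Finset.prod_eq_single b]
    · simp
    · intro i _ hi
      simp [Function.update_of_ne hi, hv.2]
    · simp
  · intro i j hij
    simp only [id] at hij
    apply hv.1
    by_cases hj : j = b
    · subst hj
      rw [Function.update_self]
      have := hs hij
      rwa [Function.update_self, Function.update_of_ne (ne_of_gt hij)] at this
    · rw [Function.update_of_ne hj]; exact hp hij

lemma SP_of_pow {n : ℕ} {v : Mat n} (hv : UU v) (ht : TNN v)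
    (hs : ∀ i j : Fin n, (j : ℕ) = i + 1 → 0 < v i j) : SP (v ^ (n * n)) := by
  refine ⟨hv.pow _, fun k f g hf hg hfg => ?_⟩
  have key : ∀ d : ℕ, (∑ i, ((g i : ℕ) - f i)) ≤ d → 0 < mnr (v ^ d) f g := by
    refine path_induct f g hf hg hfg (fun p => ∀ d : ℕ, (∑ i, ((p i : ℕ) - f i)) ≤ d → 0 < mnr (v ^ d) f p) ?_ ?_
    · intro d _
      rw [(hv.pow d).mnr_self f hf]; norm_num
    · intro p b x hp hfp hx hsm _ ih d hd
      have e1 := Finset.add_sum_erase Finset.univ (fun i => (p i : ℕ) - f i) (Finset.mem_univ b)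
      have e2 := Finset.add_sum_erase Finset.univ (fun i => (Function.update p b x i : ℕ) - f i) (Finset.mem_univ b)
      have e3 : ∑ i ∈ Finset.univ.erase b, ((Function.update p b x i : ℕ) - f i) =
        ∑ i ∈ Finset.univ.erase b, ((p i : ℕ) - f i) := by
        refine Finset.sum_congr rfl fun i hi => ?_
        rw [Function.update_of_ne (Finset.ne_of_mem_erase hi)]
      have hfb : (f b : ℕ) ≤ p b := hfp b
      simp only [Function.update_self] at e1 e2 e3
      obtain ⟨d, rfl⟩ : ∃ e, d = e + 1 := ⟨d - 1, by omega⟩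
      rw [pow_succ]
      refine lt_of_lt_of_le ?_ (TNN.mul_ge (ht.pow d) ht f p _ hf hp hsm)
      rw [mnr_step hv p b x hp hx hsm]
      exact mul_pos (ih d (by omega)) (hs _ _ hx)
  apply key
  have hk : k ≤ n := by simpa using Fintype.card_le_of_injective f hf.injective
  calc ∑ i, ((g i : ℕ) - f i) ≤ ∑ _i : Fin k, n := Finset.sum_le_sum fun i _ => by omega
    _ = k * n := by simp
    _ ≤ n * n := Nat.mul_le_mul_right _ hk

lemma tnn_transvection {n : ℕ} (i j : Fin n) (hij : (j : ℕ) = i + 1) (c : ℝ) (hc : 0 ≤ c) :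
    TNN (Matrix.transvection i j c : Mat n) := by
  intro k f g hf hg
  by_cases hj : ∃ b, g b = j
  · obtain ⟨b, hb⟩ := hj
    have e : mnr (Matrix.transvection i j c : Mat n) f g = mnr 1 f g + c * mnr 1 f (Function.update g b i) := by
      unfold mnr
      have h1 : (Matrix.transvection i j c : Mat n).submatrix f g =
        ((1 : Mat n).submatrix f g).updateCol b ((fun p => (1 : Mat n) (f p) j) + c • (fun p => (1 : Mat n) (f p) i)) := by
        ext p q
        by_cases hq : q = b
        · subst hq
          simp [Matrix.transvection, hb, Matrix.single_apply, Matrix.one_apply, eq_comm]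
        · have : j ≠ g q := fun h => hq (hg.injective (by rw [hb, h]))
          simp [Matrix.transvection, hq, Matrix.single_apply, this]
      rw [h1, Matrix.det_updateCol_add, Matrix.det_updateCol_smul]
      congr 2
      · congr 1
        ext p q
        by_cases hq : q = b
        · subst hq; simp; rw [hb]
        · simp [hq]
      · congr 1
        ext p q
        by_cases hq : q = b
        · subst hq; simp; rw [Function.update_self]
        · simp [hq]; rw [Function.update_of_ne hq]
    rw [e]
    refine add_nonneg (TNN.one k f g hf hg) (mul_nonneg hc ?_)
    by_cases hi : ∃ a, g a = i
    · obtain ⟨a, ha⟩ := hi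
      have hab : a ≠ b := by rintro rfl; rw [ha] at hb; rw [hb] at hij; omega
      rw [← mnr_transpose, mnr_not_inj_left]
      intro hinj
      refine hab (hinj ?_)
      rw [Function.update_self, Function.update_of_ne hab, ha]
    · apply TNN.one k f _ hf
      apply strictMono_update hg
      · intro p hp
        have h1 := hg hp
        have h2 : g p ≠ i := fun h => hi ⟨p, h⟩
        rw [hb, Fin.lt_def] at h1
        rw [Fin.lt_def]
        have h3 : (g p : ℕ) ≠ i := fun h => h2 (Fin.ext h)
        omega
      · intro p hp
        have h1 := hg hp
        rw [hb, Fin.lt_def] at h1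
        rw [Fin.lt_def]; omega
  · have e : mnr (Matrix.transvection i j c : Mat n) f g = mnr 1 f g := by
      unfold mnr
      congr 1
      ext p q
      have : j ≠ g q := fun h => hj ⟨q, h.symm⟩
      simp [Matrix.transvection, Matrix.single_apply, this]
    rw [e]; exact TNN.one k f g hf hg

/-- Unipotent bidiagonal matrix. -/
def bidiag {n : ℕ} (c : ℕ → ℝ) : Mat n := fun i j => if i = j then 1 else if (j : ℕ) = i + 1 then c i else 0

lemma bidiag_uu {n : ℕ} (c : ℕ → ℝ) : UU (bidiag c : Mat n) := by
  constructor
  · intro i j hij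
    unfold bidiag
    rw [if_neg (ne_of_gt hij), if_neg]
    rw [Fin.lt_def] at hij; omega
  · intro i; simp [bidiag]

lemma bidiag_tnn {n : ℕ} (c : ℕ → ℝ) (hc : ∀ i, 0 ≤ c i) : TNN (bidiag c : Mat n) := by
  have key : ∀ s : ℕ, TNN (bidiag (fun i => if i < s then c i else 0) : Mat n) := by
    intro s
    induction s with
    | zero =>
      have : (bidiag (fun i => if i < 0 then c i else 0) : Mat n) = 1 := by
        ext i j; simp [bidiag, Matrix.one_apply]
      rw [this]; exact TNN.one
    | succ s ih =>
      by_cases hs : s + 1 < n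
      · have : (bidiag (fun i => if i < s + 1 then c i else 0) : Mat n) =
          Matrix.transvection (⟨s, by omega⟩ : Fin n) ⟨s+1, hs⟩ (c s) * bidiag (fun i => if i < s then c i else 0) := by
          ext i j
          by_cases hi : i = ⟨s, by omega⟩
          · subst hi
            simp only [Matrix.transvection, Matrix.add_mul, Matrix.one_mul, Matrix.add_apply,
              Matrix.single_mul_apply_same]
            simp only [bidiag, Fin.ext_iff]
            by_cases h1 : s = j
            · simp [← h1]
            · by_cases h2 : (j : ℕ) = s + 1
              · simp [h2]
              · have h3 : ¬ (s + 1 = j) := fun h => h2 h.symm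
                simp [h1, h2, h3]
          · simp only [Matrix.transvection, Matrix.add_mul, Matrix.one_mul, Matrix.add_apply,
              Matrix.single_mul_apply_of_ne _ _ _ _ _ hi, add_zero]
            have h3 : (i : ℕ) ≠ s := fun h => hi (Fin.ext h)
            have h4 : ((i : ℕ) < s + 1) ↔ (i : ℕ) < s := by omega
            simp only [bidiag, h4]
        rw [this]
        exact (tnn_transvection _ _ rfl _ (hc s)).mul ih
      · have : (bidiag (fun i => if i < s + 1 then c i else 0) : Mat n) = bidiag (fun i => if i < s then c i else 0) := by
          ext i j
          simp only [bidiag]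
          congr 1
          by_cases h : (j : ℕ) = i + 1
          · have : (i : ℕ) < s := by omega
            simp [h, this, Nat.lt_succ_of_lt this]
          · simp [h]
        rw [this]; exact ih
  have : (bidiag c : Mat n) = bidiag (fun i => if i < n then c i else 0) := by
    ext i j
    simp [bidiag]
  rw [this]; exact key n

/-- An SP perturbation of the identity. -/
noncomputable def pert (n : ℕ) (ε : ℝ) : Mat n := (bidiag (fun _ => ε)) ^ (n * n)

lemma pert_sp {n : ℕ} {ε : ℝ} (hε : 0 < ε) : SP (pert n ε) := by
  apply SP_of_pow (bidiag_uu _) (bidiag_tnn _ fun _ => hε.le)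
  intro i j hij
  have : i ≠ j := by rintro rfl; omega
  simp [bidiag, this, hij, hε]

lemma pert_zero {n : ℕ} : pert n 0 = 1 := by
  have : (bidiag (fun _ => 0) : Mat n) = 1 := by
    ext i j; simp [bidiag, Matrix.one_apply]
  rw [pert, this, one_pow]

lemma pert_cont {n : ℕ} : Continuous (pert n) := by
  unfold pert
  apply Continuous.pow
  refine continuous_matrix fun i j => ?_
  unfold bidiag
  split_ifs <;> fun_prop

lemma SP.key_step {n k : ℕ} {v : Mat n} (hv : SP v) (p g : Fin k → Fin n) (a : Fin k) (x : Fin n)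
    (hp : StrictMono p) (hx : (x : ℕ) = p a + 1) (hs : StrictMono (Function.update p a x))
    (hg : StrictMono g) (hpg : Function.update p a x ≤ g) :
    mnr v p g ≤ mnr v p (Function.update p a x) * mnr v (Function.update p a x) g := by
  obtain ⟨m, rfl⟩ : ∃ m, k = m + 1 := ⟨k - 1, by have := a.2; omega⟩
  set p1 := Function.update p a x with hp1
  refine path_induct p1 g hs hg hpg (fun q => mnr v p q ≤ mnr v p p1 * mnr v p1 q) ?_ ?_
  · rw [hv.1.mnr_self p1 hs, mul_one]
  · intro q b y hq hpq hy hqs hqg ih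
    have hpos : 0 < mnr v p1 q := hv.2 _ _ _ hs hq hpq
    have hpq1 : p1 ≤ Function.update q b y := by
      rw [le_update_iff]
      refine ⟨(hpq b).trans ?_, fun j _ => hpq j⟩
      rw [Fin.le_def]; omega
    have hpos1 : 0 < mnr v p1 (Function.update q b y) := hv.2 _ _ _ hs hqs hpq1
    have ep : (a.insertNth (p a) (a.removeNth p) : Fin (m+1) → Fin n) = p := by simp
    have ep1 : (a.insertNth x (a.removeNth p) : Fin (m+1) → Fin n) = p1 := by rw [hp1]; simp
    have eq0 : (b.insertNth (q b) (b.removeNth q) : Fin (m+1) → Fin n) = q := by simp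
    have eq1 : (b.insertNth y (b.removeNth q) : Fin (m+1) → Fin n) = Function.update q b y := by simp
    have D := desn_adj v a b (p a) x (q b) y (a.removeNth p) (b.removeNth q)
    rw [ep, ep1, eq0, eq1] at D
    have hD : 0 ≤ mnr v (a.succ.insertNth x p : Fin (m+2) → Fin n) (b.succ.insertNth y q : Fin (m+2) → Fin n) *
        mnr v (a.removeNth p) (b.removeNth q) := by
      apply mul_nonneg
      · apply hv.tnn
        · apply strictMono_insertNth_succ hp
          · rw [Fin.lt_def]; omega
          · intro i hi
            have := hs hi
            rwa [hp1, Function.update_self, Function.update_of_ne (ne_of_gt hi)] at this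
        · apply strictMono_insertNth_succ hq
          · rw [Fin.lt_def]; omega
          · intro i hi
            have := hqs hi
            rwa [Function.update_self, Function.update_of_ne (ne_of_gt hi)] at this
      · apply hv.tnn
        · exact hp.comp (Fin.strictMono_succAbove a)
        · exact hq.comp (Fin.strictMono_succAbove b)
    rw [D] at hD
    have h1 : mnr v p (Function.update q b y) * mnr v p1 q ≤ (mnr v p p1 * mnr v p1 (Function.update q b y)) * mnr v p1 q := by
      nlinarith [mul_le_mul_of_nonneg_right ih hpos1.le]
    exact le_of_mul_le_mul_right h1 hpos

lemma UU.key_step {n k : ℕ} {v : Mat n} (hv : UU v) (ht : TNN v) (p g : Fin k → Fin n) (a : Fin k) (x : Fin n)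
    (hp : StrictMono p) (hx : (x : ℕ) = p a + 1) (hs : StrictMono (Function.update p a x))
    (hg : StrictMono g) (hpg : Function.update p a x ≤ g) :
    mnr v p g ≤ mnr v p (Function.update p a x) * mnr v (Function.update p a x) g := by
  have hc : Filter.Tendsto (fun ε => v * pert n ε) (nhdsWithin 0 (Set.Ioi 0)) (nhds v) := by
    have : Filter.Tendsto (fun ε => v * pert n ε) (nhds 0) (nhds (v * pert n 0)) :=
      (continuous_const.mul pert_cont).tendsto 0
    rw [pert_zero, mul_one] at this
    exact this.mono_left nhdsWithin_le_nhds
  have h1 := ((continuous_mnr p g).tendsto v).comp hc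
  have h2 := (((continuous_mnr p (Function.update p a x)).mul (continuous_mnr (Function.update p a x) g)).tendsto v).comp hc
  refine le_of_tendsto_of_tendsto h1 h2 ?_
  filter_upwards [self_mem_nhdsWithin] with ε hε
  exact ((pert_sp hε).tnn_mul ht hv).key_step p g a x hp hx hs hg hpg

/-- first `k` indices -/
def frst {n k : ℕ} (hk : k ≤ n) : Fin k → Fin n := Fin.castLE hk
/-- last `k` indices -/
def lst {n k : ℕ} (hk : k ≤ n) : Fin k → Fin n := fun i => ⟨i + (n - k), by omega⟩

lemma frst_sm {n k : ℕ} (hk : k ≤ n) : StrictMono (frst hk) := Fin.strictMono_castLE hk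
lemma lst_sm {n k : ℕ} (hk : k ≤ n) : StrictMono (lst hk) := by
  intro i j hij; rw [Fin.lt_def] at *; simp [lst]; omega
lemma frst_le {n k : ℕ} (hk : k ≤ n) (f : Fin k → Fin n) (hf : StrictMono f) : frst hk ≤ f := by
  intro i
  rw [Fin.le_def]
  simp only [frst, Fin.val_castLE]
  obtain ⟨i, hi⟩ := i
  induction i with
  | zero => simp
  | succ i ih =>
    have h1 := ih (by omega)
    have h2 := hf (show (⟨i, by omega⟩ : Fin k) < ⟨i+1, hi⟩ by simp)
    rw [Fin.lt_def] at h2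
    simp only at *
    omega

lemma frst_zero {n k : ℕ} {v : Mat n} (hv : UU v) (ht : TNN v) (hk : k ≤ n) (f g : Fin k → Fin n)
    (hf : StrictMono f) (hg : StrictMono g) (hfg : f ≤ g) (h0 : mnr v f g = 0) : mnr v (frst hk) g = 0 := by
  have hfr := frst_le hk f hf
  revert h0
  refine path_induct (frst hk) f (frst_sm hk) hf hfr (fun p => mnr v p g = 0 → mnr v (frst hk) g = 0) id ?_
  intro p b x hp hfp hx hs hle ih h0
  apply ih
  refine le_antisymm ?_ (ht _ _ _ hp hg)
  have := hv.key_step ht p g b x hp hx hs hg (hle.trans hfg)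
  rwa [h0, mul_zero] at this

/-- reversed transpose -/
def revT {n : ℕ} (v : Mat n) : Mat n := fun i j => v j.rev i.rev

lemma mnr_revT {n k : ℕ} (v : Mat n) (f g : Fin k → Fin n) :
    mnr (revT v) f g = mnr v (Fin.rev ∘ g ∘ Fin.rev) (Fin.rev ∘ f ∘ Fin.rev) := by
  unfold mnr
  rw [← Matrix.det_transpose, ← Matrix.det_submatrix_equiv_self Fin.revPerm]
  rfl

lemma rev_sm {n k : ℕ} (f : Fin k → Fin n) (hf : StrictMono f) : StrictMono (Fin.rev ∘ f ∘ Fin.rev) := by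
  intro i j hij
  simp only [Function.comp]
  rw [Fin.rev_lt_rev]
  exact hf (Fin.rev_lt_rev.2 hij)

lemma revT_uu {n : ℕ} {v : Mat n} (hv : UU v) : UU (revT v) :=
  ⟨fun _ _ h => hv.1 _ _ (Fin.rev_lt_rev.2 h), fun i => hv.2 _⟩

lemma revT_tnn {n : ℕ} {v : Mat n} (hv : TNN v) : TNN (revT v) := by
  intro k f g hf hg
  rw [mnr_revT]
  exact hv k _ _ (rev_sm g hg) (rev_sm f hf)

lemma rev_frst {n k : ℕ} (hk : k ≤ n) : Fin.rev ∘ frst hk ∘ Fin.rev = lst hk := by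
  ext i; simp [frst, lst, Fin.rev]; omega

lemma rev_lst {n k : ℕ} (hk : k ≤ n) : Fin.rev ∘ lst hk ∘ Fin.rev = frst hk := by
  ext i; simp [frst, lst, Fin.rev]; omega

/-- (m4): nonzero corner minors force strict positivity. -/
lemma SP_of_corners {n : ℕ} {v : Mat n} (hv : UU v) (ht : TNN v)
    (hc : ∀ (k : ℕ) (hk : k ≤ n), mnr v (frst hk) (lst hk) ≠ 0) : SP v := by
  refine ⟨hv, fun k f g hf hg hfg => ?_⟩
  refine lt_of_le_of_ne (ht k f g hf hg) fun h0 => ?_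
  have hk : k ≤ n := by simpa using Fintype.card_le_of_injective f hf.injective
  have h1 := frst_zero hv ht hk f g hf hg hfg h0.symm
  have h2 : mnr (revT v) (Fin.rev ∘ g ∘ Fin.rev) (Fin.rev ∘ frst hk ∘ Fin.rev) = 0 := by
    rw [mnr_revT]
    convert h1 using 2 <;> (ext i; simp)
  have h3 := frst_zero (revT_uu hv) (revT_tnn ht) hk _ _ (rev_sm g hg) (rev_sm _ (frst_sm hk)) ?_ h2
  · rw [mnr_revT, rev_frst, rev_lst] at h3
    exact hc k hk h3
  · intro i
    simp only [Function.comp]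
    rw [Fin.rev_le_rev]
    exact frst_le hk g hg _

lemma SP.corner {n : ℕ} {v : Mat n} (hv : SP v) (k : ℕ) (hk : k ≤ n) : 0 < mnr v (frst hk) (lst hk) :=
  hv.2 k _ _ (frst_sm hk) (lst_sm hk) (frst_le hk _ (lst_sm hk))

lemma corner_mul_ne {n : ℕ} {s v s' : Mat n} (hs : UU s) (hs' : UU s') (ts : TNN s) (tv : TNN v) (ts' : TNN s')
    (k : ℕ) (hk : k ≤ n) (h : mnr v (frst hk) (lst hk) ≠ 0) : mnr (s * v * s') (frst hk) (lst hk) ≠ 0 := by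
  have h0 := lt_of_le_of_ne (tv k _ _ (frst_sm hk) (lst_sm hk)) (Ne.symm h)
  have h1 := TNN.mul_ge ts tv _ _ _ (frst_sm hk) (frst_sm hk) (lst_sm hk)
  have h2 := TNN.mul_ge (ts.mul tv) ts' _ _ _ (frst_sm hk) (lst_sm hk) (lst_sm hk)
  rw [hs.mnr_self _ (frst_sm hk), one_mul] at h1
  rw [hs'.mnr_self _ (lst_sm hk), mul_one] at h2
  exact (lt_of_lt_of_le h0 (h1.trans h2)).ne'

/-- Openness of SP inside UU. -/
lemma SP.eventually {n : ℕ} {v : Mat n} (hv : SP v) : ∀ᶠ w in nhds v, UU w → SP w := by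
  have : ∀ᶠ w in nhds v, ∀ (k : Fin (n+1)) (f g : Fin k → Fin n), StrictMono f → StrictMono g → f ≤ g → 0 < mnr w f g := by
    rw [Filter.eventually_all]; intro k
    rw [Filter.eventually_all]; intro f
    rw [Filter.eventually_all]; intro g
    by_cases h : StrictMono f ∧ StrictMono g ∧ f ≤ g
    · have h1 := hv.2 k f g h.1 h.2.1 h.2.2
      filter_upwards [(continuous_mnr f g).continuousAt.eventually (lt_mem_nhds h1)] with w hw _ _ _ using hw
    · filter_upwards with w h1 h2 h3
      exact absurd ⟨h1, h2, h3⟩ h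
  filter_upwards [this] with w hw hu
  refine ⟨hu, fun k f g hf hg hfg => ?_⟩
  have hk : k ≤ n := by simpa using Fintype.card_le_of_injective f hf.injective
  exact hw ⟨k, by omega⟩ f g hf hg hfg

/-- two-minor inequality -/
lemma entry_le {n : ℕ} {v : Mat n} (hv : UU v) (ht : TNN v) (a i b : Fin n) (h1 : a ≤ i) (h2 : i ≤ b) :
    v a b ≤ v a i * v i b := by
  rcases h1.eq_or_lt with rfl | h1
  · simp [hv.2]
  rcases h2.eq_or_lt with rfl | h2
  · simp [hv.2]
  have := ht 2 ![a, i] ![i, b] (by intro p q h; fin_cases p <;> fin_cases q <;> simp_all)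
    (by intro p q h; fin_cases p <;> fin_cases q <;> simp_all)
  unfold mnr at this
  rw [Matrix.det_fin_two] at this
  simp [hv.2] at this
  linarith

/-- conjugation by positive diagonal matrices -/
lemma mnr_diag_conj {n k : ℕ} (v : Mat n) (d e : Fin n → ℝ) (f g : Fin k → Fin n) :
    mnr (Matrix.diagonal d * v * Matrix.diagonal e) f g = (∏ i, d (f i)) * (∏ i, e (g i)) * mnr v f g := by
  unfold mnr
  have : (Matrix.diagonal d * v * Matrix.diagonal e).submatrix f g =
      Matrix.diagonal (fun i => d (f i)) * v.submatrix f g * Matrix.diagonal (fun i => e (g i)) := by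
    ext i j; simp [Matrix.mul_diagonal, Matrix.diagonal_mul]
  rw [this, Matrix.det_mul, Matrix.det_mul, Matrix.det_diagonal, Matrix.det_diagonal]; ring

lemma SP.diag_conj {n : ℕ} {v : Mat n} (hv : SP v) (d : Fin n → ℝ) (hd : ∀ i, 0 < d i) :
    SP (Matrix.diagonal d * v * Matrix.diagonal (fun i => (d i)⁻¹)) := by
  refine ⟨⟨fun i j h => ?_, fun i => ?_⟩, fun k f g hf hg hfg => ?_⟩
  · simp [Matrix.mul_diagonal, Matrix.diagonal_mul, hv.1.1 i j h]
  · simp [Matrix.mul_diagonal, Matrix.diagonal_mul, hv.1.2 i, (hd i).ne']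
  · rw [mnr_diag_conj]
    exact mul_pos (mul_pos (Finset.prod_pos fun i _ => hd _) (Finset.prod_pos fun i _ => inv_pos.2 (hd _)))
      (hv.2 k f g hf hg hfg)

end Hit

namespace Hit

/-! ## Module B1 : triangular decompositions and transversality -/

def Low {n : ℕ} (b : Mat n) : Prop := ∀ i j, i < j → b i j = 0

lemma Low.mul {n : ℕ} {v w : Mat n} (hv : Low v) (hw : Low w) : Low (v * w) := by
  intro i j hij
  rw [Matrix.mul_apply]
  refine Finset.sum_eq_zero fun l _ => ?_
  rcases lt_or_ge i l with h | h
  · rw [hv _ _ h, zero_mul]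
  · rw [hw _ _ (lt_of_le_of_lt h hij), mul_zero]

lemma Low.mul_diag_entry {n : ℕ} {v w : Mat n} (hv : Low v) (hw : Low w) (i : Fin n) :
    (v * w) i i = v i i * w i i := by
  rw [Matrix.mul_apply, Finset.sum_eq_single i]
  · intro l _ hl
    rcases lt_or_gt_of_ne hl with h | h
    · rw [hw _ _ h, mul_zero]
    · rw [hv _ _ h, zero_mul]
  · simp

lemma Low.diagonal {n : ℕ} (d : Fin n → ℝ) : Low (Matrix.diagonal d) :=
  fun _ _ h => Matrix.diagonal_apply_ne _ (ne_of_lt h)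

lemma Low.det {n : ℕ} {b : Mat n} (hb : Low b) : b.det = ∏ i, b i i := by
  rw [Matrix.det_of_isLowerTriangular]
  intro i j h
  exact hb i j h

lemma Low.inv {n : ℕ} {b : Mat n} (hb : Low b) (hd : b.det ≠ 0) : Low b⁻¹ := by
  have hu : IsUnit b.det := isUnit_iff_ne_zero.2 hd
  have := b.invertibleOfIsUnitDet hu
  have h1 : b.BlockTriangular OrderDual.toDual := fun i j h => hb i j h
  have h2 := Matrix.blockTriangular_inv_of_blockTriangular h1
  exact fun i j h => h2 h

lemma upper_inv {n : ℕ} {b : Mat n} (hb : ∀ i j, j < i → b i j = 0) (hd : b.det ≠ 0) :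
    ∀ i j, j < i → b⁻¹ i j = 0 := by
  have hu : IsUnit b.det := isUnit_iff_ne_zero.2 hd
  have := b.invertibleOfIsUnitDet hu
  have h1 : b.BlockTriangular id := fun i j h => hb i j h
  have h2 := Matrix.blockTriangular_inv_of_blockTriangular h1
  exact fun i j h => h2 h

lemma UU.isUnit {n : ℕ} {u : Mat n} (hu : UU u) : IsUnit u.det := by rw [hu.det]; exact isUnit_one

lemma UU.inv_mul {n : ℕ} {u : Mat n} (hu : UU u) : u⁻¹ * u = 1 := Matrix.nonsing_inv_mul _ hu.isUnit
lemma UU.mul_inv {n : ℕ} {u : Mat n} (hu : UU u) : u * u⁻¹ = 1 := Matrix.mul_nonsing_inv _ hu.isUnit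

lemma UU.inv {n : ℕ} {u : Mat n} (hu : UU u) : UU u⁻¹ := by
  have h1 := upper_inv hu.1 (by rw [hu.det]; norm_num)
  refine ⟨h1, fun i => ?_⟩
  have h2 := congrFun (congrFun hu.inv_mul i) i
  rw [Matrix.mul_apply, Finset.sum_eq_single i, hu.2, mul_one, Matrix.one_apply_eq] at h2
  · exact h2
  · intro l _ hl
    rcases lt_or_gt_of_ne hl with h | h
    · rw [h1 _ _ h, zero_mul]
    · rw [hu.1 _ _ h, mul_zero]
  · simp

lemma UU_low_eq_one {n : ℕ} {u : Mat n} (hu : UU u) (hl : Low u) : u = 1 := by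
  ext i j
  rcases lt_trichotomy i j with h | h | h
  · rw [hl _ _ h, Matrix.one_apply_ne (ne_of_lt h)]
  · subst h; rw [hu.2, Matrix.one_apply_eq]
  · rw [hu.1 _ _ h, Matrix.one_apply_ne (ne_of_gt h)]

lemma ul_unique {n : ℕ} {u u' b b' : Mat n} (hu : UU u) (hu' : UU u') (hb : Low b) (hb' : Low b')
    (hd : b.det ≠ 0) (h : u * b = u' * b') : u = u' := by
  have h1 : u'⁻¹ * u = b' * b⁻¹ := by
    have h2 : u'⁻¹ * (u * b) * b⁻¹ = u'⁻¹ * (u' * b') * b⁻¹ := by rw [h]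
    rw [← mul_assoc, ← mul_assoc, hu'.inv_mul, one_mul, mul_assoc, Matrix.mul_nonsing_inv _ (isUnit_iff_ne_zero.2 hd),
      mul_one] at h2
    exact h2
  have h3 := UU_low_eq_one (hu'.inv.mul hu) (by rw [h1]; exact hb'.mul (hb.inv hd))
  have h4 : u' * (u'⁻¹ * u) = u' * 1 := by rw [h3]
  rwa [← mul_assoc, hu'.mul_inv, one_mul, mul_one] at h4

/-- block matrix `diag(1, g[≥ j])` -/
def blk {n : ℕ} (g : Mat n) (j : Fin n) : Mat n := fun i l =>
  if i < j then (if i = l then 1 else 0) else (if l < j then 0 else g i l)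

lemma blk_mulVec_lt {n : ℕ} (g : Mat n) (j : Fin n) (w : Fin n → ℝ) (i : Fin n) (h : i < j) :
    (blk g j *ᵥ w) i = w i := by
  simp [Matrix.mulVec, dotProduct, blk, h]

lemma blk_mulVec_ge {n : ℕ} (g : Mat n) (j : Fin n) (w : Fin n → ℝ) (hw : ∀ i < j, w i = 0) (i : Fin n) (h : j ≤ i) :
    (blk g j *ᵥ w) i = (g *ᵥ w) i := by
  simp only [Matrix.mulVec, dotProduct, blk, not_lt.2 h, if_false]
  refine Finset.sum_congr rfl fun l _ => ?_
  by_cases hl : l < j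
  · simp [hl, hw l hl]
  · simp [hl]

/-- all trailing blocks are invertible -/
def Trail {n : ℕ} (g : Mat n) : Prop := ∀ j, (blk g j).det ≠ 0

lemma trail_of_ker {n : ℕ} (g : Mat n) (H : ∀ (j : Fin n) (w : Fin n → ℝ), (∀ i < j, w i = 0) →
    (∀ i, j ≤ i → (g *ᵥ w) i = 0) → w = 0) : Trail g := by
  intro j h0
  obtain ⟨w, hw, hw0⟩ := Matrix.exists_mulVec_eq_zero_iff.2 h0
  have h1 : ∀ i < j, w i = 0 := fun i hi => by
    rw [← blk_mulVec_lt g j w i hi, hw0]; rfl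
  refine hw (H j w h1 fun i hi => ?_)
  rw [← blk_mulVec_ge g j w h1 i hi, hw0]; rfl

/-- lower triangular matrix with `g * ulc g` unipotent upper -/
noncomputable def ulc {n : ℕ} (g : Mat n) : Mat n := fun i j => (blk g j)⁻¹ i j

lemma ulc_col {n : ℕ} {g : Mat n} (hg : Trail g) (j : Fin n) :
    blk g j *ᵥ (fun i => ulc g i j) = Pi.single j 1 := by
  have : (fun i => ulc g i j) = (blk g j)⁻¹ *ᵥ Pi.single j 1 := by
    ext i; simp [ulc]
  rw [this, Matrix.mulVec_mulVec, Matrix.mul_nonsing_inv _ (isUnit_iff_ne_zero.2 (hg j)), Matrix.one_mulVec]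

lemma ulc_low {n : ℕ} {g : Mat n} (hg : Trail g) : Low (ulc g) := by
  intro i j hij
  have h := congrFun (ulc_col hg j) i
  rw [blk_mulVec_lt _ _ _ _ hij] at h
  rw [h, Pi.single_eq_of_ne (ne_of_lt hij)]

lemma ulc_uu {n : ℕ} {g : Mat n} (hg : Trail g) : UU (g * ulc g) := by
  have key : ∀ i j, j ≤ i → (g * ulc g) i j = (Pi.single j 1 : Fin n → ℝ) i := by
    intro i j hij
    rw [← ulc_col hg j, blk_mulVec_ge _ _ _ (fun l hl => ulc_low hg l j hl) i hij]
    rfl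
  exact ⟨fun i j h => by rw [key i j h.le, Pi.single_eq_of_ne (ne_of_gt h)], fun i => by rw [key i i le_rfl, Pi.single_eq_same]⟩

lemma ulc_det {n : ℕ} {g : Mat n} (hg : Trail g) : g.det * (ulc g).det = 1 := by
  rw [← Matrix.det_mul, (ulc_uu hg).det]

lemma trail_of_ul {n : ℕ} {u b : Mat n} (hu : UU u) (hb : Low b) (hd : b.det ≠ 0) : Trail (u * b) := by
  apply trail_of_ker
  intro j w hw h
  have hy : ∀ i < j, (b *ᵥ w) i = 0 := by
    intro i hi
    simp only [Matrix.mulVec, dotProduct]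
    refine Finset.sum_eq_zero fun l _ => ?_
    rcases lt_or_ge l j with h' | h'
    · rw [hw l h', mul_zero]
    · rw [hb _ _ (lt_of_lt_of_le hi h'), zero_mul]
  have hy2 : ∀ i, j ≤ i → (b *ᵥ w) i = 0 := by
    intro i hi
    have : b *ᵥ w = u⁻¹ *ᵥ ((u * b) *ᵥ w) := by
      rw [Matrix.mulVec_mulVec, ← mul_assoc, hu.inv_mul, one_mul]
    rw [this]
    rw [Matrix.mulVec, dotProduct]
    refine Finset.sum_eq_zero fun l _ => ?_
    rcases lt_or_ge l i with h' | h'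
    · rw [hu.inv.1 _ _ h', zero_mul]
    · rw [h l (hi.trans h'), mul_zero]
  have h0 : b *ᵥ w = 0 := by
    ext i
    rcases lt_or_ge i j with h' | h'
    · exact hy i h'
    · exact hy2 i h'
  by_contra hne
  exact hd (Matrix.exists_mulVec_eq_zero_iff.1 ⟨w, hne, h0⟩)

lemma ul_eq_ulc {n : ℕ} {u b : Mat n} (hu : UU u) (hb : Low b) (hd : b.det ≠ 0) :
    (u * b) * ulc (u * b) = u := by
  have ht := trail_of_ul hu hb hd
  have h1 := ulc_det ht
  have h2 : (ulc (u * b)).det ≠ 0 := right_ne_zero_of_mul_eq_one h1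
  have h3 : (u * b) * ulc (u * b) * (ulc (u * b))⁻¹ = u * b := by
    rw [mul_assoc, Matrix.mul_nonsing_inv _ (isUnit_iff_ne_zero.2 h2), mul_one]
  refine (ul_unique hu (ulc_uu ht) hb ((ulc_low ht).inv h2) hd h3.symm).symm

lemma continuousAt_inv {n : ℕ} {g : Mat n} (hg : g.det ≠ 0) : ContinuousAt (fun g : Mat n => g⁻¹) g := by
  have : (fun g : Mat n => g⁻¹) = fun g => (g.det)⁻¹ • g.adjugate := by
    ext g; rw [Matrix.inv_def, Ring.inverse_eq_inv']
  rw [this]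
  exact ContinuousAt.smul ((Continuous.continuousAt (by fun_prop)).inv₀ hg) (Continuous.continuousAt (by fun_prop))

lemma blk_cont {n : ℕ} (j : Fin n) : Continuous fun g : Mat n => blk g j := by
  refine continuous_matrix fun i l => ?_
  unfold blk
  split_ifs <;> fun_prop

lemma tendsto_mat {ι : Type*} {F : Filter ι} {n : ℕ} {f : ι → Mat n} {g : Mat n} :
    Filter.Tendsto f F (nhds g) ↔ ∀ i j, Filter.Tendsto (fun t => f t i j) F (nhds (g i j)) := by
  constructor
  · intro h i j
    exact ((continuous_id.matrix_elem i j).tendsto g).comp h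
  · intro h
    let f' : ι → Fin n → Fin n → ℝ := fun t i j => f t i j
    let g' : Fin n → Fin n → ℝ := fun i j => g i j
    have h1 : Filter.Tendsto f' F (nhds g') :=
      tendsto_pi_nhds.2 fun i => tendsto_pi_nhds.2 fun j => h i j
    have hc : Continuous (fun x : Fin n → Fin n → ℝ => (Matrix.of x : Mat n)) :=
      continuous_matrix fun i j => by simp only [Matrix.of_apply]; fun_prop
    exact (hc.tendsto g').comp h1

lemma continuousAt_mat {Z : Type*} [TopologicalSpace Z] {n : ℕ} {f : Z → Mat n} {z : Z} :
    ContinuousAt f z ↔ ∀ i j, ContinuousAt (fun t => f t i j) z := tendsto_mat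

lemma continuousAt_ulc {n : ℕ} {g : Mat n} (hg : Trail g) : ContinuousAt (fun g : Mat n => ulc g) g := by
  rw [continuousAt_mat]; intro i j
  have h1 : ContinuousAt (fun g : Mat n => (blk g j)⁻¹) g :=
    ContinuousAt.comp (f := fun g => blk g j) (g := fun g : Mat n => g⁻¹) (continuousAt_inv (hg j)) (blk_cont j).continuousAt
  exact continuousAt_mat.1 h1 i j

lemma Trail.eventually {n : ℕ} {g : Mat n} (hg : Trail g) : ∀ᶠ g' in nhds g, Trail g' := by
  unfold Trail
  rw [Filter.eventually_all]
  intro j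
  have : Continuous fun g' : Mat n => (blk g' j).det := Continuous.matrix_det (blk_cont j)
  exact this.continuousAt.eventually_ne (hg j)

/-! antidiagonal matrix -/
def Wm {n : ℕ} : Mat n := fun i j => if j = i.rev then 1 else 0

lemma Wm_mul {n : ℕ} (g : Mat n) (i j : Fin n) : ((Wm : Mat n) * g) i j = g i.rev j := by
  simp [Matrix.mul_apply, Wm]

lemma mul_Wm {n : ℕ} (g : Mat n) (i j : Fin n) : (g * (Wm : Mat n)) i j = g i j.rev := by
  rw [Matrix.mul_apply, Finset.sum_eq_single j.rev]
  · simp [Wm]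
  · intro l _ hl
    rw [Wm, if_neg, mul_zero]
    rintro rfl; simp at hl
  · simp

lemma Wm_sq {n : ℕ} : (Wm : Mat n) * Wm = 1 := by
  ext i j
  rw [Wm_mul]
  simp [Wm, Matrix.one_apply, eq_comm]

lemma Wm_det {n : ℕ} : (Wm : Mat n).det ≠ 0 := by
  intro h
  have := congrArg Matrix.det (Wm_sq (n := n))
  rw [Matrix.det_mul, h] at this
  simp at this

lemma Wm_inv {n : ℕ} : (Wm : Mat n)⁻¹ = Wm := Matrix.inv_eq_left_inv Wm_sq

lemma Wm_diag {n : ℕ} (e : Fin n → ℝ) : Matrix.diagonal e * Wm = Wm * Matrix.diagonal (fun i => e i.rev) := by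
  ext i j
  rw [mul_Wm, Wm_mul]
  by_cases h : i = j.rev
  · subst h; simp
  · have : i.rev ≠ j := by rintro rfl; simp at h
    simp [Matrix.diagonal_apply, h, this]

/-! transversality -/
def Tr {n : ℕ} (g g' : Mat n) : Prop := ∀ (k : ℕ) (hk : k ≤ n), mnr (g⁻¹ * g') (frst hk) (lst hk) ≠ 0

lemma mnr_low_left {n k : ℕ} (hk : k ≤ n) {L : Mat n} (hL : Low L) (v : Mat n) (g : Fin k → Fin n) :
    mnr (L * v) (frst hk) g = mnr L (frst hk) (frst hk) * mnr v (frst hk) g := by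
  rw [mnr_mul, Finset.sum_eq_single (OrderEmbedding.ofStrictMono (frst hk) (frst_sm hk))]
  · simp
  · intro h _ hne
    have h0 : ¬ (h : Fin k → Fin n) ≤ frst hk := by
      intro hle
      apply hne
      ext1 i
      exact congrFun (le_antisymm hle (frst_le hk h h.strictMono)) i
    have := mnr_upper_zero (v := Lᵀ) (fun i j hij => hL j i hij) _ _ h.strictMono (frst_sm hk) h0
    rw [mnr_transpose] at this
    rw [this, zero_mul]
  · simp

lemma le_lst {n k : ℕ} (hk : k ≤ n) (g : Fin k → Fin n) (hg : StrictMono g) : g ≤ lst hk := by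
  have := frst_le hk _ (rev_sm g hg)
  intro i
  have h := this i.rev
  have e : lst hk i = (frst hk i.rev).rev := by rw [← rev_frst]; rfl
  rw [e, Fin.le_rev_iff]
  simpa using h

lemma mnr_low_right {n k : ℕ} (hk : k ≤ n) {L : Mat n} (hL : Low L) (v : Mat n) (f : Fin k → Fin n) :
    mnr (v * L) f (lst hk) = mnr v f (lst hk) * mnr L (lst hk) (lst hk) := by
  rw [mnr_mul, Finset.sum_eq_single (OrderEmbedding.ofStrictMono (lst hk) (lst_sm hk))]
  · simp
  · intro h _ hne
    have h0 : ¬ lst hk ≤ (h : Fin k → Fin n) := by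
      intro hle
      apply hne
      ext1 i
      exact congrFun (le_antisymm (le_lst hk h h.strictMono) hle) i
    have := mnr_upper_zero (v := Lᵀ) (fun i j hij => hL j i hij) _ _ (lst_sm hk) h.strictMono h0
    rw [mnr_transpose] at this
    rw [this, mul_zero]
  · simp

lemma mnr_low_self {n k : ℕ} {L : Mat n} (hL : Low L) (hd : L.det ≠ 0) (f : Fin k → Fin n) (hf : StrictMono f) :
    mnr L f f ≠ 0 := by
  unfold mnr
  rw [Matrix.det_of_isLowerTriangular]
  · rw [hL.det] at hd
    rw [Finset.prod_ne_zero_iff] at hd ⊢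
    exact fun i _ => hd _ (Finset.mem_univ _)
  · intro i j hij
    exact hL _ _ (hf hij)

lemma Tr_low {n : ℕ} {u u' b b' : Mat n} (hb : Low b) (hb' : Low b')
    (hd : b.det ≠ 0) (hd' : b'.det ≠ 0) : Tr (u * b) (u' * b') ↔ Tr u u' := by
  unfold Tr
  refine forall_congr' fun k => forall_congr' fun hk => not_congr ?_
  have e : (u * b)⁻¹ * (u' * b') = b⁻¹ * (u⁻¹ * u' * b') := by
    rw [Matrix.mul_inv_rev]; simp only [mul_assoc]
  have hdi : (b⁻¹).det ≠ 0 := by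
    rw [Matrix.det_nonsing_inv, Ring.inverse_eq_inv']; exact inv_ne_zero hd
  rw [e, mnr_low_left hk (hb.inv hd), mnr_low_right hk hb']
  simp [mnr_low_self (hb.inv hd) hdi _ (frst_sm hk), mnr_low_self hb' hd' _ (lst_sm hk)]

lemma Tr_left {n : ℕ} {M g g' : Mat n} (hM : M.det ≠ 0) : Tr (M * g) (M * g') ↔ Tr g g' := by
  unfold Tr
  have e : (M * g)⁻¹ * (M * g') = g⁻¹ * g' := by
    rw [Matrix.mul_inv_rev, mul_assoc, ← mul_assoc M⁻¹, Matrix.nonsing_inv_mul _ (isUnit_iff_ne_zero.2 hM), one_mul]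
  rw [e]

lemma sum_frst {n k : ℕ} (hk : k ≤ n) (F : Fin n → ℝ) (h : ∀ i : Fin n, k ≤ i → F i = 0) :
    ∑ i, F (frst hk i) = ∑ i, F i := by
  refine Fintype.sum_of_injective (frst hk) (frst_sm hk).injective _ _ ?_ (fun _ => rfl)
  intro i hi
  apply h
  by_contra hcon
  exact hi ⟨⟨i, by omega⟩, rfl⟩

lemma sum_lst {n k : ℕ} (hk : k ≤ n) (F : Fin n → ℝ) (h : ∀ i : Fin n, (i : ℕ) < n - k → F i = 0) :
    ∑ i, F (lst hk i) = ∑ i, F i := by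
  refine Fintype.sum_of_injective (lst hk) (lst_sm hk).injective _ _ ?_ (fun _ => rfl)
  intro i hi
  apply h
  by_contra hcon
  exact hi ⟨⟨i - (n - k), by omega⟩, by ext; simp [lst]; omega⟩

lemma trail_of_tr_left {n : ℕ} {g : Mat n} (h : Tr Wm g) : Trail g := by
  apply trail_of_ker
  intro j w hw hgw
  have hk : n - j ≤ n := Nat.sub_le _ _
  by_contra hne
  have h1 := h (n - j) hk
  rw [Wm_inv] at h1
  apply h1
  have : mnr (Wm * g) (frst hk) (lst hk) = mnr g (lst hk ∘ Fin.revPerm) (lst hk) := by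
    unfold mnr
    congr 1
    ext a b
    simp only [submatrix_apply, Wm_mul]
    rw [← rev_frst]
    simp
  rw [this, mnr_perm_left]
  refine mul_eq_zero_of_right _ ?_
  unfold mnr
  refine Matrix.exists_mulVec_eq_zero_iff.1 ⟨w ∘ lst hk, ?_, ?_⟩
  · intro h0
    apply hne
    ext i
    rcases lt_or_ge i j with h' | h'
    · exact hw i h'
    · have := congrFun h0 ⟨i - j, by have := i.2; rw [Fin.le_def] at h'; omega⟩
      simp only [Function.comp, lst, Pi.zero_apply] at this
      show w i = 0
      convert this using 2
      ext; simp; rw [Fin.le_def] at h'; omega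
  · ext i
    simp only [Matrix.mulVec, dotProduct, submatrix_apply, Function.comp, Pi.zero_apply]
    rw [sum_lst hk (fun l => g (lst hk i) l * w l)]
    · have h2 := hgw (lst hk i) (by rw [Fin.le_def]; simp [lst]; omega)
      exact h2
    · intro l hl
      rw [hw l (by rw [Fin.lt_def]; omega), mul_zero]

lemma trail_of_tr_right {n : ℕ} {g : Mat n} (hg : g.det ≠ 0) (h : Tr g Wm) : Trail g := by
  apply trail_of_ker
  intro j w hw hgw
  have hk : (j : ℕ) ≤ n := j.2.le
  by_contra hne
  have h1 := h j hk
  apply h1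
  have : mnr (g⁻¹ * Wm) (frst hk) (lst hk) = mnr g⁻¹ (frst hk) (frst hk ∘ Fin.revPerm) := by
    unfold mnr
    congr 1
    ext a b
    simp only [submatrix_apply, mul_Wm]
    rw [← rev_frst]
    simp
  rw [this, mnr_perm_right]
  refine mul_eq_zero_of_right _ ?_
  unfold mnr
  have hw' : w = g⁻¹ *ᵥ (g *ᵥ w) := by
    rw [Matrix.mulVec_mulVec, Matrix.nonsing_inv_mul _ (isUnit_iff_ne_zero.2 hg), Matrix.one_mulVec]
  refine Matrix.exists_mulVec_eq_zero_iff.1 ⟨(g *ᵥ w) ∘ frst hk, ?_, ?_⟩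
  · intro h0
    apply hne
    have : g *ᵥ w = 0 := by
      ext i
      rcases lt_or_ge i j with h' | h'
      · exact congrFun h0 ⟨i, h'⟩
      · exact hgw i h'
    rw [hw', this, Matrix.mulVec_zero]
  · ext i
    simp only [Matrix.mulVec, dotProduct, submatrix_apply, Function.comp, Pi.zero_apply]
    have := sum_frst hk (fun l => g⁻¹ (frst hk i) l * (g *ᵥ w) l) ?_
    · refine this.trans ?_
      have h3 := congrFun hw' (frst hk i)
      rw [hw (frst hk i) (by rw [Fin.lt_def]; exact i.2)] at h3
      exact h3.symm
    · intro l hl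
      rw [hgw l (by rw [Fin.le_def]; exact hl), mul_zero]

end Hit

namespace Hit

/-! ## Module B2 : the positivity witness and its normalisation -/

lemma inv_mul_cancel' {n : ℕ} {h : Mat n} (hd : h.det ≠ 0) : h⁻¹ * h = 1 :=
  Matrix.nonsing_inv_mul _ (isUnit_iff_ne_zero.2 hd)
lemma mul_inv_cancel' {n : ℕ} {h : Mat n} (hd : h.det ≠ 0) : h * h⁻¹ = 1 :=
  Matrix.mul_nonsing_inv _ (isUnit_iff_ne_zero.2 hd)

/-- Combinatorial data. `(γ, false)` stands for `γ · 0`, `(γ, true)` for `γ · ∞`. -/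
structure Dat (Γ : Type) [Group Γ] where
  γ0 : Γ
  B : Γ
  X : Finset (Γ × Bool)
  pos : Γ × Bool → ℝ
  h0 : (1, false) ∈ X
  pos0 : pos (1, false) = 0
  hp : (B, false) ∈ X
  hq : (B, true) ∈ X
  hr : (γ0 * B, false) ∈ X
  h0p : 0 < pos (B, false)
  hpq : pos (B, false) < pos (B, true)
  hqr : pos (B, true) < pos (γ0 * B, false)

/-- the pair `(a,b)` can be moved into the good interval with a gap containing a standard pair -/
def Dat.Rel {Γ : Type} [Group Γ] (D : Dat Γ) (a b : Γ × Bool) : Prop :=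
  ∃ (γ : Γ) (y y' : Γ × Bool) (z : Γ) (l l' : ℤ), y ∈ D.X ∧ y' ∈ D.X ∧ (z, false) ∈ D.X ∧ (z, true) ∈ D.X ∧
    γ * a.1 = y.1 * D.γ0 ^ l ∧ y.2 = a.2 ∧ γ * b.1 = y'.1 * D.γ0 ^ l' ∧ y'.2 = b.2 ∧
    D.pos (D.B, false) < D.pos y ∧ D.pos y < D.pos (z, false) ∧ D.pos (z, false) < D.pos (z, true) ∧
    D.pos (z, true) < D.pos y' ∧ D.pos y' < D.pos (D.B, true)

structure Dat.MP {Γ : Type} [Group Γ] (D : Dat Γ) : Prop where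
  adj : ∀ x ∈ D.X, ∀ x' ∈ D.X, D.pos x < D.pos x' → (∀ y ∈ D.X, D.pos x < D.pos y → D.pos x' ≤ D.pos y) → D.Rel x x'
  mx : ∀ x ∈ D.X, (∀ y ∈ D.X, D.pos y ≤ D.pos x) → D.Rel x (1, true)
  mn : ∀ x ∈ D.X, (∀ y ∈ D.X, D.pos x ≤ D.pos y) → D.Rel (1, true) x

def Ws {n : ℕ} (s : Bool) : Mat n := if s then Wm else 1

lemma Ws_det {n : ℕ} (s : Bool) : (Ws s : Mat n).det ≠ 0 := by
  cases s <;> simp [Ws, Wm_det]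

structure Wit {Γ : Type} [Group Γ] {n : ℕ} (D : Dat Γ) (φ : Γ →* SL n ℝ) (h : Mat n) (lam : Fin n → ℝ)
    (u b : Γ × Bool → Mat n) (d : Fin n → ℝ) (l : Mat n) : Prop where
  hdet : h.det ≠ 0
  lpos : ∀ i, 0 < lam i
  lanti : ∀ i j : Fin n, i < j → lam j < lam i
  hg0 : (φ D.γ0 : Mat n) * h = h * Matrix.diagonal lam
  uu : ∀ x ∈ D.X, UU (u x)
  low : ∀ x ∈ D.X, Low (b x)
  dec : ∀ x ∈ D.X, (φ x.1 : Mat n) * h * Ws x.2 = h * (u x * b x)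
  sp : ∀ x ∈ D.X, ∀ x' ∈ D.X, D.pos x < D.pos x' → SP ((u x)⁻¹ * u x')
  dpos : ∀ i, 0 < d i
  lsp : SP lᵀ
  bp : b (D.B, false) = Matrix.diagonal d * l

def PosRep {Γ : Type} [Group Γ] {n : ℕ} (D : Dat Γ) (φ : Γ →* SL n ℝ) : Prop :=
  ∃ h lam u b d l, Wit D φ h lam u b d l

lemma diag_mul_inv {n : ℕ} (e : Fin n → ℝ) (he : ∀ i, 0 < e i) :
    (Matrix.diagonal e : Mat n) * Matrix.diagonal (fun i => (e i)⁻¹) = 1 := by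
  rw [Matrix.diagonal_mul_diagonal]
  have : (fun i => e i * (e i)⁻¹) = fun _ => (1:ℝ) := by ext i; exact mul_inv_cancel₀ (he i).ne'
  rw [this, Matrix.diagonal_one]

lemma diag_inv_mul {n : ℕ} (e : Fin n → ℝ) (he : ∀ i, 0 < e i) :
    (Matrix.diagonal (fun i => (e i)⁻¹) : Mat n) * Matrix.diagonal e = 1 := by
  rw [Matrix.diagonal_mul_diagonal]
  have : (fun i => (e i)⁻¹ * e i) = fun _ => (1:ℝ) := by ext i; exact inv_mul_cancel₀ (he i).ne'
  rw [this, Matrix.diagonal_one]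

lemma UU.diag_conj {n : ℕ} {v : Mat n} (hv : UU v) (d : Fin n → ℝ) (hd : ∀ i, 0 < d i) :
    UU (Matrix.diagonal (fun i => (d i)⁻¹) * v * Matrix.diagonal d) := by
  refine ⟨fun i j h => ?_, fun i => ?_⟩
  · simp [Matrix.mul_diagonal, Matrix.diagonal_mul, hv.1 i j h]
  · simp [Matrix.mul_diagonal, Matrix.diagonal_mul, hv.2 i, (hd i).ne']

lemma SP.diag_conj' {n : ℕ} {v : Mat n} (hv : SP v) (d : Fin n → ℝ) (hd : ∀ i, 0 < d i) :
    SP (Matrix.diagonal (fun i => (d i)⁻¹) * v * Matrix.diagonal d) := by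
  have := hv.diag_conj (fun i => (d i)⁻¹) (fun i => inv_pos.2 (hd i))
  simpa using this

lemma Wit.scale {Γ : Type} [Group Γ] {n : ℕ} {D : Dat Γ} {φ : Γ →* SL n ℝ} {h : Mat n} {lam : Fin n → ℝ}
    {u b : Γ × Bool → Mat n} {d : Fin n → ℝ} {l : Mat n} (w : Wit D φ h lam u b d l) (e : Fin n → ℝ) (he : ∀ i, 0 < e i) :
    Wit D φ (h * Matrix.diagonal e) lam
      (fun x => Matrix.diagonal (fun i => (e i)⁻¹) * u x * Matrix.diagonal e)
      (fun x => Matrix.diagonal (fun i => (e i)⁻¹) * b x * (if x.2 then Matrix.diagonal (fun i => e i.rev) else Matrix.diagonal e)) d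
      (Matrix.diagonal (fun i => (e i)⁻¹) * l * Matrix.diagonal e) := by
  have e1 := diag_mul_inv e he
  have e2 := diag_inv_mul e he
  refine ⟨?_, w.lpos, w.lanti, ?_, fun x hx => (w.uu x hx).diag_conj e he, ?_, ?_, ?_, w.dpos, ?_, ?_⟩
  · rw [Matrix.det_mul, Matrix.det_diagonal]
    exact mul_ne_zero w.hdet (Finset.prod_ne_zero_iff.2 fun i _ => (he i).ne')
  · rw [← mul_assoc, w.hg0, mul_assoc, mul_assoc, Matrix.diagonal_mul_diagonal, Matrix.diagonal_mul_diagonal]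
    simp only [mul_comm]
  · intro x hx
    have h1 : Low (Matrix.diagonal (fun i => (e i)⁻¹) * b x) := (Low.diagonal _).mul (w.low x hx)
    split_ifs
    · exact h1.mul (Low.diagonal _)
    · exact h1.mul (Low.diagonal _)
  · intro x hx
    have key : (Matrix.diagonal e : Mat n) * Ws x.2 = Ws x.2 * (if x.2 then Matrix.diagonal (fun i => e i.rev) else Matrix.diagonal e) := by
      unfold Ws
      split_ifs
      · rw [Wm_diag]
      · rw [mul_one, one_mul]
    rw [← mul_assoc, mul_assoc ((φ x.1 : Mat n) * h), key, ← mul_assoc, w.dec x hx]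
    simp only [← mul_assoc]
    rw [mul_assoc h (Matrix.diagonal e), e1, mul_one, mul_assoc (h * u x) (Matrix.diagonal e), e1, mul_one]
  · intro x hx x' hx' hlt
    have := (w.sp x hx x' hx' hlt).diag_conj' e he
    convert this using 1
    have h1 : (Matrix.diagonal (fun i => (e i)⁻¹) * u x * Matrix.diagonal e)⁻¹ = Matrix.diagonal (fun i => (e i)⁻¹) * (u x)⁻¹ * Matrix.diagonal e := by
      apply Matrix.inv_eq_left_inv
      simp only [← mul_assoc]
      rw [mul_assoc (Matrix.diagonal (fun i => (e i)⁻¹) * (u x)⁻¹), e1, mul_one, mul_assoc _ (u x)⁻¹ (u x), (w.uu x hx).inv_mul, mul_one, e2]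
    rw [h1]
    simp only [← mul_assoc]
    rw [mul_assoc (Matrix.diagonal (fun i => (e i)⁻¹) * (u x)⁻¹), e1, mul_one]
  · have := w.lsp.diag_conj e he
    convert this using 1
    simp [Matrix.transpose_mul, mul_assoc]
  · dsimp only
    rw [w.bp]
    simp only [if_neg Bool.false_ne_true, ← mul_assoc]
    rw [Matrix.diagonal_mul_diagonal, Matrix.diagonal_mul_diagonal]
    simp only [mul_comm]

/-- normalised witness -/
lemma PosRep.normalise {Γ : Type} [Group Γ] {n : ℕ} {D : Dat Γ} {φ : Γ →* SL n ℝ} (hn : 0 < n) (H : PosRep D φ) :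
    ∃ h lam u b d l, Wit D φ h lam u b d l ∧ (∀ i j : Fin n, (j : ℕ) = i + 1 → u (D.B, false) i j = 1) ∧
      ∑ i, ∑ j, (h i j) ^ 2 = 1 := by
  obtain ⟨h, lam, u, b, d, l, w⟩ := H
  have hu0 : SP (u (D.B, false)) := by
    have h1 := w.sp _ D.h0 _ D.hp (by rw [D.pos0]; exact D.h0p)
    have h2 : u (1, false) = 1 := by
      have h3 := w.dec _ D.h0
      simp only [Ws, map_one, Matrix.SpecialLinearGroup.coe_one, one_mul, if_neg Bool.false_ne_true, mul_one] at h3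
      have h4 : u (1, false) * b (1, false) = 1 := by
        have : h⁻¹ * h = h⁻¹ * (h * (u (1, false) * b (1, false))) := by rw [← h3]
        rwa [← mul_assoc, inv_mul_cancel' w.hdet, one_mul, eq_comm] at this
      have h5 : (b (1, false)).det ≠ 0 := by
        have := congrArg Matrix.det h4
        rw [Matrix.det_mul, Matrix.det_one] at this
        exact right_ne_zero_of_mul_eq_one this
      exact ul_unique (w.uu _ D.h0) UU.one (w.low _ D.h0) (Low.diagonal 1 : Low (Matrix.diagonal 1)) h5 (by rw [h4]; simp)
    rwa [h2, inv_one, one_mul] at h1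
  -- the scaling
  let s : ℕ → ℝ := fun i => if hi : i + 1 < n then u (D.B, false) ⟨i, by omega⟩ ⟨i+1, hi⟩ else 1
  have hs : ∀ i, 0 < s i := by
    intro i
    simp only [s]
    split_ifs with hi
    · exact hu0.entry _ _ (by rw [Fin.le_def]; simp)
    · norm_num
  let e : Fin n → ℝ := fun i => ∏ k ∈ Finset.range i, (s k)⁻¹
  have he : ∀ i, 0 < e i := fun i => Finset.prod_pos fun k _ => inv_pos.2 (hs k)
  have w1 := w.scale e he
  set h1 := h * Matrix.diagonal e with hh1
  have hS : 0 < ∑ i, ∑ j, (h1 i j) ^ 2 := by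
    by_contra hcon
    have hz : ∀ i j, h1 i j = 0 := by
      intro i j
      have h2 : ∑ i, ∑ j, (h1 i j) ^ 2 = 0 :=
        le_antisymm (not_lt.1 hcon) (Finset.sum_nonneg fun i _ => Finset.sum_nonneg fun j _ => sq_nonneg _)
      have h3 := (Finset.sum_eq_zero_iff_of_nonneg (s := Finset.univ) (f := fun i => ∑ j, (h1 i j) ^ 2)
        (fun i _ => Finset.sum_nonneg fun j _ => sq_nonneg _)).1 h2 i (Finset.mem_univ _)
      have h3' := (Finset.sum_eq_zero_iff_of_nonneg (s := Finset.univ) (f := fun j => (h1 i j) ^ 2)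
        (fun j _ => sq_nonneg _)).1 h3 j (Finset.mem_univ _)
      exact pow_eq_zero_iff (two_ne_zero) |>.1 h3'
    have : h1 = 0 := by ext i j; exact hz i j
    have h4 := w1.hdet
    rw [this] at h4
    have : Nonempty (Fin n) := ⟨⟨0, hn⟩⟩
    exact h4 Matrix.det_zero
  let c : ℝ := (Real.sqrt (∑ i, ∑ j, (h1 i j) ^ 2))⁻¹
  have hc : 0 < c := inv_pos.2 (Real.sqrt_pos.2 hS)
  have w2 := w1.scale (fun _ => c) (fun _ => hc)
  refine ⟨_, _, _, _, _, _, w2, ?_, ?_⟩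
  · intro i j hij
    simp only [Matrix.mul_diagonal, Matrix.diagonal_mul]
    have h5 : e j = e i * (s i)⁻¹ := by
      simp only [e, hij, Finset.prod_range_succ]
    have h6 : s i = u (D.B, false) i j := by
      have hi : (i : ℕ) + 1 < n := by omega
      simp only [s, dif_pos hi]
      congr 1
      ext; simp [hij]
    rw [h5, ← h6]
    have := (he i).ne'; have := (hs i).ne'; have := hc.ne'
    field_simp
  · simp only [Matrix.mul_diagonal, mul_pow, ← Finset.sum_mul]
    simp only [c, inv_pow]
    rw [Real.sq_sqrt hS.le]
    exact mul_inv_cancel₀ hS.ne'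

end Hit

namespace Hit
open Filter Topology

/-! ## Module B3 : limits of witnesses -/

lemma cv_of_bdd {ι : Type*} (F : Ultrafilter ι) {f : ι → ℝ} {C : ℝ} (h : ∀ᶠ t in F, |f t| ≤ C) :
    ∃ a, Tendsto f F (𝓝 a) := by
  have hc : IsCompact (Set.Icc (-C) C) := isCompact_Icc
  have h1 : (F.map f : Filter ℝ) ≤ 𝓟 (Set.Icc (-C) C) := by
    rw [le_principal_iff]
    exact h.mono fun t ht => abs_le.1 ht
  obtain ⟨a, _, ha⟩ := hc.ultrafilter_le_nhds (F.map f) h1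
  exact ⟨a, ha⟩

lemma cvM_of_bdd {ι : Type*} (F : Ultrafilter ι) {n : ℕ} {f : ι → Mat n}
    (h : ∀ i j, ∃ C, ∀ᶠ t in F, |f t i j| ≤ C) : ∃ A, Tendsto f F (𝓝 A) := by
  have h1 : ∀ i j, ∃ a, Tendsto (fun t => f t i j) F (𝓝 a) := fun i j => by
    obtain ⟨C, hC⟩ := h i j; exact cv_of_bdd F hC
  choose A hA using h1
  exact ⟨Matrix.of A, tendsto_mat.2 hA⟩

lemma bdd_of_tendsto {ι : Type*} {F : Filter ι} {f : ι → ℝ} {a : ℝ} (h : Tendsto f F (𝓝 a)) :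
    ∀ᶠ t in F, |f t| ≤ |a| + 1 := by
  have := h.abs.eventually (gt_mem_nhds (show |a| < |a| + 1 by linarith))
  exact this.mono fun t ht => ht.le

lemma lim_uu {ι : Type*} {F : Filter ι} [F.NeBot] {n : ℕ} {f : ι → Mat n} {A : Mat n} (h : Tendsto f F (𝓝 A))
    (hf : ∀ t, UU (f t)) : UU A := by
  rw [tendsto_mat] at h
  refine ⟨fun i j hij => ?_, fun i => ?_⟩
  · refine tendsto_nhds_unique (h i j) ?_
    simp [(hf _).1 i j hij]
  · refine tendsto_nhds_unique (h i i) ?_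
    simp [(hf _).2 i]

lemma lim_low {ι : Type*} {F : Filter ι} [F.NeBot] {n : ℕ} {f : ι → Mat n} {A : Mat n} (h : Tendsto f F (𝓝 A))
    (hf : ∀ t, Low (f t)) : Low A := by
  rw [tendsto_mat] at h
  intro i j hij
  refine tendsto_nhds_unique (h i j) ?_
  simp [(hf _) i j hij]

lemma lim_tnn {ι : Type*} {F : Filter ι} [F.NeBot] {n : ℕ} {f : ι → Mat n} {A : Mat n} (h : Tendsto f F (𝓝 A))
    (hf : ∀ t, TNN (f t)) : TNN A :=
  isClosed_TNN.mem_of_tendsto h (Eventually.of_forall hf)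

lemma lim_uu_inv {ι : Type*} {F : Filter ι} [F.NeBot] {n : ℕ} {f : ι → Mat n} {A : Mat n} (h : Tendsto f F (𝓝 A))
    (hf : ∀ t, UU (f t)) : Tendsto (fun t => (f t)⁻¹) F (𝓝 A⁻¹) :=
  (continuousAt_inv (by rw [(lim_uu h hf).det]; norm_num)).tendsto.comp h

lemma prod_lim {ι : Type*} (F : Ultrafilter ι) {n : ℕ} (f : ι → Fin n → ℝ) (hpos : ∀ t i, 0 < f t i) (C : ℝ)
    (hC : ∀ᶠ t in F, ∀ i, f t i ≤ C) (hprod : ∀ t, ∏ i, f t i = 1) :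
    ∃ f' : Fin n → ℝ, (∀ i, Tendsto (fun t => f t i) F (𝓝 (f' i))) ∧ ∀ i, 0 < f' i := by
  have h1 : ∀ i, ∃ a, Tendsto (fun t => f t i) F (𝓝 a) := fun i =>
    cv_of_bdd F (C := C) (hC.mono fun t ht => by rw [abs_of_pos (hpos t i)]; exact ht i)
  choose f' hf' using h1
  refine ⟨f', hf', fun i => ?_⟩
  have h2 : 0 ≤ f' i := ge_of_tendsto' (hf' i) fun t => (hpos t i).le
  have h3 : Tendsto (fun t => ∏ i, f t i) F (𝓝 (∏ i, f' i)) := tendsto_finsetProd _ fun i _ => hf' i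
  have h4 : ∏ i, f' i = 1 := by
    refine tendsto_nhds_unique h3 ?_
    simp [hprod]
  refine lt_of_le_of_ne h2 fun h0 => ?_
  rw [Finset.prod_eq_zero (Finset.mem_univ i) h0.symm] at h4
  norm_num at h4

lemma entry_bound {n : ℕ} {v : Mat n} (hv : UU v) (ht : TNN v) {C : ℝ} (hC : 1 ≤ C)
    (hs : ∀ i j : Fin n, (j : ℕ) = i + 1 → v i j ≤ C) (i j : Fin n) : v i j ≤ C ^ n := by
  have key : ∀ m : ℕ, ∀ i j : Fin n, (j : ℕ) = i + m → v i j ≤ C ^ m := by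
    intro m
    induction m with
    | zero => intro i j h
              have : i = j := Fin.ext (by omega)
              subst this; simp [hv.2]
    | succ m ih =>
      intro i j h
      have hj := j.2
      let k : Fin n := ⟨i + m, by omega⟩
      refine (entry_le hv ht i k j (by rw [Fin.le_def]; simp [k]) (by rw [Fin.le_def]; simp [k]; omega)).trans ?_
      rw [pow_succ]
      exact mul_le_mul (ih i k rfl) (hs k j (by simp [k]; omega)) (ht.entry _ _) (by positivity)
  rcases lt_or_ge j i with h | h
  · rw [hv.1 i j h]; positivity
  · refine (key (j - i) i j (by rw [Fin.le_def] at h; omega)).trans (pow_le_pow_right₀ hC (by omega))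

lemma tnn_mul_entry {n : ℕ} {v w : Mat n} (hv : TNN v) (hw : TNN w) (i j k : Fin n) : v i j * w j k ≤ (v * w) i k := by
  rw [Matrix.mul_apply]
  exact Finset.single_le_sum (f := fun j => v i j * w j k) (fun j _ => mul_nonneg (hv.entry _ _) (hw.entry _ _)) (Finset.mem_univ j)

lemma le_mul_uu {n : ℕ} {v w : Mat n} (hv : TNN v) (hw : TNN w) (hu : UU w) (i j : Fin n) : v i j ≤ (v * w) i j := by
  have := tnn_mul_entry hv hw i j j
  rwa [hu.2, mul_one] at this

section
variable {Γ : Type} [Group Γ] {n : ℕ} {D : Dat Γ} {φ : Γ →* SL n ℝ} {h : Mat n} {lam : Fin n → ℝ}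
    {u b : Γ × Bool → Mat n} {d : Fin n → ℝ} {l : Mat n}

lemma Wit.dec' (w : Wit D φ h lam u b d l) {x : Γ × Bool} (hx : x ∈ D.X) :
    h⁻¹ * (φ x.1 : Mat n) * h * Ws x.2 = u x * b x := by
  rw [mul_assoc h⁻¹, mul_assoc h⁻¹, w.dec x hx, ← mul_assoc, inv_mul_cancel' w.hdet, one_mul]

lemma Wit.bdet (w : Wit D φ h lam u b d l) {x : Γ × Bool} (hx : x ∈ D.X) : (b x).det = (Ws x.2 : Mat n).det := by
  have h1 := congrArg Matrix.det (w.dec x hx)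
  simp only [Matrix.det_mul, (w.uu x hx).det, Matrix.SpecialLinearGroup.det_coe, one_mul] at h1
  exact (mul_left_cancel₀ w.hdet h1).symm

lemma Wit.bdet_ne (w : Wit D φ h lam u b d l) {x : Γ × Bool} (hx : x ∈ D.X) : (b x).det ≠ 0 := by
  rw [w.bdet hx]; exact Ws_det _

lemma Wit.u_one (w : Wit D φ h lam u b d l) : u (1, false) = 1 := by
  have h3 := w.dec' D.h0
  simp only [Ws, map_one, Matrix.SpecialLinearGroup.coe_one, mul_one, if_neg Bool.false_ne_true, inv_mul_cancel' w.hdet] at h3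
  exact ul_unique (w.uu _ D.h0) UU.one (w.low _ D.h0) (Low.diagonal 1 : Low (Matrix.diagonal 1)) (w.bdet_ne D.h0) (by rw [← h3]; simp)

lemma Wit.usp (w : Wit D φ h lam u b d l) {x : Γ × Bool} (hx : x ∈ D.X) (hpos : 0 < D.pos x) : SP (u x) := by
  have h1 := w.sp _ D.h0 _ hx (by rw [D.pos0]; exact hpos)
  rwa [w.u_one, inv_one, one_mul] at h1

lemma Wit.mul_sp (w : Wit D φ h lam u b d l) {x : Γ × Bool} (hx : x ∈ D.X) (M : Mat n) : u x * ((u x)⁻¹ * M) = M := by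
  rw [← mul_assoc, (w.uu x hx).mul_inv, one_mul]

lemma Wit.NB (w : Wit D φ h lam u b d l) :
    h⁻¹ * (φ D.B : Mat n) * h = u (D.B, false) * (Matrix.diagonal d * l) := by
  have := w.dec' D.hp
  rw [w.bp] at this
  simpa [Ws] using this

lemma Wit.Ng0 (w : Wit D φ h lam u b d l) : h⁻¹ * (φ D.γ0 : Mat n) * h = Matrix.diagonal lam := by
  rw [mul_assoc, w.hg0, ← mul_assoc, inv_mul_cancel' w.hdet, one_mul]

lemma trace_conj {h : Mat n} (hd : h.det ≠ 0) (M : Mat n) : (h⁻¹ * M * h).trace = M.trace := by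
  rw [Matrix.trace_mul_comm, ← mul_assoc, mul_inv_cancel' hd, one_mul]

lemma Wit.ur (w : Wit D φ h lam u b d l) :
    u (D.γ0 * D.B, false) = Matrix.diagonal lam * u (D.B, false) * Matrix.diagonal (fun i => (lam i)⁻¹) := by
  have h1 := w.dec' D.hr
  have h2 : h⁻¹ * (φ (D.γ0 * D.B) : Mat n) * h = Matrix.diagonal lam * (u (D.B, false) * b (D.B, false)) := by
    rw [w.bp, ← w.NB, ← w.Ng0]
    simp only [map_mul, Matrix.SpecialLinearGroup.coe_mul, ← mul_assoc]
    rw [mul_assoc (h⁻¹ * (φ D.γ0 : Mat n)) h h⁻¹, mul_inv_cancel' w.hdet, mul_one]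
  simp only [Ws, if_neg Bool.false_ne_true, mul_one] at h1
  rw [h2] at h1
  have e2 := diag_inv_mul lam w.lpos
  refine ul_unique (w.uu _ D.hr) ?_ (w.low _ D.hr) (b' := Matrix.diagonal lam * b (D.B, false)) ?_ (w.bdet_ne D.hr) ?_
  · have := (w.uu _ D.hp).diag_conj (fun i => (lam i)⁻¹) (fun i => inv_pos.2 (w.lpos i))
    simpa using this
  · exact (Low.diagonal _).mul (w.low _ D.hp)
  · rw [← h1]
    simp only [← mul_assoc]
    rw [mul_assoc (Matrix.diagonal lam * u (D.B, false)), e2, mul_one]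

lemma Wit.ur_entry (w : Wit D φ h lam u b d l) (i j : Fin n) :
    u (D.γ0 * D.B, false) i j = lam i * u (D.B, false) i j * (lam j)⁻¹ := by
  rw [w.ur]; simp [Matrix.mul_diagonal, Matrix.diagonal_mul]

lemma Wit.l_entry (w : Wit D φ h lam u b d l) (i j : Fin n) : 0 ≤ l i j := w.lsp.tnn.entry j i

lemma Wit.NB_ge (w : Wit D φ h lam u b d l) (i j k : Fin n) :
    u (D.B, false) i j * d j * l j k ≤ (h⁻¹ * (φ D.B : Mat n) * h) i k := by
  rw [w.NB, Matrix.mul_apply, mul_assoc]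
  have := Finset.single_le_sum (f := fun j => u (D.B, false) i j * (Matrix.diagonal d * l) j k) (s := Finset.univ)
    (fun j _ => mul_nonneg ((w.usp D.hp D.h0p).tnn.entry _ _) (by rw [Matrix.diagonal_mul]; exact mul_nonneg (w.dpos j).le (w.l_entry j k))) (Finset.mem_univ j)
  simpa [Matrix.diagonal_mul] using this

lemma Wit.NB_nonneg (w : Wit D φ h lam u b d l) (i k : Fin n) : 0 ≤ (h⁻¹ * (φ D.B : Mat n) * h) i k := by
  refine le_trans ?_ (w.NB_ge i i k)
  rw [(w.uu _ D.hp).2, one_mul]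
  exact mul_nonneg (w.dpos i).le (w.l_entry i k)

lemma Wit.d_le (w : Wit D φ h lam u b d l) (i : Fin n) : d i ≤ (φ D.B : Mat n).trace := by
  rw [← trace_conj w.hdet]
  have h1 := w.NB_ge i i i
  rw [(w.uu _ D.hp).2, one_mul, show l i i = 1 from w.lsp.1.2 i, mul_one] at h1
  exact h1.trans (Finset.single_le_sum (f := fun i => (h⁻¹ * (φ D.B : Mat n) * h) i i) (fun i _ => w.NB_nonneg i i) (Finset.mem_univ i))

lemma Wit.d_prod (w : Wit D φ h lam u b d l) : ∏ i, d i = 1 := by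
  have h1 := w.bdet D.hp
  rw [w.bp, Matrix.det_mul, ← Matrix.det_transpose l, w.lsp.1.det, mul_one, Matrix.det_diagonal] at h1
  simpa [Ws] using h1

lemma Wit.lam_le (w : Wit D φ h lam u b d l) (i : Fin n) : lam i ≤ (φ D.γ0 : Mat n).trace := by
  rw [← trace_conj w.hdet, w.Ng0, Matrix.trace_diagonal]
  exact Finset.single_le_sum (fun i _ => (w.lpos i).le) (Finset.mem_univ i)

lemma Wit.lam_prod (w : Wit D φ h lam u b d l) : ∏ i, lam i = 1 := by
  have h1 := congrArg Matrix.det w.hg0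
  rw [Matrix.det_mul, Matrix.det_mul, Matrix.SpecialLinearGroup.det_coe, Matrix.det_diagonal, one_mul] at h1
  exact (mul_left_cancel₀ w.hdet (by rw [mul_one]; exact h1)).symm

lemma Wit.l_le (w : Wit D φ h lam u b d l) (hn1 : ∀ i j : Fin n, (j : ℕ) = i + 1 → u (D.B, false) i j = 1)
    (i j : Fin n) (hij : (j : ℕ) = i + 1) : d j * d j * l j i ≤ ((φ D.B : Mat n) * (φ D.B : Mat n)).trace := by
  rw [← trace_conj w.hdet]
  have e : h⁻¹ * ((φ D.B : Mat n) * (φ D.B : Mat n)) * h = (h⁻¹ * (φ D.B : Mat n) * h) * (h⁻¹ * (φ D.B : Mat n) * h) := by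
    simp only [← mul_assoc]
    rw [mul_assoc (h⁻¹ * (φ D.B : Mat n)) h h⁻¹, mul_inv_cancel' w.hdet, mul_one]
  rw [e]
  have h1 := w.NB_ge i j j
  have h2 := w.NB_ge j j i
  rw [hn1 i j hij, one_mul, show l j j = 1 from w.lsp.1.2 j, mul_one] at h1
  rw [(w.uu _ D.hp).2, one_mul] at h2
  have h3 : ((h⁻¹ * (φ D.B : Mat n) * h) * (h⁻¹ * (φ D.B : Mat n) * h)) i i ≤ ((h⁻¹ * (φ D.B : Mat n) * h) * (h⁻¹ * (φ D.B : Mat n) * h)).trace := by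
    refine Finset.single_le_sum (f := fun i => ((h⁻¹ * (φ D.B : Mat n) * h) * (h⁻¹ * (φ D.B : Mat n) * h)) i i) (fun i _ => ?_) (Finset.mem_univ i)
    rw [Matrix.mul_apply]
    exact Finset.sum_nonneg fun j _ => mul_nonneg (w.NB_nonneg _ _) (w.NB_nonneg _ _)
  refine le_trans ?_ h3
  rw [Matrix.mul_apply]
  refine le_trans ?_ (Finset.single_le_sum (f := fun j => (h⁻¹ * (φ D.B : Mat n) * h) i j * (h⁻¹ * (φ D.B : Mat n) * h) j i) (fun j _ => mul_nonneg (w.NB_nonneg _ _) (w.NB_nonneg _ _)) (Finset.mem_univ j))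
  rw [mul_assoc]
  exact mul_le_mul h1 h2 (mul_nonneg (w.dpos j).le (w.l_entry j i)) (w.NB_nonneg _ _)

end

end Hit

namespace Hit
open Filter Topology

/-! ## Module B4 : closedness -/

structure Sq {Γ : Type} [Group Γ] (D : Dat Γ) (n : ℕ) (ι : Type*) (F : Ultrafilter ι) where
  hn : 2 ≤ n
  φ : ι → Γ →* SL n ℝ
  φ' : Γ →* SL n ℝ
  conv : ∀ γ, Tendsto (fun t => (φ t γ : Mat n)) F (𝓝 (φ' γ : Mat n))
  h : ι → Mat n
  lam : ι → Fin n → ℝ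
  u : ι → Γ × Bool → Mat n
  b : ι → Γ × Bool → Mat n
  d : ι → Fin n → ℝ
  l : ι → Mat n
  w : ∀ t, Wit D (φ t) (h t) (lam t) (u t) (b t) (d t) (l t)
  n1 : ∀ t, ∀ i j : Fin n, (j : ℕ) = i + 1 → u t (D.B, false) i j = 1
  n2 : ∀ t, ∑ i, ∑ j, (h t i j) ^ 2 = 1

lemma Tr_one_W {n : ℕ} : Tr (1 : Mat n) Wm := by
  intro k hk
  rw [inv_one, one_mul]
  have : mnr (Wm : Mat n) (frst hk) (lst hk) = mnr (1 : Mat n) (frst hk) (frst hk ∘ Fin.revPerm) := by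
    unfold mnr
    congr 1
    ext a b
    have h1 : (Wm : Mat n) (frst hk a) (lst hk b) = (1 : Mat n) (frst hk a) (lst hk b).rev := by
      have := mul_Wm (1 : Mat n) (frst hk a) (lst hk b)
      rwa [one_mul] at this
    refine h1.trans ?_
    rw [← rev_frst]
    exact congrArg ((1 : Mat n) (frst hk a)) (by simp)
  rw [this, mnr_perm_right, UU.one.mnr_self _ (frst_sm hk), mul_one]
  rcases Int.units_eq_one_or (Equiv.Perm.sign (Fin.revPerm : Equiv.Perm (Fin k))) with h | h <;> rw [h] <;> simp

section
variable {Γ : Type} [Group Γ] {n : ℕ} {D : Dat Γ} {ι : Type*} {F : Ultrafilter ι}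

lemma Sq.lim_d (S : Sq D n ι F) : ∃ d' : Fin n → ℝ, (∀ i, Tendsto (fun t => S.d t i) F (𝓝 (d' i))) ∧ ∀ i, 0 < d' i := by
  have h1 : Tendsto (fun t => (S.φ t D.B : Mat n).trace) F (𝓝 (S.φ' D.B : Mat n).trace) :=
    ((continuous_id.matrix_trace).tendsto _).comp (S.conv D.B)
  exact prod_lim F S.d (fun t => (S.w t).dpos) _ ((bdd_of_tendsto h1).mono fun t ht i =>
    ((S.w t).d_le i).trans ((le_abs_self _).trans ht)) (fun t => (S.w t).d_prod)

lemma Sq.lim_lam (S : Sq D n ι F) : ∃ d' : Fin n → ℝ, (∀ i, Tendsto (fun t => S.lam t i) F (𝓝 (d' i))) ∧ ∀ i, 0 < d' i := by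
  have h1 : Tendsto (fun t => (S.φ t D.γ0 : Mat n).trace) F (𝓝 (S.φ' D.γ0 : Mat n).trace) :=
    ((continuous_id.matrix_trace).tendsto _).comp (S.conv D.γ0)
  exact prod_lim F S.lam (fun t => (S.w t).lpos) _ ((bdd_of_tendsto h1).mono fun t ht i =>
    ((S.w t).lam_le i).trans ((le_abs_self _).trans ht)) (fun t => (S.w t).lam_prod)

lemma Sq.lim_l (S : Sq D n ι F) : ∃ l', Tendsto S.l F (𝓝 l') := by
  obtain ⟨d', hd, hd'⟩ := S.lim_d
  have h1 : Tendsto (fun t => ((S.φ t D.B : Mat n) * (S.φ t D.B : Mat n)).trace) F (𝓝 ((S.φ' D.B : Mat n) * (S.φ' D.B : Mat n)).trace) :=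
    ((continuous_id.matrix_trace).tendsto _).comp ((S.conv D.B).mul (S.conv D.B))
  have hA := bdd_of_tendsto h1
  set A := |((S.φ' D.B : Mat n) * (S.φ' D.B : Mat n)).trace| + 1
  have hA0 : 0 < A := by positivity
  have hdd : ∀ᶠ t in F, ∀ j, d' j / 2 < S.d t j := by
    rw [eventually_all]; intro j
    exact (hd j).eventually (lt_mem_nhds (by linarith [hd' j]))
  let C : ℝ := 1 + ∑ j, A / (d' j / 2 * (d' j / 2))
  have hC1 : ∀ j, A / (d' j / 2 * (d' j / 2)) ≤ C := fun j => by
    have := Finset.single_le_sum (f := fun j => A / (d' j / 2 * (d' j / 2))) (s := Finset.univ)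
      (fun j _ => by have := hd' j; positivity) (Finset.mem_univ j)
    simp only [C]; linarith
  have hC : 1 ≤ C := by
    have : 0 ≤ ∑ j, A / (d' j / 2 * (d' j / 2)) := Finset.sum_nonneg fun j _ => by have := hd' j; positivity
    simp only [C]; linarith
  refine cvM_of_bdd F fun i j => ⟨C ^ n, ?_⟩
  filter_upwards [hA, hdd] with t htA htd
  rw [abs_of_nonneg ((S.w t).l_entry i j)]
  refine entry_bound (v := (S.l t)ᵀ) (S.w t).lsp.1 (S.w t).lsp.tnn hC ?_ j i
  intro i j hij
  rw [Matrix.transpose_apply]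
  refine le_trans ?_ (hC1 j)
  have hj := hd' j
  rw [le_div_iff₀ (by positivity)]
  have h2 := (S.w t).l_le (S.n1 t) i j hij
  have h3 := (S.w t).l_entry j i
  have h4 := htd j
  have h5 := (le_abs_self _).trans htA
  have h6 : d' j / 2 * (d' j / 2) ≤ S.d t j * S.d t j := mul_self_le_mul_self (by positivity) h4.le
  nlinarith

lemma Sq.lim_up (S : Sq D n ι F) : ∃ A, Tendsto (fun t => S.u t (D.B, false)) F (𝓝 A) := by
  refine cvM_of_bdd F fun i j => ⟨1 ^ n, Eventually.of_forall fun t => ?_⟩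
  have h1 := (S.w t).usp D.hp D.h0p
  rw [abs_of_nonneg (h1.tnn.entry _ _)]
  exact entry_bound h1.1 h1.tnn le_rfl (fun i j hij => (S.n1 t i j hij).le) i j

lemma Sq.lim_ur (S : Sq D n ι F) : ∃ A, Tendsto (fun t => S.u t (D.γ0 * D.B, false)) F (𝓝 A) := by
  obtain ⟨A, hA⟩ := S.lim_up
  obtain ⟨lam', h1, h2⟩ := S.lim_lam
  refine ⟨Matrix.of fun i j => lam' i * A i j * (lam' j)⁻¹, tendsto_mat.2 fun i j => ?_⟩
  simp only [fun t => (S.w t).ur_entry]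
  exact ((h1 i).mul (tendsto_mat.1 hA i j)).mul ((h1 j).inv₀ (h2 j).ne')

/-- sandwich : `u_x` between `0` and a convergent `u_y`. -/
lemma Sq.lim_lt (S : Sq D n ι F) {x y : Γ × Bool} (hx : x ∈ D.X) (hy : y ∈ D.X) (h0 : 0 < D.pos x)
    (hxy : D.pos x < D.pos y) (hA : ∃ A, Tendsto (fun t => S.u t y) F (𝓝 A)) : ∃ A, Tendsto (fun t => S.u t x) F (𝓝 A) := by
  obtain ⟨A, hA⟩ := hA
  rw [tendsto_mat] at hA
  refine cvM_of_bdd F fun i j => ⟨|A i j| + 1, (bdd_of_tendsto (hA i j)).mono fun t ht => ?_⟩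
  have h1 := ((S.w t).usp hx h0).tnn
  have h2 := (S.w t).sp x hx y hy hxy
  rw [abs_of_nonneg (h1.entry _ _)]
  have h3 := le_mul_uu h1 h2.tnn h2.1 i j
  rw [(S.w t).mul_sp hx] at h3
  exact h3.trans ((le_abs_self _).trans ht)

lemma Sq.lim_uq (S : Sq D n ι F) : ∃ A, Tendsto (fun t => S.u t (D.B, true)) F (𝓝 A) :=
  S.lim_lt D.hq D.hr (D.h0p.trans D.hpq) D.hqr S.lim_ur

lemma tnn_lim_inv_mul (S : Sq D n ι F) {x y : Γ × Bool} (hx : x ∈ D.X) (hy : y ∈ D.X)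
    (hxy : D.pos x < D.pos y) {A A' : Mat n} (hA : Tendsto (fun t => S.u t x) F (𝓝 A))
    (hA' : Tendsto (fun t => S.u t y) F (𝓝 A')) : UU (A⁻¹ * A') ∧ TNN (A⁻¹ * A') := by
  have h1 := (lim_uu_inv hA fun t => (S.w t).uu x hx).mul hA'
  exact ⟨lim_uu h1 fun t => ((S.w t).sp x hx y hy hxy).1, lim_tnn h1 fun t => ((S.w t).sp x hx y hy hxy).tnn⟩

/-- limit of `N(B)` -/
lemma Sq.lim_b (S : Sq D n ι F) {x : Γ × Bool} (hx : x ∈ D.X) {A G : Mat n} (hA : Tendsto (fun t => S.u t x) F (𝓝 A))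
    (hG : Tendsto (fun t => (S.h t)⁻¹ * (S.φ t x.1 : Mat n) * S.h t * Ws x.2) F (𝓝 G)) :
    ∃ b, Tendsto (fun t => S.b t x) F (𝓝 b) ∧ Low b ∧ b.det ≠ 0 ∧ G = A * b := by
  have hAu := lim_uu hA fun t => (S.w t).uu x hx
  have h1 := (lim_uu_inv hA fun t => (S.w t).uu x hx).mul hG
  have h2 : (fun t => (S.u t x)⁻¹ * ((S.h t)⁻¹ * (S.φ t x.1 : Mat n) * S.h t * Ws x.2)) = fun t => S.b t x := by
    ext1 t
    rw [(S.w t).dec' hx, ← mul_assoc, ((S.w t).uu x hx).inv_mul, one_mul]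
  rw [h2] at h1
  refine ⟨_, h1, lim_low h1 fun t => (S.w t).low x hx, ?_, ?_⟩
  · have h3 := (Continuous.matrix_det continuous_id).continuousAt.tendsto.comp h1
    have h4 : (A⁻¹ * G).det = (Ws x.2 : Mat n).det := by
      refine tendsto_nhds_unique h3 ?_
      simp [Function.comp_def, fun t => (S.w t).bdet hx]
    rw [h4]; exact Ws_det _
  · rw [← mul_assoc, hAu.mul_inv, one_mul]

lemma tendsto_diagonal {n : ℕ} {f : ι → Fin n → ℝ} {g : Fin n → ℝ} {F : Filter ι} (h : ∀ i, Tendsto (fun t => f t i) F (𝓝 (g i))) :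
    Tendsto (fun t => (Matrix.diagonal (f t) : Mat n)) F (𝓝 (Matrix.diagonal g)) := by
  rw [tendsto_mat]
  intro i j
  simp only [Matrix.diagonal_apply]
  split_ifs
  · exact h i
  · exact tendsto_const_nhds

/-- a pair `(z,0),(z,∞)` of convergent points gives transversality -/
lemma Tr_pair {M A A' b b' : Mat n} (hM : M.det ≠ 0) (hb : Low b) (hb' : Low b') (hd : b.det ≠ 0) (hd' : b'.det ≠ 0)
    (h1 : M = A * b) (h2 : M * Wm = A' * b') : Tr A A' := by
  rw [← Tr_low hb hb' hd hd', ← h1, ← h2]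
  have := Tr_left (g := 1) (g' := Wm) hM
  rw [mul_one] at this
  exact this.2 Tr_one_W

lemma corner_LWL {L1 L2 : Mat n} (h1 : Low L1) (h2 : Low L2) (d1 : L1.det ≠ 0) (d2 : L2.det ≠ 0) (k : ℕ) (hk : k ≤ n) :
    mnr (L1 * Wm * L2) (frst hk) (lst hk) ≠ 0 := by
  rw [mul_assoc, mnr_low_left hk h1, mnr_low_right hk h2]
  have := Tr_one_W (n := n) k hk
  rw [inv_one, one_mul] at this
  exact mul_ne_zero (mnr_low_self h1 d1 _ (frst_sm hk)) (mul_ne_zero this (mnr_low_self h2 d2 _ (lst_sm hk)))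

end
end Hit

namespace Hit
open Filter Topology

lemma anti_of_step {n : ℕ} {f : Fin n → ℝ} (h : ∀ i j : Fin n, (j : ℕ) = i + 1 → f j < f i) :
    ∀ i j : Fin n, i < j → f j < f i := by
  have key : ∀ m : ℕ, ∀ i j : Fin n, (j : ℕ) = i + m + 1 → f j < f i := by
    intro m
    induction m with
    | zero => intro i j hij; exact h i j (by omega)
    | succ m ih =>
      intro i j hij
      have hj := j.2
      exact (h ⟨i + m + 1, by omega⟩ j (by simp; omega)).trans (ih i ⟨i + m + 1, by omega⟩ rfl)
  intro i j hij
  rw [Fin.lt_def] at hij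
  exact key (j - i - 1) i j (by omega)

/-- a subspace invariant under a diagonal matrix with distinct entries contains the coordinate vectors it sees -/
lemma diag_inv_single {n : ℕ} (K : Submodule ℝ (Fin n → ℝ)) (lam : Fin n → ℝ) (hl : Function.Injective lam)
    (hK : ∀ w ∈ K, Matrix.diagonal lam *ᵥ w ∈ K) (i : Fin n) (w : Fin n → ℝ) (hw : w ∈ K) (hi : w i ≠ 0) :
    Pi.single i 1 ∈ K := by
  have key : ∀ s : Finset (Fin n), i ∉ s → ∃ w ∈ K, w i ≠ 0 ∧ ∀ j ∈ s, w j = 0 := by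
    intro s
    induction s using Finset.induction_on with
    | empty => intro _; exact ⟨w, hw, hi, by simp⟩
    | insert a s ha ih =>
      intro his
      rw [Finset.mem_insert, not_or] at his
      obtain ⟨w, hw, hwi, hws⟩ := ih his.2
      refine ⟨Matrix.diagonal lam *ᵥ w - lam a • w, K.sub_mem (hK w hw) (K.smul_mem _ hw), ?_, ?_⟩
      · simp only [Pi.sub_apply, Matrix.mulVec_diagonal, Pi.smul_apply, smul_eq_mul, ← sub_mul]
        exact mul_ne_zero (sub_ne_zero.2 fun h => his.1 (hl h)) hwi
      · intro j hj
        simp only [Pi.sub_apply, Matrix.mulVec_diagonal, Pi.smul_apply, smul_eq_mul, ← sub_mul]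
        rcases Finset.mem_insert.1 hj with rfl | hj
        · simp
        · rw [hws j hj, mul_zero]
  obtain ⟨w, hw, hwi, hws⟩ := key (Finset.univ.erase i) (by simp)
  have : Pi.single i 1 = (w i)⁻¹ • w := by
    ext j
    by_cases hj : j = i
    · subst hj; simp [hwi]
    · simp [hj, hws j (by simp [hj])]
  rw [this]
  exact K.smul_mem _ hw

lemma irred_aux {n : ℕ} (K : Submodule ℝ (Fin n → ℝ)) (lam : Fin n → ℝ) (hl : Function.Injective lam)
    (hK : ∀ w ∈ K, Matrix.diagonal lam *ᵥ w ∈ K) (M : Mat n) (hM : ∀ w ∈ K, M *ᵥ w ∈ K)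
    (h1 : ∀ i j : Fin n, (j : ℕ) = i + 1 → M i j ≠ 0) (h2 : ∀ i j : Fin n, (j : ℕ) = i + 1 → M j i ≠ 0)
    (hne : K ≠ ⊥) : K = ⊤ := by
  obtain ⟨w, hw, hw0⟩ := K.exists_mem_ne_zero_of_ne_bot hne
  obtain ⟨i0, hi0⟩ := Function.ne_iff.1 hw0
  have s0 := diag_inv_single K lam hl hK i0 w hw hi0
  have up : ∀ i j : Fin n, (j : ℕ) = i + 1 → Pi.single i 1 ∈ K → (Pi.single j 1 : Fin n → ℝ) ∈ K := by
    intro i j hij hi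
    refine diag_inv_single K lam hl hK j _ (hM _ hi) ?_
    simpa using h2 i j hij
  have dn : ∀ i j : Fin n, (j : ℕ) = i + 1 → Pi.single j 1 ∈ K → (Pi.single i 1 : Fin n → ℝ) ∈ K := by
    intro i j hij hi
    refine diag_inv_single K lam hl hK i _ (hM _ hi) ?_
    simpa using h1 i j hij
  have all1 : ∀ m : ℕ, ∀ j : Fin n, (j : ℕ) = i0 + m → (Pi.single j 1 : Fin n → ℝ) ∈ K := by
    intro m
    induction m with
    | zero => intro j hj; rwa [show j = i0 from Fin.ext hj]
    | succ m ih => intro j hj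
                   have := j.2
                   exact up ⟨i0 + m, by omega⟩ j (by simp; omega) (ih _ rfl)
  have all2 : ∀ m : ℕ, ∀ j : Fin n, (i0 : ℕ) = j + m → (Pi.single j 1 : Fin n → ℝ) ∈ K := by
    intro m
    induction m with
    | zero => intro j hj; rwa [show j = i0 from Fin.ext (by omega)]
    | succ m ih => intro j hj
                   have := i0.2
                   exact dn j ⟨j + 1, by omega⟩ rfl (ih _ (by simp; omega))
  have all : ∀ j : Fin n, (Pi.single j 1 : Fin n → ℝ) ∈ K := by
    intro j
    rcases le_total (i0 : ℕ) j with h | h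
    · exact all1 (j - i0) j (by omega)
    · exact all2 (i0 - j) j (by omega)
  rw [eq_top_iff]
  intro v _
  rw [← Finset.univ_sum_single v]
  refine K.sum_mem fun i _ => ?_
  have : (Pi.single i (v i) : Fin n → ℝ) = v i • Pi.single i 1 := by
    ext j; by_cases hj : j = i
    · subst hj; simp
    · simp [hj]
  rw [this]; exact K.smul_mem _ (all i)

section
variable {Γ : Type} [Group Γ] {n : ℕ} {D : Dat Γ} {ι : Type*} {F : Ultrafilter ι}

lemma Sq.core (S : Sq D n ι F) : ∃ (d' lam' : Fin n → ℝ) (l' h' : Mat n),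
    (∀ i, Tendsto (fun t => S.d t i) F (𝓝 (d' i))) ∧ (∀ i, 0 < d' i) ∧
    (∀ i, Tendsto (fun t => S.lam t i) F (𝓝 (lam' i))) ∧ (∀ i, 0 < lam' i) ∧ (∀ i j : Fin n, i < j → lam' j < lam' i) ∧
    Tendsto S.l F (𝓝 l') ∧ SP l'ᵀ ∧ Tendsto S.h F (𝓝 h') ∧ h'.det ≠ 0 := by
  obtain ⟨d', hd, hd'⟩ := S.lim_d
  obtain ⟨lam', hlam, hlam'⟩ := S.lim_lam
  obtain ⟨l', hl⟩ := S.lim_l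
  obtain ⟨Ap, hAp⟩ := S.lim_up
  obtain ⟨Aq, hAq⟩ := S.lim_uq
  have uAp : UU Ap := lim_uu hAp fun t => (S.w t).uu _ D.hp
  have tAp : TNN Ap := lim_tnn hAp fun t => ((S.w t).usp D.hp D.h0p).tnn
  have uAq : UU Aq := lim_uu hAq fun t => (S.w t).uu _ D.hq
  have sAp : ∀ i j : Fin n, (j : ℕ) = i + 1 → Ap i j = 1 := by
    intro i j hij
    refine tendsto_nhds_unique (tendsto_mat.1 hAp i j) ?_
    simp [fun t => S.n1 t i j hij]
  -- limit of N(B)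
  set Bp := Matrix.diagonal d' * l' with hBp
  set M := Ap * Bp with hM
  have hlu : UU l'ᵀ := lim_uu ((continuous_id.matrix_transpose.tendsto _).comp hl) fun t => (S.w t).lsp.1
  have hlt : TNN l'ᵀ := lim_tnn ((continuous_id.matrix_transpose.tendsto _).comp hl) fun t => (S.w t).lsp.tnn
  have hLow : Low Bp := (Low.diagonal _).mul fun i j hij => hlu.1 j i hij
  have hBdet : Bp.det ≠ 0 := by
    rw [hBp, Matrix.det_mul, Matrix.det_diagonal, ← Matrix.det_transpose l', hlu.det, mul_one]
    exact Finset.prod_ne_zero_iff.2 fun i _ => (hd' i).ne'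
  have hMdet : M.det ≠ 0 := by rw [hM, Matrix.det_mul, uAp.det, one_mul]; exact hBdet
  have hNB : Tendsto (fun t => (S.h t)⁻¹ * (S.φ t D.B : Mat n) * S.h t) F (𝓝 M) := by
    simp only [fun t => (S.w t).NB]
    exact hAp.mul ((tendsto_diagonal hd).mul hl)
  obtain ⟨bq, _, hbql, hbqd, hbq⟩ := S.lim_b D.hq hAq (G := M * Wm) (by simpa [Ws] using hNB.mul_const _)
  have tr := Tr_pair hMdet hLow hbql hBdet hbqd hM hbq
  obtain ⟨vu, vt⟩ := tnn_lim_inv_mul S D.hp D.hq D.hpq hAp hAq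
  have vsp : SP (Ap⁻¹ * Aq) := SP_of_corners vu vt tr
  have hanti : ∀ i j : Fin n, i < j → lam' j < lam' i := by
    apply anti_of_step
    intro i j hij
    have hlt : i < j := by rw [Fin.lt_def]; omega
    have h1 : Aq i j ≤ lam' i * (lam' j)⁻¹ := by
      refine le_of_tendsto_of_tendsto' (tendsto_mat.1 hAq i j) ((hlam i).mul ((hlam j).inv₀ (hlam' j).ne')) fun t => ?_
      have h2 := (S.w t).sp _ D.hq _ D.hr D.hqr
      have h3 := le_mul_uu ((S.w t).usp D.hq (D.h0p.trans D.hpq)).tnn h2.tnn h2.1 i j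
      rw [(S.w t).mul_sp D.hq, (S.w t).ur_entry, S.n1 t i j hij, mul_one] at h3
      exact h3
    have h4 : 1 + (Ap⁻¹ * Aq) i j ≤ Aq i j := by
      have e : Aq = Ap * (Ap⁻¹ * Aq) := by rw [← mul_assoc, uAp.mul_inv, one_mul]
      conv_rhs => rw [e, Matrix.mul_apply]
      have := Finset.sum_le_sum_of_subset_of_nonneg (Finset.subset_univ ({i, j} : Finset (Fin n)))
        (f := fun k => Ap i k * (Ap⁻¹ * Aq) k j) (fun k _ _ => mul_nonneg (tAp.entry _ _) (vt.entry _ _))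
      rw [Finset.sum_pair hlt.ne, uAp.2, sAp i j hij, vu.2] at this
      linarith
    have h5 := vsp.entry i j hlt.le
    have h6 : 1 < lam' i * (lam' j)⁻¹ := by linarith
    rw [← div_eq_mul_inv, one_lt_div (hlam' j)] at h6
    exact h6
  have hlsp : SP l'ᵀ := by
    refine SP_of_corners hlu hlt fun k hk => ?_
    have e1 : Bp * Wm = Ap⁻¹ * Aq * bq := by
      rw [mul_assoc Ap⁻¹ Aq bq, ← hbq, hM, mul_assoc Ap Bp Wm, ← mul_assoc Ap⁻¹ Ap, uAp.inv_mul, one_mul]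
    have Wt : (Wm : Mat n)ᵀ = Wm := by
      ext i j
      have : (j = i.rev) ↔ (i = j.rev) := by constructor <;> (rintro rfl; simp)
      simp only [Matrix.transpose_apply, Wm, this]
    have e2 := congrArg Matrix.transpose e1
    rw [Matrix.transpose_mul, hBp, Matrix.transpose_mul, Matrix.transpose_mul, Wt, Matrix.diagonal_transpose] at e2
    have e3 : l'ᵀ = (Wm * bqᵀ * Wm) * Wm * ((Ap⁻¹ * Aq)ᵀ * Matrix.diagonal (fun i => (d' i)⁻¹)) := by
      rw [mul_assoc (Wm * bqᵀ), Wm_sq, mul_one, mul_assoc, ← mul_assoc bqᵀ, ← e2, mul_assoc Wm, mul_assoc l'ᵀ,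
        diag_mul_inv d' hd', mul_one, ← mul_assoc, Wm_sq, one_mul]
    rw [e3]
    apply corner_LWL
    · intro i j hij
      rw [mul_Wm, Wm_mul, Matrix.transpose_apply]
      exact hbql _ _ (Fin.rev_lt_rev.2 hij)
    · exact Low.mul (fun i j hij => vu.1 j i hij) (Low.diagonal _)
    · rw [Matrix.det_mul, Matrix.det_mul, Matrix.det_transpose]
      exact mul_ne_zero (mul_ne_zero Wm_det hbqd) Wm_det
    · rw [Matrix.det_mul, Matrix.det_transpose, vu.det, one_mul, Matrix.det_diagonal]
      exact Finset.prod_ne_zero_iff.2 fun i _ => inv_ne_zero (hd' i).ne'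
  -- limit of h
  obtain ⟨h', hh⟩ : ∃ A, Tendsto S.h F (𝓝 A) := by
    refine cvM_of_bdd F fun i j => ⟨1, Eventually.of_forall fun t => ?_⟩
    rw [← sq_le_one_iff_abs_le_one, ← S.n2 t]
    refine le_trans ?_ (Finset.single_le_sum (f := fun i => ∑ j, (S.h t i j) ^ 2) (fun i _ => Finset.sum_nonneg fun j _ => sq_nonneg _) (Finset.mem_univ i))
    exact Finset.single_le_sum (f := fun j => (S.h t i j) ^ 2) (fun j _ => sq_nonneg _) (Finset.mem_univ j)
  have hne : h' ≠ 0 := by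
    rintro rfl
    have h1 : Tendsto (fun t => ∑ i, ∑ j, (S.h t i j) ^ 2) F (𝓝 (∑ i, ∑ j, ((0 : Mat n) i j) ^ 2)) :=
      tendsto_finsetSum _ fun i _ => tendsto_finsetSum _ fun j _ => (tendsto_mat.1 hh i j).pow 2
    simp only [S.n2] at h1
    have := tendsto_nhds_unique h1 tendsto_const_nhds
    simp at this
  have r1 : (S.φ' D.γ0 : Mat n) * h' = h' * Matrix.diagonal lam' := by
    refine tendsto_nhds_unique ((S.conv D.γ0).mul hh) ?_
    simp only [fun t => (S.w t).hg0]
    exact hh.mul (tendsto_diagonal hlam)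
  have r2 : (S.φ' D.B : Mat n) * h' = h' * M := by
    refine tendsto_nhds_unique ((S.conv D.B).mul hh) ?_
    have := hh.mul hNB
    refine this.congr fun t => ?_
    rw [mul_assoc (S.h t)⁻¹, ← mul_assoc, mul_inv_cancel' (S.w t).hdet, one_mul]
  have hMge : ∀ i j k : Fin n, Ap i j * d' j * l' j k ≤ M i k := by
    intro i j k
    refine le_of_tendsto_of_tendsto' (((tendsto_mat.1 hAp i j).mul (hd j)).mul (tendsto_mat.1 hl j k)) (tendsto_mat.1 hNB i k) fun t => ?_
    exact (S.w t).NB_ge i j k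
  refine ⟨d', lam', l', h', hd, hd', hlam, hlam', hanti, hl, hlsp, hh, fun hdet => ?_⟩
  obtain ⟨w, hw0, hw⟩ := Matrix.exists_mulVec_eq_zero_iff.2 hdet
  let K : Submodule ℝ (Fin n → ℝ) := LinearMap.ker (Matrix.toLin' h')
  have memK : ∀ w, w ∈ K ↔ h' *ᵥ w = 0 := fun w => by simp [K, LinearMap.mem_ker]
  have inj : Function.Injective lam' := by
    intro i j hij
    rcases lt_trichotomy i j with h | h | h
    · exact absurd hij (hanti _ _ h).ne'
    · exact h
    · exact absurd hij (hanti _ _ h).ne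
  have := irred_aux K lam' inj (fun w hw => by
      rw [memK] at hw ⊢
      rw [Matrix.mulVec_mulVec, ← r1, ← Matrix.mulVec_mulVec, hw, Matrix.mulVec_zero]) M (fun w hw => by
      rw [memK] at hw ⊢
      rw [Matrix.mulVec_mulVec, ← r2, ← Matrix.mulVec_mulVec, hw, Matrix.mulVec_zero])
    (fun i j hij => by
      have h1 := hMge i j j
      rw [sAp i j hij, one_mul, show l' j j = 1 from hlu.2 j, mul_one] at h1
      exact ((hd' j).trans_le h1).ne')
    (fun i j hij => by
      have h1 := hMge j j i
      rw [uAp.2, one_mul] at h1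
      have h2 : 0 < l' j i := hlsp.entry i j (by rw [Fin.le_def]; omega)
      exact ((mul_pos (hd' j) h2).trans_le h1).ne')
    (fun h0 => hw0 (by
      have : w ∈ K := (memK w).2 hw
      rw [h0, Submodule.mem_bot] at this; exact this))
  apply hne
  ext i j
  have h3 : (Pi.single j 1 : Fin n → ℝ) ∈ K := by rw [this]; trivial
  rw [memK] at h3
  have := congrFun h3 i
  simpa using this

end
end Hit

namespace Hit
open Filter Topology

lemma diag_Ws {n : ℕ} (e : Fin n → ℝ) (s : Bool) :
    (Matrix.diagonal e : Mat n) * Ws s = Ws s * Matrix.diagonal (if s then fun i => e i.rev else e) := by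
  cases s
  · simp [Ws]
  · simp [Ws, Wm_diag]

lemma conj_zpow_diag {Γ : Type} [Group Γ] {n : ℕ} (φ : Γ →* SL n ℝ) (h : Mat n) (hd : h.det ≠ 0) (γ0 : Γ) (lam : Fin n → ℝ)
    (hl : ∀ i, 0 < lam i) (h0 : (φ γ0 : Mat n) * h = h * Matrix.diagonal lam) (l : ℤ) :
    ∃ e : Fin n → ℝ, (∀ i, 0 < e i) ∧ (φ (γ0 ^ l) : Mat n) * h = h * Matrix.diagonal e := by
  have nat : ∀ k : ℕ, ∃ e : Fin n → ℝ, (∀ i, 0 < e i) ∧ (φ (γ0 ^ k) : Mat n) * h = h * Matrix.diagonal e := by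
    intro k
    induction k with
    | zero => exact ⟨fun _ => 1, fun _ => one_pos, by simp⟩
    | succ k ih =>
      obtain ⟨e, he, he'⟩ := ih
      refine ⟨fun i => lam i * e i, fun i => mul_pos (hl i) (he i), ?_⟩
      rw [pow_succ, map_mul, Matrix.SpecialLinearGroup.coe_mul, mul_assoc, h0, ← mul_assoc, he', mul_assoc, Matrix.diagonal_mul_diagonal]
      simp only [mul_comm]
  rcases Int.eq_nat_or_neg l with ⟨k, rfl | rfl⟩
  · simpa using nat k
  · obtain ⟨e, he, he'⟩ := nat k
    refine ⟨fun i => (e i)⁻¹, fun i => inv_pos.2 (he i), ?_⟩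
    have h1 : (φ (γ0 ^ (-(k:ℤ))) : Mat n) * (φ (γ0 ^ k) : Mat n) = 1 := by
      rw [← Matrix.SpecialLinearGroup.coe_mul, ← map_mul]; simp
    calc (φ (γ0 ^ (-(k:ℤ))) : Mat n) * h = (φ (γ0 ^ (-(k:ℤ))) : Mat n) * (h * Matrix.diagonal e) * Matrix.diagonal (fun i => (e i)⁻¹) := by
            rw [mul_assoc, mul_assoc, diag_mul_inv e he, mul_one]
      _ = _ := by rw [← he', ← mul_assoc, h1, one_mul]

section
variable {Γ : Type} [Group Γ] {n : ℕ} {D : Dat Γ} {ι : Type*} {F : Ultrafilter ι}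

theorem Sq.limit (S : Sq D n ι F) (mp : D.MP) : PosRep D S.φ' := by
  obtain ⟨d', lam', l', h', hd, hd', hlam, hlam', hanti, hl, hlsp, hh, hdet⟩ := S.core
  have r1 : (S.φ' D.γ0 : Mat n) * h' = h' * Matrix.diagonal lam' := by
    refine tendsto_nhds_unique ((S.conv D.γ0).mul hh) ?_
    simp only [fun t => (S.w t).hg0]
    exact hh.mul (tendsto_diagonal hlam)
  set N : Γ → Mat n := fun γ => h'⁻¹ * (S.φ' γ : Mat n) * h' with hN
  have Nmul : ∀ γ δ, N (γ * δ) = N γ * N δ := by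
    intro γ δ
    simp only [hN, map_mul, Matrix.SpecialLinearGroup.coe_mul, ← mul_assoc]
    rw [mul_assoc (h'⁻¹ * (S.φ' γ : Mat n)) h' h'⁻¹, mul_inv_cancel' hdet, mul_one]
  have Ndet : ∀ γ, (N γ).det ≠ 0 := by
    intro γ
    have e : N γ = h'⁻¹ * (S.φ' γ : Mat n) * h' := rfl
    rw [e, Matrix.det_mul, Matrix.det_mul, Matrix.SpecialLinearGroup.det_coe, mul_one, ← Matrix.det_mul, inv_mul_cancel' hdet, Matrix.det_one]
    exact one_ne_zero
  have Nlim : ∀ γ, Tendsto (fun t => (S.h t)⁻¹ * (S.φ t γ : Mat n) * S.h t) F (𝓝 (N γ)) := fun γ =>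
    (((continuousAt_inv hdet).tendsto.comp hh).mul (S.conv γ)).mul hh
  set G : Γ × Bool → Mat n := fun x => N x.1 * Ws x.2 with hG
  have Glim : ∀ x : Γ × Bool, Tendsto (fun t => (S.h t)⁻¹ * (S.φ t x.1 : Mat n) * S.h t * Ws x.2) F (𝓝 (G x)) := fun x =>
    (Nlim x.1).mul_const _
  have Gdet : ∀ x, (G x).det ≠ 0 := fun x => by
    have e : G x = N x.1 * Ws x.2 := rfl
    rw [e, Matrix.det_mul]; exact mul_ne_zero (Ndet _) (Ws_det _)
  have mid : ∀ x ∈ D.X, D.pos (D.B, false) < D.pos x → D.pos x < D.pos (D.B, true) → ∃ A, Tendsto (fun t => S.u t x) F (𝓝 A) :=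
    fun x hx h1 h2 => S.lim_lt hx D.hq (D.h0p.trans h1) h2 S.lim_uq
  have relTr : ∀ a b, D.Rel a b → Tr (G a) (G b) := by
    rintro a b ⟨γ, y, y', z, k, k', hy, hy', hz0, hz1, ea, sa, eb, sb, p1, p2, p3, p4, p5⟩
    obtain ⟨Ay, hAy⟩ := mid y hy p1 (by linarith)
    obtain ⟨Ay', hAy'⟩ := mid y' hy' (by linarith) (by linarith)
    obtain ⟨Az, hAz⟩ := mid _ hz0 (by linarith) (by linarith)
    obtain ⟨Az', hAz'⟩ := mid _ hz1 (by linarith) (by linarith)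
    obtain ⟨_, _, by1, by2, by3⟩ := S.lim_b hy hAy (Glim y)
    obtain ⟨_, _, by1', by2', by3'⟩ := S.lim_b hy' hAy' (Glim y')
    obtain ⟨_, _, bz1, bz2, bz3⟩ := S.lim_b hz0 hAz (Glim (z, false))
    obtain ⟨_, _, bz1', bz2', bz3'⟩ := S.lim_b hz1 hAz' (Glim (z, true))
    have t1 : Tr Az Az' := Tr_pair (Ndet z) bz1 bz1' bz2 bz2' (by rw [← bz3]; simp [hG, Ws]) (by rw [← bz3']; simp [hG, Ws])
    have uz := (lim_uu hAz fun t => (S.w t).uu _ hz0).mul_inv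
    have uz' := (lim_uu hAz' fun t => (S.w t).uu _ hz1).mul_inv
    have s1 := tnn_lim_inv_mul S hy hz0 p2 hAy hAz
    have s2 := tnn_lim_inv_mul S hz0 hz1 p3 hAz hAz'
    have s3 := tnn_lim_inv_mul S hz1 hy' p4 hAz' hAy'
    have t2 : Tr Ay Ay' := by
      intro m hm
      have := corner_mul_ne s1.1 s3.1 s1.2 s2.2 s3.2 m hm (t1 m hm)
      simp only [← mul_assoc] at this
      rwa [mul_assoc Ay⁻¹ Az, uz, mul_one, mul_assoc Ay⁻¹ Az', uz', mul_one] at this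
    have t3 : Tr (G y) (G y') := by rw [by3, by3', Tr_low by1 by1' by2 by2']; exact t2
    have mv : ∀ (a y : Γ × Bool) (k : ℤ), γ * a.1 = y.1 * D.γ0 ^ k → y.2 = a.2 →
        ∃ e : Mat n, Low e ∧ e.det ≠ 0 ∧ N γ * G a = G y * e := by
      intro a y k e1 e2
      obtain ⟨e, he, he'⟩ := conj_zpow_diag S.φ' h' hdet D.γ0 lam' hlam' r1 k
      have e3 : N (D.γ0 ^ k) = Matrix.diagonal e := by
        simp only [hN]
        rw [mul_assoc, he', ← mul_assoc, inv_mul_cancel' hdet, one_mul]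
      refine ⟨Matrix.diagonal (if a.2 then fun i => e i.rev else e), Low.diagonal _, ?_, ?_⟩
      · rw [Matrix.det_diagonal]
        refine Finset.prod_ne_zero_iff.2 fun i _ => ?_
        split_ifs
        · exact (he _).ne'
        · exact (he _).ne'
      · show N γ * (N a.1 * Ws a.2) = N y.1 * Ws y.2 * _
        rw [← mul_assoc, ← Nmul, e1, Nmul, e3, mul_assoc (N y.1) (Matrix.diagonal e), diag_Ws, e2, ← mul_assoc (N y.1)]
    obtain ⟨e, e1, e2, e3⟩ := mv a y k ea sa
    obtain ⟨e', e1', e2', e3'⟩ := mv b y' k' eb sb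
    rw [← Tr_left (Ndet γ), e3, e3', Tr_low e1 e1' e2 e2']
    exact t3
  have G1 : G (1, true) = Wm := by
    simp [hG, hN, Ws, inv_mul_cancel' hdet]
  have trailConv : ∀ x ∈ D.X, Trail (G x) → ∃ A, Tendsto (fun t => S.u t x) F (𝓝 A) := by
    intro x hx ht
    refine ⟨G x * ulc (G x), ?_⟩
    have h1 := (Glim x).mul ((continuousAt_ulc ht).tendsto.comp (Glim x))
    refine h1.congr fun t => ?_
    simp only [Function.comp]
    rw [(S.w t).dec' hx]
    exact ul_eq_ulc ((S.w t).uu x hx) ((S.w t).low x hx) ((S.w t).bdet_ne hx)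
  obtain ⟨xM, hxM, hxM'⟩ := D.X.exists_max_image D.pos ⟨_, D.h0⟩
  obtain ⟨xm, hxm, hxm'⟩ := D.X.exists_min_image D.pos ⟨_, D.h0⟩
  have cmax : ∀ x ∈ D.X, (∀ y ∈ D.X, D.pos y ≤ D.pos x) → ∃ A, Tendsto (fun t => S.u t x) F (𝓝 A) := fun x hx hm => by
    refine trailConv x hx (trail_of_tr_right (Gdet x) ?_)
    rw [← G1]; exact relTr _ _ (mp.mx x hx hm)
  have cmin : ∀ x ∈ D.X, (∀ y ∈ D.X, D.pos x ≤ D.pos y) → ∃ A, Tendsto (fun t => S.u t x) F (𝓝 A) := fun x hx hm => by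
    refine trailConv x hx (trail_of_tr_left ?_)
    rw [← G1]; exact relTr _ _ (mp.mn x hx hm)
  have call : ∀ x, ∃ A, x ∈ D.X → Tendsto (fun t => S.u t x) F (𝓝 A) := by
    intro x
    by_cases hx : x ∈ D.X
    swap
    · exact ⟨0, fun h => absurd h hx⟩
    suffices ∃ A, Tendsto (fun t => S.u t x) F (𝓝 A) by
      obtain ⟨A, hA⟩ := this; exact ⟨A, fun _ => hA⟩
    rcases (hxM' x hx).lt_or_eq with h1 | h1
    swap
    · exact cmax x hx fun y hy => h1 ▸ hxM' y hy
    rcases (hxm' x hx).lt_or_eq with h2 | h2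
    swap
    · exact cmin x hx fun y hy => h2 ▸ hxm' y hy
    obtain ⟨AM, hAM⟩ := cmax xM hxM hxM'
    obtain ⟨Am, hAm⟩ := cmin xm hxm hxm'
    have h3 := (lim_uu_inv hAm fun t => (S.w t).uu _ hxm).mul hAM
    have h4 : ∃ A, Tendsto (fun t => (S.u t xm)⁻¹ * S.u t x) F (𝓝 A) := by
      refine cvM_of_bdd F fun i j => ⟨|(Am⁻¹ * AM) i j| + 1, (bdd_of_tendsto (tendsto_mat.1 h3 i j)).mono ?_⟩
      intro t ht
      have a1 := (S.w t).sp _ hxm _ hx h2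
      have a2 := (S.w t).sp _ hx _ hxM h1
      have a3 := le_mul_uu a1.tnn a2.tnn a2.1 i j
      rw [mul_assoc, (S.w t).mul_sp hx] at a3
      exact (abs_of_nonneg (a1.tnn.entry i j)).le.trans (a3.trans ((le_abs_self _).trans ht))
    obtain ⟨A, hA⟩ := h4
    refine ⟨_, (hAm.mul hA).congr fun t => ?_⟩
    exact (S.w t).mul_sp hxm _
  choose A hA using call
  have cb : ∀ x, ∃ b, x ∈ D.X → (Tendsto (fun t => S.b t x) F (𝓝 b) ∧ Low b ∧ b.det ≠ 0 ∧ G x = A x * b) := by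
    intro x
    by_cases hx : x ∈ D.X
    · obtain ⟨b, hb⟩ := S.lim_b hx (hA x hx) (Glim x)
      exact ⟨b, fun _ => hb⟩
    · exact ⟨0, fun h => absurd h hx⟩
  choose b hb using cb
  have Auu : ∀ x ∈ D.X, UU (A x) := fun x hx => lim_uu (hA x hx) fun t => (S.w t).uu x hx
  have relSP : ∀ x ∈ D.X, ∀ x' ∈ D.X, D.pos x < D.pos x' → D.Rel x x' → SP ((A x)⁻¹ * A x') := by
    intro x hx x' hx' hlt hr
    obtain ⟨h1, h2⟩ := tnn_lim_inv_mul S hx hx' hlt (hA x hx) (hA x' hx')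
    refine SP_of_corners h1 h2 ?_
    have h3 := relTr x x' hr
    obtain ⟨_, b1, b2, b3⟩ := hb x hx
    obtain ⟨_, b1', b2', b3'⟩ := hb x' hx'
    rw [b3, b3', Tr_low b1 b1' b2 b2'] at h3
    exact h3
  refine ⟨h', lam', A, b, d', l', hdet, hlam', hanti, r1, Auu, fun x hx => (hb x hx).2.1, ?_, ?_, hd', hlsp, ?_⟩
  · intro x hx
    rw [← (hb x hx).2.2.2]
    simp only [hG, hN, ← mul_assoc]
    rw [mul_inv_cancel' hdet, one_mul]
  · intro x hx x' hx' hlt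
    obtain ⟨x1, hx1, hx1'⟩ := (D.X.filter fun y => D.pos x < D.pos y).exists_min_image D.pos ⟨x', by simp [hx', hlt]⟩
    simp only [Finset.mem_filter] at hx1 hx1'
    rcases (hx1' x' ⟨hx', hlt⟩).lt_or_eq with h1 | h1
    · have s1 := relSP x hx x1 hx1.1 hx1.2 (mp.adj x hx x1 hx1.1 hx1.2 fun y hy hy' => hx1' y ⟨hy, hy'⟩)
      obtain ⟨s2, s3⟩ := tnn_lim_inv_mul S hx1.1 hx' h1 (hA x1 hx1.1) (hA x' hx')
      have s4 := s1.mul_tnn s3 s2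
      rwa [mul_assoc, ← mul_assoc (A x1), (Auu x1 hx1.1).mul_inv, one_mul] at s4
    · exact relSP x hx x' hx' hlt (mp.adj x hx x' hx' hlt fun y hy hy' => h1 ▸ hx1' y ⟨hy, hy'⟩)
  · refine tendsto_nhds_unique (hb _ D.hp).1 ?_
    simp only [fun t => (S.w t).bp]
    exact (tendsto_diagonal hd).mul hl

end

theorem isClosed_posRep {Γ : Type} [Group Γ] {n : ℕ} (hn : 2 ≤ n) (D : Dat Γ) (mp : D.MP) {Z : Type*} [TopologicalSpace Z]
    (Φ : Z → Γ →* SL n ℝ) (hΦ : ∀ γ, Continuous fun z => (Φ z γ : Mat n)) : IsClosed {z | PosRep D (Φ z)} := by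
  classical
  rw [isClosed_iff_ultrafilter]
  intro z0 F hF hmem
  obtain ⟨t0, ht0⟩ := F.nonempty_of_mem hmem
  let ψ : Z → Γ →* SL n ℝ := fun t => if PosRep D (Φ t) then Φ t else Φ t0
  have hψ : ∀ t, PosRep D (ψ t) := by
    intro t
    simp only [ψ]
    split_ifs with h
    · exact h
    · exact ht0
  choose h lam u b d l w n1 n2 using fun t => (hψ t).normalise (by omega : 0 < n)
  let S : Sq D n Z F := ⟨hn, ψ, Φ z0, fun γ => by
    have h1 : Tendsto (fun z => (Φ z γ : Mat n)) F (𝓝 (Φ z0 γ : Mat n)) := ((hΦ γ).tendsto z0).mono_left hF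
    refine h1.congr' ?_
    filter_upwards [hmem] with t ht
    have : ψ t = Φ t := if_pos ht
    rw [this], h, lam, u, b, d, l, w, n1, n2⟩
  exact S.limit mp

end Hit

namespace Hit
open Filter Topology

/-! ## Module B7 : openness -/

lemma root_near {n : ℕ} (Λ : Fin n → ℝ) (hΛ : Function.Injective Λ) (i : Fin n) {ε0 : ℝ} (h0 : 0 < ε0) :
    ∀ᶠ M in 𝓝 (Matrix.diagonal Λ : Mat n), ∃ x, |x - Λ i| < ε0 ∧ (Matrix.diagonal (fun _ => x) - M).det = 0 := by
  have h1 : ∃ ε > 0, ε < ε0 ∧ ∀ j, j ≠ i → ε < |Λ i - Λ j| := by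
    have : ∀ᶠ ε in 𝓝[>] (0:ℝ), 0 < ε ∧ ε < ε0 ∧ ∀ j, j ≠ i → ε < |Λ i - Λ j| := by
      refine (eventually_mem_nhdsWithin).and (((gt_mem_nhds h0).filter_mono nhdsWithin_le_nhds).and ?_)
      rw [eventually_all]
      intro j
      by_cases hj : j = i
      · simp [hj]
      · have : 0 < |Λ i - Λ j| := abs_pos.2 (sub_ne_zero.2 fun h => hj (hΛ h).symm)
        filter_upwards [(gt_mem_nhds this).filter_mono nhdsWithin_le_nhds] with e he _
        exact he
    exact this.exists
  obtain ⟨ε, he, he0, hej⟩ := h1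
  have hc : ∀ x : ℝ, Continuous fun M : Mat n => (Matrix.diagonal (fun _ => x) - M).det := fun x =>
    Continuous.matrix_det (by fun_prop)
  have hneg : (Matrix.diagonal (fun _ => Λ i + ε) - Matrix.diagonal Λ : Mat n).det *
      (Matrix.diagonal (fun _ => Λ i - ε) - Matrix.diagonal Λ : Mat n).det < 0 := by
    rw [Matrix.diagonal_sub, Matrix.diagonal_sub, Matrix.det_diagonal, Matrix.det_diagonal, ← Finset.prod_mul_distrib,
      ← Finset.mul_prod_erase _ _ (Finset.mem_univ i)]
    refine mul_neg_of_neg_of_pos (by nlinarith) (Finset.prod_pos fun j hj => ?_)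
    have := hej j (Finset.ne_of_mem_erase hj)
    have h2 : ε ^ 2 < (Λ i - Λ j) ^ 2 := by rw [← sq_abs (Λ i - Λ j)]; gcongr
    nlinarith
  have hev := ((hc (Λ i + ε)).mul (hc (Λ i - ε))).tendsto (Matrix.diagonal Λ) |>.eventually (gt_mem_nhds hneg)
  filter_upwards [hev] with M hM
  have hcx : Continuous fun x : ℝ => (Matrix.diagonal (fun _ => x) - M).det :=
    Continuous.matrix_det (by fun_prop)
  have hle : Λ i - ε ≤ Λ i + ε := by linarith
  rcases mul_neg_iff.1 hM with ⟨ha, hb⟩ | ⟨ha, hb⟩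
  · obtain ⟨x, hx, hx0⟩ := intermediate_value_Icc hle hcx.continuousOn ⟨hb.le, ha.le⟩
    exact ⟨x, by rw [abs_lt]; constructor <;> linarith [hx.1, hx.2], hx0⟩
  · obtain ⟨x, hx, hx0⟩ := intermediate_value_Icc' hle hcx.continuousOn ⟨ha.le, hb.le⟩
    exact ⟨x, by rw [abs_lt]; constructor <;> linarith [hx.1, hx.2], hx0⟩

noncomputable def eigH {n : ℕ} (c : Fin n → ℝ) (q : Mat n × (Fin n → ℝ)) : Mat n :=
  fun a i => (Matrix.diagonal (fun _ => q.2 i) - q.1).adjugate a i / c i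

lemma eigH_cont {n : ℕ} (c : Fin n → ℝ) : Continuous (eigH c) := by
  refine continuous_matrix fun a i => ?_
  unfold eigH
  refine Continuous.div_const ?_ _
  refine Continuous.matrix_elem (Continuous.matrix_adjugate ?_) a i
  fun_prop

lemma eigH_spec {n : ℕ} (c : Fin n → ℝ) (M : Mat n) (L : Fin n → ℝ) (h : ∀ i, (Matrix.diagonal (fun _ => L i) - M).det = 0) :
    M * eigH c (M, L) = eigH c (M, L) * Matrix.diagonal L := by
  ext a i
  have h1 := Matrix.mul_adjugate (Matrix.diagonal (fun _ => L i) - M)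
  rw [h i, zero_smul, sub_mul, sub_eq_zero] at h1
  have h2 := congrFun (congrFun h1 a) i
  rw [Matrix.diagonal_mul] at h2
  rw [Matrix.mul_diagonal, Matrix.mul_apply]
  simp only [eigH]
  rw [Matrix.mul_apply] at h2
  simp only [mul_div_assoc']
  rw [← Finset.sum_div, ← h2]; ring

lemma eig_near {n : ℕ} (Λ : Fin n → ℝ) (hΛ : Function.Injective Λ) {P : Mat n × (Fin n → ℝ) → Prop}
    (hP : ∀ᶠ q in 𝓝 ((1 : Mat n), Λ), P q) :
    ∀ᶠ M in 𝓝 (Matrix.diagonal Λ : Mat n), ∃ H L, P (H, L) ∧ M * H = H * Matrix.diagonal L := by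
  set c : Fin n → ℝ := fun i => ∏ j ∈ Finset.univ.erase i, (Λ i - Λ j) with hc
  have h1 : eigH c (Matrix.diagonal Λ, Λ) = 1 := by
    ext a i
    simp only [eigH]
    rw [Matrix.diagonal_sub, Matrix.adjugate_diagonal]
    have : c i ≠ 0 := Finset.prod_ne_zero_iff.2 fun j hj => sub_ne_zero.2 fun h => Finset.ne_of_mem_erase hj (hΛ h).symm
    by_cases ha : a = i
    · subst ha; simp only [Matrix.diagonal_apply_eq, Matrix.one_apply_eq]; exact div_self this
    · rw [Matrix.diagonal_apply_ne _ ha, Matrix.one_apply_ne ha, zero_div]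
  have h2 : Tendsto (fun q : Mat n × (Fin n → ℝ) => (eigH c q, q.2)) (𝓝 (Matrix.diagonal Λ, Λ)) (𝓝 ((1 : Mat n), Λ)) := by
    have := ((eigH_cont c).prodMk continuous_snd).tendsto (Matrix.diagonal Λ, Λ)
    rwa [h1] at this
  have h3 := h2.eventually hP
  rw [nhds_prod_eq, eventually_prod_iff] at h3
  obtain ⟨pa, hpa, pb, hpb, hab⟩ := h3
  obtain ⟨ε, he, hball⟩ := Metric.eventually_nhds_iff.1 hpb
  have h4 : ∀ᶠ M in 𝓝 (Matrix.diagonal Λ : Mat n), ∀ i, ∃ x, |x - Λ i| < ε ∧ (Matrix.diagonal (fun _ => x) - M).det = 0 :=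
    eventually_all.2 fun i => root_near Λ hΛ i he
  filter_upwards [hpa, h4] with M hM hr
  choose L hL hL' using hr
  refine ⟨eigH c (M, L), L, hab hM (hball ?_), eigH_spec c M L hL'⟩
  rw [dist_pi_lt_iff he]
  intro i; rw [Real.dist_eq]; exact hL i

lemma low_diag_ne {n : ℕ} {b : Mat n} (hb : Low b) (hd : b.det ≠ 0) (i : Fin n) : b i i ≠ 0 := by
  rw [hb.det] at hd
  exact Finset.prod_ne_zero_iff.1 hd i (Finset.mem_univ i)

theorem wit_near {Γ : Type} [Group Γ] {n : ℕ} (D : Dat Γ) {Z : Type*} [TopologicalSpace Z]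
    (Φ : Z → Γ →* SL n ℝ) (hΦ : ∀ γ, Continuous fun z => (Φ z γ : Mat n)) (z0 : Z) {h0 lam0 u0 b0 d0 l0}
    (w : Wit D (Φ z0) h0 lam0 u0 b0 d0 l0) :
    ∀ᶠ q in 𝓝 (z0, h0, lam0), (Φ q.1 D.γ0 : Mat n) * q.2.1 = q.2.1 * Matrix.diagonal q.2.2 → PosRep D (Φ q.1) := by
  set q0 : Z × Mat n × (Fin n → ℝ) := (z0, h0, lam0) with hq0
  let G : (Γ × Bool) → (Z × Mat n × (Fin n → ℝ)) → Mat n := fun x q => q.2.1⁻¹ * (Φ q.1 x.1 : Mat n) * q.2.1 * Ws x.2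
  have hh : Continuous fun q : Z × Mat n × (Fin n → ℝ) => q.2.1 := by fun_prop
  have Gc : ∀ x, ContinuousAt (G x) q0 := by
    intro x
    have c1 : ContinuousAt (fun q : Z × Mat n × (Fin n → ℝ) => q.2.1⁻¹) q0 :=
      ContinuousAt.comp (g := fun g : Mat n => g⁻¹) (f := fun q : Z × Mat n × (Fin n → ℝ) => q.2.1) (continuousAt_inv w.hdet) hh.continuousAt
    exact ((c1.mul ((hΦ x.1).comp continuous_fst).continuousAt).mul hh.continuousAt).mul continuousAt_const
  have G0 : ∀ x ∈ D.X, G x q0 = u0 x * b0 x := fun x hx => w.dec' hx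
  have T0 : ∀ x ∈ D.X, Trail (G x q0) := fun x hx => by
    rw [G0 x hx]; exact trail_of_ul (w.uu x hx) (w.low x hx) (w.bdet_ne hx)
  have uC : ∀ x ∈ D.X, ContinuousAt (fun q => ulc (G x q)) q0 := fun x hx =>
    ContinuousAt.comp (g := fun g : Mat n => ulc g) (f := G x) (continuousAt_ulc (T0 x hx)) (Gc x)
  have ud : ∀ x ∈ D.X, (ulc (G x q0)).det ≠ 0 := fun x hx => right_ne_zero_of_mul_eq_one (ulc_det (T0 x hx))
  let u : (Z × Mat n × (Fin n → ℝ)) → (Γ × Bool) → Mat n := fun q x => G x q * ulc (G x q)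
  let b : (Z × Mat n × (Fin n → ℝ)) → (Γ × Bool) → Mat n := fun q x => (ulc (G x q))⁻¹
  have u00 : ∀ x ∈ D.X, u q0 x = u0 x := fun x hx => by
    show G x q0 * ulc (G x q0) = _
    rw [G0 x hx]; exact ul_eq_ulc (w.uu x hx) (w.low x hx) (w.bdet_ne hx)
  have b00 : ∀ x ∈ D.X, b q0 x = b0 x := fun x hx => by
    show (ulc (G x q0))⁻¹ = _
    refine Matrix.inv_eq_left_inv ?_
    have e : u0 x * (b0 x * ulc (G x q0)) = u0 x := by
      rw [← mul_assoc, ← G0 x hx]; exact u00 x hx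
    have e2 := congrArg (fun M => (u0 x)⁻¹ * M) e
    rwa [← mul_assoc, (w.uu x hx).inv_mul, one_mul] at e2
  have uc : ∀ x ∈ D.X, ContinuousAt (fun q => u q x) q0 := fun x hx => (Gc x).mul (uC x hx)
  have bc : ∀ x ∈ D.X, ContinuousAt (fun q => b q x) q0 := fun x hx =>
    ContinuousAt.comp (g := fun g : Mat n => g⁻¹) (f := fun q => ulc (G x q)) (continuousAt_inv (ud x hx)) (uC x hx)
  have ev1 : ∀ᶠ q in 𝓝 q0, q.2.1.det ≠ 0 := by
    have : Continuous fun q : Z × Mat n × (Fin n → ℝ) => q.2.1.det := hh.matrix_det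
    exact this.continuousAt.eventually_ne w.hdet
  have hlam : ∀ i, Continuous fun q : Z × Mat n × (Fin n → ℝ) => q.2.2 i := fun i => by fun_prop
  have ev2 : ∀ᶠ q in 𝓝 q0, ∀ i, 0 < q.2.2 i := eventually_all.2 fun i =>
    (hlam i).continuousAt.eventually (lt_mem_nhds (w.lpos i))
  have ev3 : ∀ᶠ q in 𝓝 q0, ∀ i j : Fin n, i < j → q.2.2 j < q.2.2 i := eventually_all.2 fun i => eventually_all.2 fun j => by
    by_cases hij : i < j
    · filter_upwards [(hlam j).continuousAt.eventually_lt (hlam i).continuousAt (w.lanti i j hij)] with q hq _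
      exact hq
    · exact Eventually.of_forall fun q h => absurd h hij
  have ev4 : ∀ᶠ q in 𝓝 q0, ∀ x ∈ D.X, Trail (G x q) := by
    rw [Filter.eventually_all_finset]
    intro x hx
    exact (Gc x).eventually (T0 x hx).eventually
  have ev5 : ∀ᶠ q in 𝓝 q0, ∀ x ∈ D.X, ∀ x' ∈ D.X, D.pos x < D.pos x' → UU ((u q x)⁻¹ * u q x') → SP ((u q x)⁻¹ * u q x') := by
    rw [Filter.eventually_all_finset]
    intro x hx
    rw [Filter.eventually_all_finset]
    intro x' hx'
    by_cases hlt : D.pos x < D.pos x'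
    swap
    · exact Eventually.of_forall fun q h => absurd h hlt
    have hdu : (u q0 x).det ≠ 0 := by rw [u00 x hx, (w.uu x hx).det]; exact one_ne_zero
    have c2 : ContinuousAt (fun q => (u q x)⁻¹ * u q x') q0 :=
      (ContinuousAt.comp (g := fun g : Mat n => g⁻¹) (f := fun q => u q x) (continuousAt_inv hdu) (uc x hx)).mul (uc x' hx')
    have s0 : SP ((u q0 x)⁻¹ * u q0 x') := by rw [u00 x hx, u00 x' hx']; exact w.sp x hx x' hx' hlt
    filter_upwards [c2.eventually s0.eventually] with q hq _
    exact hq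
  let p : Γ × Bool := (D.B, false)
  have bpi : ∀ i, ContinuousAt (fun q => b q p i i) q0 := fun i => continuousAt_mat.1 (bc p D.hp) i i
  have lii : ∀ i, l0 i i = 1 := fun i => w.lsp.1.2 i
  have bp0 : b q0 p = Matrix.diagonal d0 * l0 := (b00 p D.hp).trans w.bp
  have bpii : ∀ i, b q0 p i i = d0 i := fun i => by rw [bp0, Matrix.diagonal_mul, lii, mul_one]
  have ev6 : ∀ᶠ q in 𝓝 q0, ∀ i, 0 < b q p i i := eventually_all.2 fun i =>
    (bpi i).eventually (lt_mem_nhds (lt_of_lt_of_eq (w.dpos i) (bpii i).symm))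
  let l : (Z × Mat n × (Fin n → ℝ)) → Mat n := fun q => Matrix.diagonal (fun i => (b q p i i)⁻¹) * b q p
  have lc : ContinuousAt (fun q => (l q)ᵀ) q0 := by
    rw [continuousAt_mat]; intro i j
    have : (fun q => (l q)ᵀ i j) = fun q => (b q p j j)⁻¹ * b q p j i := by
      ext q; simp [l, Matrix.diagonal_mul]
    rw [this]
    exact ((bpi j).inv₀ (by rw [bpii]; exact (w.dpos j).ne')).mul (continuousAt_mat.1 (bc p D.hp) j i)
  have l00 : l q0 = l0 := by
    have : (fun i => (b q0 p i i)⁻¹) = fun i => (d0 i)⁻¹ := by ext i; rw [bpii]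
    show Matrix.diagonal (fun i => (b q0 p i i)⁻¹) * b q0 p = l0
    rw [this, bp0, ← mul_assoc, diag_inv_mul d0 w.dpos, one_mul]
  have ev7 : ∀ᶠ q in 𝓝 q0, UU (l q)ᵀ → SP (l q)ᵀ := lc.eventually (by
    have : SP (l q0)ᵀ := by rw [l00]; exact w.lsp
    exact this.eventually)
  filter_upwards [ev1, ev2, ev3, ev4, ev5, ev6, ev7] with q h1 h2 h3 h4 h5 h6 h7 heq
  have uq : ∀ x ∈ D.X, UU (u q x) := fun x hx => ulc_uu (h4 x hx)
  have ud : ∀ x ∈ D.X, (ulc (G x q)).det ≠ 0 := fun x hx => right_ne_zero_of_mul_eq_one (ulc_det (h4 x hx))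
  have bq : ∀ x ∈ D.X, Low (b q x) := fun x hx => (ulc_low (h4 x hx)).inv (ud x hx)
  refine ⟨q.2.1, q.2.2, u q, b q, fun i => b q p i i, l q, h1, h2, h3, heq, uq, bq, ?_, ?_, h6, ?_, ?_⟩
  · intro x hx
    have : u q x * b q x = G x q := by
      show G x q * ulc (G x q) * (ulc (G x q))⁻¹ = G x q
      rw [mul_assoc, mul_inv_cancel' (ud x hx), mul_one]
    rw [this]
    show _ = q.2.1 * (q.2.1⁻¹ * (Φ q.1 x.1 : Mat n) * q.2.1 * Ws x.2)
    simp only [← mul_assoc]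
    rw [mul_inv_cancel' h1, one_mul]
  · intro x hx x' hx' hlt
    exact h5 x hx x' hx' hlt ((uq x hx).inv.mul (uq x' hx'))
  · refine h7 ⟨fun i j hij => ?_, fun i => ?_⟩
    · show (Matrix.diagonal (fun i => (b q p i i)⁻¹) * b q p) j i = 0
      rw [Matrix.diagonal_mul, bq p D.hp j i hij, mul_zero]
    · show (Matrix.diagonal (fun i => (b q p i i)⁻¹) * b q p) i i = 1
      rw [Matrix.diagonal_mul, inv_mul_cancel₀ (h6 i).ne']
  · show b q p = Matrix.diagonal (fun i => b q p i i) * (Matrix.diagonal (fun i => (b q p i i)⁻¹) * b q p)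
    rw [← mul_assoc, diag_mul_inv _ h6, one_mul]

theorem isOpen_posRep {Γ : Type} [Group Γ] {n : ℕ} (D : Dat Γ) {Z : Type*} [TopologicalSpace Z]
    (Φ : Z → Γ →* SL n ℝ) (hΦ : ∀ γ, Continuous fun z => (Φ z γ : Mat n)) : IsOpen {z | PosRep D (Φ z)} := by
  rw [isOpen_iff_mem_nhds]
  rintro z0 ⟨h0, lam0, u0, b0, d0, l0, w⟩
  have inj : Function.Injective lam0 := by
    intro i j hij
    rcases lt_trichotomy i j with h | h | h
    · exact absurd hij (w.lanti _ _ h).ne'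
    · exact h
    · exact absurd hij (w.lanti _ _ h).ne
  have h1 := wit_near D Φ hΦ z0 w
  rw [nhds_prod_eq, eventually_prod_iff] at h1
  obtain ⟨pa, hpa, pb, hpb, hab⟩ := h1
  have h2 : ∀ᶠ q in 𝓝 ((1 : Mat n), lam0), pb (h0 * q.1, q.2) := by
    have c : Continuous fun q : Mat n × (Fin n → ℝ) => (h0 * q.1, q.2) := by fun_prop
    have := c.tendsto (1, lam0)
    simp only [mul_one] at this
    exact this.eventually hpb
  have h3 := eig_near lam0 inj h2
  have c : Continuous fun z => h0⁻¹ * (Φ z D.γ0 : Mat n) * h0 := (continuous_const.mul (hΦ D.γ0)).mul continuous_const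
  have h4 := c.tendsto z0
  rw [w.Ng0] at h4
  filter_upwards [hpa, h4.eventually h3] with z hz hz'
  obtain ⟨H, L, hp, he⟩ := hz'
  refine hab hz hp ?_
  show (Φ z D.γ0 : Mat n) * (h0 * H) = h0 * H * Matrix.diagonal L
  have := congrArg (fun M => h0 * M) he
  simp only [← mul_assoc] at this
  rw [mul_inv_cancel' w.hdet, one_mul] at this
  rw [← mul_assoc]
  exact this

/-- Conclusion from positivity: the centraliser is `± 1`. -/
theorem PosRep.centralizer {Γ : Type} [Group Γ] {n : ℕ} {D : Dat Γ} {φ : Γ →* SL n ℝ} (hP : PosRep D φ) (ξ : SL n ℝ)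
    (hξ : ∀ γ, ξ * φ γ = φ γ * ξ) : (ξ : Mat n) = 1 ∨ (ξ : Mat n) = -1 := by
  obtain ⟨h, lam, u, b, d, l, w⟩ := hP
  set K : Mat n := h⁻¹ * (ξ : Mat n) * h with hK
  have comm : ∀ γ, K * (h⁻¹ * (φ γ : Mat n) * h) = (h⁻¹ * (φ γ : Mat n) * h) * K := by
    intro γ
    have e := congrArg (fun M : SL n ℝ => h⁻¹ * (M : Mat n) * h) (hξ γ)
    simp only [Matrix.SpecialLinearGroup.coe_mul] at e
    have k : ∀ A B : Mat n, h⁻¹ * A * h * (h⁻¹ * B * h) = h⁻¹ * (A * B) * h := fun A B => by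
      simp only [← mul_assoc]
      rw [mul_assoc (h⁻¹ * A) h h⁻¹, mul_inv_cancel' w.hdet, mul_one]
    rw [hK, k, k, e]
  have hdiag : ∀ i j, i ≠ j → K i j = 0 := by
    intro i j hij
    have e := congrFun (congrFun (comm D.γ0) i) j
    rw [w.Ng0, Matrix.mul_diagonal, Matrix.diagonal_mul] at e
    have hne : lam i ≠ lam j := by
      rcases lt_or_gt_of_ne hij with h | h
      · exact (w.lanti _ _ h).ne'
      · exact (w.lanti _ _ h).ne
    have : (lam i - lam j) * K i j = 0 := by linear_combination -e
    exact (mul_eq_zero.1 this).resolve_left (sub_ne_zero.2 hne)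
  have hKd : K = Matrix.diagonal (fun i => K i i) := by
    ext i j
    by_cases h : i = j
    · subst h; simp
    · rw [hdiag i j h, Matrix.diagonal_apply_ne _ h]
  have hstep : ∀ i j : Fin n, (j : ℕ) = i + 1 → K i i = K j j := by
    intro i j hij
    have e := congrFun (congrFun (comm D.B) i) j
    rw [hKd, Matrix.mul_diagonal, Matrix.diagonal_mul] at e
    have hpos : 0 < (h⁻¹ * (φ D.B : Mat n) * h) i j := by
      have g1 := w.NB_ge i j j
      have lt : i < j := by rw [Fin.lt_def]; omega
      have g2 : 0 < u (D.B, false) i j := (w.usp D.hp D.h0p).entry _ _ lt.le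
      rw [show l j j = 1 from w.lsp.1.2 j, mul_one] at g1
      exact lt_of_lt_of_le (mul_pos g2 (w.dpos j)) g1
    have : (K i i - K j j) * (h⁻¹ * (φ D.B : Mat n) * h) i j = 0 := by linear_combination e
    exact sub_eq_zero.1 ((mul_eq_zero.1 this).resolve_right hpos.ne')
  rcases Nat.eq_zero_or_pos n with rfl | hn
  · left; ext i; exact i.elim0
  set c := K ⟨0, hn⟩ ⟨0, hn⟩ with hc
  have hall : ∀ (k : ℕ) (hk : k < n), K ⟨k, hk⟩ ⟨k, hk⟩ = c := by
    intro k
    induction k with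
    | zero => intro hk; rfl
    | succ k ih => intro hk; rw [← ih (by omega)]; exact (hstep _ _ rfl).symm
  have hKc : K = c • (1 : Mat n) := by
    rw [hKd]
    ext i j
    by_cases h : i = j
    · subst h; simp [hall i.1 i.2]
    · simp [h]
  have hξc : (ξ : Mat n) = c • (1 : Mat n) := by
    have e : h * K * h⁻¹ = (ξ : Mat n) := by
      rw [hK]
      simp only [← mul_assoc]
      rw [mul_inv_cancel' w.hdet, one_mul, mul_assoc, mul_inv_cancel' w.hdet, mul_one]
    rw [← e, hKc]
    simp [mul_inv_cancel' w.hdet]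
  have hdet := ξ.det_coe
  rw [hξc, Matrix.det_smul, Matrix.det_one, mul_one, Fintype.card_fin] at hdet
  have : |c| = 1 := by
    have h1 : |c| ^ n = 1 := by rw [← abs_pow, hdet, abs_one]
    exact (pow_eq_one_iff_of_nonneg (abs_nonneg c) (by omega)).1 h1
  rcases (abs_eq zero_le_one).1 this with h | h
  · left; rw [hξc, h, one_smul]
  · right; rw [hξc, h, neg_smul, one_smul]

end Hit

namespace Hit
open Filter Topology

/-! ## Module B8 : positivity along the component -/

lemma coe_inv_SL {n : ℕ} (A : SL n ℝ) : ((A⁻¹ : SL n ℝ) : Mat n) = (A : Mat n)⁻¹ := by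
  symm
  apply Matrix.inv_eq_left_inv
  rw [← Matrix.SpecialLinearGroup.coe_mul, inv_mul_cancel, Matrix.SpecialLinearGroup.coe_one]

lemma coe_list_prod {n : ℕ} (L : List (SL n ℝ)) : ((L.prod : SL n ℝ) : Mat n) = (L.map fun A : SL n ℝ => (A : Mat n)).prod := by
  induction L with
  | nil => simp
  | cons a L ih => simp [ih]

def tupSL {g n : ℕ} (z : ↥(RepVariety g n ℝ)) (x : Fin g × Bool) : SL n ℝ := ⟨z.1 x, z.2.1 x⟩

lemma tup_rel {g n : ℕ} (z : ↥(RepVariety g n ℝ)) :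
    ∀ r ∈ ({surfaceRelator g} : Set (FreeGroup (Fin g × Bool))), FreeGroup.lift (tupSL z) r = 1 := by
  intro r hr
  rw [Set.mem_singleton_iff] at hr
  subst hr
  apply Matrix.SpecialLinearGroup.ext
  have h := z.2.2
  have e : ((FreeGroup.lift (tupSL z) (surfaceRelator g) : SL n ℝ) : Mat n) = (List.ofFn fun i : Fin g =>
      z.1 (i, false) * z.1 (i, true) * (z.1 (i, false))⁻¹ * (z.1 (i, true))⁻¹).prod := by
    unfold surfaceRelator
    rw [map_list_prod, List.map_ofFn]
    rw [coe_list_prod, List.map_ofFn]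
    congr 1
    refine congrArg List.ofFn ?_
    funext i
    simp only [Function.comp, commutatorElement_def, map_mul, map_inv, FreeGroup.lift_apply_of, Matrix.SpecialLinearGroup.coe_mul, coe_inv_SL]
    rfl
  rw [e, h]; simp

def tupRep {g n : ℕ} (z : ↥(RepVariety g n ℝ)) : SurfaceGroup g →* SL n ℝ := PresentedGroup.toGroup (tup_rel z)

lemma tupRep_cont {g n : ℕ} (γ : SurfaceGroup g) : Continuous fun z : ↥(RepVariety g n ℝ) => (tupRep z γ : Mat n) := by
  obtain ⟨w, rfl⟩ := PresentedGroup.mk_surjective _ γ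
  have hof : ∀ x, Continuous fun z : ↥(RepVariety g n ℝ) => (tupRep z (PresentedGroup.of x) : Mat n) := by
    intro x
    have : (fun z : ↥(RepVariety g n ℝ) => (tupRep z (PresentedGroup.of x) : Mat n)) = fun z => z.1 x := by
      funext z; simp [tupRep, tupSL]
    rw [this]; exact (continuous_apply x).comp continuous_subtype_val
  induction w using FreeGroup.induction_on with
  | C1 => simpa using continuous_const
  | of x => exact hof x
  | inv_of x _ =>
    simp only [map_inv, Matrix.SpecialLinearGroup.coe_inv]
    exact (hof x).matrix_adjugate
  | mul x y hx hy =>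
    simp only [map_mul, Matrix.SpecialLinearGroup.coe_mul]
    exact hx.mul hy

lemma repTuple_mem {g n : ℕ} (ρ : SurfaceGroup g →* SL n ℝ) : repTuple ρ ∈ RepVariety g n ℝ := by
  refine ⟨fun x => (ρ _).det_coe, ?_⟩
  have h : ρ (PresentedGroup.mk _ (surfaceRelator g)) = 1 := by
    rw [PresentedGroup.one_of_mem (Set.mem_singleton _), map_one]
  have h3 : ∀ f : FreeGroup (Fin g × Bool) →* SL n ℝ, f (surfaceRelator g) = (List.ofFn fun i : Fin g =>
    ⁅f (FreeGroup.of (i, false)), f (FreeGroup.of (i, true))⁆).prod := by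
    intro f
    unfold surfaceRelator
    rw [map_list_prod, List.map_ofFn]
    congr 1
    refine congrArg List.ofFn ?_
    funext i
    simp
  rw [← MonoidHom.comp_apply, h3] at h
  have h2 := congrArg (fun A : SL n ℝ => (A : Mat n)) h
  simp only [coe_list_prod, List.map_ofFn, Matrix.SpecialLinearGroup.coe_one] at h2
  rw [← h2]
  congr 1
  refine congrArg List.ofFn ?_
  funext i
  simp only [Function.comp, commutatorElement_def, map_mul, map_inv, Matrix.SpecialLinearGroup.coe_mul, coe_inv_SL]
  rfl

lemma tupRep_repTuple {g n : ℕ} (ρ : SurfaceGroup g →* SL n ℝ) (h : repTuple ρ ∈ RepVariety g n ℝ) :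
    tupRep ⟨repTuple ρ, h⟩ = ρ := by
  apply PresentedGroup.ext
  intro x
  simp only [tupRep, PresentedGroup.toGroup.of]
  rfl

theorem posRep_of_HIT {g n : ℕ} (hn : 2 ≤ n) (D : Dat (SurfaceGroup g)) (mp : D.MP) (φ ρ : SurfaceGroup g →* SL n ℝ)
    (hφ : PosRep D φ) (hρ : repTuple ρ ∈ HIT g n (repTuple φ)) : PosRep D ρ := by
  unfold HIT at hρ
  rw [connectedComponentIn_eq_image (repTuple_mem φ)] at hρ
  obtain ⟨z, hz, hz'⟩ := hρ
  have hclopen : IsClopen {z : ↥(RepVariety g n ℝ) | PosRep D (tupRep z)} :=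
    ⟨isClosed_posRep hn D mp tupRep tupRep_cont, isOpen_posRep D tupRep tupRep_cont⟩
  have h0 : (⟨repTuple φ, repTuple_mem φ⟩ : ↥(RepVariety g n ℝ)) ∈ {z : ↥(RepVariety g n ℝ) | PosRep D (tupRep z)} := by
    show PosRep D (tupRep _)
    rwa [tupRep_repTuple]
  have h1 : PosRep D (tupRep z) := hclopen.connectedComponent_subset h0 hz
  have e : z = ⟨repTuple ρ, repTuple_mem ρ⟩ := Subtype.ext hz'
  rwa [e, tupRep_repTuple] at h1

end Hit

namespace Hit
open Filter Topology

/-! ## Module C1 : one-parameter groups are exponentials -/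

section
variable {A : Type*} [NormedRing A] [NormedAlgebra ℝ A] [CompleteSpace A]

lemma oneparam_ring (f : ℝ → A) (hc : Continuous f) (h0 : f 0 = 1) (hadd : ∀ s t, f (s + t) = f s * f t) :
    ∃ X : A, ∀ t, f t = NormedSpace.exp (t • X) := by
  let F : ℝ → A := fun a => ∫ s in (0:ℝ)..a, f s
  have hF : ∀ a, HasDerivAt F (f a) a := fun a =>
    intervalIntegral.integral_hasDerivAt_right (hc.intervalIntegrable _ _) (hc.stronglyMeasurableAtFilter _ _) hc.continuousAt
  have hF0 : F 0 = 0 := intervalIntegral.integral_same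
  have hu : ∃ a : ℝ, IsUnit (F a) := by
    have h1 := hasDerivAt_iff_tendsto_slope_zero.1 (hF 0)
    rw [h0] at h1
    have h2 : ∀ᶠ t in 𝓝[≠] (0:ℝ), IsUnit (t⁻¹ • (F (0 + t) - F 0)) :=
      h1.eventually (Units.isOpen.mem_nhds isUnit_one)
    obtain ⟨t, ht, ht0⟩ := (h2.and eventually_mem_nhdsWithin).exists
    refine ⟨t, ?_⟩
    rw [hF0, sub_zero, zero_add] at ht
    have ht0' : t ≠ 0 := ht0
    have h3 : F t = (algebraMap ℝ A t) * (t⁻¹ • F t) := by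
      rw [← Algebra.smul_def, smul_smul, mul_inv_cancel₀ ht0', one_smul]
    rw [h3]
    exact ((isUnit_iff_ne_zero.2 ht0').map (algebraMap ℝ A)).mul ht
  obtain ⟨a, ⟨V, hV⟩⟩ := hu
  have hmul : ∀ t, f t * F a = F (t + a) - F t := by
    intro t
    have e1 : f t * F a = ∫ s in (0:ℝ)..a, f (t + s) := by
      simp only [hadd]
      exact ((ContinuousLinearMap.mul ℝ A (f t)).intervalIntegral_comp_comm (hc.intervalIntegrable 0 a)).symm
    rw [e1, intervalIntegral.integral_comp_add_left (fun s => f s) t, add_zero]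
    exact (intervalIntegral.integral_interval_sub_left (hc.intervalIntegrable _ _) (hc.intervalIntegrable _ _)).symm
  have hf : ∀ t, f t = (F (t + a) - F t) * ↑V⁻¹ := by
    intro t
    rw [← hmul, ← hV, mul_assoc, Units.mul_inv, mul_one]
  let X : A := (f a - 1) * ↑V⁻¹
  have hd : ∀ t, HasDerivAt f (f t * X) t := by
    intro t
    have h1 : HasDerivAt (fun t => (F (t + a) - F t) * ↑V⁻¹) ((f (t + a) - f t) * ↑V⁻¹) t :=
      (((hF (t + a)).comp_add_const t a).sub (hF t)).mul_const _
    have e : (fun t => (F (t + a) - F t) * ↑V⁻¹) = f := by funext t; exact (hf t).symm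
    rw [e] at h1
    convert h1 using 1
    show f t * ((f a - 1) * ↑V⁻¹) = _
    rw [hadd, ← mul_assoc, mul_sub, mul_one]
  refine ⟨X, ?_⟩
  have hg : ∀ t, HasDerivAt (fun t : ℝ => f t * NormedSpace.exp (t • (-X))) 0 t := by
    intro t
    have h1 := (hd t).mul (hasDerivAt_exp_smul_const' (𝕂 := ℝ) (-X) t)
    refine h1.congr_deriv ?_
    simp [mul_assoc]
  have hconst : ∀ t, f t * NormedSpace.exp (t • (-X)) = 1 := by
    intro t
    have := is_const_of_deriv_eq_zero (fun t => (hg t).differentiableAt) (fun t => (hg t).deriv) t 0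
    simpa [h0] using this
  intro t
  have h1 := hconst t
  have h2 : NormedSpace.exp (t • (-X)) * NormedSpace.exp (t • X) = 1 := by
    letI : NormedAlgebra ℚ A := NormedAlgebra.restrictScalars ℚ ℝ A
    rw [← NormedSpace.exp_add_of_commute (by rw [smul_neg]; exact (Commute.refl _).neg_left), smul_neg, neg_add_cancel,
      NormedSpace.exp_zero]
  calc f t = f t * (NormedSpace.exp (t • (-X)) * NormedSpace.exp (t • X)) := by rw [h2, mul_one]
    _ = _ := by rw [← mul_assoc, h1, one_mul]

open NormedSpace (exp)

lemma exp_deriv (X : A) (t : ℝ) : HasDerivAt (fun t : ℝ => exp (t • X)) (X * exp (t • X)) t :=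
  hasDerivAt_exp_smul_const' (𝕂 := ℝ) X t

lemma exp_deriv0 (X : A) : HasDerivAt (fun t : ℝ => exp (t • X)) X 0 := by
  simpa using exp_deriv X 0

lemma deriv_unique {f : ℝ → A} {P Q : A} {t : ℝ} (h1 : HasDerivAt f P t) (h2 : HasDerivAt f Q t) : P = Q :=
  h1.unique h2

/-- relation coming from `D U D⁻¹`. -/
lemma rel_HX {H X : A} {c : ℝ}
    (h : ∀ s x : ℝ, exp (s • H) * exp (x • X) = exp ((Real.exp (c * s) * x) • X) * exp (s • H)) : H * X = X * H + c • X := by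
  have h1 : ∀ s : ℝ, exp (s • H) * X = (Real.exp (c * s) • X) * exp (s • H) := by
    intro s
    have d1 : HasDerivAt (fun x : ℝ => exp (s • H) * exp (x • X)) (exp (s • H) * X) 0 := (exp_deriv0 X).const_mul _
    have d2 : HasDerivAt (fun x : ℝ => exp ((Real.exp (c * s) * x) • X) * exp (s • H)) ((Real.exp (c * s) • X) * exp (s • H)) 0 := by
      refine HasDerivAt.mul_const ?_ _
      have := exp_deriv0 (Real.exp (c * s) • X)
      have e : (fun x : ℝ => exp ((Real.exp (c * s) * x) • X)) = fun t : ℝ => exp (t • (Real.exp (c * s) • X)) := by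
        funext t; rw [smul_smul, mul_comm]
      rw [e]; exact this
    have e : (fun x : ℝ => exp (s • H) * exp (x • X)) = fun x : ℝ => exp ((Real.exp (c * s) * x) • X) * exp (s • H) := by
      funext x; exact h s x
    rw [e] at d1
    exact d1.unique d2
  have d1 : HasDerivAt (fun s : ℝ => exp (s • H) * X) (H * X) 0 := (exp_deriv0 H).mul_const _
  have d3 : HasDerivAt (fun s : ℝ => Real.exp (c * s) • X) (c • X) 0 := by
    have : HasDerivAt (fun s : ℝ => Real.exp (c * s)) c 0 := by
      have := ((hasDerivAt_id (0:ℝ)).const_mul c).exp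
      exact this.congr_deriv (by simp)
    exact this.smul_const X
  have d2 := d3.mul (exp_deriv0 H)
  have e : (fun s : ℝ => exp (s • H) * X) = fun s : ℝ => (Real.exp (c * s) • X) * exp (s • H) := by
    funext s; exact h1 s
  rw [e] at d1
  have := d1.unique d2
  simp at this
  rw [this, add_comm]

/-- relation from `U L = L D U`. -/
lemma rel_XY {H X Y : A}
    (h : ∀ x y : ℝ, 0 < 1 + x * y → exp (x • X) * exp (y • Y) =
      exp ((y / (1 + x * y)) • Y) * exp (Real.log (1 + x * y) • H) * exp ((x / (1 + x * y)) • X)) : X * Y = Y * X + H := by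
  have h1 : ∀ x : ℝ, exp (x • X) * Y = Y * exp (x • X) + x • (H * exp (x • X)) - x ^ 2 • (X * exp (x • X)) := by
    intro x
    have d1 : HasDerivAt (fun y : ℝ => exp (x • X) * exp (y • Y)) (exp (x • X) * Y) 0 := (exp_deriv0 Y).const_mul _
    have dq : HasDerivAt (fun y : ℝ => 1 + x * y) x 0 := by
      exact (((hasDerivAt_id (0:ℝ)).const_mul x).const_add 1).congr_deriv (by simp)
    have a1 : HasDerivAt (fun y : ℝ => y / (1 + x * y)) 1 0 := by
      have := (hasDerivAt_id (0:ℝ)).div dq (by simp)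
      exact this.congr_deriv (by simp)
    have a2 : HasDerivAt (fun y : ℝ => Real.log (1 + x * y)) x 0 := by
      have := dq.log (by simp)
      exact this.congr_deriv (by simp)
    have a3 : HasDerivAt (fun y : ℝ => x / (1 + x * y)) (-x ^ 2) 0 := by
      have := (hasDerivAt_const (0:ℝ) x).div dq (by simp)
      exact this.congr_deriv (by simp [sq])
    have b1 : HasDerivAt (fun y : ℝ => exp ((y / (1 + x * y)) • Y)) Y 0 := by
      have := HasDerivAt.scomp_of_eq (0:ℝ) (exp_deriv0 Y) a1 (by simp)
      exact this.congr_deriv (by simp)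
    have b2 : HasDerivAt (fun y : ℝ => exp (Real.log (1 + x * y) • H)) (x • H) 0 := by
      have := HasDerivAt.scomp_of_eq (0:ℝ) (exp_deriv0 H) a2 (by simp)
      exact this.congr_deriv (by simp)
    have b3 : HasDerivAt (fun y : ℝ => exp ((x / (1 + x * y)) • X)) ((-x ^ 2) • (X * exp (x • X))) 0 := by
      have := HasDerivAt.scomp_of_eq (0:ℝ) (exp_deriv X x) a3 (by simp)
      exact this.congr_deriv (by simp)
    have d2 := (b1.mul b2).mul b3
    have e : (fun y : ℝ => exp (x • X) * exp (y • Y)) =ᶠ[𝓝 0] fun y : ℝ => exp ((y / (1 + x * y)) • Y) * exp (Real.log (1 + x * y) • H) * exp ((x / (1 + x * y)) • X) := by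
      have : ∀ᶠ y : ℝ in 𝓝 0, 0 < 1 + x * y := dq.continuousAt.eventually (lt_mem_nhds (by simp))
      filter_upwards [this] with y hy
      exact h x y hy
    have := (d1.congr_of_eventuallyEq e.symm).unique d2
    simp at this
    rw [this]
    simp [add_mul, sub_eq_add_neg]
  have d1 : HasDerivAt (fun x : ℝ => exp (x • X) * Y) (X * Y) 0 := (exp_deriv0 X).mul_const _
  have c1 : HasDerivAt (fun x : ℝ => Y * exp (x • X)) (Y * X) 0 := (exp_deriv0 X).const_mul _
  have c2 : HasDerivAt (fun x : ℝ => x • (H * exp (x • X))) H 0 := by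
    have := (hasDerivAt_id (0:ℝ)).smul ((exp_deriv0 X).const_mul H)
    exact this.congr_deriv (by simp)
  have c3 : HasDerivAt (fun x : ℝ => x ^ 2 • (X * exp (x • X))) 0 0 := by
    have := (hasDerivAt_pow 2 (0:ℝ)).smul ((exp_deriv0 X).const_mul X)
    exact this.congr_deriv (by simp)
  have d2 := (c1.add c2).sub c3
  have e : (fun x : ℝ => exp (x • X) * Y) = fun x : ℝ => Y * exp (x • X) + x • (H * exp (x • X)) - x ^ 2 • (X * exp (x • X)) := by
    funext x; exact h1 x
  rw [e] at d1
  have := d1.unique d2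
  simpa using this

lemma exp_nilp {n : ℕ} {X : A} (h : X ^ n = 0) (x : ℝ) : exp (x • X) = ∑ k ∈ Finset.range n, (x ^ k / k.factorial) • X ^ k := by
  rw [NormedSpace.exp_eq_tsum ℝ]
  simp only
  rw [tsum_eq_sum (s := Finset.range n)]
  · refine Finset.sum_congr rfl fun k _ => ?_
    rw [smul_pow, smul_smul]; congr 1; ring
  · intro k hk
    rw [Finset.mem_range, not_lt] at hk
    rw [smul_pow, pow_eq_zero_of_le hk h, smul_zero, smul_zero]

lemma exp_nilp_tendsto {n : ℕ} {X : A} (h : X ^ n = 0) :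
    Tendsto (fun m : ℕ => (1 + ((m:ℝ)⁻¹) • X) ^ m) atTop (𝓝 (exp X)) := by
  have e0 : exp X = exp ((1:ℝ) • X) := by rw [one_smul]
  rw [e0, exp_nilp h]
  have e : ∀ᶠ m : ℕ in atTop, ∑ k ∈ Finset.range n, ((m.choose k : ℝ) * ((m:ℝ)⁻¹) ^ k) • X ^ k = (1 + ((m:ℝ)⁻¹) • X) ^ m := by
    filter_upwards [eventually_ge_atTop n] with m hm
    rw [add_comm, Commute.add_pow (Commute.one_right _)]
    have : Finset.range n ⊆ Finset.range (m + 1) := Finset.range_subset_range.2 (by omega)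
    rw [Finset.sum_subset this]
    · refine Finset.sum_congr rfl fun k _ => ?_
      rw [one_pow, mul_one, smul_pow, ← (Nat.cast_commute (m.choose k) _).eq, mul_smul, Nat.cast_smul_eq_nsmul, nsmul_eq_mul]
    · intro k _ hk
      rw [Finset.mem_range, not_lt] at hk
      rw [pow_eq_zero_of_le hk h, smul_zero]
  refine Tendsto.congr' e (tendsto_finsetSum _ fun k _ => ?_)
  refine Tendsto.smul_const ?_ _
  refine ProbabilityTheory.tendsto_choose_mul_pow_atTop k ?_
  refine tendsto_const_nhds.congr' ?_
  filter_upwards [eventually_gt_atTop 0] with m hm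
  rw [mul_inv_cancel₀]; positivity

end

noncomputable section
open NormedSpace (exp)


lemma oneparam {n : ℕ} (f : ℝ → Mat n) (hc : Continuous f) (h0 : f 0 = 1) (hadd : ∀ s t, f (s + t) = f s * f t) :
    ∃ X : Mat n, ∀ t, f t = exp (t • X) := by
  letI : NormedRing (Mat n) := Matrix.linftyOpNormedRing
  letI : NormedAlgebra ℝ (Mat n) := Matrix.linftyOpNormedAlgebra
  exact oneparam_ring f hc h0 hadd

lemma rel_HX' {n : ℕ} {H X : Mat n} {c : ℝ}
    (h : ∀ s x : ℝ, exp (s • H) * exp (x • X) = exp ((Real.exp (c * s) * x) • X) * exp (s • H)) : H * X = X * H + c • X := by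
  letI : NormedRing (Mat n) := Matrix.linftyOpNormedRing
  letI : NormedAlgebra ℝ (Mat n) := Matrix.linftyOpNormedAlgebra
  exact rel_HX h

lemma rel_XY' {n : ℕ} {H X Y : Mat n}
    (h : ∀ x y : ℝ, 0 < 1 + x * y → exp (x • X) * exp (y • Y) =
      exp ((y / (1 + x * y)) • Y) * exp (Real.log (1 + x * y) • H) * exp ((x / (1 + x * y)) • X)) : X * Y = Y * X + H := by
  letI : NormedRing (Mat n) := Matrix.linftyOpNormedRing
  letI : NormedAlgebra ℝ (Mat n) := Matrix.linftyOpNormedAlgebra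
  exact rel_XY h

lemma exp_nilp' {n : ℕ} {X : Mat n} (h : X ^ n = 0) (x : ℝ) : exp (x • X) = ∑ k ∈ Finset.range n, (x ^ k / k.factorial) • X ^ k := by
  letI : NormedRing (Mat n) := Matrix.linftyOpNormedRing
  letI : NormedAlgebra ℝ (Mat n) := Matrix.linftyOpNormedAlgebra
  exact exp_nilp h x

lemma exp_nilp_tendsto' {n : ℕ} {X : Mat n} (h : X ^ n = 0) :
    Tendsto (fun m : ℕ => (1 + ((m:ℝ)⁻¹) • X) ^ m) atTop (𝓝 (exp X)) := by
  letI : NormedRing (Mat n) := Matrix.linftyOpNormedRing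
  letI : NormedAlgebra ℝ (Mat n) := Matrix.linftyOpNormedAlgebra
  exact exp_nilp_tendsto h
end
end Hit

namespace Hit
open Filter Topology

/-! ## Module C2 : structure of irreducible sl2-modules -/

/-- single superdiagonal matrix -/
def shift {n : ℕ} (c : ℕ → ℝ) : Mat n := fun i j => if (j : ℕ) = i + 1 then c i else 0

lemma isNilp_pow {n : ℕ} {X : Mat n} (h : IsNilpotent X) : X ^ n = 0 := by
  have h1 : IsNilpotent (Matrix.toLin' X) := h.map (Matrix.toLinAlgEquiv' (R := ℝ) (n := Fin n))
  have h2 := (LinearMap.charpoly_eq_X_pow_iff (Matrix.toLin' X)).2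
    (fun m => by
      obtain ⟨k, hk⟩ := h1
      exact ⟨k, by rw [hk]; rfl⟩)
  rw [← LinearMap.charpoly_toMatrix (Matrix.toLin' X) (Pi.basisFun ℝ (Fin n)), Module.finrank_fin_fun, LinearMap.toMatrix_eq_toMatrix', LinearMap.toMatrix'_toLin'] at h2
  have h3 := Matrix.aeval_self_charpoly X
  rw [h2] at h3
  simpa using h3

lemma nilp_of_comm {n : ℕ} {H X : Mat n} {c : ℝ} (hc : c ≠ 0) (h : H * X = X * H + c • X) : X ^ n = 0 := by
  apply isNilp_pow
  by_contra hX
  have hX' : ∀ k, X ^ k ≠ 0 := fun k hk => hX ⟨k, hk⟩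
  have hk : ∀ k : ℕ, H * X ^ k = X ^ k * H + ((k : ℝ) * c) • X ^ k := by
    intro k
    induction k with
    | zero => simp
    | succ k ih =>
      rw [pow_succ, ← mul_assoc, ih, add_mul, mul_assoc _ H X, h, mul_add, mul_smul_comm, smul_mul_assoc, mul_assoc]
      push_cast
      module
  let T : Module.End ℝ (Mat n) := LinearMap.mulLeft ℝ H - LinearMap.mulRight ℝ H
  have hT : ∀ k : ℕ, T.HasEigenvector ((k : ℝ) * c) (X ^ k) := by
    intro k
    rw [Module.End.hasEigenvector_iff]
    refine ⟨Module.End.mem_eigenspace_iff.2 ?_, hX' k⟩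
    simp [T, hk k]
  have hli := Module.End.eigenvectors_linearIndependent' T (fun k : ℕ => (k : ℝ) * c)
    (fun a b hab => by exact_mod_cast mul_right_cancel₀ hc hab) (fun k => X ^ k) hT
  have := hli.finite
  exact not_finite ℕ

section
variable {n : ℕ} {X Y H : Mat n}

lemma sl2_XYk (hHY : H * Y = Y * H + (-2 : ℝ) • Y) (hXY : X * Y = Y * X + H) (k : ℕ) :
    X * Y ^ (k + 1) = Y ^ (k + 1) * X + ((k : ℝ) + 1) • (Y ^ k * (H - (k : ℝ) • 1)) := by
  induction k with
  | zero => simpa using hXY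
  | succ k ih =>
    have e1 : (H - (k : ℝ) • 1) * Y = Y * (H - ((k : ℝ) + 2) • 1) := by
      rw [sub_mul, hHY, mul_sub, smul_mul_assoc, one_mul, mul_smul_comm, mul_one]
      module
    rw [pow_succ Y (k + 1), ← mul_assoc, ih, add_mul, mul_assoc _ X Y, hXY, smul_mul_assoc, mul_assoc (Y ^ k), e1,
      ← mul_assoc (Y ^ k) Y, ← pow_succ Y k]
    simp only [mul_add, mul_sub, mul_smul_comm, mul_one, ← mul_assoc]
    push_cast
    module

lemma sl2_HYk (hHY : H * Y = Y * H + (-2 : ℝ) • Y) (k : ℕ) : H * Y ^ k = Y ^ k * H + (-2 * (k : ℝ)) • Y ^ k := by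
  induction k with
  | zero => simp
  | succ k ih =>
    rw [pow_succ, ← mul_assoc, ih, add_mul, mul_assoc _ H Y, hHY, mul_add, mul_smul_comm, smul_mul_assoc, mul_assoc]
    push_cast
    module

lemma sl2_exists (hn : 0 < n) (hHX : H * X = X * H + (2 : ℝ) • X) (hHY : H * Y = Y * H + (-2 : ℝ) • Y)
    (hXY : X * Y = Y * X + H) : ∃ (v : Fin n → ℝ) (m : ℝ), v ≠ 0 ∧ X *ᵥ v = 0 ∧ H *ᵥ v = m • v := by
  have hX := nilp_of_comm (by norm_num) hHX
  have key : ∀ k : ℕ, ∀ v : Fin n → ℝ, v ≠ 0 → X *ᵥ v = 0 → (X ^ k * Y ^ k) *ᵥ v = 0 →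
      ∃ (v : Fin n → ℝ) (m : ℝ), v ≠ 0 ∧ X *ᵥ v = 0 ∧ H *ᵥ v = m • v := by
    intro k
    induction k with
    | zero => intro v hv _ h; simp at h; exact absurd h hv
    | succ k ih =>
      intro v hv hXv h
      by_cases hw : (H - (k : ℝ) • 1) *ᵥ v = 0
      · refine ⟨v, k, hv, hXv, ?_⟩
        rw [Matrix.sub_mulVec, Matrix.smul_mulVec, Matrix.one_mulVec] at hw
        exact sub_eq_zero.1 hw
      · refine ih _ hw ?_ ?_
        · have : X * (H - (k : ℝ) • 1) = (H - ((k : ℝ) + 2) • 1) * X := by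
            rw [mul_sub, sub_mul, hHX, mul_smul_comm, mul_one, smul_mul_assoc, one_mul]; module
          rw [Matrix.mulVec_mulVec, this, ← Matrix.mulVec_mulVec, hXv, Matrix.mulVec_zero]
        · rw [pow_succ X, mul_assoc, sl2_XYk hHY hXY, mul_add, Matrix.add_mulVec, ← mul_assoc, ← Matrix.mulVec_mulVec, hXv,
            Matrix.mulVec_zero, zero_add, mul_smul_comm, Matrix.smul_mulVec] at h
          have h2 := (smul_eq_zero.1 h).resolve_left (by positivity)
          rwa [Matrix.mulVec_mulVec, mul_assoc]
  have hdet : X.det = 0 := by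
    have hne : Nonempty (Fin n) := ⟨⟨0, hn⟩⟩
    have := congrArg Matrix.det hX
    rw [Matrix.det_pow, Matrix.det_zero] at this
    exact pow_eq_zero_iff (by omega) |>.1 this
  obtain ⟨v, hv, hXv⟩ := Matrix.exists_mulVec_eq_zero_iff.2 hdet
  exact key n v hv hXv (by rw [hX, zero_mul, Matrix.zero_mulVec])

lemma sl2_basis (hn : 0 < n) (hHX : H * X = X * H + (2 : ℝ) • X) (hHY : H * Y = Y * H + (-2 : ℝ) • Y)
    (hXY : X * Y = Y * X + H)
    (irr : ∀ W : Submodule ℝ (Fin n → ℝ), (∀ v ∈ W, X *ᵥ v ∈ W) → (∀ v ∈ W, Y *ᵥ v ∈ W) → W = ⊥ ∨ W = ⊤) :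
    ∃ P : Mat n, P.det ≠ 0 ∧ X * P = P * shift (fun i => (n : ℝ) - 1 - i) ∧ Y * P = P * (shift (fun i => (i : ℝ) + 1))ᵀ ∧
      H * P = P * Matrix.diagonal (fun k : Fin n => (n : ℝ) - 1 - 2 * (k : ℝ)) := by
  obtain ⟨v, m, hv, hXv, hHv⟩ := sl2_exists hn hHX hHY hXY
  have hYn : Y ^ n = 0 := nilp_of_comm (by norm_num) hHY
  have hY : ∀ k, Y *ᵥ (Y ^ k *ᵥ v) = Y ^ (k + 1) *ᵥ v := fun k => by rw [Matrix.mulVec_mulVec, ← pow_succ']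
  have hHk : ∀ k : ℕ, H *ᵥ (Y ^ k *ᵥ v) = (m - 2 * (k : ℝ)) • (Y ^ k *ᵥ v) := by
    intro k
    rw [Matrix.mulVec_mulVec, sl2_HYk hHY, Matrix.add_mulVec, Matrix.smul_mulVec, ← Matrix.mulVec_mulVec, hHv, Matrix.mulVec_smul]
    module
  have hXk : ∀ k : ℕ, X *ᵥ (Y ^ (k + 1) *ᵥ v) = (((k : ℝ) + 1) * (m - (k : ℝ))) • (Y ^ k *ᵥ v) := by
    intro k
    rw [Matrix.mulVec_mulVec, sl2_XYk hHY hXY, Matrix.add_mulVec, ← Matrix.mulVec_mulVec, hXv, Matrix.mulVec_zero, zero_add,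
      Matrix.smul_mulVec, ← Matrix.mulVec_mulVec, Matrix.sub_mulVec, hHv, Matrix.smul_mulVec, Matrix.one_mulVec, ← sub_smul,
      Matrix.mulVec_smul, smul_smul]
  let W := Submodule.span ℝ (Set.range fun k : Fin n => Y ^ (k : ℕ) *ᵥ v)
  have hmem : ∀ k : ℕ, Y ^ k *ᵥ v ∈ W := by
    intro k
    by_cases hk : k < n
    · exact Submodule.subset_span ⟨⟨k, hk⟩, rfl⟩
    · rw [pow_eq_zero_of_le (not_lt.1 hk) hYn, Matrix.zero_mulVec]; exact W.zero_mem
  have hinv : ∀ Z : Mat n, (∀ k : ℕ, Z *ᵥ (Y ^ k *ᵥ v) ∈ W) → ∀ w ∈ W, Z *ᵥ w ∈ W := by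
    intro Z hZ w hw
    induction hw using Submodule.span_induction with
    | mem x hx => obtain ⟨k, rfl⟩ := hx; exact hZ k
    | zero => rw [Matrix.mulVec_zero]; exact W.zero_mem
    | add x y _ _ hx hy => rw [Matrix.mulVec_add]; exact W.add_mem hx hy
    | smul a x _ hx => rw [Matrix.mulVec_smul]; exact W.smul_mem a hx
  have hWtop : W = ⊤ := by
    refine (irr W (hinv X ?_) (hinv Y ?_)).resolve_left ?_
    · intro k
      cases k with
      | zero => rw [pow_zero, Matrix.one_mulVec, hXv]; exact W.zero_mem
      | succ k => rw [hXk]; exact W.smul_mem _ (hmem k)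
    · intro k; rw [hY]; exact hmem _
    · intro h
      have := hmem 0
      rw [h, Submodule.mem_bot, pow_zero, Matrix.one_mulVec] at this
      exact hv this
  have hli : LinearIndependent ℝ (fun k : Fin n => Y ^ (k : ℕ) *ᵥ v) :=
    linearIndependent_of_top_le_span_of_card_eq_finrank hWtop.ge (by simp)
  have hm : m = (n : ℝ) - 1 := by
    obtain ⟨k, rfl⟩ : ∃ k, n = k + 1 := ⟨n - 1, by omega⟩
    have h1 := hXk k
    rw [hYn, Matrix.zero_mulVec, Matrix.mulVec_zero] at h1
    have h2 := hli.ne_zero ⟨k, by omega⟩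
    have h3 := (smul_eq_zero.1 h1.symm).resolve_right h2
    have h4 := (mul_eq_zero.1 h3).resolve_left (by positivity)
    push_cast; linarith
  have hf : ∀ k : ℕ, ((k.factorial : ℝ)⁻¹) ≠ 0 := fun k => inv_ne_zero (by exact_mod_cast k.factorial_ne_zero)
  let p : ℕ → Fin n → ℝ := fun k => ((k.factorial : ℝ)⁻¹) • (Y ^ k *ᵥ v)
  let P : Mat n := fun i k => p k i
  have hP : ∀ (Z : Mat n) (i k : Fin n), (Z * P) i k = (Z *ᵥ p k) i := fun Z i k => rfl
  refine ⟨P, ?_, ?_, ?_, ?_⟩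
  · have h1 : LinearIndependent ℝ (fun k : Fin n => p k) := by
      have := hli.units_smul (fun k : Fin n => Units.mk0 _ (hf k))
      exact this
    have h2 : IsUnit P := Matrix.linearIndependent_cols_iff_isUnit.1 h1
    exact ((Matrix.isUnit_iff_isUnit_det P).1 h2).ne_zero
  · ext i k
    rw [hP]
    obtain ⟨k, hk⟩ := k
    cases k with
    | zero =>
      rw [Matrix.mul_apply, Finset.sum_eq_zero]
      · simp [p, hXv]
      · intro j _; simp [shift]
    | succ k =>
      rw [Matrix.mul_apply, Finset.sum_eq_single ⟨k, by omega⟩]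
      · simp only [p, shift, Matrix.mulVec_smul, hXk, hm, P, Nat.factorial_succ, if_true, Pi.smul_apply, smul_eq_mul]
        have := hf k
        push_cast
        field_simp
      · intro j _ hj
        have : ¬ (k = (j : ℕ)) := fun h => hj (Fin.ext (by simp; omega))
        simp [shift, this]
      · simp
  · ext i k
    rw [hP, Matrix.mul_apply]
    by_cases hk : (k : ℕ) + 1 < n
    · rw [Finset.sum_eq_single ⟨k + 1, hk⟩]
      · simp only [p, shift, Matrix.mulVec_smul, hY, P, Nat.factorial_succ, if_true, Pi.smul_apply, smul_eq_mul, Matrix.transpose_apply]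
        have := hf k
        push_cast
        field_simp
      · intro j _ hj
        have : ¬ ((j : ℕ) = (k : ℕ) + 1) := fun h => hj (Fin.ext h)
        simp [shift, this]
      · simp
    · have : (k : ℕ) + 1 = n := by omega
      rw [Finset.sum_eq_zero]
      · simp only [p, Matrix.mulVec_smul, hY, this, hYn]; simp
      · intro j _
        have : ¬ ((j : ℕ) = (k : ℕ) + 1) := by omega
        simp [shift, this]
  · ext i k
    rw [hP, Matrix.mul_diagonal]
    simp only [p, Matrix.mulVec_smul, hHk, hm, P, Pi.smul_apply, smul_eq_mul]
    ring
end
end Hit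

namespace Hit
open Filter Topology

/-! ## Module C3 : normal form of irreducible representations of SL2 -/

def U2 (x : ℝ) : SL 2 ℝ := ⟨!![1, x; 0, 1], by simp [Matrix.det_fin_two]⟩
def L2 (y : ℝ) : SL 2 ℝ := ⟨!![1, 0; y, 1], by simp [Matrix.det_fin_two]⟩
noncomputable def D2 (s : ℝ) : SL 2 ℝ := ⟨!![Real.exp s, 0; 0, Real.exp (-s)], by simp [Matrix.det_fin_two, ← Real.exp_add]⟩
def W2 : SL 2 ℝ := ⟨!![0, -1; 1, 0], by simp [Matrix.det_fin_two]⟩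

lemma sl2_ext {A B : SL 2 ℝ} (h00 : A 0 0 = B 0 0) (h01 : A 0 1 = B 0 1) (h10 : A 1 0 = B 1 0) (h11 : A 1 1 = B 1 1) : A = B := by
  ext i j
  fin_cases i <;> fin_cases j <;> assumption

@[simp] lemma U2_00 (x : ℝ) : U2 x 0 0 = 1 := rfl
@[simp] lemma U2_01 (x : ℝ) : U2 x 0 1 = x := rfl
@[simp] lemma U2_10 (x : ℝ) : U2 x 1 0 = 0 := rfl
@[simp] lemma U2_11 (x : ℝ) : U2 x 1 1 = 1 := rfl
@[simp] lemma L2_00 (x : ℝ) : L2 x 0 0 = 1 := rfl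
@[simp] lemma L2_01 (x : ℝ) : L2 x 0 1 = 0 := rfl
@[simp] lemma L2_10 (x : ℝ) : L2 x 1 0 = x := rfl
@[simp] lemma L2_11 (x : ℝ) : L2 x 1 1 = 1 := rfl
@[simp] lemma D2_00 (x : ℝ) : D2 x 0 0 = Real.exp x := rfl
@[simp] lemma D2_01 (x : ℝ) : D2 x 0 1 = 0 := rfl
@[simp] lemma D2_10 (x : ℝ) : D2 x 1 0 = 0 := rfl
@[simp] lemma D2_11 (x : ℝ) : D2 x 1 1 = Real.exp (-x) := rfl
@[simp] lemma W2_00 : W2 0 0 = 0 := rfl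
@[simp] lemma W2_01 : W2 0 1 = -1 := rfl
@[simp] lemma W2_10 : W2 1 0 = 1 := rfl
@[simp] lemma W2_11 : W2 1 1 = 0 := rfl

lemma mul2 (A B : SL 2 ℝ) (i j : Fin 2) : (A * B) i j = A i 0 * B 0 j + A i 1 * B 1 j := by
  show ((A : Matrix (Fin 2) (Fin 2) ℝ) * (B : Matrix (Fin 2) (Fin 2) ℝ)) i j = _
  rw [Matrix.mul_apply, Fin.sum_univ_two]

lemma det2 (A : SL 2 ℝ) : A 0 0 * A 1 1 - A 0 1 * A 1 0 = 1 := by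
  have := A.det_coe
  rwa [Matrix.det_fin_two] at this

lemma neg2 (A : SL 2 ℝ) (i j : Fin 2) : (-A) i j = - A i j := rfl
lemma one2_00 : (1 : SL 2 ℝ) 0 0 = 1 := rfl
lemma one2_01 : (1 : SL 2 ℝ) 0 1 = 0 := rfl
lemma one2_10 : (1 : SL 2 ℝ) 1 0 = 0 := rfl
lemma one2_11 : (1 : SL 2 ℝ) 1 1 = 1 := rfl

lemma U2_add (x y : ℝ) : U2 (x + y) = U2 x * U2 y := by
  apply sl2_ext <;> simp [mul2]; ring
lemma L2_add (x y : ℝ) : L2 (x + y) = L2 x * L2 y := by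
  apply sl2_ext <;> simp [mul2]
lemma D2_add (x y : ℝ) : D2 (x + y) = D2 x * D2 y := by
  apply sl2_ext <;> simp [mul2, Real.exp_add]; ring
lemma U2_zero : U2 0 = 1 := sl2_ext rfl rfl rfl rfl
lemma L2_zero : L2 0 = 1 := sl2_ext rfl rfl rfl rfl
lemma D2_zero : D2 0 = 1 := by apply sl2_ext <;> simp [one2_00, one2_01, one2_10, one2_11]

lemma D2_U2 (s x : ℝ) : D2 s * U2 x = U2 (Real.exp (2 * s) * x) * D2 s := by
  apply sl2_ext <;> simp [mul2]
  rw [mul_right_comm, ← Real.exp_add]; congr 2; ring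
lemma D2_L2 (s x : ℝ) : D2 s * L2 x = L2 (Real.exp (-2 * s) * x) * D2 s := by
  apply sl2_ext <;> simp [mul2]
  rw [mul_right_comm, ← Real.exp_add]; congr 2; ring
lemma U2_L2 (x y : ℝ) (h : 0 < 1 + x * y) : U2 x * L2 y = L2 (y / (1 + x * y)) * D2 (Real.log (1 + x * y)) * U2 (x / (1 + x * y)) := by
  have h' := h.ne'
  have h'' : 1 + y * x ≠ 0 := by rw [mul_comm y x]; exact h'
  apply sl2_ext <;> simp [mul2, Real.exp_log h, Real.exp_neg]
  · field_simp
  · field_simp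
  · field_simp; ring

lemma U2_cont : Continuous U2 := by
  refine continuous_induced_rng.2 (continuous_matrix fun i j => ?_)
  fin_cases i <;> fin_cases j <;> simp [U2] <;> fun_prop
lemma L2_cont : Continuous L2 := by
  refine continuous_induced_rng.2 (continuous_matrix fun i j => ?_)
  fin_cases i <;> fin_cases j <;> simp [L2] <;> fun_prop
lemma D2_cont : Continuous D2 := by
  refine continuous_induced_rng.2 (continuous_matrix fun i j => ?_)
  fin_cases i <;> fin_cases j <;> simp [D2] <;> fun_prop

/-- generation of SL2 -/
lemma sl2_gen {p : SL 2 ℝ → Prop} (hm : ∀ A B, p A → p B → p (A * B)) (hU : ∀ x, p (U2 x)) (hL : ∀ x, p (L2 x)) (A : SL 2 ℝ) : p A := by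
  have h1 : ∀ A : SL 2 ℝ, A 1 0 ≠ 0 → p A := by
    intro A hc
    have : A = U2 ((A 0 0 - 1) / A 1 0) * L2 (A 1 0) * U2 ((A 1 1 - 1) / A 1 0) := by
      have := det2 A
      apply sl2_ext <;> simp [mul2]
      · field_simp; ring
      · field_simp; linear_combination - this
      · field_simp; ring
    rw [this]
    exact hm _ _ (hm _ _ (hU _) (hL _)) (hU _)
  by_cases hc : A 1 0 = 0
  · have hd : A 1 1 ≠ 0 := by
      intro h; have := det2 A; rw [hc, h] at this; simp at this
    have : A = (A * L2 1) * L2 (-1) := by rw [mul_assoc, ← L2_add]; simp [L2_zero]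
    rw [this]
    exact hm _ _ (h1 _ (by simpa [mul2, hc] using hd)) (hL _)
  · exact h1 A hc

end Hit

namespace Hit
open Filter Topology
noncomputable section
open NormedSpace (exp)

/-! ## Module C4 : exponentials of the standard nilpotents, the standard frame -/

lemma shift_pow {n : ℕ} (c : ℕ → ℝ) : (shift c : Mat n) ^ n = 0 := by
  refine nilp_of_comm (H := Matrix.diagonal fun i : Fin n => -(i : ℝ)) (c := 1) one_ne_zero ?_
  ext i j
  rw [Matrix.add_apply, Matrix.diagonal_mul, Matrix.mul_diagonal, Matrix.smul_apply]
  unfold shift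
  split_ifs with h
  · rw [h]; push_cast; simp; ring
  · simp

lemma superdiag_mul {n : ℕ} {u v : Mat n} (hu : UU u) (hv : UU v) (i j : Fin n) (h : (j : ℕ) = i + 1) :
    (u * v) i j = u i j + v i j := by
  have hne : i ≠ j := fun e => by rw [e] at h; omega
  rw [Matrix.mul_apply, Finset.sum_eq_add i j hne]
  · rw [hu.2, hv.2]; ring
  · intro k _ hk
    rcases lt_or_ge k i with h1 | h1
    · rw [hu.1 i k h1, zero_mul]
    · have : j < k := by
        have h2 : (i : ℕ) ≤ k := h1
        have h3 : (k : ℕ) ≠ i := fun e => hk.1 (Fin.ext e)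
        have h4 : (k : ℕ) ≠ j := fun e => hk.2 (Fin.ext e)
        show (j : ℕ) < k
        omega
      rw [hv.1 k j this, mul_zero]
  · simp
  · simp

lemma superdiag_pow {n : ℕ} {u : Mat n} (hu : UU u) (i j : Fin n) (h : (j : ℕ) = i + 1) (m : ℕ) :
    (u ^ m) i j = m * u i j := by
  have hne : i ≠ j := fun e => by rw [e] at h; omega
  induction m with
  | zero => simp [hne]
  | succ m ih => rw [pow_succ, superdiag_mul (hu.pow m) hu i j h, ih]; push_cast; ring

lemma exp_shift_tendsto {n : ℕ} (c : ℕ → ℝ) :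
    Tendsto (fun m : ℕ => (bidiag (fun i => (m : ℝ)⁻¹ * c i) : Mat n) ^ m) atTop (𝓝 (exp (shift c : Mat n))) := by
  have h := exp_nilp_tendsto' (shift_pow (n := n) c)
  refine h.congr fun m => ?_
  congr 1
  ext i j
  rw [Matrix.add_apply, Matrix.smul_apply]
  unfold shift bidiag
  by_cases h : i = j
  · subst h; simp
  · simp [h, Matrix.one_apply_ne h]

lemma exp_shift_props {n : ℕ} (c : ℕ → ℝ) (hc : ∀ i, 0 ≤ c i) :
    UU (exp (shift c : Mat n)) ∧ TNN (exp (shift c : Mat n)) ∧ ∀ i j : Fin n, (j : ℕ) = i + 1 → exp (shift c : Mat n) i j = c i := by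
  have ht := exp_shift_tendsto (n := n) c
  have hte : ∀ i j, Tendsto (fun m : ℕ => ((bidiag (fun i => (m : ℝ)⁻¹ * c i) : Mat n) ^ m) i j) atTop (𝓝 (exp (shift c : Mat n) i j)) :=
    fun i j => (tendsto_mat.1 ht) i j
  have hu : ∀ m : ℕ, UU ((bidiag (fun i => (m : ℝ)⁻¹ * c i) : Mat n) ^ m) := fun m => (bidiag_uu _).pow m
  refine ⟨⟨fun i j h => ?_, fun i => ?_⟩, ?_, ?_⟩
  · refine tendsto_nhds_unique (hte i j) (tendsto_const_nhds.congr fun m => ?_)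
    exact ((hu m).1 i j h).symm
  · refine tendsto_nhds_unique (hte i i) (tendsto_const_nhds.congr fun m => ?_)
    exact ((hu m).2 i).symm
  · refine isClosed_TNN.mem_of_tendsto ht (Eventually.of_forall fun m => ?_)
    have hb : TNN (bidiag (fun i => (m : ℝ)⁻¹ * c i) : Mat n) := bidiag_tnn _ fun i => mul_nonneg (by positivity) (hc i)
    have : ∀ k : ℕ, TNN ((bidiag (fun i => (m : ℝ)⁻¹ * c i) : Mat n) ^ k) := by
      intro k
      induction k with
      | zero => rw [pow_zero]; exact TNN.one
      | succ k ih => rw [pow_succ]; exact ih.mul hb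
    exact this m
  · intro i j h
    refine tendsto_nhds_unique (hte i j) (tendsto_const_nhds.congr' ?_)
    filter_upwards [eventually_gt_atTop 0] with m hm
    have e := superdiag_pow (bidiag_uu (n := n) fun i => (m : ℝ)⁻¹ * c i) i j h m
    rw [e]
    have hne : i ≠ j := fun e => by rw [e] at h; omega
    have hm' : (m : ℝ) ≠ 0 := by positivity
    simp [bidiag, hne, h, hm']

lemma exp_shift_SP {n : ℕ} (c : ℕ → ℝ) (hc : ∀ i, i + 1 < n → 0 < c i) (x : ℝ) (hx : 0 < x) : SP (exp (x • (shift c : Mat n))) := by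
  by_cases hn : n = 0
  · subst hn
    refine ⟨⟨fun i => i.elim0, fun i => i.elim0⟩, fun k f g hf hg hfg => ?_⟩
    cases k with
    | zero => simp [mnr]
    | succ k => exact (f 0).elim0
  have hn' : 0 < (n * n : ℝ) := by positivity
  let c' : ℕ → ℝ := fun i => if i + 1 < n then x / (n * n) * c i else 0
  have e : x • (shift c : Mat n) = (n * n) • (shift c' : Mat n) := by
    ext i j
    rw [Matrix.smul_apply, Matrix.smul_apply]
    unfold shift
    split_ifs with h
    · have : (i : ℕ) + 1 < n := by omega
      simp only [c', this, if_true, nsmul_eq_mul, smul_eq_mul]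
      push_cast
      field_simp
    · simp
  rw [e, Matrix.exp_nsmul]
  obtain ⟨h1, h2, h3⟩ := exp_shift_props (n := n) c' (fun i => by
    dsimp only [c']; split_ifs with h
    · exact mul_nonneg (by positivity) (hc i h).le
    · exact le_rfl)
  refine SP_of_pow h1 h2 fun i j h => ?_
  rw [h3 i j h]
  have : (i : ℕ) + 1 < n := by omega
  simp only [c', this, if_true]
  exact mul_pos (by positivity) (hc i this)

lemma exp_conj' {n : ℕ} {P A A' : Mat n} (hP : P.det ≠ 0) (h : A * P = P * A') (x : ℝ) : exp (x • A) * P = P * exp (x • A') := by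
  have hu : IsUnit P := (Matrix.isUnit_iff_isUnit_det P).2 (isUnit_iff_ne_zero.2 hP)
  have e : x • A = P * (x • A') * P⁻¹ := by
    rw [mul_smul_comm, smul_mul_assoc, ← h, mul_assoc, mul_inv_cancel' hP, mul_one]
  rw [e, Matrix.exp_conj _ _ hu, mul_assoc, inv_mul_cancel' hP, mul_one]

def cU (n : ℕ) : ℕ → ℝ := fun i => (n : ℝ) - 1 - i
def cL : ℕ → ℝ := fun i => (i : ℝ) + 1

/-- standard frame for a representation of SL2 -/
structure Frame {n : ℕ} (j : SL 2 ℝ →* SL n ℝ) (h : Mat n) : Prop where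
  hdet : h.det ≠ 0
  hU : ∀ x, (j (U2 x) : Mat n) * h = h * exp (x • (shift (cU n) : Mat n))
  hL : ∀ y, (j (L2 y) : Mat n) * h = h * exp (y • (shift cL : Mat n)ᵀ)
  hD : ∀ s, (j (D2 s) : Mat n) * h = h * Matrix.diagonal (fun k : Fin n => Real.exp (s * ((n : ℝ) - 1 - 2 * (k : ℝ))))

lemma exists_frame {n : ℕ} (hn : 0 < n) {j : SL 2 ℝ →* SL n ℝ} (hj : IsIrreducibleEmbedding n j) : ∃ h, Frame j h := by
  obtain ⟨hc, hirr⟩ := hj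
  have hco : Continuous fun A : SL 2 ℝ => (j A : Mat n) := continuous_induced_dom.comp hc
  have hmul : ∀ A B, (j (A * B) : Mat n) = (j A : Mat n) * (j B : Mat n) := fun A B => by rw [map_mul]; rfl
  have hone : (j 1 : Mat n) = 1 := by rw [map_one]; rfl
  obtain ⟨X, hX⟩ := oneparam (fun t => (j (U2 t) : Mat n)) (hco.comp U2_cont) (by rw [U2_zero, hone]) (fun s t => by rw [U2_add, hmul])
  obtain ⟨Y, hY⟩ := oneparam (fun t => (j (L2 t) : Mat n)) (hco.comp L2_cont) (by rw [L2_zero, hone]) (fun s t => by rw [L2_add, hmul])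
  obtain ⟨H, hH⟩ := oneparam (fun t => (j (D2 t) : Mat n)) (hco.comp D2_cont) (by rw [D2_zero, hone]) (fun s t => by rw [D2_add, hmul])
  have r1 : H * X = X * H + (2 : ℝ) • X := by
    apply rel_HX'
    intro s x
    rw [← hX, ← hX, ← hH, ← hmul, ← hmul, D2_U2]
  have r2 : H * Y = Y * H + (-2 : ℝ) • Y := by
    apply rel_HX'
    intro s x
    rw [← hY, ← hY, ← hH, ← hmul, ← hmul, D2_L2]
  have r3 : X * Y = Y * X + H := by
    apply rel_XY'
    intro x y h
    rw [← hX, ← hX, ← hY, ← hY, ← hH, ← hmul, ← hmul, ← hmul, U2_L2 x y h]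
  have hXn : X ^ n = 0 := nilp_of_comm (by norm_num) r1
  have hYn : Y ^ n = 0 := nilp_of_comm (by norm_num) r2
  have hinv : ∀ (Z : Mat n) (hZ : Z ^ n = 0) (W : Submodule ℝ (Fin n → ℝ)), (∀ v ∈ W, Z *ᵥ v ∈ W) → ∀ (x : ℝ), ∀ v ∈ W, exp (x • Z) *ᵥ v ∈ W := by
    intro Z hZ W hW x v hv
    rw [exp_nilp' hZ, Matrix.sum_mulVec]
    refine W.sum_mem fun k hk => ?_
    clear hk
    rw [Matrix.smul_mulVec]
    refine W.smul_mem _ ?_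
    induction k with
    | zero => simpa using hv
    | succ k ih => rw [pow_succ', ← Matrix.mulVec_mulVec]; exact hW _ ih
  obtain ⟨P, hP, p1, p2, p3⟩ := sl2_basis hn r1 r2 r3 (fun W hWX hWY => by
    apply hirr
    intro A
    refine sl2_gen (p := fun A => ∀ v ∈ W, (j A : Mat n) *ᵥ v ∈ W) ?_ ?_ ?_ A
    · intro A B hA hB v hv
      rw [hmul, ← Matrix.mulVec_mulVec]
      exact hA _ (hB _ hv)
    · intro x v hv
      have := hX x
      rw [this]; exact hinv X hXn W hWX x v hv
    · intro x v hv
      have := hY x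
      rw [this]; exact hinv Y hYn W hWY x v hv)
  refine ⟨P, hP, fun x => ?_, fun x => ?_, fun s => ?_⟩
  · have := hX x
    rw [this]; exact exp_conj' hP p1 x
  · have := hY x
    rw [this]; exact exp_conj' hP p2 x
  · have := hH s
    rw [this, exp_conj' hP p3 s]
    congr 1
    rw [← Matrix.diagonal_smul, Matrix.exp_diagonal]
    congr 1
    funext k
    rw [Pi.coe_exp]
    simp [Real.exp_eq_exp_ℝ]
end
end Hit

namespace Hit
open Filter Topology
noncomputable section
open NormedSpace (exp)

/-! ## Module C5 : Teichmueller representations are positive -/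

structure Compat {Γ : Type} [Group Γ] (D : Dat Γ) (r : Γ →* SL 2 ℝ) : Prop where
  g0 : ∃ t : ℝ, 0 < t ∧ r D.γ0 = D2 t
  fl : ∀ γ, (γ, false) ∈ D.X → r γ 1 1 ≠ 0 ∧ D.pos (γ, false) = r γ 0 1 / r γ 1 1
  tr : ∀ γ, (γ, true) ∈ D.X → r γ 1 0 ≠ 0 ∧ D.pos (γ, true) = r γ 0 0 / r γ 1 0
  bd : 0 < r D.B 1 1
  bc : 0 < r D.B 1 0

section
variable {n : ℕ} {j : SL 2 ℝ →* SL n ℝ} {h : Mat n}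

def KK (j : SL 2 ℝ →* SL n ℝ) (h : Mat n) (A : SL 2 ℝ) : Mat n := h⁻¹ * (j A : Mat n) * h

lemma Frame.mul (f : Frame j h) (A B : SL 2 ℝ) : KK j h (A * B) = KK j h A * KK j h B := by
  unfold KK
  have : (j (A * B) : Mat n) = (j A : Mat n) * (j B : Mat n) := by rw [map_mul]; rfl
  rw [this]
  simp only [mul_assoc]
  rw [← mul_assoc h h⁻¹, mul_inv_cancel' f.hdet, one_mul]

lemma Frame.of (f : Frame j h) {A : SL 2 ℝ} {M : Mat n} (e : (j A : Mat n) * h = h * M) : KK j h A = M := by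
  unfold KK
  rw [mul_assoc, e, ← mul_assoc, inv_mul_cancel' f.hdet, one_mul]

lemma Frame.to (f : Frame j h) (A : SL 2 ℝ) : (j A : Mat n) * h = h * KK j h A := by
  unfold KK
  rw [← mul_assoc, ← mul_assoc, mul_inv_cancel' f.hdet, one_mul]

def dw (n : ℕ) (s : ℝ) : Fin n → ℝ := fun k => Real.exp (s * ((n : ℝ) - 1 - 2 * (k : ℝ)))

lemma Frame.kU (f : Frame j h) (x : ℝ) : KK j h (U2 x) = exp (x • (shift (cU n) : Mat n)) := f.of (f.hU x)
lemma Frame.kL (f : Frame j h) (x : ℝ) : KK j h (L2 x) = exp (x • (shift cL : Mat n)ᵀ) := f.of (f.hL x)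
lemma Frame.kD (f : Frame j h) (x : ℝ) : KK j h (D2 x) = Matrix.diagonal (dw n x) := f.of (f.hD x)

lemma cU_pos : ∀ i, i + 1 < n → 0 < cU n i := by
  intro i hi
  unfold cU
  have : ((i + 1 : ℕ) : ℝ) < n := by exact_mod_cast hi
  push_cast at this; linarith
lemma cL_pos : ∀ i, i + 1 < n → 0 < cL i := by intro i hi; unfold cL; positivity

lemma dw_inj {a b : Fin n} (e : dw n 1 a = dw n 1 b) : a = b := by
  have := Real.exp_injective e
  have h2 : (a : ℝ) = b := by linarith
  exact Fin.ext (by exact_mod_cast h2)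

lemma uu_expU (x : ℝ) : UU (exp (x • (shift (cU n) : Mat n))) := by
  rcases lt_trichotomy x 0 with h | h | h
  · have e : exp (x • (shift (cU n) : Mat n)) = (exp ((-x) • (shift (cU n) : Mat n)))⁻¹ := by
      rw [← Matrix.exp_neg]; congr 1; rw [neg_smul, neg_neg]
    rw [e]
    exact (exp_shift_SP (n := n) (cU n) cU_pos (-x) (by linarith)).1.inv
  · rw [h, zero_smul, NormedSpace.exp_zero]; exact UU.one
  · exact (exp_shift_SP (n := n) (cU n) cU_pos x h).1

lemma low_expL (x : ℝ) : Low (exp (x • (shift cL : Mat n)ᵀ)) := by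
  have key : UU (exp (x • (shift cL : Mat n))) := by
    rcases lt_trichotomy x 0 with h | h | h
    · have e : exp (x • (shift cL : Mat n)) = (exp ((-x) • (shift cL : Mat n)))⁻¹ := by
        rw [← Matrix.exp_neg]; congr 1; rw [neg_smul, neg_neg]
      rw [e]
      exact (exp_shift_SP (n := n) cL cL_pos (-x) (by linarith)).1.inv
    · rw [h, zero_smul, NormedSpace.exp_zero]; exact UU.one
    · exact (exp_shift_SP (n := n) cL cL_pos x h).1
  rw [← Matrix.transpose_smul, Matrix.exp_transpose]
  intro a b hab
  exact key.1 b a hab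

lemma Frame.kneg (f : Frame j h) : Low (KK j h (-1)) := by
  have e : KK j h (-1) * Matrix.diagonal (dw n 1) = Matrix.diagonal (dw n 1) * KK j h (-1) := by
    rw [← f.kD, ← f.mul, ← f.mul]
    congr 1
    simp
  intro a b hab
  have h1 := congrFun (congrFun e a) b
  rw [Matrix.mul_diagonal, Matrix.diagonal_mul] at h1
  by_contra hne
  have : dw n 1 b = dw n 1 a := by
    apply mul_left_cancel₀ hne; rw [h1, mul_comm]
  exact hab.ne (dw_inj this).symm

lemma Frame.klow (f : Frame j h) (A : SL 2 ℝ) (hA : A 0 1 = 0) : Low (KK j h A) := by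
  have key : ∀ A : SL 2 ℝ, A 0 1 = 0 → 0 < A 1 1 → Low (KK j h A) := by
    intro A hA hd
    have hdet := det2 A
    rw [hA] at hdet
    have e : A = D2 (-Real.log (A 1 1)) * L2 (A 1 0 / A 1 1) := by
      apply sl2_ext <;> simp [mul2, Real.exp_log hd, Real.exp_neg, hA]
      · field_simp; linarith
      · field_simp
    rw [e, f.mul, f.kD, f.kL]
    exact (Low.diagonal _).mul (low_expL _)
  have hdet := det2 A
  rw [hA] at hdet
  rcases lt_trichotomy (A 1 1) 0 with h1 | h1 | h1
  · have e : A = (-1) * (-A) := by simp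
    rw [e, f.mul]
    exact f.kneg.mul (key (-A) (by rw [neg2, hA, neg_zero]) (by rw [neg2]; linarith))
  · rw [h1] at hdet; simp at hdet
  · exact key A hA h1

lemma Frame.kW (f : Frame j h) : Low (KK j h W2⁻¹ * Wm) := by
  have e : KK j h W2⁻¹ * Matrix.diagonal (dw n (-1)) = Matrix.diagonal (dw n 1) * KK j h W2⁻¹ := by
    rw [← f.kD, ← f.kD, ← f.mul, ← f.mul]
    congr 1
    rw [inv_mul_eq_iff_eq_mul, ← mul_assoc, eq_mul_inv_iff_mul_eq]
    apply sl2_ext <;> simp [mul2]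
  intro a b hab
  rw [mul_Wm]
  have h1 := congrFun (congrFun e a) b.rev
  rw [Matrix.mul_diagonal, Matrix.diagonal_mul] at h1
  by_contra hne
  have h2 : dw n (-1) b.rev = dw n 1 a := by
    apply mul_left_cancel₀ hne; rw [h1, mul_comm]
  have h3 : dw n (-1) b.rev = dw n 1 b := by
    unfold dw
    congr 1
    rw [Fin.val_rev, Nat.cast_sub (by omega)]
    push_cast; ring
  rw [h3] at h2
  exact hab.ne (dw_inj h2).symm

lemma posRep_of_frame {Γ : Type} [Group Γ] {D : Dat Γ} {r : Γ →* SL 2 ℝ} (hc : Compat D r) (f : Frame j h) :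
    PosRep D (j.comp r) := by
  obtain ⟨t, ht, hg⟩ := hc.g0
  have hUinv : ∀ x : ℝ, exp (x • (shift (cU n) : Mat n)) * KK j h (U2 (-x)) = 1 := by
    intro x
    rw [← f.kU, ← f.mul, ← U2_add, add_neg_cancel, f.kU, zero_smul, NormedSpace.exp_zero]
  refine ⟨h, dw n t, fun x => exp (D.pos x • (shift (cU n) : Mat n)), fun x => KK j h (U2 (-D.pos x)) * KK j h (r x.1) * Ws x.2,
    dw n (-Real.log (r D.B 1 1)), exp ((r D.B 1 0 / r D.B 1 1) • (shift cL : Mat n)ᵀ), ?_⟩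
  refine ⟨f.hdet, fun i => Real.exp_pos _, ?_, ?_, fun x _ => uu_expU _, ?_, ?_, ?_, fun i => Real.exp_pos _, ?_, ?_⟩
  · intro a b hab
    apply Real.exp_lt_exp.2
    apply mul_lt_mul_of_pos_left _ ht
    have : (a : ℝ) < b := by exact_mod_cast hab
    linarith
  · show (j (r D.γ0) : Mat n) * h = _
    rw [hg]; exact f.hD t
  · rintro ⟨γ, s⟩ hx
    cases s with
    | false =>
      obtain ⟨h1, h2⟩ := hc.fl γ hx
      dsimp only
      rw [← f.mul, Ws, if_neg (by decide), mul_one]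
      apply f.klow
      simp [mul2]
      rw [h2]; field_simp; ring
    | true =>
      obtain ⟨h1, h2⟩ := hc.tr γ hx
      dsimp only
      have e : KK j h (r γ) = KK j h (r γ * W2) * KK j h W2⁻¹ := by rw [← f.mul, mul_assoc, mul_inv_cancel, mul_one]
      rw [e, Ws, if_pos rfl, ← mul_assoc, ← f.mul, mul_assoc]
      refine Low.mul (f.klow _ ?_) f.kW
      simp [mul2]
      rw [h2]; field_simp; ring
  · rintro ⟨γ, s⟩ hx
    show (j (r γ) : Mat n) * h * _ = _
    rw [f.to]
    simp only [← mul_assoc]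
    rw [mul_assoc h (exp _) (KK j h (U2 _)), hUinv, mul_one]
  · intro x hx x' hx' hlt
    rw [← Matrix.exp_neg, ← Matrix.exp_add_of_commute, ← neg_smul, ← add_smul]
    · exact exp_shift_SP (n := n) (cU n) cU_pos _ (by linarith)
    · exact ((Commute.refl (shift (cU n) : Mat n)).smul_left _).smul_right _ |>.neg_left
  · rw [← Matrix.transpose_smul, Matrix.exp_transpose, Matrix.transpose_transpose]
    exact exp_shift_SP (n := n) cL cL_pos _ (div_pos hc.bc hc.bd)
  · dsimp only
    rw [← f.kD, ← f.kL, ← f.mul, ← f.mul, Ws, if_neg (by decide), mul_one]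
    congr 1
    obtain ⟨h1, h2⟩ := hc.fl D.B D.hp
    have hdet := det2 (r D.B)
    rw [h2]
    have := hc.bd
    apply sl2_ext <;> simp [mul2, Real.exp_log this, Real.exp_neg]
    · field_simp; linarith
    · field_simp; ring
    · field_simp

lemma posRep_teich {Γ : Type} [Group Γ] {D : Dat Γ} {r : Γ →* SL 2 ℝ} (hc : Compat D r) (hn : 0 < n) (hj : IsIrreducibleEmbedding n j) :
    PosRep D (j.comp r) := by
  obtain ⟨h, f⟩ := exists_frame hn hj
  exact posRep_of_frame hc f
end
end
end Hit

namespace Hit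

/-! ## Module E1 : surface groups have at most one end -/

section
variable {g : ℕ}

/-- generators in the surface group -/
def gn (x : Fin g × Bool) : SurfaceGroup g := PresentedGroup.of x

/-- partial relator in the free group -/
def Cf (i : Fin (g + 1)) : FreeGroup (Fin g × Bool) :=
  Fin.partialProd (fun i : Fin g => ⁅FreeGroup.of (i, false), FreeGroup.of (i, true)⁆) i

lemma Cf_last : Cf (Fin.last g) = surfaceRelator g := by
  unfold Cf Fin.partialProd surfaceRelator
  rw [List.take_of_length_le (by simp)]

/-- projection of the free group -/
def prj : FreeGroup (Fin g × Bool) →* SurfaceGroup g := PresentedGroup.mk _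

lemma prj_of (x : Fin g × Bool) : prj (FreeGroup.of x) = gn x := rfl
lemma prj_rel : prj (surfaceRelator g) = 1 := by
  apply (PresentedGroup.one_of_mem)
  exact Set.mem_singleton _

def Pf (x : Fin g × Bool) : FreeGroup (Fin g × Bool) :=
  if x.2 then Cf x.1.castSucc * FreeGroup.of (x.1, false) else Cf x.1.castSucc
def Qf (x : Fin g × Bool) : FreeGroup (Fin g × Bool) :=
  if x.2 then Cf x.1.succ else Cf x.1.castSucc * FreeGroup.of (x.1, false) * FreeGroup.of (x.1, true) * (FreeGroup.of (x.1, false))⁻¹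

noncomputable def kk (e : Fin g × Bool → SurfaceGroup g → ℝ) (i : Fin (g + 1)) (v : SurfaceGroup g) : ℝ :=
  ∑ j : Fin g, if j.castSucc < i then
    (e (j, false) v - e (j, false) (v * (gn (j, false))⁻¹)) + (e (j, true) v - e (j, true) (v * (gn (j, true))⁻¹)) else 0

lemma kk_zero (e : Fin g × Bool → SurfaceGroup g → ℝ) (v) : kk e 0 v = 0 := by simp [kk]
lemma kk_last (e : Fin g × Bool → SurfaceGroup g → ℝ) (v) :
    kk e (Fin.last g) v = ∑ x, (e x v - e x (v * (gn x)⁻¹)) := by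
  rw [Fintype.sum_prod_type]
  unfold kk
  refine Finset.sum_congr rfl fun j _ => ?_
  rw [if_pos (Fin.castSucc_lt_last j), Fintype.sum_bool]
  ring
lemma kk_succ (e : Fin g × Bool → SurfaceGroup g → ℝ) (v) (i : Fin g) :
    kk e i.succ v = kk e i.castSucc v + ((e (i, false) v - e (i, false) (v * (gn (i, false))⁻¹)) + (e (i, true) v - e (i, true) (v * (gn (i, true))⁻¹))) := by
  have : ((e (i, false) v - e (i, false) (v * (gn (i, false))⁻¹)) + (e (i, true) v - e (i, true) (v * (gn (i, true))⁻¹))) =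
      ∑ j : Fin g, if j = i then
    (e (j, false) v - e (j, false) (v * (gn (j, false))⁻¹)) + (e (j, true) v - e (j, true) (v * (gn (j, true))⁻¹)) else 0 := by
    rw [Finset.sum_ite_eq' Finset.univ i]; simp
  rw [this]
  unfold kk
  rw [← Finset.sum_add_distrib]
  refine Finset.sum_congr rfl fun j _ => ?_
  have h1 : (j.castSucc < i.succ) ↔ j < i ∨ j = i := by
    rw [Fin.castSucc_lt_succ_iff, le_iff_lt_or_eq]
  have h2 : (j.castSucc < i.castSucc) ↔ j < i := Fin.castSucc_lt_castSucc_iff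
  simp only [h1, h2]
  by_cases h3 : j = i
  · subst h3; simp
  · simp [h3]

noncomputable def kA (e : Fin g × Bool → SurfaceGroup g → ℝ) (i : Fin g) (v : SurfaceGroup g) : ℝ :=
  (kk e i.castSucc v + e (i, false) v) - (kk e i.castSucc (v * gn (i, false)) + e (i, false) (v * gn (i, false)))
    + e (i, true) (v * gn (i, false) * (gn (i, true))⁻¹)
noncomputable def kB (e : Fin g × Bool → SurfaceGroup g → ℝ) (i : Fin g) (v : SurfaceGroup g) : ℝ :=
  (kk e i.castSucc (v * (gn (i, false))⁻¹) - kA e i (v * (gn (i, false))⁻¹))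
    - (kk e i.castSucc (v * gn (i, true)) + e (i, false) (v * gn (i, true))) + e (i, true) v

noncomputable def kg (e : Fin g × Bool → SurfaceGroup g → ℝ) (x : Fin g × Bool) : SurfaceGroup g → ℝ :=
  if x.2 then kB e x.1 else kA e x.1

/-- affine permutation -/
def affP (s : SurfaceGroup g) (k : SurfaceGroup g → ℝ) : Equiv.Perm (SurfaceGroup g → ℝ) where
  toFun φ := fun v => φ (v * s) + k v
  invFun φ := fun v => φ (v * s⁻¹) - k (v * s⁻¹)
  left_inv φ := by funext v; simp
  right_inv φ := by funext v; simp

noncomputable def Th (e : Fin g × Bool → SurfaceGroup g → ℝ) : FreeGroup (Fin g × Bool) →* Equiv.Perm (SurfaceGroup g → ℝ) :=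
  FreeGroup.lift fun x => affP (gn x) (kg e x)

noncomputable def kap (e : Fin g × Bool → SurfaceGroup g → ℝ) (w : FreeGroup (Fin g × Bool)) : SurfaceGroup g → ℝ := Th e w 0

lemma Th_aff (e : Fin g × Bool → SurfaceGroup g → ℝ) (w : FreeGroup (Fin g × Bool)) :
    ∀ (φ : SurfaceGroup g → ℝ) (v), Th e w φ v = φ (v * prj w) + kap e w v := by
  induction w using FreeGroup.induction_on with
  | C1 => intro φ v; simp [kap]
  | of x => intro φ v; simp [kap, Th, affP, prj_of]
  | inv_of x _ =>
    intro φ v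
    simp only [kap, Th, map_inv, FreeGroup.lift_apply_of, prj_of]
    show φ _ - _ = φ _ + ((0 : ℝ) - _)
    ring
  | mul a b ha hb =>
    intro φ v
    simp only [kap, map_mul, Equiv.Perm.mul_apply] at *
    rw [ha, hb, ha (Th e b 0), mul_assoc]
    ring

lemma kap_mul (e : Fin g × Bool → SurfaceGroup g → ℝ) (w w' : FreeGroup (Fin g × Bool)) (v) :
    kap e (w * w') v = kap e w v + kap e w' (v * prj w) := by
  have : kap e (w * w') = Th e w (kap e w') := by simp [kap]
  rw [this, Th_aff]; ring

lemma kap_one (e : Fin g × Bool → SurfaceGroup g → ℝ) (v) : kap e 1 v = 0 := by simp [kap]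
lemma kap_inv (e : Fin g × Bool → SurfaceGroup g → ℝ) (w : FreeGroup (Fin g × Bool)) (v) :
    kap e w⁻¹ v = - kap e w (v * (prj w)⁻¹) := by
  have := kap_mul e w⁻¹ w v
  rw [inv_mul_cancel, kap_one, map_inv] at this
  linarith
lemma kap_of (e : Fin g × Bool → SurfaceGroup g → ℝ) (x) (v) : kap e (FreeGroup.of x) v = kg e x v := by
  simp [kap, Th, affP]

lemma kap_step (e : Fin g × Bool → SurfaceGroup g → ℝ) (i : Fin g) (hi : ∀ v, kap e (Cf i.castSucc)⁻¹ v = kk e i.castSucc v) (v) :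
    kap e (Qf (i, false))⁻¹ v = kk e i.castSucc v + e (i, false) v ∧
    kap e (Pf (i, true))⁻¹ v = kk e i.castSucc (v * (gn (i, false))⁻¹) - kA e i (v * (gn (i, false))⁻¹) ∧
    kap e (Cf i.succ)⁻¹ v = kk e i.castSucc (v * (gn (i, false))⁻¹) - kA e i (v * (gn (i, false))⁻¹) + e (i, true) v := by
  have h1 : ∀ v, kap e (Qf (i, false))⁻¹ v = kk e i.castSucc v + e (i, false) v := by
    intro v
    simp only [Qf, Bool.false_eq_true, if_false, _root_.mul_inv_rev, _root_.inv_inv]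
    rw [kap_mul, kap_mul, kap_mul, kap_inv, kap_inv, kap_of, kap_of, kap_of, hi]
    simp only [prj_of, map_mul, map_inv, kg, if_true, Bool.false_eq_true, if_false, kB]
    have e1 : v * gn (i, false) * (gn (i, true))⁻¹ * gn (i, true) = v * gn (i, false) := by group
    simp only [kA, mul_assoc, inv_mul_cancel_left, mul_inv_cancel_left, inv_mul_cancel, mul_inv_cancel, mul_one]
    ring
  refine ⟨h1 v, ?_, ?_⟩
  · simp only [Pf, if_true, _root_.mul_inv_rev]
    rw [kap_mul, kap_inv, kap_of, hi]
    simp only [prj_of, map_inv, kg, Bool.false_eq_true, if_false]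
    ring
  · have e1 : (Cf i.succ)⁻¹ = FreeGroup.of (i, true) * (Qf (i, false))⁻¹ := by
      simp only [Qf, Bool.false_eq_true, if_false, Cf]
      rw [Fin.partialProd_succ, commutatorElement_def]
      group
    rw [e1, kap_mul, h1, kap_of]
    simp only [prj_of, kg, if_true, kB]
    ring

lemma kap_C (e : Fin g × Bool → SurfaceGroup g → ℝ) (i : Fin (g + 1)) : ∀ v, kap e (Cf i)⁻¹ v = kk e i v := by
  induction i using Fin.induction with
  | zero => intro v; rw [kk_zero]; simp [Cf, kap_one]
  | succ i ih =>
    intro v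
    rw [(kap_step e i ih v).2.2, kk_succ]
    have e1 : v * (gn (i, false))⁻¹ * gn (i, false) = v := by group
    rw [kA, e1]
    ring

lemma exists_kappa (e : Fin g × Bool → SurfaceGroup g → ℝ) (he : ∀ v, ∑ x, (e x (v * (gn x)⁻¹) - e x v) = 0) :
    ∃ κ : SurfaceGroup g → ℝ, ∀ v x, e x v = κ (v * (prj (Qf x))⁻¹) - κ (v * (prj (Pf x))⁻¹) := by
  have hk0 : ∀ v, kk e (Fin.last g) v = 0 := by
    intro v
    rw [kk_last, ← neg_eq_zero, ← Finset.sum_neg_distrib, ← he v]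
    exact Finset.sum_congr rfl fun x _ => by ring
  have hrel : Th e (surfaceRelator g) = 1 := by
    rw [← _root_.inv_inj, inv_one, ← map_inv]
    ext φ v
    have h0 : kap e (surfaceRelator g)⁻¹ v = 0 :=
      (congrArg (fun w => kap e w⁻¹ v) (Cf_last (g := g))).symm.trans ((kap_C e (Fin.last g) v).trans (hk0 v))
    rw [Th_aff, h0, map_inv, prj_rel]
    simp
  let Θ : SurfaceGroup g →* Equiv.Perm (SurfaceGroup g → ℝ) := PresentedGroup.toGroup (f := fun x => affP (gn x) (kg e x))
    (fun w hw => by rw [Set.mem_singleton_iff.1 hw]; exact hrel)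
  have hΘ : ∀ w, Θ (prj w) = Th e w := by
    intro w
    have : Θ.comp prj = Th e := by
      ext x : 1
      simp [Θ, prj_of, gn, Th]
    rw [← this]; rfl
  have hΘk : ∀ v w, Θ (v * prj w) 0 1 = Θ v 0 1 + kap e w v := by
    intro v w
    obtain ⟨u, rfl⟩ := PresentedGroup.mk_surjective _ v
    have h1 : Θ (prj u * prj w) 0 1 = kap e (u * w) 1 := by rw [← map_mul, hΘ]; rfl
    have h2 : Θ (prj u) 0 1 = kap e u 1 := by rw [hΘ]; rfl
    change Θ (prj u * prj w) 0 1 = Θ (prj u) 0 1 + kap e w (prj u)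
    rw [h1, h2, kap_mul, one_mul]
  refine ⟨fun v => Θ v 0 1, fun v x => ?_⟩
  dsimp only
  rw [← map_inv, ← map_inv, hΘk, hΘk]
  obtain ⟨i, s⟩ := x
  have hs := kap_step e i (kap_C e _) v
  cases s with
  | false =>
    rw [hs.1]
    have : Pf (i, false) = Cf i.castSucc := by simp [Pf]
    rw [this, kap_C]; ring
  | true =>
    have : Qf (i, true) = Cf i.succ := by simp [Qf]
    rw [this, hs.2.1, hs.2.2]; ring

end
end Hit

namespace Hit

section
variable {g : ℕ}

lemma tele_relator (f : SurfaceGroup g → ℝ) (γ : SurfaceGroup g) :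
    ∑ x, ((f (γ * prj (Qf x) * gn x) - f (γ * prj (Qf x))) - (f (γ * prj (Pf x) * gn x) - f (γ * prj (Pf x)))) = 0 := by
  rw [Fintype.sum_prod_type]
  have h1 : ∀ i : Fin g, ∑ s : Bool, ((f (γ * prj (Qf (i, s)) * gn (i, s)) - f (γ * prj (Qf (i, s)))) - (f (γ * prj (Pf (i, s)) * gn (i, s)) - f (γ * prj (Pf (i, s)))))
      = f (γ * prj (Cf i.castSucc)) - f (γ * prj (Cf i.succ)) := by
    intro i
    have e1 : prj (Cf i.succ) = prj (Cf i.castSucc) * gn (i, false) * gn (i, true) * (gn (i, false))⁻¹ * (gn (i, true))⁻¹ := by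
      simp only [Cf]
      rw [Fin.partialProd_succ, commutatorElement_def]
      simp only [map_mul, map_inv, prj_of, mul_assoc]
    rw [Fintype.sum_bool]
    simp only [Qf, Pf, if_true, Bool.false_eq_true, if_false, e1, map_mul, map_inv, prj_of, mul_assoc, inv_mul_cancel, mul_one]
    ring
  simp only [h1]
  rw [Finset.sum_sub_distrib]
  have h2 := Fin.sum_univ_succ (fun i : Fin (g + 1) => f (γ * prj (Cf i)))
  have h3 := Fin.sum_univ_castSucc (fun i : Fin (g + 1) => f (γ * prj (Cf i)))
  have h4 : f (γ * prj (Cf 0)) = f (γ * prj (Cf (Fin.last g))) := by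
    have h5 : prj (Cf (Fin.last g)) = 1 := (congrArg prj (Cf_last (g := g))).trans prj_rel
    rw [h5]
    simp [Cf]
  linarith

lemma cosum_zero (f : SurfaceGroup g → ℝ) (hf : ∀ x, {γ | f (γ * gn x) - f γ ≠ 0}.Finite)
    (e : Fin g × Bool → SurfaceGroup g → ℝ) (he : ∀ v, ∑ x, (e x (v * (gn x)⁻¹) - e x v) = 0) :
    ∑ x, ∑ᶠ v, (f (v * gn x) - f v) * e x v = 0 := by
  obtain ⟨κ, hκ⟩ := exists_kappa e he
  have hfin : ∀ (x) (q : SurfaceGroup g), (Function.support fun γ => (f (γ * q * gn x) - f (γ * q)) * κ γ).Finite := by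
    intro x q
    refine Set.Finite.subset ((hf x).preimage ((mul_left_injective q).injOn)) ?_
    intro γ hγ
    simp only [Function.mem_support] at hγ
    exact left_ne_zero_of_mul hγ
  have hre : ∀ (x) (q : SurfaceGroup g), ∑ᶠ v, (f (v * gn x) - f v) * κ (v * q⁻¹) = ∑ᶠ γ, (f (γ * q * gn x) - f (γ * q)) * κ γ := by
    intro x q
    rw [← finsum_comp_equiv (Equiv.mulRight q)]
    simp [mul_assoc]
  have h1 : ∀ x, ∑ᶠ v, (f (v * gn x) - f v) * e x v = ∑ᶠ γ, ((f (γ * prj (Qf x) * gn x) - f (γ * prj (Qf x))) - (f (γ * prj (Pf x) * gn x) - f (γ * prj (Pf x)))) * κ γ := by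
    intro x
    have hs : ∀ q : SurfaceGroup g, (Function.support fun v => (f (v * gn x) - f v) * κ (v * q⁻¹)).Finite := by
      intro q
      refine (hf x).subset ?_
      intro γ hγ
      simp only [Function.mem_support] at hγ
      exact left_ne_zero_of_mul hγ
    calc _ = ∑ᶠ v, ((f (v * gn x) - f v) * κ (v * (prj (Qf x))⁻¹) - (f (v * gn x) - f v) * κ (v * (prj (Pf x))⁻¹)) :=
          finsum_congr fun v => by rw [hκ]; ring
      _ = _ := finsum_sub_distrib (hs _) (hs _)
      _ = _ := by rw [hre, hre]
      _ = _ := (finsum_sub_distrib (hfin x _) (hfin x _)).symm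
      _ = _ := finsum_congr fun v => by ring
  simp only [h1]
  rw [← finsum_sum_comm]
  · simp only [← Finset.sum_mul, tele_relator]
    simp
  · intro x _
    refine ((hfin x (prj (Qf x))).union (hfin x (prj (Pf x)))).subset ?_
    intro γ hγ
    simp only [Function.mem_support, Set.mem_union] at hγ ⊢
    by_contra hc
    push Not at hc
    apply hγ
    rw [sub_mul, hc.1, hc.2, sub_zero]

open Classical in
theorem one_ended (f : SurfaceGroup g → ℝ) (hf : ∀ x, {γ | f (γ * gn x) - f γ ≠ 0}.Finite) :
    ∃ k, {γ | f γ ≠ k}.Finite := by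
  let cs : (Fin g × Bool) × SurfaceGroup g →₀ ℝ := Finsupp.ofSupportFinite (fun p => f (p.2 * gn p.1) - f p.2) (by
    have : (⋃ x, (fun γ => (x, γ)) '' {γ | f (γ * gn x) - f γ ≠ 0}).Finite := Set.finite_iUnion fun x => (hf x).image _
    refine this.subset ?_
    rintro ⟨x, γ⟩ h
    exact Set.mem_iUnion.2 ⟨x, γ, h, rfl⟩)
  have hcs : ∀ x γ, cs (x, γ) = f (γ * gn x) - f γ := fun x γ => rfl
  let δ : SurfaceGroup g → ((Fin g × Bool) × SurfaceGroup g →₀ ℝ) := fun v =>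
    ∑ x, (Finsupp.single (x, v * (gn x)⁻¹) 1 - Finsupp.single (x, v) 1)
  have hmem : cs ∈ Submodule.span ℝ (Set.range δ) := by
    by_contra hc
    obtain ⟨ℓ, hℓ, hker⟩ := Submodule.exists_le_ker_of_notMem hc
    apply hℓ
    let e : Fin g × Bool → SurfaceGroup g → ℝ := fun x v => ℓ (Finsupp.single (x, v) 1)
    have he : ∀ v, ∑ x, (e x (v * (gn x)⁻¹) - e x v) = 0 := by
      intro v
      have : ℓ (δ v) = 0 := hker (Submodule.subset_span ⟨v, rfl⟩)
      simpa [δ, e, map_sum, map_sub] using this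
    rw [← cosum_zero f hf e he]
    have h1 : ℓ cs = cs.sum fun p r => r * e p.1 p.2 := by
      conv_lhs => rw [← Finsupp.sum_single cs]
      rw [Finsupp.sum, map_sum, Finsupp.sum]
      refine Finset.sum_congr rfl fun p _ => ?_
      have : (Finsupp.single p (cs p) : (Fin g × Bool) × SurfaceGroup g →₀ ℝ) = cs p • Finsupp.single p 1 := by simp
      rw [this, map_smul]; rfl
    rw [h1]
    have h2 : (cs.sum fun p r => r * e p.1 p.2) = ∑ᶠ p, cs p * e p.1 p.2 := by
      rw [Finsupp.sum, finsum_eq_sum_of_support_subset]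
      intro p hp
      simp only [Function.mem_support] at hp
      exact Finsupp.mem_support_iff.2 (left_ne_zero_of_mul hp)
    rw [h2, finsum_curry, finsum_eq_sum_of_fintype]
    · rfl
    · refine (Finsupp.finite_support cs).subset ?_
      intro p hp
      exact left_ne_zero_of_mul hp
  obtain ⟨F, hF⟩ := Finsupp.mem_span_range_iff_exists_finsupp.1 hmem
  have hFc : ∀ x γ, F (γ * gn x) - F γ = f (γ * gn x) - f γ := by
    intro x γ
    rw [← hcs, ← hF]
    simp only [Finsupp.sum, Finsupp.finset_sum_apply, Finsupp.smul_apply, δ, Finsupp.sub_apply]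
    have h3 : ∀ v, ∑ y, ((Finsupp.single (y, v * (gn y)⁻¹) (1:ℝ)) (x, γ) - (Finsupp.single (y, v) (1:ℝ)) (x, γ)) =
        (if v = γ * gn x then 1 else 0) - (if v = γ then 1 else 0) := by
      intro v
      rw [Finset.sum_eq_single x]
      · simp only [Finsupp.single_apply, Prod.mk.injEq, true_and, mul_inv_eq_iff_eq_mul]
      · intro y _ hy
        simp [Finsupp.single_apply, hy]
      · simp
    simp only [h3, smul_eq_mul, mul_sub, mul_ite, mul_one, mul_zero, Finset.sum_sub_distrib, Finset.sum_ite_eq', Finsupp.mem_support_iff]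
    split_ifs <;> simp_all
  have hconst : ∀ w γ, f (γ * prj w) - F (γ * prj w) = f γ - F γ := by
    intro w
    induction w using FreeGroup.induction_on with
    | C1 => intro γ; simp
    | of x => intro γ; rw [prj_of]; linarith [hFc x γ]
    | inv_of x _ =>
      intro γ
      rw [map_inv, prj_of]
      have := hFc x (γ * (gn x)⁻¹)
      rw [inv_mul_cancel_right] at this
      linarith
    | mul a b ha hb => intro γ; rw [map_mul, ← mul_assoc, hb, ha]
  refine ⟨f 1 - F 1, F.finite_support.subset ?_⟩
  intro γ hγ
  obtain ⟨w, rfl⟩ := PresentedGroup.mk_surjective _ γ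
  have := hconst w 1
  rw [one_mul] at this
  intro h0
  apply hγ
  change F (prj w) = 0 at h0
  change f (prj w) = _
  linarith

/-- left almost-invariant sets are finite or cofinite -/
theorem one_ended_set (E : Set (SurfaceGroup g)) (hE : ∀ x, {γ | ¬ (gn x * γ ∈ E ↔ γ ∈ E)}.Finite) :
    E.Finite ∨ Eᶜ.Finite := by
  classical
  obtain ⟨k, hk⟩ := one_ended (fun γ => if γ⁻¹ ∈ E then (1:ℝ) else 0) (by
    intro x
    refine (((hE x).image (fun γ => (gn x * γ)⁻¹))).subset ?_
    intro γ hγ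
    refine ⟨(gn x)⁻¹ * γ⁻¹, ?_, by simp⟩
    intro hc
    apply hγ
    simp only [mul_inv_cancel_left] at hc
    simp [_root_.mul_inv_rev, hc])
  by_cases h1 : k = 1
  · right
    refine (hk.image (fun γ => γ⁻¹)).subset ?_
    intro γ hγ
    refine ⟨γ⁻¹, ?_, by simp⟩
    simp only [Set.mem_compl_iff] at hγ
    simp [hγ, h1]
  · left
    refine (hk.image (fun γ => γ⁻¹)).subset ?_
    intro γ hγ
    refine ⟨γ⁻¹, ?_, by simp⟩
    simp only [ne_eq, Set.mem_ofPred_eq, _root_.inv_inv, hγ, if_true]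
    exact fun h => h1 h.symm

end
end Hit

namespace Hit

section

def sg5 : Equiv.Perm (Fin 5) := Equiv.swap 0 1 * Equiv.swap 1 2
def ta5 : Equiv.Perm (Fin 5) := Equiv.swap 2 3 * Equiv.swap 3 4

/-- the commutator of commutators of squares -/
def dcom {G : Type*} [Group G] (a b : G) : Prop :=
  (a^2*b^2*(a^2)⁻¹*(b^2)⁻¹) * (a^2*(a*b)^2*(a^2)⁻¹*((a*b)^2)⁻¹) = (a^2*(a*b)^2*(a^2)⁻¹*((a*b)^2)⁻¹) * (a^2*b^2*(a^2)⁻¹*(b^2)⁻¹)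

set_option maxRecDepth 10000 in
lemma sgta_ne : ¬ dcom sg5 ta5 := by
  unfold sg5 ta5 dcom
  decide

lemma not_dcom {g : ℕ} (hg : 2 ≤ g) : ∃ a b : SurfaceGroup g, ¬ dcom a b := by
  let i0 : Fin g := ⟨0, by omega⟩
  let i1 : Fin g := ⟨1, by omega⟩
  let f : Fin g × Bool → Equiv.Perm (Fin 5) := fun x => if x = (i0, false) then sg5 else if x = (i1, false) then ta5 else 1
  have hf : ∀ w ∈ ({surfaceRelator g} : Set (FreeGroup (Fin g × Bool))), FreeGroup.lift f w = 1 := by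
    intro w hw
    rw [Set.mem_singleton_iff.1 hw, surfaceRelator, map_list_prod]
    apply List.prod_eq_one
    intro x hx
    rw [List.mem_map] at hx
    obtain ⟨y, hy, rfl⟩ := hx
    rw [List.mem_ofFn] at hy
    obtain ⟨i, rfl⟩ := hy
    have h1 : f (i, true) = 1 := by simp [f]
    simp [commutatorElement_def, h1]
  let φ : SurfaceGroup g →* Equiv.Perm (Fin 5) := PresentedGroup.toGroup hf
  have ha : φ (gn (i0, false)) = sg5 := by
    simp [φ, gn, f]
  have hb : φ (gn (i1, false)) = ta5 := by
    simp [φ, gn, f, i0, i1]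
  refine ⟨gn (i0, false), gn (i1, false), fun h => sgta_ne ?_⟩
  have := congrArg φ h
  simp only [map_mul, map_pow, map_inv, ha, hb] at this
  exact this

/-! plane vectors -/
def act (A : SL 2 ℝ) (v : ℝ × ℝ) : ℝ × ℝ := (A 0 0 * v.1 + A 0 1 * v.2, A 1 0 * v.1 + A 1 1 * v.2)
def ip (v u : ℝ × ℝ) : ℝ := v.1 * u.1 + v.2 * u.2
def dt (v u : ℝ × ℝ) : ℝ := v.1 * u.2 - v.2 * u.1
def N2 (A : SL 2 ℝ) : ℝ := A 0 0 ^ 2 + A 0 1 ^ 2 + A 1 0 ^ 2 + A 1 1 ^ 2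

lemma act_mul (A B : SL 2 ℝ) (v) : act (A * B) v = act A (act B v) := by
  simp only [act, mul2]; ext <;> simp <;> ring
lemma act_one (v) : act 1 v = v := by
  simp [act]
lemma act_inv (A : SL 2 ℝ) (v) : act A⁻¹ (act A v) = v := by rw [← act_mul, inv_mul_cancel, act_one]
lemma act_inv' (A : SL 2 ℝ) (v) : act A (act A⁻¹ v) = v := by rw [← act_mul, mul_inv_cancel, act_one]
lemma act_smul (A : SL 2 ℝ) (c : ℝ) (v) : act A (c • v) = c • act A v := by
  simp only [act]; ext <;> simp <;> ring
lemma act_add (A : SL 2 ℝ) (v u) : act A (v + u) = act A v + act A u := by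
  simp only [act]; ext <;> simp <;> ring
lemma dt_act (A : SL 2 ℝ) (v u) : dt (act A v) (act A u) = dt v u := by
  simp only [act, dt]; linear_combination (v.1 * u.2 - v.2 * u.1) * det2 A
lemma ip_self_nonneg (v) : 0 ≤ ip v v := by unfold ip; nlinarith [sq_nonneg v.1, sq_nonneg v.2]
lemma ip_self_eq {v} (h : ip v v = 0) : v = 0 := by
  unfold ip at h
  have h1 : v.1 = 0 := by nlinarith [sq_nonneg v.1, sq_nonneg v.2]
  have h2 : v.2 = 0 := by nlinarith [sq_nonneg v.1, sq_nonneg v.2]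
  exact Prod.ext h1 h2
lemma ip_self_pos {v} (h : v ≠ 0) : 0 < ip v v :=
  lt_of_le_of_ne (ip_self_nonneg v) fun h' => h (ip_self_eq h'.symm)
lemma ip_dt (v u) : ip v u ^ 2 + dt v u ^ 2 = ip v v * ip u u := by unfold ip dt; ring
lemma ip_comm (v u) : ip v u = ip u v := by unfold ip; ring
lemma dt_comm (v u) : dt v u = - dt u v := by unfold dt; ring
lemma ip_trans (a b c) : ip b b * ip a c = ip a b * ip b c - dt a b * dt b c := by unfold ip dt; ring

lemma inv2_00 (A : SL 2 ℝ) : A⁻¹ 0 0 = A 1 1 := by simp [Matrix.SpecialLinearGroup.coe_inv, Matrix.adjugate_fin_two]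
lemma inv2_01 (A : SL 2 ℝ) : A⁻¹ 0 1 = - A 0 1 := by simp [Matrix.SpecialLinearGroup.coe_inv, Matrix.adjugate_fin_two]
lemma inv2_10 (A : SL 2 ℝ) : A⁻¹ 1 0 = - A 1 0 := by simp [Matrix.SpecialLinearGroup.coe_inv, Matrix.adjugate_fin_two]
lemma inv2_11 (A : SL 2 ℝ) : A⁻¹ 1 1 = A 0 0 := by simp [Matrix.SpecialLinearGroup.coe_inv, Matrix.adjugate_fin_two]

lemma N2_inv (A : SL 2 ℝ) : N2 A⁻¹ = N2 A := by
  simp only [N2, inv2_00, inv2_01, inv2_10, inv2_11]; ring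
lemma N2_ge (A : SL 2 ℝ) : 2 ≤ N2 A := by
  unfold N2; nlinarith [det2 A, sq_nonneg (A 0 0 - A 1 1), sq_nonneg (A 0 1 + A 1 0)]
lemma act_le (A : SL 2 ℝ) (v) : ip (act A v) (act A v) ≤ N2 A * ip v v := by
  simp only [act, ip, N2]
  nlinarith [sq_nonneg (A 0 0 * v.2 - A 0 1 * v.1), sq_nonneg (A 1 0 * v.2 - A 1 1 * v.1)]
lemma act_ge (A : SL 2 ℝ) (v) : ip v v ≤ N2 A * ip (act A v) (act A v) := by
  have := act_le A⁻¹ (act A v)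
  rwa [act_inv, N2_inv] at this
lemma N2_mul (A B : SL 2 ℝ) : N2 (A * B) ≤ N2 A * N2 B := by
  have h1 := act_le A (B 0 0, B 1 0)
  have h2 := act_le A (B 0 1, B 1 1)
  simp only [act, ip] at h1 h2
  have h3 : N2 A * N2 B = N2 A * (B 0 0 * B 0 0 + B 1 0 * B 1 0) + N2 A * (B 0 1 * B 0 1 + B 1 1 * B 1 1) := by
    unfold N2; ring
  have h4 : N2 (A * B) = ((A * B) 0 0 ^ 2 + (A * B) 1 0 ^ 2) + ((A * B) 0 1 ^ 2 + (A * B) 1 1 ^ 2) := by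
    unfold N2; ring
  rw [h3, h4, mul2, mul2, mul2, mul2]
  linarith

lemma tri_dcom (A B : SL 2 ℝ) (hA : A 1 0 = 0) (hB : B 1 0 = 0) :
    (A * B * A⁻¹ * B⁻¹) 1 0 = 0 ∧ (A * B * A⁻¹ * B⁻¹) 0 0 = 1 ∧ (A * B * A⁻¹ * B⁻¹) 1 1 = 1 := by
  have d1 := det2 A
  have d2 := det2 B
  rw [hA] at d1; rw [hB] at d2
  simp only [mul2, inv2_00, inv2_01, inv2_10, inv2_11, hA, hB]
  refine ⟨by ring, ?_, ?_⟩
  · linear_combination d1 + A 0 0 * A 1 1 * d2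
  · linear_combination d1 + A 0 0 * A 1 1 * d2

lemma tri_comm (A B : SL 2 ℝ) (hA : A 1 0 = 0 ∧ A 0 0 = 1 ∧ A 1 1 = 1) (hB : B 1 0 = 0 ∧ B 0 0 = 1 ∧ B 1 1 = 1) : A * B = B * A := by
  obtain ⟨a1, a2, a3⟩ := hA
  obtain ⟨b1, b2, b3⟩ := hB
  apply sl2_ext <;> simp only [mul2, a1, a2, a3, b1, b2, b3] <;> ring

/-- a matrix with first column a given nonzero vector, up to scaling -/
lemma exists_frm2 {v : ℝ × ℝ} (hv : v ≠ 0) : ∃ m : SL 2 ℝ, act m (1, 0) = v := by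
  have h := ip_self_pos hv
  refine ⟨⟨!![v.1, - v.2 / ip v v; v.2, v.1 / ip v v], ?_⟩, ?_⟩
  · rw [Matrix.det_fin_two_of]
    field_simp
    unfold ip; ring
  · simp [act]

/-- squares in a faithful surface group have no common eigenline -/
theorem no_line {g : ℕ} (hg : 2 ≤ g) (r : SurfaceGroup g →* SL 2 ℝ) (hr : Function.Injective r) (v : ℝ × ℝ) (hv : v ≠ 0)
    (h : ∀ γ, dt (act (r (γ ^ 2)) v) v = 0) : False := by
  obtain ⟨a, b, hab⟩ := not_dcom hg
  obtain ⟨m, hm⟩ := exists_frm2 hv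
  have key : ∀ γ, (m⁻¹ * r (γ ^ 2) * m) 1 0 = 0 := by
    intro γ
    have h1 := h γ
    rw [← hm] at h1
    rw [← dt_act m⁻¹, act_inv, ← act_mul, ← act_mul] at h1
    simpa [dt, act] using h1
  apply hab
  apply hr
  have hc : ∀ x y : SL 2 ℝ, m⁻¹ * x * m = m⁻¹ * y * m → x = y := by
    intro x y hxy
    exact mul_left_cancel (mul_right_cancel hxy)
  apply hc
  have e : ∀ x y : SurfaceGroup g, m⁻¹ * r (x^2 * y^2 * (x^2)⁻¹ * (y^2)⁻¹) * m =
      (m⁻¹ * r (x^2) * m) * (m⁻¹ * r (y^2) * m) * (m⁻¹ * r (x^2) * m)⁻¹ * (m⁻¹ * r (y^2) * m)⁻¹ := by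
    intro x y
    simp only [map_mul, map_inv]
    group
  have e2 : ∀ x y : SL 2 ℝ, m⁻¹ * (x * y) * m = (m⁻¹ * x * m) * (m⁻¹ * y * m) := by
    intro x y; group
  rw [map_mul r (_ * _ * _ * _), map_mul r (_ * _ * _ * _), e2, e2, e, e]
  exact tri_comm _ _ (tri_dcom _ _ (key _) (key _)) (tri_dcom _ _ (key _) (key _))

end
end Hit

namespace Hit
open Filter Topology

section

/-- the four entries -/
def q4 (A : SL 2 ℝ) : ℝ × ℝ × ℝ × ℝ := (A 0 0, A 0 1, A 1 0, A 1 1)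

def K4 (R : ℝ) : Set (ℝ × ℝ × ℝ × ℝ) :=
  {p | p.1 * p.2.2.2 - p.2.1 * p.2.2.1 = 1 ∧ p.1 ^ 2 + p.2.1 ^ 2 + p.2.2.1 ^ 2 + p.2.2.2 ^ 2 ≤ R}

lemma K4_compact (R : ℝ) : IsCompact (K4 R) := by
  have hc : IsClosed (K4 R) := by
    have h1 : Continuous fun p : ℝ × ℝ × ℝ × ℝ => p.1 * p.2.2.2 - p.2.1 * p.2.2.1 := by fun_prop
    have h2 : Continuous fun p : ℝ × ℝ × ℝ × ℝ => p.1 ^ 2 + p.2.1 ^ 2 + p.2.2.1 ^ 2 + p.2.2.2 ^ 2 := by fun_prop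
    exact (isClosed_eq h1 continuous_const).inter (isClosed_le h2 continuous_const)
  refine IsCompact.of_isClosed_subset (isCompact_Icc (a := ((-(R+1), -(R+1), -(R+1), -(R+1)) : ℝ × ℝ × ℝ × ℝ)) (b := ((R+1), (R+1), (R+1), (R+1)))) hc ?_
  rintro ⟨a, b, c, d⟩ ⟨_, h⟩
  simp only at h
  simp only [Set.mem_Icc, Prod.mk_le_mk]
  refine ⟨⟨?_, ?_, ?_, ?_⟩, ?_, ?_, ?_, ?_⟩ <;> nlinarith [sq_nonneg a, sq_nonneg b, sq_nonneg c, sq_nonneg d, sq_nonneg (a-1), sq_nonneg (a+1), sq_nonneg (b-1), sq_nonneg (b+1), sq_nonneg (c-1), sq_nonneg (c+1), sq_nonneg (d-1), sq_nonneg (d+1)]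

lemma q4_mem (A : SL 2 ℝ) {R : ℝ} (h : N2 A ≤ R) : q4 A ∈ K4 R := ⟨det2 A, h⟩

lemma K4_ex {R : ℝ} {p} (h : p ∈ K4 R) : ∃ A : SL 2 ℝ, q4 A = p ∧ N2 A ≤ R := by
  refine ⟨⟨!![p.1, p.2.1; p.2.2.1, p.2.2.2], by rw [Matrix.det_fin_two_of]; exact h.1⟩, rfl, h.2⟩

lemma finite_balls {Γ : Type} [Group Γ] (r : Γ →* SL 2 ℝ) (hi : Function.Injective r)
    (hd : DiscreteTopology (r.range : Subgroup (SL 2 ℝ))) (R : ℝ) : {γ | N2 (r γ) ≤ R}.Finite := by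
  obtain ⟨V, hVo, hV⟩ : ∃ V : Set (Matrix (Fin 2) (Fin 2) ℝ), IsOpen V ∧ ∀ A : SL 2 ℝ, A ∈ r.range → ((A : Matrix (Fin 2) (Fin 2) ℝ) ∈ V ↔ A = 1) := by
    have h1 : IsOpen ({1} : Set r.range) := isOpen_discrete _
    obtain ⟨U, hU, hU1⟩ := isOpen_induced_iff.1 h1
    obtain ⟨V, hV, hV1⟩ := isOpen_induced_iff.1 hU
    refine ⟨V, hV, fun A hA => ?_⟩
    have h2 : (⟨A, hA⟩ : r.range) ∈ (Subtype.val ⁻¹' U : Set r.range) ↔ (⟨A, hA⟩ : r.range) ∈ ({1} : Set r.range) := by rw [hU1]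
    rw [← hV1] at h2
    simpa [Subtype.ext_iff] using h2
  let G : (ℝ × ℝ × ℝ × ℝ) × (ℝ × ℝ × ℝ × ℝ) → Matrix (Fin 2) (Fin 2) ℝ := fun z =>
    !![z.1.2.2.2 * z.2.1 - z.1.2.1 * z.2.2.2.1, z.1.2.2.2 * z.2.2.1 - z.1.2.1 * z.2.2.2.2;
       -z.1.2.2.1 * z.2.1 + z.1.1 * z.2.2.2.1, -z.1.2.2.1 * z.2.2.1 + z.1.1 * z.2.2.2.2]
  have hG : Continuous G := by
    refine continuous_matrix fun i j => ?_
    fin_cases i <;> fin_cases j <;> simp [G] <;> fun_prop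
  have hGq : ∀ A B : SL 2 ℝ, G (q4 A, q4 B) = ((A⁻¹ * B : SL 2 ℝ) : Matrix (Fin 2) (Fin 2) ℝ) := by
    intro A B
    ext i j
    have := mul2 A⁻¹ B i j
    refine Eq.trans ?_ this.symm
    fin_cases i <;> fin_cases j <;> simp [G, q4, inv2_00, inv2_01, inv2_10, inv2_11] <;> ring
  have key : {γ | q4 (r γ) ∈ K4 R}.Finite := by
    refine (K4_compact R).induction_on (p := fun S => {γ | q4 (r γ) ∈ S}.Finite) (by simp) ?_ ?_ ?_
    · intro S T hST hT
      exact hT.subset fun γ hγ => hST hγ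
    · intro S T hS hT
      exact (hS.union hT).subset fun γ hγ => hγ
    · intro p hp
      obtain ⟨A, rfl, -⟩ := K4_ex hp
      have h1 : G (q4 A, q4 A) ∈ V := by
        rw [hGq, inv_mul_cancel]
        exact (hV 1 (one_mem _)).2 rfl
      have h2 : G ⁻¹' V ∈ 𝓝 (q4 A, q4 A) := hG.continuousAt.preimage_mem_nhds (hVo.mem_nhds h1)
      rw [nhds_prod_eq] at h2
      obtain ⟨W, hW, hWV⟩ := mem_prod_same_iff.1 h2
      refine ⟨W, mem_nhdsWithin_of_mem_nhds hW, ?_⟩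
      apply Set.Subsingleton.finite
      intro γ hγ γ' hγ'
      have h3 : G (q4 (r γ), q4 (r γ')) ∈ V := hWV (Set.mk_mem_prod hγ hγ')
      rw [hGq, ← map_inv, ← map_mul] at h3
      have h4 := (hV _ ⟨_, rfl⟩).1 h3
      rw [← map_one r] at h4
      exact (inv_mul_eq_one.1 (hi h4))
  exact key.subset fun γ hγ => q4_mem _ hγ

/-- limits of almost-minimal elements -/
lemma exists_w {Γ : Type} [Group Γ] (r : Γ →* SL 2 ℝ) (hnc : ∀ R : ℝ, ∃ m : SL 2 ℝ, ∀ γ, R < N2 (r γ * m)) :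
    ∃ (w : ℝ × ℝ) (ε : ℝ), 0 < ε ∧ ∀ γ, ε ≤ ip (act (r γ) w) (act (r γ) w) := by
  have h1 : ∀ k : ℕ, ∃ m : SL 2 ℝ, (k : ℝ) < N2 m ∧ ∀ γ, N2 m ≤ 2 * N2 (r γ * m) := by
    intro k
    obtain ⟨m, hm⟩ := hnc k
    have hbd : BddBelow (Set.range fun γ => N2 (r γ * m)) := ⟨2, by rintro _ ⟨γ, rfl⟩; exact N2_ge _⟩
    have h2 : 2 ≤ ⨅ γ, N2 (r γ * m) := le_ciInf fun γ => N2_ge _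
    obtain ⟨γ1, h3⟩ := exists_lt_of_ciInf_lt (show (⨅ γ, N2 (r γ * m)) < 2 * ⨅ γ, N2 (r γ * m) by linarith)
    refine ⟨r γ1 * m, hm γ1, fun γ => ?_⟩
    have h4 := ciInf_le hbd (γ * γ1)
    simp only [map_mul, mul_assoc] at h4
    linarith
  choose m hm1 hm2 using h1
  -- normalise
  let p : ℕ → ℝ × ℝ × ℝ × ℝ := fun k => ((m k 0 0) / √(N2 (m k)), (m k 0 1) / √(N2 (m k)), (m k 1 0) / √(N2 (m k)), (m k 1 1) / √(N2 (m k)))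
  have hs : ∀ k, 0 < √(N2 (m k)) := fun k => Real.sqrt_pos.2 (by linarith [N2_ge (m k)])
  have hsq : ∀ k, √(N2 (m k)) ^ 2 = N2 (m k) := fun k => Real.sq_sqrt (by linarith [N2_ge (m k)])
  have hpn : ∀ k, (p k).1 ^ 2 + (p k).2.1 ^ 2 + (p k).2.2.1 ^ 2 + (p k).2.2.2 ^ 2 = 1 := by
    intro k
    simp only [p, div_pow, hsq]
    rw [← add_div, ← add_div, ← add_div, div_eq_one_iff_eq (by linarith [N2_ge (m k)])]
    rfl
  have hpd : ∀ k, (p k).1 * (p k).2.2.2 - (p k).2.1 * (p k).2.2.1 = 1 / N2 (m k) := by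
    intro k
    simp only [p]
    have h2 := hsq k
    have h3 := hs k
    have h4 := det2 (m k)
    generalize √(N2 (m k)) = t at *
    rw [← h2]
    field_simp
    linarith
  let nf : SL 2 ℝ → (ℝ × ℝ × ℝ × ℝ) → ℝ := fun A z =>
    ip (act A (z.1, z.2.2.1)) (act A (z.1, z.2.2.1)) + ip (act A (z.2.1, z.2.2.2)) (act A (z.2.1, z.2.2.2))
  have hpg : ∀ k γ, 1 ≤ 2 * nf (r γ) (p k) := by
    intro k γ
    have h := hm2 k γ
    have e : nf (r γ) (p k) = N2 (r γ * m k) / N2 (m k) := by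
      simp only [nf, p, ip, act]
      have h2 := hsq k
      have h3 := hs k
      generalize √(N2 (m k)) = t at *
      rw [← h2]
      have : N2 (r γ * m k) = ((r γ * m k) 0 0 ^ 2 + (r γ * m k) 1 0 ^ 2) + ((r γ * m k) 0 1 ^ 2 + (r γ * m k) 1 1 ^ 2) := by
        unfold N2; ring
      rw [this, mul2, mul2, mul2, mul2]
      field_simp
    rw [e, ← mul_div_assoc, le_div_iff₀ (by linarith [N2_ge (m k)])]
    linarith
  have hcpt : IsCompact (Set.Icc ((-1, -1, -1, -1) : ℝ × ℝ × ℝ × ℝ) (1, 1, 1, 1)) := isCompact_Icc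
  have hin : ∀ k, p k ∈ Set.Icc ((-1, -1, -1, -1) : ℝ × ℝ × ℝ × ℝ) (1, 1, 1, 1) := by
    intro k
    have h := hpn k
    have e : p k = ((p k).1, (p k).2.1, (p k).2.2.1, (p k).2.2.2) := rfl
    rw [e]
    generalize (p k).1 = a at *
    generalize (p k).2.1 = b at *
    generalize (p k).2.2.1 = c at *
    generalize (p k).2.2.2 = d at *
    simp only [Set.mem_Icc, Prod.mk_le_mk]
    refine ⟨⟨?_, ?_, ?_, ?_⟩, ?_, ?_, ?_, ?_⟩ <;> nlinarith [sq_nonneg a, sq_nonneg b, sq_nonneg c, sq_nonneg d]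
  obtain ⟨z, -, φ, hφ, hz⟩ := hcpt.tendsto_subseq hin
  have hz1 : z.1 ^ 2 + z.2.1 ^ 2 + z.2.2.1 ^ 2 + z.2.2.2 ^ 2 = 1 := by
    have hc : Continuous fun z : ℝ × ℝ × ℝ × ℝ => z.1 ^ 2 + z.2.1 ^ 2 + z.2.2.1 ^ 2 + z.2.2.2 ^ 2 := by fun_prop
    refine tendsto_nhds_unique ((hc.tendsto z).comp hz) ?_
    simp only [Function.comp_def, hpn]
    exact tendsto_const_nhds
  have hz2 : z.1 * z.2.2.2 - z.2.1 * z.2.2.1 = 0 := by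
    have hc : Continuous fun z : ℝ × ℝ × ℝ × ℝ => z.1 * z.2.2.2 - z.2.1 * z.2.2.1 := by fun_prop
    refine tendsto_nhds_unique ((hc.tendsto z).comp hz) ?_
    simp only [Function.comp_def, hpd]
    have : Tendsto (fun k => N2 (m k)) atTop atTop :=
      tendsto_atTop_mono (fun k => (hm1 k).le) tendsto_natCast_atTop_atTop
    simpa [Function.comp_def] using ((tendsto_inv_atTop_zero.comp this).comp hφ.tendsto_atTop)
  have hz3 : ∀ γ, 1 ≤ 2 * nf (r γ) z := by
    intro γ
    have hc : Continuous fun z : ℝ × ℝ × ℝ × ℝ => 2 * nf (r γ) z := by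
      simp only [nf, ip, act]; fun_prop
    exact ge_of_tendsto ((hc.tendsto z).comp hz) (Eventually.of_forall fun k => hpg _ γ)
  -- extract
  by_cases h0 : (z.1, z.2.2.1) = (0 : ℝ × ℝ)
  · refine ⟨(z.2.1, z.2.2.2), 1 / 2, by norm_num, fun γ => ?_⟩
    have := hz3 γ
    simp only [nf, h0] at this
    have e : act (r γ) 0 = 0 := by simp [act]
    rw [e] at this
    simp only [ip] at this ⊢
    simp at this
    linarith
  · have hc : ∃ c : ℝ, (z.2.1, z.2.2.2) = c • (z.1, z.2.2.1) := by
      by_cases h1 : z.1 = 0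
      · have h2 : z.2.2.1 ≠ 0 := by
          intro h2; apply h0; rw [h1, h2]; rfl
        refine ⟨z.2.2.2 / z.2.2.1, ?_⟩
        have h3 : z.2.1 = 0 := by
          rw [h1] at hz2
          have : z.2.1 * z.2.2.1 = 0 := by linarith
          exact (mul_eq_zero.1 this).resolve_right h2
        ext
        · simp [h1, h3]
        · simp; field_simp
      · refine ⟨z.2.1 / z.1, ?_⟩
        ext
        · simp; field_simp
        · simp; field_simp; linarith
    obtain ⟨c, hc⟩ := hc
    refine ⟨(z.1, z.2.2.1), 1 / (2 * (1 + c ^ 2)), by positivity, fun γ => ?_⟩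
    have := hz3 γ
    simp only [nf, hc, act_smul] at this
    rw [div_le_iff₀ (by positivity)]
    generalize act (r γ) (z.1, z.2.2.1) = u at *
    simp only [ip, Prod.smul_fst, Prod.smul_snd, smul_eq_mul] at *
    nlinarith

end
end Hit

namespace Hit
open Filter Topology

section

lemma N2_le_of_pair (A : SL 2 ℝ) (u v : ℝ × ℝ) :
    dt u v ^ 2 * N2 A ≤ 2 * (ip (act A u) (act A u) * ip v v + ip (act A v) (act A v) * ip u u) := by
  have h1 : dt u v * A 0 0 = (act A u).1 * v.2 - (act A v).1 * u.2 := by simp only [dt, act]; ring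
  have h2 : dt u v * A 0 1 = (act A v).1 * u.1 - (act A u).1 * v.1 := by simp only [dt, act]; ring
  have h3 : dt u v * A 1 0 = (act A u).2 * v.2 - (act A v).2 * u.2 := by simp only [dt, act]; ring
  have h4 : dt u v * A 1 1 = (act A v).2 * u.1 - (act A u).2 * v.1 := by simp only [dt, act]; ring
  have : dt u v ^ 2 * N2 A = (dt u v * A 0 0) ^ 2 + (dt u v * A 0 1) ^ 2 + (dt u v * A 1 0) ^ 2 + (dt u v * A 1 1) ^ 2 := by
    unfold N2; ring
  rw [this, h1, h2, h3, h4]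
  simp only [ip]
  generalize act A u = p
  generalize act A v = q
  nlinarith [sq_nonneg (p.1 * v.2 + q.1 * u.2), sq_nonneg (q.1 * u.1 + p.1 * v.1), sq_nonneg (p.2 * v.2 + q.2 * u.2), sq_nonneg (q.2 * u.1 + p.2 * v.1)]

lemma ip_flip (s : SL 2 ℝ) (v u : ℝ × ℝ) (h1 : 0 < ip v u) (h2 : ip (act s v) (act s u) ≤ 0) :
    ip v u ≤ |dt v u| * N2 s ^ 2 := by
  have hu : 0 < ip u u := by
    apply ip_self_pos
    rintro rfl
    simp [ip] at h1
  set J : ℝ × ℝ := (-u.2, u.1) with hJ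
  have e1 : ip u u * ip (act s v) (act s u) = ip v u * ip (act s u) (act s u) - dt v u * ip (act s J) (act s u) := by
    simp only [ip, dt, act, hJ]; ring
  have e2 : |ip (act s J) (act s u)| ≤ N2 s * ip u u := by
    have h3 := act_le s J
    have h4 := act_le s u
    have h5 : ip J J = ip u u := by simp only [ip, hJ]; ring
    rw [h5] at h3
    generalize act s J = p at *
    generalize act s u = q at *
    rw [abs_le]
    unfold ip at *
    constructor <;> nlinarith [sq_nonneg (p.1 - q.1), sq_nonneg (p.2 - q.2), sq_nonneg (p.1 + q.1), sq_nonneg (p.2 + q.2)]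
  have e3 := act_ge s u
  have hN := N2_ge s
  have e4 : ip v u * ip (act s u) (act s u) ≤ |dt v u| * (N2 s * ip u u) := by
    have h5 : dt v u * ip (act s J) (act s u) ≤ |dt v u| * (N2 s * ip u u) :=
      (le_abs_self _).trans (by rw [abs_mul]; exact mul_le_mul_of_nonneg_left e2 (abs_nonneg _))
    have h6 : ip u u * ip (act s v) (act s u) ≤ 0 := mul_nonpos_of_nonneg_of_nonpos hu.le h2
    linarith
  have e5 : ip v u * ip u u ≤ (|dt v u| * N2 s ^ 2) * ip u u := by
    calc ip v u * ip u u ≤ ip v u * (N2 s * ip (act s u) (act s u)) := mul_le_mul_of_nonneg_left e3 h1.le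
      _ = N2 s * (ip v u * ip (act s u) (act s u)) := by ring
      _ ≤ N2 s * (|dt v u| * (N2 s * ip u u)) := mul_le_mul_of_nonneg_left e4 (by linarith)
      _ = _ := by ring
  exact le_of_mul_le_mul_right e5 hu

lemma surface_infinite {g : ℕ} (hg : 2 ≤ g) : Infinite (SurfaceGroup g) := by
  let f : Fin g × Bool → Multiplicative ℤ := fun _ => Multiplicative.ofAdd 1
  have hf : ∀ w ∈ ({surfaceRelator g} : Set (FreeGroup (Fin g × Bool))), FreeGroup.lift f w = 1 := by
    intro w hw
    rw [Set.mem_singleton_iff.1 hw, surfaceRelator, map_list_prod]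
    apply List.prod_eq_one
    intro x hx
    rw [List.mem_map] at hx
    obtain ⟨y, hy, rfl⟩ := hx
    rw [List.mem_ofFn] at hy
    obtain ⟨i, rfl⟩ := hy
    rw [map_commutatorElement, commutatorElement_eq_one_iff_mul_comm, mul_comm]
  let φ : SurfaceGroup g →* Multiplicative ℤ := PresentedGroup.toGroup hf
  have ha : φ (gn (⟨0, by omega⟩, false)) = Multiplicative.ofAdd 1 := by
    simp [φ, gn, f]
  refine Infinite.of_surjective (fun γ => Multiplicative.toAdd (φ γ)) ?_
  intro k
  refine ⟨(gn (⟨0, by omega⟩, false)) ^ k, ?_⟩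
  simp [ha]

variable {g : ℕ} (r : SurfaceGroup g →* SL 2 ℝ) (w : ℝ × ℝ)

def orb (η : SurfaceGroup g) : ℝ × ℝ := act (r η) w

lemma orb_mul (γ η) : orb r w (γ * η) = act (r γ) (orb r w η) := by
  unfold orb; rw [map_mul, act_mul]

def Sim (a b : SurfaceGroup g) : Prop := ∀ᶠ γ in cofinite, 0 < ip (orb r w (γ * a)) (orb r w (γ * b))

variable {r w} {ε : ℝ}

lemma orb_dt (γ a b : SurfaceGroup g) : dt (orb r w (γ * a)) (orb r w (γ * b)) = dt (orb r w a) (orb r w b) := by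
  rw [orb_mul, orb_mul, dt_act]

lemma factF (hfb : ∀ R, {γ | N2 (r γ) ≤ R}.Finite) (hε : 0 < ε) (hw : ∀ γ, ε ≤ ip (orb r w γ) (orb r w γ))
    (a b : SurfaceGroup g) (hd : dt (orb r w a) (orb r w b) ≠ 0) (K : ℝ) :
    {γ | ip (orb r w (γ * a)) (orb r w (γ * b)) ^ 2 ≤ K}.Finite := by
  set d := dt (orb r w a) (orb r w b) with hdd
  set P := ip (orb r w a) (orb r w a)
  set Q := ip (orb r w b) (orb r w b)
  have hP : 0 ≤ P := ip_self_nonneg _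
  have hQ : 0 ≤ Q := ip_self_nonneg _
  have hd2 : 0 < d ^ 2 := by positivity
  refine (hfb (2 * ((K + d ^ 2) / ε * Q + (K + d ^ 2) / ε * P) / d ^ 2)).subset ?_
  intro γ hγ
  simp only [Set.mem_ofPred_eq] at hγ ⊢
  have h1 := ip_dt (orb r w (γ * a)) (orb r w (γ * b))
  rw [orb_dt, ← hdd] at h1
  have ha := hw (γ * a)
  have hb := hw (γ * b)
  have h2 := N2_le_of_pair (r γ) (orb r w a) (orb r w b)
  rw [← orb_mul, ← orb_mul, ← hdd] at h2
  have h3 : ip (orb r w (γ * a)) (orb r w (γ * a)) ≤ (K + d ^ 2) / ε := by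
    rw [le_div_iff₀ hε]; nlinarith
  have h4 : ip (orb r w (γ * b)) (orb r w (γ * b)) ≤ (K + d ^ 2) / ε := by
    rw [le_div_iff₀ hε]; nlinarith
  rw [le_div_iff₀ hd2]
  have h5 := mul_le_mul_of_nonneg_right h3 hQ
  have h6 := mul_le_mul_of_nonneg_right h4 hP
  change d ^ 2 * N2 (r γ) ≤ 2 * (ip (orb r w (γ * a)) (orb r w (γ * a)) * Q + ip (orb r w (γ * b)) (orb r w (γ * b)) * P) at h2
  linarith

lemma sim_dich (hfb : ∀ R, {γ | N2 (r γ) ≤ R}.Finite) (hε : 0 < ε) (hw : ∀ γ, ε ≤ ip (orb r w γ) (orb r w γ))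
    (a b : SurfaceGroup g) : Sim r w a b ∨ ∀ᶠ γ in cofinite, ip (orb r w (γ * a)) (orb r w (γ * b)) < 0 := by
  have hflip : ∀ s : SurfaceGroup g, {γ | 0 < ip (orb r w (γ * a)) (orb r w (γ * b)) ∧ ip (orb r w (s * γ * a)) (orb r w (s * γ * b)) ≤ 0}.Finite := by
    intro s
    by_cases hd : dt (orb r w a) (orb r w b) = 0
    · convert Set.finite_empty
      ext γ
      simp only [Set.mem_ofPred_eq, Set.mem_empty_iff_false, iff_false, not_and]
      intro h1 h2
      rw [mul_assoc, mul_assoc, orb_mul r w s, orb_mul r w s] at h2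
      have := ip_flip _ _ _ h1 h2
      rw [orb_dt, hd] at this
      simp at this
      linarith
    · refine (factF hfb hε hw a b hd ((|dt (orb r w a) (orb r w b)| * N2 (r s) ^ 2) ^ 2)).subset ?_
      rintro γ ⟨h1, h2⟩
      rw [mul_assoc, mul_assoc, orb_mul r w s, orb_mul r w s] at h2
      have := ip_flip _ _ _ h1 h2
      rw [orb_dt] at this
      exact pow_le_pow_left₀ h1.le this 2
  have hz : {γ | ip (orb r w (γ * a)) (orb r w (γ * b)) = 0}.Finite := by
    by_cases hd : dt (orb r w a) (orb r w b) = 0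
    · convert Set.finite_empty
      ext γ
      simp only [Set.mem_ofPred_eq, Set.mem_empty_iff_false, iff_false]
      intro h
      have h1 := ip_dt (orb r w (γ * a)) (orb r w (γ * b))
      rw [orb_dt, hd, h] at h1
      have ha := hw (γ * a)
      have hb := hw (γ * b)
      nlinarith
    · refine (factF hfb hε hw a b hd 0).subset ?_
      intro γ hγ
      simp only [Set.mem_ofPred_eq] at hγ ⊢
      rw [hγ]; simp
  rcases one_ended_set {γ | 0 < ip (orb r w (γ * a)) (orb r w (γ * b))} (by
    intro x
    refine ((hflip (gn x)).union ((hflip (gn x)⁻¹).preimage (f := fun γ => gn x * γ) ((mul_right_injective (gn x)).injOn))).subset ?_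
    intro γ hγ
    simp only [Set.mem_ofPred_eq, Set.mem_union, Set.mem_preimage] at hγ ⊢
    rw [inv_mul_cancel_left]
    by_cases h1 : 0 < ip (orb r w (γ * a)) (orb r w (γ * b))
    · left
      refine ⟨h1, ?_⟩
      by_contra h2
      push Not at h2
      exact hγ ⟨fun _ => h1, fun _ => h2⟩
    · right
      refine ⟨?_, by push Not at h1; exact h1⟩
      by_contra h2
      exact hγ ⟨fun h => absurd h h2, fun h => absurd h h1⟩) with h | h
  · right
    rw [eventually_cofinite]
    refine (h.union hz).subset ?_
    intro γ hγ
    simp only [Set.mem_ofPred_eq, Set.mem_union, not_lt] at hγ ⊢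
    rcases hγ.lt_or_eq with h | h
    · exact Or.inl h
    · exact Or.inr h.symm
  · left
    exact h

lemma sim_trans_aux (hfb : ∀ R, {γ | N2 (r γ) ≤ R}.Finite) (hε : 0 < ε) (hw : ∀ γ, ε ≤ ip (orb r w γ) (orb r w γ))
    (a b c : SurfaceGroup g) : ∀ᶠ γ in cofinite, 0 < ip (orb r w (γ * a)) (orb r w (γ * b)) * ip (orb r w (γ * b)) (orb r w (γ * c)) →
      0 < ip (orb r w (γ * a)) (orb r w (γ * c)) := by
  set D := dt (orb r w a) (orb r w b) * dt (orb r w b) (orb r w c) with hD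
  have hb : ∀ γ, 0 < ip (orb r w (γ * b)) (orb r w (γ * b)) := fun γ => hε.trans_le (hw _)
  have hid : ∀ γ, ip (orb r w (γ * b)) (orb r w (γ * b)) * ip (orb r w (γ * a)) (orb r w (γ * c)) =
      ip (orb r w (γ * a)) (orb r w (γ * b)) * ip (orb r w (γ * b)) (orb r w (γ * c)) - D := by
    intro γ
    rw [ip_trans, orb_dt, orb_dt]
  by_cases h0 : D = 0
  · refine Eventually.of_forall fun γ hγ => ?_
    have := hid γ
    rw [h0, sub_zero] at this
    rw [← this] at hγ
    exact (pos_iff_pos_of_mul_pos hγ).1 (hb γ)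
  · have h1 := factF hfb hε hw a b (left_ne_zero_of_mul h0) |D|
    have h2 := factF hfb hε hw b c (right_ne_zero_of_mul h0) |D|
    rw [eventually_cofinite]
    refine (h1.union h2).subset ?_
    intro γ hγ
    simp only [Set.mem_ofPred_eq, Set.mem_union] at hγ ⊢
    by_contra hc
    push Not at hc
    apply hγ
    intro hpos
    have h3 : D ^ 2 < (ip (orb r w (γ * a)) (orb r w (γ * b)) * ip (orb r w (γ * b)) (orb r w (γ * c))) ^ 2 := by
      rw [← sq_abs D, sq |D|, mul_pow]
      exact mul_lt_mul'' hc.1 hc.2 (abs_nonneg _) (abs_nonneg _)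
    have h4 := abs_lt_of_sq_lt_sq h3 hpos.le
    have h5 : 0 < ip (orb r w (γ * b)) (orb r w (γ * b)) * ip (orb r w (γ * a)) (orb r w (γ * c)) := by
      rw [hid]; linarith [(abs_lt.1 h4).2]
    exact (pos_iff_pos_of_mul_pos h5).1 (hb γ)

end
end Hit

namespace Hit
open Filter Topology

section
variable {g : ℕ} {r : SurfaceGroup g →* SL 2 ℝ} {w : ℝ × ℝ} {ε : ℝ}

lemma Sim.symm {a b : SurfaceGroup g} (h : Sim r w a b) : Sim r w b a := by
  unfold Sim at *
  simpa only [ip_comm] using h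

lemma Sim.shift {a b : SurfaceGroup g} (η) (h : Sim r w a b) : Sim r w (η * a) (η * b) := by
  have := ((mul_left_injective η).tendsto_cofinite).eventually h
  simpa only [Sim, mul_assoc] using this

lemma Sim.trans (hfb : ∀ R, {γ | N2 (r γ) ≤ R}.Finite) (hε : 0 < ε) (hw : ∀ γ, ε ≤ ip (orb r w γ) (orb r w γ))
    {a b c : SurfaceGroup g} (h1 : Sim r w a b) (h2 : Sim r w b c) : Sim r w a c := by
  filter_upwards [h1, h2, sim_trans_aux hfb hε hw a b c] with γ h3 h4 h5
  exact h5 (mul_pos h3 h4)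

lemma Sim.sq (hfb : ∀ R, {γ | N2 (r γ) ≤ R}.Finite) (hε : 0 < ε) (hw : ∀ γ, ε ≤ ip (orb r w γ) (orb r w γ))
    (η : SurfaceGroup g) : Sim r w 1 (η ^ 2) := by
  rcases sim_dich hfb hε hw 1 η with h | h
  · have h2 := h.shift η
    rw [mul_one, ← pow_two] at h2
    exact h.trans hfb hε hw h2
  · have h2 := ((mul_left_injective η).tendsto_cofinite).eventually h
    simp only [mul_assoc, mul_one] at h2
    filter_upwards [h, h2, sim_trans_aux hfb hε hw 1 η (η ^ 2)] with γ h3 h4 h5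
    rw [← pow_two] at h4
    exact h5 (mul_pos_of_neg_of_neg h3 h4)

/-- no positive relation -/
lemma no_rel [Infinite (SurfaceGroup g)] {a b c : SurfaceGroup g} (h1 : Sim r w a b) (h2 : Sim r w c b)
    (hε : 0 < ε) (hw : ∀ γ, ε ≤ ip (orb r w γ) (orb r w γ))
    {x y z : ℝ} (hx : 0 ≤ x) (hy : 0 < y) (hz : 0 ≤ z) (h : x • orb r w a + y • orb r w b + z • orb r w c = 0) : False := by
  obtain ⟨γ, h3, h4⟩ := (h1.and h2).exists
  have h5 := congrArg (act (r γ)) h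
  rw [act_add, act_add, act_smul, act_smul, act_smul, ← orb_mul, ← orb_mul, ← orb_mul] at h5
  have h6 : act (r γ) 0 = 0 := by simp [act]
  rw [h6] at h5
  have h7 := congrArg (fun v => ip v (orb r w (γ * b))) h5
  have h8 : x * ip (orb r w (γ * a)) (orb r w (γ * b)) + y * ip (orb r w (γ * b)) (orb r w (γ * b)) + z * ip (orb r w (γ * c)) (orb r w (γ * b)) = 0 := by
    simp only [ip, Prod.fst_add, Prod.snd_add, Prod.smul_fst, Prod.smul_snd, smul_eq_mul, Prod.fst_zero, Prod.snd_zero] at h7 ⊢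
    linarith
  have h9 := mul_pos hy (hε.trans_le (hw (γ * b)))
  have h10 := mul_nonneg hx h3.le
  have h11 := mul_nonneg hz h4.le
  linarith

theorem cocompact (hg : 2 ≤ g) (r : SurfaceGroup g →* SL 2 ℝ) (hr : Function.Injective r)
    (hfb : ∀ R, {γ | N2 (r γ) ≤ R}.Finite) : ∃ R : ℝ, ∀ m : SL 2 ℝ, ∃ γ, N2 (r γ * m) ≤ R := by
  by_contra hnc
  push Not at hnc
  obtain ⟨w, ε, hε, hw⟩ := exists_w r hnc
  change ∀ γ, ε ≤ ip (orb r w γ) (orb r w γ) at hw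
  haveI := surface_infinite hg
  have hrefl : Sim r w 1 1 := by
    refine Eventually.of_forall fun γ => ?_
    exact hε.trans_le (hw _)
  have hsim : ∀ {a b}, Sim r w 1 a → Sim r w 1 b → Sim r w a b := fun ha hb => ha.symm.trans hfb hε hw hb
  have htrans : ∀ a b c, Sim r w 1 a → Sim r w 1 b → Sim r w 1 c → 0 ≤ dt (orb r w a) (orb r w b) → 0 ≤ dt (orb r w b) (orb r w c) → 0 ≤ dt (orb r w a) (orb r w c) := by
    intro a b c ha hb hc h1 h2
    by_contra h3
    push Not at h3
    refine no_rel (hsim ha hb) (hsim hc hb) hε hw h2 (y := dt (orb r w c) (orb r w a)) (by rw [dt_comm]; linarith) h1 ?_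
    generalize orb r w a = p
    generalize orb r w b = q
    generalize orb r w c = s
    ext
    · simp [dt]; ring
    · simp [dt]; ring
  have hmax : ∀ F : Finset {η // Sim r w 1 η}, ∃ a, Sim r w 1 a ∧ ∀ η ∈ F, 0 ≤ dt (orb r w η.1) (orb r w a) := by
    classical
    intro F
    induction F using Finset.induction_on with
    | empty => exact ⟨1, hrefl, by simp⟩
    | insert b F hb ih =>
      obtain ⟨a, ha, hF⟩ := ih
      by_cases h : 0 ≤ dt (orb r w b.1) (orb r w a)
      · refine ⟨a, ha, fun η hη => ?_⟩
        rcases Finset.mem_insert.1 hη with rfl | hη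
        · exact h
        · exact hF η hη
      · refine ⟨b.1, b.2, fun η hη => ?_⟩
        rcases Finset.mem_insert.1 hη with rfl | hη
        · simp [dt]; linarith
        · refine htrans _ a _ η.2 ha b.2 (hF η hη) ?_
          push Not at h
          rw [dt_comm]; linarith
  let nrm : SurfaceGroup g → ℝ × ℝ := fun η => (1 / √(ip (orb r w η) (orb r w η))) • orb r w η
  have hsq : ∀ η, 0 < √(ip (orb r w η) (orb r w η)) := fun η => Real.sqrt_pos.2 (hε.trans_le (hw η))
  have hnrm : ∀ η, ip (nrm η) (nrm η) = 1 := by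
    intro η
    have h1 := Real.sq_sqrt (hε.trans_le (hw η)).le
    have h2 := hsq η
    have h3 : ip (nrm η) (nrm η) = (1 / √(ip (orb r w η) (orb r w η))) ^ 2 * ip (orb r w η) (orb r w η) := by
      simp only [nrm]
      generalize 1 / √(ip (orb r w η) (orb r w η)) = t
      simp only [ip, Prod.smul_fst, Prod.smul_snd, smul_eq_mul]; ring
    rw [h3, div_pow, h1, one_pow, one_div, inv_mul_cancel₀ (hε.trans_le (hw η)).ne']
  let D : Set (ℝ × ℝ) := nrm '' {η | Sim r w 1 η}
  have hipc : Continuous fun v : ℝ × ℝ => ip v v := by unfold ip; fun_prop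
  have hD1 : closure D ⊆ {v | ip v v = 1} := by
    apply closure_minimal
    · rintro _ ⟨η, -, rfl⟩
      exact hnrm η
    · exact isClosed_eq hipc continuous_const
  have hDc : IsCompact (closure D) := by
    refine IsCompact.of_isClosed_subset (isCompact_Icc (a := ((-1, -1) : ℝ × ℝ)) (b := (1, 1))) isClosed_closure ?_
    intro v hv
    have h1 := hD1 hv
    obtain ⟨a, b⟩ := v
    simp only [Set.mem_ofPred_eq, ip] at h1
    simp only [Set.mem_Icc, Prod.mk_le_mk]
    refine ⟨⟨?_, ?_⟩, ?_, ?_⟩ <;> nlinarith [sq_nonneg a, sq_nonneg b]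
  have hdtc : ∀ v, Continuous fun u => dt v u := by intro v; unfold dt; fun_prop
  obtain ⟨e, heD, he⟩ := hDc.inter_iInter_nonempty (fun η : {η // Sim r w 1 η} => {u | 0 ≤ dt (orb r w η.1) u})
    (fun η => isClosed_le continuous_const (hdtc _)) (by
      intro F
      obtain ⟨a, ha, hF⟩ := hmax F
      refine ⟨nrm a, subset_closure ⟨a, ha, rfl⟩, ?_⟩
      simp only [Set.mem_iInter, Set.mem_ofPred_eq]
      intro η hη
      have h1 := hF η hη
      have h2 : dt (orb r w η.1) (nrm a) = (1 / √(ip (orb r w a) (orb r w a))) * dt (orb r w η.1) (orb r w a) := by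
        simp only [nrm, dt, Prod.smul_fst, Prod.smul_snd, smul_eq_mul]; ring
      rw [h2]
      have := hsq a
      positivity)
  simp only [Set.mem_iInter, Set.mem_ofPred_eq] at he
  have hmain : ∀ γ, Sim r w 1 γ → 0 ≤ dt (act (r γ) e) e := by
    intro γ hγ
    have hc : IsClosed {u | 0 ≤ dt (act (r γ) u) e} := by
      refine isClosed_le continuous_const ?_
      unfold dt act; fun_prop
    refine closure_minimal ?_ hc heD
    rintro _ ⟨η, hη, rfl⟩
    simp only [Set.mem_ofPred_eq]
    have h1 : Sim r w 1 (γ * η) := by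
      have := hη.shift γ
      rw [mul_one] at this
      exact hγ.trans hfb hε hw this
    have h2 := he ⟨_, h1⟩
    simp only [orb_mul] at h2
    have h3 : dt (act (r γ) (nrm η)) e = (1 / √(ip (orb r w η) (orb r w η))) * dt (act (r γ) (orb r w η)) e := by
      simp only [nrm, act_smul]
      simp only [dt, Prod.smul_fst, Prod.smul_snd, smul_eq_mul]; ring
    rw [h3]
    have := hsq η
    positivity
  have hne : e ≠ 0 := by
    rintro rfl
    have := hD1 heD
    simp [ip] at this
  refine no_line hg r hr e hne fun γ => ?_
  have h1 := hmain _ (Sim.sq hfb hε hw γ)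
  have h2 := hmain _ (Sim.sq hfb hε hw γ⁻¹)
  rw [← dt_act (r (γ ^ 2)), ← act_mul, ← map_mul] at h2
  have : γ ^ 2 * γ⁻¹ ^ 2 = 1 := by group
  rw [this, map_one, act_one, dt_comm] at h2
  linarith

end
end Hit

namespace Hit
open Filter Topology

/-! ## Module F : dynamics of cocompact groups on the circle -/
section
variable {Γ : Type} [Group Γ]

structure Good (r : Γ →* SL 2 ℝ) : Prop where
  fb : ∀ R, {γ | N2 (r γ) ≤ R}.Finite
  cc : ∃ R : ℝ, ∀ m : SL 2 ℝ, ∃ γ, N2 (r γ * m) ≤ R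
  nl : ∀ v : ℝ × ℝ, v ≠ 0 → ∃ γ, dt (act (r γ) v) v ≠ 0

lemma good_of {g : ℕ} (hg : 2 ≤ g) (r : SurfaceGroup g →* SL 2 ℝ) (hr : Function.Injective r)
    (hfb : ∀ R, {γ | N2 (r γ) ≤ R}.Finite) : Good r where
  fb := hfb
  cc := cocompact hg r hr hfb
  nl := by
    intro v hv
    by_contra hc
    push Not at hc
    exact no_line hg r hr v hv fun γ => hc _

lemma tendsto_entry {α : Type*} {l : Filter α} {f : α → SL 2 ℝ} {A : SL 2 ℝ} (h : Tendsto (fun k => q4 (f k)) l (𝓝 (q4 A))) (i j : Fin 2) :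
    Tendsto (fun k => f k i j) l (𝓝 (A i j)) := by
  have h1 := (continuous_fst.tendsto _).comp h
  have h2 := (continuous_fst.tendsto _).comp ((continuous_snd.tendsto _).comp h)
  have h3 := (continuous_fst.tendsto _).comp ((continuous_snd.tendsto _).comp ((continuous_snd.tendsto _).comp h))
  have h4 := (continuous_snd.tendsto _).comp ((continuous_snd.tendsto _).comp ((continuous_snd.tendsto _).comp h))
  fin_cases i <;> fin_cases j
  · exact h1
  · exact h2
  · exact h3
  · exact h4

lemma exists_contract {r : Γ →* SL 2 ℝ} (hr : Good r) (g : SL 2 ℝ) :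
    ∃ η : ℕ → Γ, (∀ᶠ k in atTop, (g⁻¹ * r (η k) * g) 0 0 ≠ 0) ∧
      ∀ i j : Fin 2, (i, j) ≠ (0, 0) → Tendsto (fun k => (g⁻¹ * r (η k) * g) i j / (g⁻¹ * r (η k) * g) 0 0) atTop (𝓝 0) := by
  obtain ⟨R, hR⟩ := hr.cc
  choose γ hγ using fun k : ℕ => hR (g * D2 k)
  choose δ hδ using fun k : ℕ => hR (g * D2 (-k))
  obtain ⟨z, hz, φ, hφ, hlim⟩ := ((K4_compact R).prod (K4_compact R)).tendsto_subseq
    (x := fun k : ℕ => (q4 (r (γ k) * (g * D2 k)), q4 (r (δ k) * (g * D2 (-k)))))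
    (fun k => Set.mk_mem_prod (q4_mem _ (hγ k)) (q4_mem _ (hδ k)))
  obtain ⟨c, hc, -⟩ := K4_ex hz.1
  obtain ⟨d, hd, -⟩ := K4_ex hz.2
  set cs : ℕ → SL 2 ℝ := fun k => r (γ (φ k)) * (g * D2 (φ k)) with hcs
  set ds : ℕ → SL 2 ℝ := fun k => r (δ (φ k)) * (g * D2 (-(φ k))) with hds
  have hcl : Tendsto (fun k => q4 (cs k)) atTop (𝓝 (q4 c)) := by
    rw [hc]; exact (continuous_fst.tendsto _).comp hlim
  have hdl : Tendsto (fun k => q4 (ds k)) atTop (𝓝 (q4 d)) := by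
    rw [hd]; exact (continuous_snd.tendsto _).comp hlim
  obtain ⟨σ, hσ⟩ : ∃ σ, (c⁻¹ * r σ * d) 0 0 ≠ 0 := by
    have e : ∀ σ, (c⁻¹ * r σ * d) 0 0 = dt (act (r σ) (act d (1, 0))) (act c (0, 1)) := by
      intro σ
      rw [← dt_act c⁻¹, act_inv, ← act_mul, ← act_mul]
      simp [act, dt, mul_assoc]
    simp only [e]
    by_cases h1 : dt (act (r 1) (act d (1, 0))) (act c (0, 1)) ≠ 0
    · exact ⟨1, h1⟩
    · push Not at h1
      rw [map_one, act_one] at h1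
      set v := act d (1, 0)
      set u := act c (0, 1)
      have hv : v ≠ 0 := by
        intro h
        have := dt_act d (1, 0) (0, 1)
        change dt v _ = _ at this
        rw [h] at this
        simp [dt] at this
      have hu : u ≠ 0 := by
        intro h
        have := dt_act c (1, 0) (0, 1)
        change dt _ u = _ at this
        rw [h] at this
        simp [dt] at this
      obtain ⟨σ, hs⟩ := hr.nl v hv
      refine ⟨σ, fun h => hs ?_⟩
      -- u parallel to v
      have hid : ip u u * dt (act (r σ) v) v = ip v u * dt (act (r σ) v) u - dt v u * ip (act (r σ) v) u := by
        unfold ip dt; ring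
      rw [h, h1] at hid
      have := ip_self_pos hu
      have h5 : ip u u * dt (act (r σ) v) v = 0 := by linarith
      exact (mul_eq_zero.1 h5).resolve_left this.ne'
  set M : ℕ → SL 2 ℝ := fun k => (cs k)⁻¹ * r σ * ds k with hM
  have hMl : ∀ i j, Tendsto (fun k => M k i j) atTop (𝓝 ((c⁻¹ * r σ * d) i j)) := by
    have c00 := tendsto_entry hcl 0 0
    have c01 := tendsto_entry hcl 0 1
    have c10 := tendsto_entry hcl 1 0
    have c11 := tendsto_entry hcl 1 1
    have d0 := fun j => tendsto_entry hdl 0 j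
    have d1 := fun j => tendsto_entry hdl 1 j
    intro i j
    simp only [hM, mul2]
    fin_cases i
    · simp only [Fin.zero_eta, inv2_00, inv2_01]
      exact ((((c11.mul_const _).add (c01.neg.mul_const _)).mul (d0 j)).add (((c11.mul_const _).add (c01.neg.mul_const _)).mul (d1 j)))
    · simp only [Fin.mk_one, inv2_10, inv2_11]
      exact ((((c10.neg.mul_const _).add (c00.mul_const _)).mul (d0 j)).add (((c10.neg.mul_const _).add (c00.mul_const _)).mul (d1 j)))
  have heq : ∀ k, g⁻¹ * r ((γ (φ k))⁻¹ * σ * δ (φ k)) * g = D2 (φ k) * M k * D2 (φ k) := by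
    intro k
    simp only [hM, hcs, hds, map_mul, map_inv, _root_.mul_inv_rev]
    have h1 : ∀ x : ℝ, (D2 x)⁻¹ = D2 (-x) := by
      intro x
      rw [inv_eq_iff_mul_eq_one, ← D2_add, add_neg_cancel, D2_zero]
    have h2 : D2 (-(φ k : ℝ)) = (D2 (φ k))⁻¹ := (h1 _).symm
    rw [h2]
    group
  refine ⟨fun k => (γ (φ k))⁻¹ * σ * δ (φ k), ?_, ?_⟩
  · have := (hMl 0 0).eventually_ne hσ
    filter_upwards [this] with k hk
    rw [heq]
    simp only [mul2, D2_00, D2_01, D2_10, D2_11]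
    simp [hk, Real.exp_ne_zero]
  · have he0 : Tendsto (fun k : ℕ => Real.exp (-(φ k : ℝ))) atTop (𝓝 0) :=
      Real.tendsto_exp_neg_atTop_nhds_zero.comp (tendsto_natCast_atTop_atTop.comp hφ.tendsto_atTop)
    have he2 : Tendsto (fun k : ℕ => Real.exp (-(φ k : ℝ)) ^ 2) atTop (𝓝 0) := by simpa using he0.pow 2
    have he4 : Tendsto (fun k : ℕ => Real.exp (-(φ k : ℝ)) ^ 4) atTop (𝓝 0) := by simpa using he0.pow 4
    intro i j hij
    simp only [heq]
    have hdiv : Tendsto (fun k => M k i j / M k 0 0) atTop (𝓝 ((c⁻¹ * r σ * d) i j / (c⁻¹ * r σ * d) 0 0)) := (hMl i j).div (hMl 0 0) hσ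
    have hx : ∀ k : ℕ, Real.exp (φ k : ℝ) = (Real.exp (-(φ k : ℝ)))⁻¹ := by intro k; rw [Real.exp_neg, _root_.inv_inv]
    have hpos : ∀ k : ℕ, Real.exp (-(φ k : ℝ)) ≠ 0 := fun k => Real.exp_ne_zero _
    fin_cases i <;> fin_cases j
    · simp at hij
    · have h := he2.mul hdiv
      rw [zero_mul] at h
      refine h.congr fun k => ?_
      simp only [mul2, D2_00, D2_01, D2_10, D2_11, hx, Fin.zero_eta, Fin.mk_one]
      have := hpos k
      generalize Real.exp (-(φ k : ℝ)) = t at *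
      field_simp
      ring_nf
    · have h := he2.mul hdiv
      rw [zero_mul] at h
      refine h.congr fun k => ?_
      simp only [mul2, D2_00, D2_01, D2_10, D2_11, hx, Fin.zero_eta, Fin.mk_one]
      have := hpos k
      generalize Real.exp (-(φ k : ℝ)) = t at *
      field_simp
      ring_nf
    · have h := he4.mul hdiv
      rw [zero_mul] at h
      refine h.congr fun k => ?_
      simp only [mul2, D2_00, D2_01, D2_10, D2_11, hx, Fin.mk_one]
      have := hpos k
      generalize Real.exp (-(φ k : ℝ)) = t at *
      field_simp
      ring_nf

lemma exists_attract {r : Γ →* SL 2 ℝ} (hr : Good r) {p q : ℝ × ℝ} (hpq : dt p q ≠ 0) :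
    ∃ (η : ℕ → Γ) (c : ℕ → ℝ), ∀ u, Tendsto (fun k => c k • act (r (η k)) u) atTop (𝓝 (dt u q • p)) := by
  set d := dt p q with hd
  let g : SL 2 ℝ := ⟨!![p.1, q.1 / d; p.2, q.2 / d], by
    rw [Matrix.det_fin_two_of]; field_simp; rw [hd]; unfold dt; ring⟩
  have g00 : g 0 0 = p.1 := rfl
  have g01 : g 0 1 = q.1 / d := rfl
  have g10 : g 1 0 = p.2 := rfl
  have g11 : g 1 1 = q.2 / d := rfl
  obtain ⟨η, h0, h1⟩ := exists_contract hr g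
  have h01 := h1 0 1 (by simp)
  have h10 := h1 1 0 (by simp)
  have h11 := h1 1 1 (by simp)
  refine ⟨η, fun k => d / (g⁻¹ * r (η k) * g) 0 0, fun u => ?_⟩
  set α := dt u q / d with hα
  set β := dt p u with hβ
  have hlim : Tendsto (fun k => d • ((α + (g⁻¹ * r (η k) * g) 0 1 / (g⁻¹ * r (η k) * g) 0 0 * β) • p +
      ((g⁻¹ * r (η k) * g) 1 0 / (g⁻¹ * r (η k) * g) 0 0 * α + (g⁻¹ * r (η k) * g) 1 1 / (g⁻¹ * r (η k) * g) 0 0 * β) • ((1 / d) • q)))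
      atTop (𝓝 (d • ((α + 0 * β) • p + (0 * α + 0 * β) • ((1 / d) • q)))) :=
    ((((h01.mul_const β).const_add α).smul_const p).add (((h10.mul_const α).add (h11.mul_const β)).smul_const _)).const_smul d
  have e : d • ((α + 0 * β) • p + (0 * α + 0 * β) • ((1 / d) • q)) = dt u q • p := by
    simp only [zero_mul, add_zero, zero_smul, smul_smul, hα]
    rw [mul_div_cancel₀ _ hpq]
  rw [e] at hlim
  refine hlim.congr' ?_
  filter_upwards [h0] with k hk
  have hu : act (r (η k)) u = act g (act (g⁻¹ * r (η k) * g) (α, β)) := by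
    rw [← act_mul]
    have h2 : act g (α, β) = u := by
      simp only [act, g00, g01, g10, g11, hα, hβ]
      ext
      · simp only
        field_simp
        simp only [hd, dt]; ring
      · simp only
        field_simp
        simp only [hd, dt]; ring
    have h3 : g * (g⁻¹ * r (η k) * g) = r (η k) * g := by group
    rw [h3, act_mul, h2]
  rw [hu]
  set M := g⁻¹ * r (η k) * g
  simp only [act, g00, g01, g10, g11]
  ext
  · simp
    field_simp
  · simp
    field_simp

end
end Hit

namespace Hit
open Filter Topology

section
variable {Γ : Type} [Group Γ]

lemma cont_fst2 {f : ℕ → ℝ × ℝ} {p : ℝ × ℝ} (h : Tendsto f atTop (𝓝 p)) : Tendsto (fun k => (f k).1) atTop (𝓝 p.1) :=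
  (continuous_fst.tendsto _).comp h
lemma cont_snd2 {f : ℕ → ℝ × ℝ} {p : ℝ × ℝ} (h : Tendsto f atTop (𝓝 p)) : Tendsto (fun k => (f k).2) atTop (𝓝 p.2) :=
  (continuous_snd.tendsto _).comp h

lemma cstar {r : Γ →* SL 2 ℝ} (hr : Good r) (m : SL 2 ℝ) {s t : ℝ} (hst : s < t) :
    ∃ η, 0 < (act (r η) (act m (1, 0))).2 * (act (r η) (act m (0, 1))).2 ∧
      s * (act (r η) (act m (0, 1))).2 ^ 2 < (act (r η) (act m (0, 1))).1 * (act (r η) (act m (0, 1))).2 ∧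
      (act (r η) (act m (1, 0))).1 * (act (r η) (act m (1, 0))).2 < t * (act (r η) (act m (1, 0))).2 ^ 2 := by
  set q := act m (1, -1) with hq
  have h1 : dt (act m (1, 0)) q = -1 := by rw [hq, dt_act]; simp [dt]
  have h2 : dt (act m (0, 1)) q = -1 := by rw [hq, dt_act]; simp [dt]
  obtain ⟨x, hx1, hx2, hx⟩ : ∃ x, s < x ∧ x < t ∧ dt (x, 1) q ≠ 0 := by
    by_contra hc
    push Not at hc
    have e1 := hc ((2 * s + t) / 3) (by linarith) (by linarith)
    have e2 := hc ((s + 2 * t) / 3) (by linarith) (by linarith)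
    simp only [dt] at e1 e2
    have e3 : (t - s) * q.2 = 0 := by linarith
    have e4 : q.2 = 0 := (mul_eq_zero.1 e3).resolve_left (by linarith)
    have e5 : q.1 = 0 := by rw [e4] at e1; linarith
    simp [dt, e4, e5] at h1
  obtain ⟨η, c, hl⟩ := exists_attract hr hx
  have ha := hl (act m (1, 0))
  have hb := hl (act m (0, 1))
  rw [h1] at ha
  rw [h2] at hb
  have a1 := cont_fst2 ha
  have a2 := cont_snd2 ha
  have b1 := cont_fst2 hb
  have b2 := cont_snd2 hb
  simp only [Prod.smul_fst, Prod.smul_snd, smul_eq_mul] at a1 a2 b1 b2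
  have l1 := (a2.mul b2).eventually (lt_mem_nhds (a := 0) (by norm_num))
  have l2 := ((b1.mul b2).sub ((b2.pow 2).const_mul s)).eventually (lt_mem_nhds (a := 0) (by linarith))
  have l3 := (((a2.pow 2).const_mul t).sub (a1.mul a2)).eventually (lt_mem_nhds (a := 0) (by linarith))
  obtain ⟨k, hk1, hk2, hk3⟩ := (l1.and (l2.and l3)).exists
  refine ⟨η k, ?_⟩
  generalize act (r (η k)) (act m (1, 0)) = a at *
  generalize act (r (η k)) (act m (0, 1)) = b at *
  generalize c k = c at *
  have hc : 0 < c ^ 2 := by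
    apply lt_of_le_of_ne (sq_nonneg _)
    intro h
    have : c = 0 := by simpa using h.symm
    rw [this] at hk1
    simp at hk1
  refine ⟨?_, ?_, ?_⟩
  · exact pos_of_mul_pos_right (a := c ^ 2) (by linarith) hc.le
  · have : 0 < b.1 * b.2 - s * b.2 ^ 2 := pos_of_mul_pos_right (a := c ^ 2) (by linarith) hc.le
    linarith
  · have : 0 < t * a.2 ^ 2 - a.1 * a.2 := pos_of_mul_pos_right (a := c ^ 2) (by linarith) hc.le
    linarith

lemma cone {r : Γ →* SL 2 ℝ} (hr : Good r) {w' w : ℝ × ℝ} (h : 0 < dt w' w) :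
    ∃ η, 0 < dt w' (act (r η) (0, 1)) * dt (act (r η) (0, 1)) w := by
  set p := w' + w with hp
  have p1 : dt w' p = dt w' w := by simp only [hp, dt, Prod.fst_add, Prod.snd_add]; ring
  have p2 : dt p w = dt w' w := by simp only [hp, dt, Prod.fst_add, Prod.snd_add]; ring
  obtain ⟨y, hy⟩ : ∃ y, dt p (1, y) ≠ 0 := by
    by_contra hc
    push Not at hc
    have e1 := hc 0
    have e2 := hc 1
    simp only [dt] at e1 e2
    have e3 : p.2 = 0 := by linarith
    have e4 : p.1 = 0 := by linarith
    simp only [dt, e3, e4] at p1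
    simp only [dt] at h
    linarith
  obtain ⟨η, c, hl⟩ := exists_attract hr hy
  have ha := hl (0, 1)
  have e : dt (0, 1) (1, y) = -1 := by simp [dt]
  rw [e] at ha
  have a1 := cont_fst2 ha
  have a2 := cont_snd2 ha
  simp only [Prod.smul_fst, Prod.smul_snd, smul_eq_mul] at a1 a2
  have l1 := (((a2.const_mul w'.1).sub (a1.const_mul w'.2)).mul ((a1.mul_const w.2).sub (a2.mul_const w.1))).eventually
    (lt_mem_nhds (a := 0) (by
      have := mul_pos h h
      have e1 := congrArg₂ (· * ·) p1 p2
      simp only [dt] at e1 this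
      linarith))
  obtain ⟨k, hk⟩ := l1.exists
  refine ⟨η k, ?_⟩
  generalize act (r (η k)) (0, 1) = a at *
  generalize c k = c at *
  have hc : 0 < c ^ 2 := by
    apply lt_of_le_of_ne (sq_nonneg _)
    intro h
    have : c = 0 := by simpa using h.symm
    rw [this] at hk
    simp at hk
  refine pos_of_mul_pos_right (a := c ^ 2) ?_ hc.le
  unfold dt
  linarith

lemma cont_act (A : SL 2 ℝ) : Continuous (act A) := by
  unfold act; fun_prop

lemma density {r : Γ →* SL 2 ℝ} (hr : Good r) {ε : ℝ} (hε : 0 < ε) :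
    ∃ F : Finset Γ, ∀ w' w : ℝ × ℝ, ip w' w' = 1 → ip w w = 1 → ε ≤ dt w' w →
      ∃ η ∈ F, 0 < dt w' (act (r η) (0, 1)) * dt (act (r η) (0, 1)) w := by
  classical
  let K : Set ((ℝ × ℝ) × (ℝ × ℝ)) := {p | ip p.1 p.1 = 1 ∧ ip p.2 p.2 = 1 ∧ ε ≤ dt p.1 p.2}
  have hK : IsCompact K := by
    apply Metric.isCompact_of_isClosed_isBounded
    · have c1 : Continuous fun p : (ℝ × ℝ) × (ℝ × ℝ) => ip p.1 p.1 := by unfold ip; fun_prop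
      have c2 : Continuous fun p : (ℝ × ℝ) × (ℝ × ℝ) => ip p.2 p.2 := by unfold ip; fun_prop
      have c3 : Continuous fun p : (ℝ × ℝ) × (ℝ × ℝ) => dt p.1 p.2 := by unfold dt; fun_prop
      exact (isClosed_eq c1 continuous_const).inter ((isClosed_eq c2 continuous_const).inter (isClosed_le continuous_const c3))
    · refine (Metric.isBounded_closedBall (x := (0 : (ℝ × ℝ) × (ℝ × ℝ))) (r := 1)).subset ?_
      rintro ⟨⟨a, b⟩, ⟨c, d⟩⟩ ⟨h1, h2, -⟩
      simp only [ip] at h1 h2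
      rw [mem_closedBall_zero_iff]
      simp only [Prod.norm_def, Real.norm_eq_abs, sup_le_iff, abs_le]
      refine ⟨⟨⟨?_, ?_⟩, ⟨?_, ?_⟩⟩, ⟨⟨?_, ?_⟩, ⟨?_, ?_⟩⟩⟩ <;>
        nlinarith [sq_nonneg a, sq_nonneg b, sq_nonneg c, sq_nonneg d]
  have key := hK.induction_on (p := fun S => ∃ F : Finset Γ, ∀ p ∈ S,
      ∃ η ∈ F, 0 < dt p.1 (act (r η) (0, 1)) * dt (act (r η) (0, 1)) p.2) ?_ ?_ ?_ ?_
  · obtain ⟨F, hF⟩ := key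
    exact ⟨F, fun w' w h1 h2 h3 => hF (w', w) ⟨h1, h2, h3⟩⟩
  · exact ⟨∅, by simp⟩
  · rintro S T hST ⟨F, hF⟩
    exact ⟨F, fun p hp => hF p (hST hp)⟩
  · rintro S T ⟨F, hF⟩ ⟨G, hG⟩
    refine ⟨F ∪ G, fun p hp => ?_⟩
    rcases hp with hp | hp
    · obtain ⟨η, h, h'⟩ := hF p hp
      exact ⟨η, Finset.mem_union_left _ h, h'⟩
    · obtain ⟨η, h, h'⟩ := hG p hp
      exact ⟨η, Finset.mem_union_right _ h, h'⟩
  · rintro ⟨w', w⟩ ⟨-, -, h3⟩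
    obtain ⟨η, hη⟩ := cone hr (lt_of_lt_of_le hε h3)
    have c : Continuous fun p : (ℝ × ℝ) × (ℝ × ℝ) => dt p.1 (act (r η) (0, 1)) * dt (act (r η) (0, 1)) p.2 := by
      unfold dt; fun_prop
    refine ⟨{p | 0 < dt p.1 (act (r η) (0, 1)) * dt (act (r η) (0, 1)) p.2}, ?_, {η}, ?_⟩
    · exact mem_nhdsWithin_of_mem_nhds ((isOpen_lt continuous_const c).mem_nhds hη)
    · intro p hp
      exact ⟨η, by simp, hp⟩

end
end Hit

namespace Hit
open Filter Topology

section
variable {Γ : Type} [Group Γ]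

lemma exists_hyp {r : Γ →* SL 2 ℝ} (hr : Good r) : ∃ γ, 2 < r γ 0 0 + r γ 1 1 := by
  obtain ⟨η, h0, h1⟩ := exists_contract hr 1
  have h01 := h1 0 1 (by simp)
  have h10 := h1 1 0 (by simp)
  have h11 := h1 1 1 (by simp)
  simp only [inv_one, one_mul, mul_one] at h0 h01 h10 h11
  have l := (((h11.const_add 1).pow 2).sub ((h11.sub (h01.mul h10)).const_mul 4)).eventually (lt_mem_nhds (a := 0) (by norm_num))
  obtain ⟨k, hk, hk0⟩ := (l.and h0).exists
  refine ⟨η k * η k, ?_⟩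
  rw [map_mul, mul2, mul2]
  have hd := det2 (r (η k))
  generalize r (η k) 0 0 = a at *
  generalize r (η k) 0 1 = b at *
  generalize r (η k) 1 0 = c at *
  generalize r (η k) 1 1 = d at *
  have ha : 0 < a ^ 2 := by positivity
  have e : a ^ 2 * ((1 + d / a) ^ 2 - 4 * (d / a - b / a * (c / a))) = (a + d) ^ 2 - 4 * (a * d - b * c) := by
    field_simp
  have := mul_pos ha hk
  rw [e, hd] at this
  nlinarith

lemma exists_diag (A : SL 2 ℝ) (hA : 2 < A 0 0 + A 1 1) : ∃ (m : SL 2 ℝ) (t : ℝ), 0 < t ∧ m⁻¹ * A * m = D2 t := by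
  have hd := det2 A
  obtain ⟨l, hl1, hl⟩ : ∃ l : ℝ, 1 < l ∧ l ^ 2 - (A 0 0 + A 1 1) * l + 1 = 0 := by
    set τ := A 0 0 + A 1 1
    have hs : 0 ≤ τ ^ 2 - 4 := by nlinarith
    have h1 := Real.sq_sqrt hs
    have h2 := Real.sqrt_nonneg (τ ^ 2 - 4)
    refine ⟨(τ + √(τ ^ 2 - 4)) / 2, by linarith, by linarith⟩
  obtain ⟨v, hv, hAv⟩ : ∃ v : ℝ × ℝ, v ≠ 0 ∧ act A v = l • v := by
    by_cases hb : A 0 1 = 0 ∧ l - A 0 0 = 0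
    · refine ⟨(l - A 1 1, A 1 0), ?_, ?_⟩
      · intro h
        have h1 : l - A 1 1 = 0 := congrArg Prod.fst h
        rw [hb.1] at hd
        have e1 : A 0 0 = l := by linarith [hb.2]
        have e2 : A 1 1 = l := by linarith
        rw [e1, e2] at hd
        nlinarith
      · ext
        · simp [act]; linear_combination -hl - hd
        · simp [act]; ring
    · refine ⟨(A 0 1, l - A 0 0), ?_, ?_⟩
      · intro h
        exact hb ⟨congrArg Prod.fst h, congrArg Prod.snd h⟩
      · ext
        · simp [act]; ring
        · simp [act]; linear_combination -hl - hd
  obtain ⟨m, hm⟩ := exists_frm2 hv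
  have h3 : act (m⁻¹ * A * m) (1, 0) = l • (1, 0) := by
    rw [act_mul, act_mul, hm, hAv, act_smul, ← hm, act_inv]
  have m00 : (m⁻¹ * A * m) 0 0 = l := by simpa [act] using congrArg Prod.fst h3
  have m10 : (m⁻¹ * A * m) 1 0 = 0 := by simpa [act] using congrArg Prod.snd h3
  have hd' := det2 (m⁻¹ * A * m)
  set M := m⁻¹ * A * m with hM
  rw [m00, m10] at hd'
  have m11 : M 1 1 = l⁻¹ := by field_simp; linarith
  refine ⟨m * U2 (- M 0 1 / (l - l⁻¹)), Real.log l, Real.log_pos hl1, ?_⟩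
  have e : (m * U2 (- M 0 1 / (l - l⁻¹)))⁻¹ * A * (m * U2 (- M 0 1 / (l - l⁻¹))) = (U2 (- M 0 1 / (l - l⁻¹)))⁻¹ * M * U2 (- M 0 1 / (l - l⁻¹)) := by
    rw [hM]; group
  rw [e]
  have hl0 : 0 < l := by linarith
  have hne : l - l⁻¹ ≠ 0 := by
    have : l⁻¹ < 1 := inv_lt_one_of_one_lt₀ hl1
    linarith
  apply sl2_ext
  · simp only [mul2, inv2_00, inv2_01, inv2_10, inv2_11, m00, m10, m11, U2_00, U2_01, U2_10, U2_11, D2_00, Real.exp_log hl0]; ring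
  · simp only [mul2, inv2_00, inv2_01, inv2_10, inv2_11, m00, m10, m11, U2_00, U2_01, U2_10, U2_11, D2_01]
    generalize M 0 1 = y at *
    generalize l⁻¹ = l' at *
    field_simp; ring
  · simp only [mul2, inv2_00, inv2_01, inv2_10, inv2_11, m00, m10, m11, U2_00, U2_01, U2_10, U2_11, D2_10]; ring
  · simp only [mul2, inv2_00, inv2_01, inv2_10, inv2_11, m00, m10, m11, U2_00, U2_01, U2_10, U2_11, D2_11, Real.exp_neg, Real.exp_log hl0]; ring

/-- conjugated representation -/
def cj (m : SL 2 ℝ) (r : Γ →* SL 2 ℝ) : Γ →* SL 2 ℝ := (MulAut.conj m⁻¹).toMonoidHom.comp r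

lemma cj_apply (m : SL 2 ℝ) (r : Γ →* SL 2 ℝ) (γ) : cj m r γ = m⁻¹ * r γ * m := by
  simp [cj]

lemma cj_inj (m : SL 2 ℝ) {r : Γ →* SL 2 ℝ} (hr : Function.Injective r) : Function.Injective (cj m r) := by
  intro a b h
  rw [cj_apply, cj_apply] at h
  exact hr (mul_left_cancel (mul_right_cancel h))

lemma cj_fb (m : SL 2 ℝ) {r : Γ →* SL 2 ℝ} (hr : ∀ R, {γ | N2 (r γ) ≤ R}.Finite) (R : ℝ) : {γ | N2 (cj m r γ) ≤ R}.Finite := by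
  refine (hr (N2 m * R * N2 m)).subset fun γ hγ => ?_
  have hγ' : N2 (cj m r γ) ≤ R := hγ
  have e : r γ = m * cj m r γ * m⁻¹ := by rw [cj_apply]; group
  show N2 (r γ) ≤ _
  rw [e]
  have h1 := N2_mul (m * cj m r γ) m⁻¹
  have h2 := N2_mul m (cj m r γ)
  rw [N2_inv] at h1
  have := N2_ge m
  nlinarith [mul_le_mul_of_nonneg_right h2 (by linarith : 0 ≤ N2 m), mul_le_mul_of_nonneg_left hγ' (mul_nonneg (by linarith : 0 ≤ N2 m) (by linarith : 0 ≤ N2 m))]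

lemma D2_pow (t : ℝ) (N : ℕ) : D2 t ^ N = D2 (N * t) := by
  induction N with
  | zero => simp [D2_zero]
  | succ k ih => rw [pow_succ, ih, ← D2_add]; congr 1; push_cast; ring

lemma exists_B {r : Γ →* SL 2 ℝ} (hr : Good r) : ∃ B, 0 < r B 0 0 ∧ 0 < r B 0 1 ∧ 0 < r B 1 0 ∧ 0 < r B 1 1 := by
  obtain ⟨η, h1, h2, h3⟩ := cstar hr 1 (show (1 : ℝ) < 2 by norm_num)
  have hd := det2 (r η)
  simp only [act_one] at h1 h2 h3
  simp only [act, mul_one, mul_zero, zero_add, add_zero, one_mul] at h1 h2 h3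
  have key : (0 < r η 0 0 ∧ 0 < r η 0 1 ∧ 0 < r η 1 0 ∧ 0 < r η 1 1) ∨ (r η 0 0 < 0 ∧ r η 0 1 < 0 ∧ r η 1 0 < 0 ∧ r η 1 1 < 0) := by
    generalize r η 0 0 = a at *
    generalize r η 0 1 = b at *
    generalize r η 1 0 = c at *
    generalize r η 1 1 = d at *
    rcases pos_and_pos_or_neg_and_neg_of_mul_pos h1 with ⟨hc, hd'⟩ | ⟨hc, hd'⟩
    · left
      have hb : 0 < b := by nlinarith
      refine ⟨?_, hb, hc, hd'⟩
      by_contra hh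
      nlinarith
    · right
      have hb : b < 0 := by nlinarith
      refine ⟨?_, hb, hc, hd'⟩
      by_contra hh
      nlinarith
  rcases key with h | ⟨ha, hb, hc, hd⟩
  · exact ⟨η, h⟩
  · refine ⟨η * η, ?_⟩
    simp only [map_mul, mul2]
    have := mul_pos_of_neg_of_neg ha ha
    have := mul_pos_of_neg_of_neg ha hb
    have := mul_pos_of_neg_of_neg ha hc
    have := mul_pos_of_neg_of_neg hb hd
    have := mul_pos_of_neg_of_neg hb hc
    have := mul_pos_of_neg_of_neg hc hd
    have := mul_pos_of_neg_of_neg hd hd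
    refine ⟨by linarith, by linarith, by linarith, by linarith⟩

/-- normalised data -/
structure NDat (r : Γ →* SL 2 ℝ) (γ0 B : Γ) (T : ℝ) : Prop where
  gd : Good r
  Tp : 0 < T
  hT : r γ0 = D2 T
  b00 : 0 < r B 0 0
  b01 : 0 < r B 0 1
  b10 : 0 < r B 1 0
  b11 : 0 < r B 1 1
  bT : r B 0 0 * r B 1 1 < Real.exp (2 * T) * (r B 0 1 * r B 1 0)

lemma exists_norm_aux {r : Γ →* SL 2 ℝ} (gd : Good r) {γ : Γ} {t : ℝ} (ht : 0 < t) (hm : r γ = D2 t) :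
    ∃ γ0 B T, NDat r γ0 B T := by
  obtain ⟨B, b00, b01, b10, b11⟩ := exists_B gd
  obtain ⟨N, hN⟩ := pow_unbounded_of_one_lt (max 1 (r B 0 0 * r B 1 1 / (r B 0 1 * r B 1 0))) (Real.one_lt_exp_iff.2 (by linarith : 0 < 2 * t))
  rw [max_lt_iff] at hN
  have hN0 : 0 < (N : ℝ) := by
    rcases Nat.eq_zero_or_pos N with h | h
    · rw [h] at hN; simp at hN
    · exact_mod_cast h
  refine ⟨γ ^ N, B, N * t, gd, by positivity, ?_, b00, b01, b10, b11, ?_⟩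
  · rw [map_pow, hm, D2_pow]
  · have h2 := hN.2
    rw [← Real.exp_nat_mul, div_lt_iff₀ (by positivity)] at h2
    rwa [show 2 * (N * t) = N * (2 * t) by ring]

lemma exists_norm {g : ℕ} (hg : 2 ≤ g) (r : SurfaceGroup g →* SL 2 ℝ) (hr : Function.Injective r)
    (hfb : ∀ R, {γ | N2 (r γ) ≤ R}.Finite) : ∃ m γ0 B T, NDat (cj m r) γ0 B T := by
  obtain ⟨γ, hγ⟩ := exists_hyp (good_of hg r hr hfb)
  obtain ⟨m, t, ht, hm⟩ := exists_diag _ hγ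
  have gd := good_of hg (cj m r) (cj_inj m hr) (cj_fb m hfb)
  have hm' : cj m r γ = D2 t := by rw [cj_apply, hm]
  exact ⟨m, exists_norm_aux gd ht hm'⟩

end
end Hit

namespace Hit
open Filter Topology

section
variable {Γ : Type} [Group Γ]

def ee (b : Bool) : ℝ × ℝ := if b then (1, 0) else (0, 1)
def Vv (r : Γ →* SL 2 ℝ) (a : Γ × Bool) : ℝ × ℝ := act (r a.1) (ee a.2)

lemma Vv_mul (r : Γ →* SL 2 ℝ) (γ δ : Γ) (b : Bool) : Vv r (γ * δ, b) = act (r γ) (Vv r (δ, b)) := by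
  simp only [Vv, map_mul, act_mul]

lemma N2_cols (A : SL 2 ℝ) : N2 A = ip (act A (1, 0)) (act A (1, 0)) + ip (act A (0, 1)) (act A (0, 1)) := by
  simp only [N2, ip, act]; ring

lemma N2_V (r : Γ →* SL 2 ℝ) (δ : Γ) (b : Bool) : N2 (r δ) = ip (Vv r (δ, b)) (Vv r (δ, b)) + ip (Vv r (δ, !b)) (Vv r (δ, !b)) := by
  rw [N2_cols]
  cases b <;> simp [Vv, ee, add_comm]

lemma dt_V (r : Γ →* SL 2 ℝ) (δ : Γ) (b : Bool) : dt (Vv r (δ, b)) (Vv r (δ, !b)) ^ 2 = 1 := by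
  simp only [Vv, dt_act]
  cases b <;> simp [ee, dt]

lemma V_ne (r : Γ →* SL 2 ℝ) (a : Γ × Bool) : Vv r a ≠ 0 := by
  intro h
  have := dt_V r a.1 a.2
  rw [show (a.1, a.2) = a from rfl, h] at this
  simp [dt] at this

/-- condition for a pair `(μ, z)` to be good for the frame `(a, b)`. -/
def QM (r : Γ →* SL 2 ℝ) (p q : ℝ) (x : Γ × Γ) (u v : ℝ × ℝ) : Prop :=
  (0 < r x.2 1 0 * r x.2 1 1) ∧ 0 < (act (r x.1) u).2 * (act (r x.1) v).2 ∧
  p * (act (r x.1) v).2 ^ 2 < (act (r x.1) v).1 * (act (r x.1) v).2 ∧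
  (act (r x.1) v).1 * (act (r x.1) v).2 < r x.2 0 1 / r x.2 1 1 * (act (r x.1) v).2 ^ 2 ∧
  r x.2 0 0 / r x.2 1 0 * (act (r x.1) u).2 ^ 2 < (act (r x.1) u).1 * (act (r x.1) u).2 ∧
  (act (r x.1) u).1 * (act (r x.1) u).2 < q * (act (r x.1) u).2 ^ 2

lemma QM_ex {r : Γ →* SL 2 ℝ} (hr : Good r) {p q : ℝ} (hpq : p < q) (m : SL 2 ℝ) :
    ∃ x, QM r p q x (act m (1, 0)) (act m (0, 1)) := by
  obtain ⟨μ, h1, h2, h3⟩ := cstar hr m hpq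
  have hd : dt (act (r μ) (act m (1, 0))) (act (r μ) (act m (0, 1))) = 1 := by
    rw [dt_act, dt_act]; simp [dt]
  have hs : (act (r μ) (act m (0, 1))).1 / (act (r μ) (act m (0, 1))).2 < (act (r μ) (act m (1, 0))).1 / (act (r μ) (act m (1, 0))).2 := by
    have h5 : (act (r μ) (act m (1, 0))).2 ≠ 0 := left_ne_zero_of_mul h1.ne'
    have h6 : (act (r μ) (act m (0, 1))).2 ≠ 0 := right_ne_zero_of_mul h1.ne'
    rw [← sub_pos, div_sub_div _ _ h5 h6]
    apply div_pos _ h1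
    unfold dt at hd
    linarith
  obtain ⟨z, z1, z2, z3⟩ := cstar hr 1 hs
  simp only [act_one] at z1 z2 z3
  have hb : 0 < (act (r μ) (act m (0, 1))).2 ^ 2 := by
    have : (act (r μ) (act m (0, 1))).2 ≠ 0 := right_ne_zero_of_mul h1.ne'
    positivity
  have ha : 0 < (act (r μ) (act m (1, 0))).2 ^ 2 := by
    have : (act (r μ) (act m (1, 0))).2 ≠ 0 := left_ne_zero_of_mul h1.ne'
    positivity
  refine ⟨(μ, z), ?_, h1, h2, ?_, ?_, h3⟩
  · simpa [act] using z1
  · simp only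
    generalize act (r μ) (act m (0, 1)) = b at *
    have z1' : 0 < r z 1 0 * r z 1 1 := by simpa [act] using z1
    simp only [act, mul_one, mul_zero, zero_add, add_zero] at z2
    have hz : r z 1 1 ≠ 0 := right_ne_zero_of_mul z1'.ne'
    have hb' : b.2 ≠ 0 := right_ne_zero_of_mul h1.ne'
    have hz2 : 0 < r z 1 1 ^ 2 := by positivity
    have e : b.1 / b.2 < r z 0 1 / r z 1 1 := by
      rw [← lt_div_iff₀ hz2] at z2
      calc _ < _ := z2
        _ = _ := by field_simp
    have := mul_lt_mul_of_pos_right e hb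
    calc b.1 * b.2 = b.1 / b.2 * b.2 ^ 2 := by field_simp
      _ < _ := this
  · simp only
    generalize act (r μ) (act m (1, 0)) = b at *
    have z1' : 0 < r z 1 0 * r z 1 1 := by simpa [act] using z1
    simp only [act, mul_one, mul_zero, add_zero] at z3
    have hz : r z 1 0 ≠ 0 := left_ne_zero_of_mul z1'.ne'
    have hb' : b.2 ≠ 0 := left_ne_zero_of_mul h1.ne'
    have hz2 : 0 < r z 1 0 ^ 2 := by positivity
    have e : r z 0 0 / r z 1 0 < b.1 / b.2 := by
      rw [← div_lt_iff₀ hz2] at z3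
      calc _ = _ := by field_simp
        _ < _ := z3
    have := mul_lt_mul_of_pos_right e ha
    calc _ < _ := this
      _ = b.1 * b.2 := by field_simp

lemma QM_open (r : Γ →* SL 2 ℝ) (p q : ℝ) (x : Γ × Γ) :
    IsOpen {y : ℝ × ℝ × ℝ × ℝ | QM r p q x (y.1, y.2.2.1) (y.2.1, y.2.2.2)} := by
  have cu : Continuous fun y : ℝ × ℝ × ℝ × ℝ => act (r x.1) (y.1, y.2.2.1) := (cont_act _).comp (by fun_prop)
  have cv : Continuous fun y : ℝ × ℝ × ℝ × ℝ => act (r x.1) (y.2.1, y.2.2.2) := (cont_act _).comp (by fun_prop)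
  have u1 := cu.fst
  have u2 := cu.snd
  have v1 := cv.fst
  have v2 := cv.snd
  unfold QM
  refine (isOpen_const).inter ((isOpen_lt continuous_const (u2.mul v2)).inter ((isOpen_lt ((v2.pow 2).const_mul p) (v1.mul v2)).inter
    ((isOpen_lt (v1.mul v2) ((v2.pow 2).const_mul _)).inter ((isOpen_lt ((u2.pow 2).const_mul _) (u1.mul u2)).inter (isOpen_lt (u1.mul u2) ((u2.pow 2).const_mul q))))))

lemma finM {r : Γ →* SL 2 ℝ} (hr : Good r) {p q : ℝ} (hpq : p < q) (R0 : ℝ) :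
    ∃ F : Finset (Γ × Γ), ∀ m : SL 2 ℝ, N2 m ≤ R0 → ∃ x ∈ F, QM r p q x (act m (1, 0)) (act m (0, 1)) := by
  classical
  have e1 : ∀ m : SL 2 ℝ, act m (1, 0) = (m 0 0, m 1 0) := fun m => by simp [act]
  have e2 : ∀ m : SL 2 ℝ, act m (0, 1) = (m 0 1, m 1 1) := fun m => by simp [act]
  have key := (K4_compact R0).induction_on (p := fun S => ∃ F : Finset (Γ × Γ), ∀ y ∈ S,
      ∃ x ∈ F, QM r p q x (y.1, y.2.2.1) (y.2.1, y.2.2.2)) ?_ ?_ ?_ ?_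
  · obtain ⟨F, hF⟩ := key
    refine ⟨F, fun m hm => ?_⟩
    rw [e1, e2]
    exact hF (q4 m) (q4_mem _ hm)
  · exact ⟨∅, by simp⟩
  · rintro S T hST ⟨F, hF⟩
    exact ⟨F, fun p hp => hF p (hST hp)⟩
  · rintro S T ⟨F, hF⟩ ⟨G, hG⟩
    refine ⟨F ∪ G, fun p hp => ?_⟩
    rcases hp with hp | hp
    · obtain ⟨η, h, h'⟩ := hF p hp
      exact ⟨η, Finset.mem_union_left _ h, h'⟩
    · obtain ⟨η, h, h'⟩ := hG p hp
      exact ⟨η, Finset.mem_union_right _ h, h'⟩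
  · intro y hy
    obtain ⟨m, hm, -⟩ := K4_ex hy
    obtain ⟨x, hx⟩ := QM_ex hr hpq m
    refine ⟨_, mem_nhdsWithin_of_mem_nhds ((QM_open r p q x).mem_nhds ?_), {x}, fun p hp => ⟨x, by simp, hp⟩⟩
    rw [← hm]
    rw [e1, e2] at hx
    exact hx

lemma D2_zpow (t : ℝ) (l : ℤ) : D2 t ^ l = D2 (l * t) := by
  obtain ⟨n, rfl | rfl⟩ := l.eq_nat_or_neg
  · rw [zpow_natCast, D2_pow]; simp
  · rw [_root_.zpow_neg, zpow_natCast, D2_pow, inv_eq_iff_mul_eq_one, ← D2_add]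
    rw [← D2_zero]; congr 1; push_cast; ring

lemma le_of_sq_le_sq' {a b : ℝ} (hb : 0 ≤ b) (h : a ^ 2 ≤ b ^ 2) : a ≤ b := by nlinarith

lemma pow_bound {x y R T : ℝ} (hx : 0 < x) (hy : 0 < y) (hT : 0 < T) (hR : 0 ≤ R) (h : x * y ≤ R ^ 2) :
    ∃ l : ℤ, x * Real.exp (l * T) ^ 2 + y * Real.exp (-(l * T)) ^ 2 ≤ R * (1 + Real.exp (2 * T)) := by
  obtain ⟨l, h1, h2⟩ := exists_mem_Ico_zpow (div_pos hy hx) (Real.one_lt_exp_iff.2 (by linarith : 0 < 4 * T))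
  refine ⟨l, ?_⟩
  have hz : ∀ (u : ℝ) (l : ℤ), Real.exp u ^ l = Real.exp (l * u) := by
    intro u l
    rw [← Real.rpow_intCast, ← Real.exp_mul, mul_comm]
  rw [hz, le_div_iff₀ hx] at h1
  rw [hz, div_lt_iff₀ hx] at h2
  push_cast at h2
  set E := Real.exp (l * T) with hE
  set G := Real.exp (2 * T) with hG
  have hE0 : 0 < E := Real.exp_pos _
  have hG0 : 0 < G := Real.exp_pos _
  have f1 : Real.exp (l * (4 * T)) = E ^ 4 := by rw [hE, ← Real.exp_nat_mul]; congr 1; push_cast; ring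
  have f2 : Real.exp ((l + 1) * (4 * T)) = E ^ 4 * G ^ 2 := by
    rw [hE, hG, ← Real.exp_nat_mul, ← Real.exp_nat_mul, ← Real.exp_add]; congr 1; push_cast; ring
  rw [f1] at h1
  rw [f2] at h2
  rw [Real.exp_neg, ← hE]
  have hXY : (x * E ^ 2) * (y * E⁻¹ ^ 2) ≤ R ^ 2 := by
    calc _ = x * y := by field_simp
      _ ≤ _ := h
  have g1 : x * E ^ 2 ≤ y * E⁻¹ ^ 2 := by
    rw [inv_pow, ← div_eq_mul_inv, le_div_iff₀ (by positivity)]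
    linarith
  have g2 : y * E⁻¹ ^ 2 ≤ x * E ^ 2 * G ^ 2 := by
    rw [inv_pow, ← div_eq_mul_inv, div_le_iff₀ (by positivity)]
    linarith
  have hX : 0 < x * E ^ 2 := by positivity
  have hY : 0 < y * E⁻¹ ^ 2 := by positivity
  generalize x * E ^ 2 = X at *
  generalize y * E⁻¹ ^ 2 = Y at *
  have k1 : X ≤ R := by
    apply le_of_sq_le_sq' hR
    nlinarith
  have k2 : Y ≤ R * G := by
    apply le_of_sq_le_sq' (by positivity)
    have : Y * Y ≤ Y * (X * G ^ 2) := mul_le_mul_of_nonneg_left g2 hY.le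
    have : (X * Y) * G ^ 2 ≤ R ^ 2 * G ^ 2 := mul_le_mul_of_nonneg_right hXY (by positivity)
    nlinarith
  linarith

lemma V_pow {r : Γ →* SL 2 ℝ} {γ0 B : Γ} {T : ℝ} (N : NDat r γ0 B T) (δ : Γ) (l : ℤ) (b : Bool) :
    Vv r (δ * γ0 ^ l, b) = Real.exp (if b then l * T else -(l * T)) • Vv r (δ, b) := by
  simp only [Vv, map_mul, map_zpow, N.hT, D2_zpow, act_mul]
  rw [← act_smul]
  congr 1
  cases b <;> simp [ee, act]

lemma ip_smul (c : ℝ) (v : ℝ × ℝ) : ip (c • v) (c • v) = c ^ 2 * ip v v := by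
  simp only [ip, Prod.smul_fst, Prod.smul_snd, smul_eq_mul]; ring

lemma pow_lem {r : Γ →* SL 2 ℝ} {γ0 B : Γ} {T : ℝ} (N : NDat r γ0 B T) (δ : Γ) (b : Bool) {R : ℝ} (hR : 0 ≤ R)
    (h : ip (Vv r (δ, b)) (Vv r (δ, b)) * ip (Vv r (δ, !b)) (Vv r (δ, !b)) ≤ R ^ 2) :
    ∃ l : ℤ, N2 (r (δ * γ0 ^ l)) ≤ R * (1 + Real.exp (2 * T)) := by
  have h' : ip (Vv r (δ, true)) (Vv r (δ, true)) * ip (Vv r (δ, false)) (Vv r (δ, false)) ≤ R ^ 2 := by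
    cases b <;> simp at h <;> linarith
  obtain ⟨l, hl⟩ := pow_bound (ip_self_pos (V_ne r _)) (ip_self_pos (V_ne r _)) N.Tp hR h'
  refine ⟨l, ?_⟩
  rw [N2_V r _ true, V_pow N, V_pow N, ip_smul, ip_smul]
  simp only [if_true, Bool.not_true, Bool.false_eq_true, if_false]
  linarith

lemma dt_smul_l (c : ℝ) (v u : ℝ × ℝ) : dt (c • v) u = c * dt v u := by
  simp only [dt, Prod.smul_fst, Prod.smul_snd, smul_eq_mul]; ring
lemma dt_smul_r (c : ℝ) (v u : ℝ × ℝ) : dt v (c • u) = c * dt v u := by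
  simp only [dt, Prod.smul_fst, Prod.smul_snd, smul_eq_mul]; ring
lemma ip_add_le (v u : ℝ × ℝ) : ip (v + u) (v + u) ≤ 2 * (ip v v + ip u u) := by
  simp only [ip, Prod.fst_add, Prod.snd_add]; nlinarith [sq_nonneg (v.1 - u.1), sq_nonneg (v.2 - u.2)]

lemma bound_lem (A : SL 2 ℝ) {w w' V V' : ℝ × ℝ} {s κ C : ℝ} (hw : ip w w = 1) (hw' : ip w' w' = 1) (hκ : dt w' w ^ 2 = κ ^ 2) (hκ0 : 0 < κ)
    (h1 : ip (act A w) (act A w) ≤ κ * C) (h2 : ip (act A w') (act A w') ≤ κ * C) (hV : V = s • w) (hd : dt V V' ^ 2 = 1) :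
    ip (act A V) (act A V) * ip (act A V') (act A V') ≤ 2 * C ^ 2 * (3 + 2 * κ ^ 2 * (ip V V * ip V' V')) := by
  have e1 : dt w' w • V' = dt V' w • w' + dt w' V' • w := by
    ext <;> simp only [dt, Prod.smul_fst, Prod.smul_snd, Prod.fst_add, Prod.snd_add, smul_eq_mul] <;> ring
  have e2 : dt w' V' = ip w' w * dt w V' + dt w' w * ip w V' := by
    have : ip w w * dt w' V' = ip w' w * dt w V' + dt w' w * ip w V' := by unfold ip dt; ring
    rwa [hw, one_mul] at this
  have e3 : ip w' w ^ 2 ≤ 1 := by have := ip_dt w' w; rw [hw, hw'] at this; nlinarith [sq_nonneg (dt w' w)]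
  have e4 : ip w V' ^ 2 ≤ ip V' V' := by have := ip_dt w V'; rw [hw] at this; nlinarith [sq_nonneg (dt w V')]
  have e5 : dt w' V' ^ 2 ≤ 2 * (dt w V' ^ 2 + κ ^ 2 * ip V' V') := by
    rw [e2]
    have := mul_le_mul_of_nonneg_right e3 (sq_nonneg (dt w V'))
    have := mul_le_mul_of_nonneg_left e4 (sq_nonneg κ)
    have := sq_nonneg (ip w' w * dt w V' - dt w' w * ip w V')
    have e : (dt w' w * ip w V') ^ 2 = κ ^ 2 * ip w V' ^ 2 := by rw [mul_pow, hκ]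
    nlinarith
  have e6 : dt V' w ^ 2 = dt w V' ^ 2 := by rw [dt_comm]; ring
  have f1 : κ ^ 2 * ip (act A V') (act A V') ≤ 2 * (dt V' w ^ 2 * (κ * C) + dt w' V' ^ 2 * (κ * C)) := by
    rw [← hκ, ← ip_smul, ← act_smul, e1, act_add, act_smul, act_smul]
    refine (ip_add_le _ _).trans ?_
    rw [ip_smul, ip_smul]
    have := mul_le_mul_of_nonneg_left h1 (sq_nonneg (dt w' V'))
    have := mul_le_mul_of_nonneg_left h2 (sq_nonneg (dt V' w))
    linarith
  have hC : 0 ≤ κ * C := (ip_self_nonneg _).trans h1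
  have f2 : κ ^ 2 * ip (act A V') (act A V') ≤ 2 * (κ * C) * (3 * dt w V' ^ 2 + 2 * κ ^ 2 * ip V' V') := by
    rw [e6] at f1
    have := mul_le_mul_of_nonneg_right e5 hC
    linarith
  have f3 : ip (act A V) (act A V) ≤ s ^ 2 * (κ * C) := by
    rw [hV, act_smul, ip_smul]
    exact mul_le_mul_of_nonneg_left h1 (sq_nonneg s)
  have f4 : ip V V = s ^ 2 := by rw [hV, ip_smul, hw, mul_one]
  have f5 : s ^ 2 * dt w V' ^ 2 = 1 := by rw [hV, dt_smul_l, mul_pow] at hd; exact hd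
  have g : (κ ^ 2 * ip (act A V') (act A V')) * ip (act A V) (act A V) ≤ (2 * (κ * C) * (3 * dt w V' ^ 2 + 2 * κ ^ 2 * ip V' V')) * (s ^ 2 * (κ * C)) := by
    apply mul_le_mul f2 f3 (ip_self_nonneg _)
    have := ip_self_nonneg V'
    positivity
  have hk : 0 < κ ^ 2 := by positivity
  apply le_of_mul_le_mul_left _ hk
  rw [f4]
  calc _ = _ := by ring
    _ ≤ _ := g
    _ = _ := by linear_combination 6 * κ ^ 2 * C ^ 2 * f5

end
end Hit

namespace Hit
open Filter Topology

section
variable {Γ : Type} [Group Γ]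

noncomputable def sl (v : ℝ × ℝ) : ℝ := v.1 / v.2

def InX (r : Γ →* SL 2 ℝ) (R : ℝ) (a : Γ × Bool) : Prop := N2 (r a.1) ≤ R ∧ (Vv r a).2 ≠ 0

lemma Vv_false (r : Γ →* SL 2 ℝ) (δ : Γ) : Vv r (δ, false) = (r δ 0 1, r δ 1 1) := by simp [Vv, ee, act]
lemma Vv_true (r : Γ →* SL 2 ℝ) (δ : Γ) : Vv r (δ, true) = (r δ 0 0, r δ 1 0) := by simp [Vv, ee, act]

lemma sl_smul {c : ℝ} (hc : c ≠ 0) (v : ℝ × ℝ) : sl (c • v) = sl v := by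
  simp only [sl, Prod.smul_fst, Prod.smul_snd, smul_eq_mul]
  exact mul_div_mul_left _ _ hc

lemma lt_sl {p : ℝ} {v : ℝ × ℝ} (hv : v.2 ≠ 0) (h : p * v.2 ^ 2 < v.1 * v.2) : p < sl v := by
  have h2 : 0 < v.2 ^ 2 := by positivity
  rw [← lt_div_iff₀ h2] at h
  calc _ < _ := h
    _ = _ := by unfold sl; field_simp
lemma sl_lt {p : ℝ} {v : ℝ × ℝ} (hv : v.2 ≠ 0) (h : v.1 * v.2 < p * v.2 ^ 2) : sl v < p := by
  have h2 : 0 < v.2 ^ 2 := by positivity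
  rw [← div_lt_iff₀ h2] at h
  calc _ = _ := by unfold sl; field_simp
    _ < _ := h

lemma sub_lem {r : Γ →* SL 2 ℝ} {γ0 B : Γ} {T : ℝ} (N : NDat r γ0 B T) {γ : Γ} {a : Γ × Bool} {R C ε κ s : ℝ} {w w' : ℝ × ℝ}
    (hR : 0 ≤ R) (c1 : 12 * C ^ 2 ≤ R ^ 2) (c2 : C ^ 2 * ε ^ 2 * (1 + Real.exp (2 * T)) ^ 2 ≤ 1 / 2)
    (ha : N2 (r a.1) ≤ R * (1 + Real.exp (2 * T)))
    (hw : ip w w = 1) (hw' : ip w' w' = 1) (hκ : dt w' w ^ 2 = κ ^ 2) (hκ0 : 0 < κ) (hκε : κ ≤ ε)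
    (h1 : ip (act (r γ) w) (act (r γ) w) ≤ κ * C) (h2 : ip (act (r γ) w') (act (r γ) w') ≤ κ * C) (hV : Vv r a = s • w) :
    ∃ l : ℤ, N2 (r (γ * a.1 * γ0 ^ l)) ≤ R * (1 + Real.exp (2 * T)) := by
  apply pow_lem N _ a.2 hR
  rw [Vv_mul, Vv_mul]
  refine (bound_lem (r γ) hw hw' hκ hκ0 h1 h2 hV (dt_V r a.1 a.2)).trans ?_
  rw [N2_V r a.1 a.2] at ha
  have hx := ip_self_nonneg (Vv r (a.1, a.2))
  have hy := ip_self_nonneg (Vv r (a.1, !a.2))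
  show 2 * C ^ 2 * (3 + 2 * κ ^ 2 * (ip (Vv r (a.1, a.2)) (Vv r (a.1, a.2)) * ip (Vv r (a.1, !a.2)) (Vv r (a.1, !a.2)))) ≤ R ^ 2
  generalize ip (Vv r (a.1, a.2)) (Vv r (a.1, a.2)) = x at *
  generalize ip (Vv r (a.1, !a.2)) (Vv r (a.1, !a.2)) = y at *
  generalize 1 + Real.exp (2 * T) = E at *
  have e1 : (x + y) ^ 2 ≤ (R * E) ^ 2 := pow_le_pow_left₀ (by linarith) ha 2
  have e2 : x * y ≤ (R * E) ^ 2 / 4 := by nlinarith [sq_nonneg (x - y)]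
  have e3 : κ ^ 2 ≤ ε ^ 2 := pow_le_pow_left₀ hκ0.le hκε 2
  have e4 : κ ^ 2 * (x * y) ≤ ε ^ 2 * ((R * E) ^ 2 / 4) := mul_le_mul e3 e2 (by positivity) (by positivity)
  have e5 := mul_le_mul_of_nonneg_left e4 (sq_nonneg C)
  have e6 := mul_le_mul_of_nonneg_right c2 (sq_nonneg R)
  nlinarith

lemma rel_core {r : Γ →* SL 2 ℝ} {γ0 B : Γ} {T : ℝ} (N : NDat r γ0 B T) {R R0 C ε : ℝ} {F : Finset (Γ × Γ)}
    (hR0 : ∀ m : SL 2 ℝ, ∃ γ, N2 (r γ * m) ≤ R0)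
    (hF : ∀ m : SL 2 ℝ, N2 m ≤ R0 → ∃ x ∈ F, QM r (sl (Vv r (B, false))) (sl (Vv r (B, true))) x (act m (1, 0)) (act m (0, 1)))
    (hC : ∀ x ∈ F, N2 (r x.1) ≤ C) (hz : ∀ x ∈ F, N2 (r x.2) ≤ R * (1 + Real.exp (2 * T)))
    (hR : 0 ≤ R) (c1 : 12 * (C * R0) ^ 2 ≤ R ^ 2) (c2 : (C * R0) ^ 2 * ε ^ 2 * (1 + Real.exp (2 * T)) ^ 2 ≤ 1 / 2)
    {a b : Γ × Bool} (ha : N2 (r a.1) ≤ R * (1 + Real.exp (2 * T))) (hb : N2 (r b.1) ≤ R * (1 + Real.exp (2 * T)))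
    {w w' : ℝ × ℝ} {s s' : ℝ} (hw : ip w w = 1) (hw' : ip w' w' = 1) (hκ0 : 0 < dt w' w) (hκε : dt w' w ≤ ε)
    (hV : Vv r a = s • w) (hV' : Vv r b = s' • w') :
    ∃ (γ : Γ) (y y' : Γ × Bool) (z : Γ) (l l' : ℤ), InX r (R * (1 + Real.exp (2 * T))) y ∧ InX r (R * (1 + Real.exp (2 * T))) y' ∧
      InX r (R * (1 + Real.exp (2 * T))) (z, false) ∧ InX r (R * (1 + Real.exp (2 * T))) (z, true) ∧
    γ * a.1 = y.1 * γ0 ^ l ∧ y.2 = a.2 ∧ γ * b.1 = y'.1 * γ0 ^ l' ∧ y'.2 = b.2 ∧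
    sl (Vv r (B, false)) < sl (Vv r y) ∧ sl (Vv r y) < sl (Vv r (z, false)) ∧ sl (Vv r (z, false)) < sl (Vv r (z, true)) ∧
    sl (Vv r (z, true)) < sl (Vv r y') ∧ sl (Vv r y') < sl (Vv r (B, true)) := by
  obtain ⟨κ, hκ⟩ : ∃ κ, κ = dt w' w := ⟨_, rfl⟩
  rw [← hκ] at hκ0 hκε
  have hq : 0 < √κ := Real.sqrt_pos.2 hκ0
  have hqq : √κ ^ 2 = κ := Real.sq_sqrt hκ0.le
  obtain ⟨m, hm1, hm2⟩ : ∃ m : SL 2 ℝ, w' = √κ • act m (1, 0) ∧ w = √κ • act m (0, 1) := by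
    refine ⟨⟨!![w'.1 / √κ, w.1 / √κ; w'.2 / √κ, w.2 / √κ], ?_⟩, ?_, ?_⟩
    · rw [Matrix.det_fin_two_of]
      have : w'.1 / √κ * (w.2 / √κ) - w.1 / √κ * (w'.2 / √κ) = dt w' w / √κ ^ 2 := by
        unfold dt; field_simp
      rw [this, hqq, hκ, div_self]
      rw [← hκ]; exact hκ0.ne'
    · ext <;> simp [act] <;> field_simp
    · ext <;> simp [act] <;> field_simp
  obtain ⟨γ1, hγ1⟩ := hR0 m
  obtain ⟨x, hxF, hx⟩ := hF _ hγ1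
  have hCx := hC x hxF
  rw [act_mul, act_mul] at hx
  -- images
  have i1 : act (r (x.1 * γ1)) w' = √κ • act (r x.1) (act (r γ1) (act m (1, 0))) := by
    rw [map_mul, act_mul, hm1, act_smul, act_smul]
  have i2 : act (r (x.1 * γ1)) w = √κ • act (r x.1) (act (r γ1) (act m (0, 1))) := by
    rw [map_mul, act_mul, hm2, act_smul, act_smul]
  have nb : N2 (r x.1 * (r γ1 * m)) ≤ C * R0 := by
    refine (N2_mul _ _).trans ?_
    have := N2_ge (r x.1)
    have := N2_ge (r γ1 * m)
    exact mul_le_mul hCx hγ1 (by linarith) (by linarith)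
  rw [N2_cols] at nb
  simp only [act_mul] at nb
  generalize hu : act (r x.1) (act (r γ1) (act m (1, 0))) = u at *
  generalize hv : act (r x.1) (act (r γ1) (act m (0, 1))) = v at *
  obtain ⟨q1, q2, q3, q4, q5, q6⟩ := hx
  rw [hu] at q2 q5 q6
  rw [hv] at q2 q3 q4
  have n1 : ip (act (r (x.1 * γ1)) w) (act (r (x.1 * γ1)) w) ≤ κ * (C * R0) := by
    rw [i2, ip_smul, hqq]
    have := ip_self_nonneg u
    exact mul_le_mul_of_nonneg_left (by linarith) hκ0.le
  have n2 : ip (act (r (x.1 * γ1)) w') (act (r (x.1 * γ1)) w') ≤ κ * (C * R0) := by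
    rw [i1, ip_smul, hqq]
    have := ip_self_nonneg v
    exact mul_le_mul_of_nonneg_left (by linarith) hκ0.le
  obtain ⟨l, hl⟩ := sub_lem N hR c1 c2 ha hw hw' (by rw [hκ]) hκ0 hκε n1 n2 hV
  obtain ⟨l', hl'⟩ := sub_lem N hR c1 c2 hb hw' hw (by rw [hκ, dt_comm]; ring) hκ0 hκε n2 n1 hV'
  have hs : s ≠ 0 := by rintro rfl; exact V_ne r a (by rw [hV, zero_smul])
  have hs' : s' ≠ 0 := by rintro rfl; exact V_ne r b (by rw [hV', zero_smul])
  have hu2 : u.2 ≠ 0 := left_ne_zero_of_mul q2.ne'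
  have hv2 : v.2 ≠ 0 := right_ne_zero_of_mul q2.ne'
  obtain ⟨c, hc, hy⟩ : ∃ c : ℝ, c ≠ 0 ∧ Vv r (x.1 * γ1 * a.1 * γ0 ^ l, a.2) = c • v := by
    refine ⟨Real.exp (if a.2 then l * T else -(l * T)) * (s * √κ), by positivity, ?_⟩
    rw [V_pow N, Vv_mul, show (a.1, a.2) = a from rfl, hV, act_smul, i2, smul_smul, smul_smul, mul_assoc]
  obtain ⟨c', hc', hy'⟩ : ∃ c : ℝ, c ≠ 0 ∧ Vv r (x.1 * γ1 * b.1 * γ0 ^ l', b.2) = c • u := by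
    refine ⟨Real.exp (if b.2 then l' * T else -(l' * T)) * (s' * √κ), by positivity, ?_⟩
    rw [V_pow N, Vv_mul, show (b.1, b.2) = b from rfl, hV', act_smul, i1, smul_smul, smul_smul, mul_assoc]
  have z10 : r x.2 1 0 ≠ 0 := left_ne_zero_of_mul q1.ne'
  have z11 : r x.2 1 1 ≠ 0 := right_ne_zero_of_mul q1.ne'
  refine ⟨x.1 * γ1, (x.1 * γ1 * a.1 * γ0 ^ l, a.2), (x.1 * γ1 * b.1 * γ0 ^ l', b.2), x.2, -l, -l', ⟨hl, ?_⟩, ⟨hl', ?_⟩, ⟨hz x hxF, ?_⟩, ⟨hz x hxF, ?_⟩,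
    by group, rfl, by group, rfl, ?_, ?_, ?_, ?_, ?_⟩
  · rw [hy]; exact mul_ne_zero hc hv2
  · rw [hy']; exact mul_ne_zero hc' hu2
  · rw [Vv_false]; exact z11
  · rw [Vv_true]; exact z10
  · rw [hy, sl_smul hc]; exact lt_sl hv2 q3
  · rw [hy, sl_smul hc, Vv_false]; exact sl_lt hv2 q4
  · rw [Vv_false, Vv_true]
    simp only [sl]
    rw [← sub_pos, div_sub_div _ _ z10 z11]
    apply div_pos _ q1
    linarith [det2 (r x.2)]
  · rw [hy', sl_smul hc', Vv_true]; exact lt_sl hu2 q5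
  · rw [hy', sl_smul hc']; exact sl_lt hu2 q6

lemma between {w' w v : ℝ × ℝ} (hκ : 0 < dt w' w) (h : 0 < dt w' v * dt v w) (hw : 0 ≤ w.2) (hw' : 0 ≤ w'.2) :
    v.2 ≠ 0 ∧ (0 < w.2 → sl w < sl v) ∧ (0 < w'.2 → sl v < sl w') := by
  have id1 : v.2 * dt w' w = dt v w * w'.2 + dt w' v * w.2 := by unfold dt; ring
  have hv : v.2 ≠ 0 := by
    intro hv
    rw [hv, zero_mul] at id1
    have e : dt v w ^ 2 * w'.2 + (dt w' v * dt v w) * w.2 = 0 := by linear_combination - dt v w * id1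
    have h3 : dt v w ≠ 0 := right_ne_zero_of_mul h.ne'
    have h4 : 0 < dt v w ^ 2 := by positivity
    have e1 : w.2 = 0 := by nlinarith [mul_nonneg h4.le hw', mul_nonneg h.le hw]
    have e2 : w'.2 = 0 := by nlinarith [mul_nonneg h4.le hw', mul_nonneg h.le hw]
    unfold dt at hκ
    rw [e1, e2] at hκ
    simp at hκ
  refine ⟨hv, fun hp => ?_, fun hp => ?_⟩
  · have h4 : 0 < dt v w * v.2 := by
      apply pos_of_mul_pos_left _ hκ.le
      have : dt v w * v.2 * dt w' w = dt v w ^ 2 * w'.2 + (dt w' v * dt v w) * w.2 := by linear_combination dt v w * id1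
      rw [this]
      have := mul_pos h hp
      positivity
    unfold sl
    rw [← sub_pos, div_sub_div _ _ hv hp.ne']
    have e : (v.1 * w.2 - v.2 * w.1) / (v.2 * w.2) = (dt v w * v.2) / (v.2 ^ 2 * w.2) := by unfold dt; field_simp
    rw [e]
    positivity
  · have h4 : 0 < dt w' v * v.2 := by
      apply pos_of_mul_pos_left _ hκ.le
      have : dt w' v * v.2 * dt w' w = dt w' v ^ 2 * w.2 + (dt w' v * dt v w) * w'.2 := by linear_combination dt w' v * id1
      rw [this]
      have := mul_pos h hp
      positivity
    unfold sl
    rw [← sub_pos, div_sub_div _ _ hp.ne' hv]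
    have e : (w'.1 * v.2 - w'.2 * v.1) / (w'.2 * v.2) = (dt w' v * v.2) / (v.2 ^ 2 * w'.2) := by unfold dt; field_simp
    rw [e]
    positivity

lemma unit_pos {v : ℝ × ℝ} (hv : v.2 ≠ 0) : ∃ (s : ℝ) (w : ℝ × ℝ), v = s • w ∧ ip w w = 1 ∧ 0 < w.2 ∧ sl w = sl v := by
  have hv0 : v ≠ 0 := fun h => hv (by rw [h]; rfl)
  have hi := ip_self_pos hv0
  have hq : 0 < √(ip v v) := Real.sqrt_pos.2 hi
  have hqq : √(ip v v) ^ 2 = ip v v := Real.sq_sqrt hi.le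
  have main : ∀ s : ℝ, s ≠ 0 → s ^ 2 = ip v v → 0 < s⁻¹ * v.2 → ∃ (s : ℝ) (w : ℝ × ℝ), v = s • w ∧ ip w w = 1 ∧ 0 < w.2 ∧ sl w = sl v := by
    intro s hs h1 h2
    refine ⟨s, s⁻¹ • v, ?_, ?_, h2, sl_smul (inv_ne_zero hs) v⟩
    · rw [smul_smul, mul_inv_cancel₀ hs, one_smul]
    · rw [ip_smul, ← h1]; field_simp
  rcases lt_or_gt_of_ne hv with h | h
  · exact main (-√(ip v v)) (by linarith) (by rw [neg_sq, hqq]) (mul_pos_of_neg_of_neg (inv_lt_zero.2 (by linarith)) h)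
  · exact main (√(ip v v)) hq.ne' hqq (by positivity)

lemma fin_bd {α : Type*} (F : Finset α) (f : α → ℝ) : ∃ C, ∀ x ∈ F, f x ≤ C := by
  classical
  obtain ⟨C, hC⟩ := (F.image f).bddAbove
  exact ⟨C, fun x hx => hC (by simpa using ⟨x, hx, rfl⟩)⟩

end
end Hit

namespace Hit
open Filter Topology

section
variable {Γ : Type} [Group Γ]

lemma inX_finite {r : Γ →* SL 2 ℝ} (hr : Good r) (R : ℝ) : {a | InX r R a}.Finite := by
  refine ((hr.fb R).prod (Set.finite_univ (α := Bool))).subset fun a ha => ?_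
  exact ⟨ha.1, trivial⟩

lemma exists_data {r : Γ →* SL 2 ℝ} {γ0 B : Γ} {T : ℝ} (N : NDat r γ0 B T) : ∃ D : Dat Γ, Compat D r ∧ D.MP := by
  classical
  obtain ⟨R0, hR0⟩ := N.gd.cc
  have hR02 : 2 ≤ R0 := by
    obtain ⟨γ, h⟩ := hR0 1
    exact (N2_ge _).trans h
  have b10 := N.b10
  have b11 := N.b11
  have b01 := N.b01
  have b00 := N.b00
  have hpq : sl (Vv r (B, false)) < sl (Vv r (B, true)) := by
    rw [Vv_false, Vv_true]
    simp only [sl]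
    rw [← sub_pos, div_sub_div _ _ b10.ne' b11.ne']
    apply div_pos _ (by positivity)
    linarith [det2 (r B)]
  obtain ⟨F, hF⟩ := finM N.gd hpq R0
  obtain ⟨C', hC'⟩ := fin_bd F fun x => N2 (r x.1)
  obtain ⟨Z, hZ⟩ := fin_bd F fun x => N2 (r x.2)
  set C := max C' 1 with hCd
  have hC : ∀ x ∈ F, N2 (r x.1) ≤ C := fun x hx => (hC' x hx).trans (le_max_left _ _)
  have hC1 : 1 ≤ C := le_max_right _ _
  have hE1 : 1 ≤ 1 + Real.exp (2 * T) := by linarith [Real.exp_pos (2 * T)]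
  have hC2 : 0 < C * R0 := by positivity
  set ε := 1 / (2 * (C * R0) * (1 + Real.exp (2 * T))) with hεd
  have hε : 0 < ε := by positivity
  have c2 : (C * R0) ^ 2 * ε ^ 2 * (1 + Real.exp (2 * T)) ^ 2 ≤ 1 / 2 := by
    have : (C * R0) ^ 2 * ε ^ 2 * (1 + Real.exp (2 * T)) ^ 2 = 1 / 4 := by
      rw [hεd]
      generalize 1 + Real.exp (2 * T) = E at *
      generalize C * R0 = c at *
      field_simp
      norm_num
    rw [this]; norm_num
  obtain ⟨G, hG⟩ := density N.gd hε
  obtain ⟨Y, hY⟩ := fin_bd G fun x => N2 (r x)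
  obtain ⟨R, hR⟩ : ∃ R, R = max (4 * (C * R0)) (max Z (max Y (max (N2 (r 1)) (max (N2 (r B)) (N2 (r (γ0 * B))))))) := ⟨_, rfl⟩
  have r1 : 4 * (C * R0) ≤ R := by rw [hR]; simp
  have hRp : 0 ≤ R := by linarith
  have hRE : R ≤ R * (1 + Real.exp (2 * T)) := by nlinarith
  have r2 : Z ≤ R * (1 + Real.exp (2 * T)) := le_trans (by rw [hR]; simp) hRE
  have r3 : Y ≤ R * (1 + Real.exp (2 * T)) := le_trans (by rw [hR]; simp) hRE
  have r4 : N2 (r 1) ≤ R * (1 + Real.exp (2 * T)) := le_trans (by rw [hR]; simp) hRE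
  have r5 : N2 (r B) ≤ R * (1 + Real.exp (2 * T)) := le_trans (by rw [hR]; simp) hRE
  have r6 : N2 (r (γ0 * B)) ≤ R * (1 + Real.exp (2 * T)) := le_trans (by rw [hR]; simp) hRE
  have c1 : 12 * (C * R0) ^ 2 ≤ R ^ 2 := by nlinarith
  have hz : ∀ x ∈ F, N2 (r x.2) ≤ R * (1 + Real.exp (2 * T)) := fun x hx => (hZ x hx).trans r2
  set RR := R * (1 + Real.exp (2 * T)) with hRR
  have memX : ∀ a, a ∈ (inX_finite N.gd RR).toFinset ↔ InX r RR a := fun a => by simp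
  have vg : Vv r (γ0 * B, false) = (Real.exp T * r B 0 1, Real.exp (-T) * r B 1 1) := by
    rw [Vv_mul, Vv_false, N.hT]
    simp [act]
  let D : Dat Γ :=
    { γ0 := γ0
      B := B
      X := (inX_finite N.gd RR).toFinset
      pos := fun a => sl (Vv r a)
      h0 := (memX _).2 ⟨r4, by rw [Vv_false, map_one]; exact one_ne_zero⟩
      pos0 := by rw [Vv_false, map_one]; simp [sl]
      hp := (memX _).2 ⟨r5, by rw [Vv_false]; exact b11.ne'⟩
      hq := (memX _).2 ⟨r5, by rw [Vv_true]; exact b10.ne'⟩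
      hr := (memX _).2 ⟨r6, by rw [vg]; positivity⟩
      h0p := by rw [Vv_false]; exact div_pos b01 b11
      hpq := hpq
      hqr := by
        rw [Vv_true, vg]
        simp only [sl]
        have h := N.bT
        rw [div_lt_div_iff₀ b10 (by positivity)]
        have e : Real.exp (2 * T) = Real.exp T * Real.exp T := by rw [← Real.exp_add]; congr 1; ring
        have e2 : Real.exp (-T) * Real.exp T = 1 := by rw [← Real.exp_add]; simp
        have h3 := mul_lt_mul_of_pos_left h (Real.exp_pos (-T))
        rw [e] at h3
        calc r B 0 0 * (Real.exp (-T) * r B 1 1) = Real.exp (-T) * (r B 0 0 * r B 1 1) := by ring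
          _ < _ := h3
          _ = (Real.exp (-T) * Real.exp T) * (Real.exp T * r B 0 1 * r B 1 0) := by ring
          _ = _ := by rw [e2, one_mul] }
  have core : ∀ {a b : Γ × Bool} {w w' : ℝ × ℝ} {s s' : ℝ}, N2 (r a.1) ≤ RR → N2 (r b.1) ≤ RR → ip w w = 1 → ip w' w' = 1 →
      0 < dt w' w → dt w' w ≤ ε → Vv r a = s • w → Vv r b = s' • w' → D.Rel a b := by
    intro a b w w' s s' ha hb hw hw' hk hk' hV hV'
    obtain ⟨γ, y, y', z, l, l', h1, h2, h3, h4, h5⟩ := rel_core N hR0 hF hC hz hRp c1 c2 ha hb hw hw' hk hk' hV hV'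
    exact ⟨γ, y, y', z, l, l', (memX _).2 h1, (memX _).2 h2, (memX _).2 h3, (memX _).2 h4, h5⟩
  have dens : ∀ {w w' : ℝ × ℝ}, ip w w = 1 → ip w' w' = 1 → 0 < dt w' w → ¬ dt w' w ≤ ε → 0 ≤ w.2 → 0 ≤ w'.2 →
      ∃ y ∈ D.X, (0 < w.2 → sl w < D.pos y) ∧ (0 < w'.2 → D.pos y < sl w') := by
    intro w w' hw hw' hk hk' h2 h2'
    obtain ⟨η, hη, h⟩ := hG w' w hw' hw (not_le.1 hk').le
    obtain ⟨k1, k2, k3⟩ := between hk h h2 h2'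
    exact ⟨(η, false), (memX _).2 ⟨(hY η hη).trans r3, k1⟩, k2, k3⟩
  have v1 : Vv r (1, true) = (1, 0) := by simp [Vv, ee, act]
  refine ⟨D, ⟨⟨T, N.Tp, N.hT⟩, ?_, ?_, b11, b10⟩, ⟨?_, ?_, ?_⟩⟩
  · intro γ hγ
    have := ((memX _).1 hγ).2
    rw [Vv_false] at this
    refine ⟨this, ?_⟩
    show sl (Vv r (γ, false)) = _
    rw [Vv_false]; rfl
  · intro γ hγ
    have := ((memX _).1 hγ).2
    rw [Vv_true] at this
    refine ⟨this, ?_⟩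
    show sl (Vv r (γ, true)) = _
    rw [Vv_true]; rfl
  · intro x hx x' hx' hlt hadj
    obtain ⟨hx1, hx2⟩ := (memX _).1 hx
    obtain ⟨hx1', hx2'⟩ := (memX _).1 hx'
    obtain ⟨s, w, hV, hw, hw2, hsl⟩ := unit_pos hx2
    obtain ⟨s', w', hV', hw', hw2', hsl'⟩ := unit_pos hx2'
    have hlt' : sl w < sl w' := by rw [hsl, hsl']; exact hlt
    have hk : 0 < dt w' w := by
      unfold sl at hlt'
      rw [div_lt_div_iff₀ hw2 hw2'] at hlt'
      unfold dt; linarith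
    by_cases hk' : dt w' w ≤ ε
    · exact core hx1 hx1' hw hw' hk hk' hV hV'
    · exfalso
      obtain ⟨y, hy, h1, h2⟩ := dens hw hw' hk hk' hw2.le hw2'.le
      have h1 := h1 hw2
      have h2 := h2 hw2'
      rw [hsl] at h1
      rw [hsl'] at h2
      exact absurd (hadj y hy h1) (not_le.2 h2)
  · intro x hx hmax
    obtain ⟨hx1, hx2⟩ := (memX _).1 hx
    obtain ⟨s, w, hV, hw, hw2, hsl⟩ := unit_pos hx2
    have hw' : ip ((1, 0) : ℝ × ℝ) (1, 0) = 1 := by simp [ip]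
    have hk : 0 < dt (1, 0) w := by simpa [dt] using hw2
    by_cases hk' : dt (1, 0) w ≤ ε
    · exact core (s' := 1) hx1 r4 hw hw' hk hk' hV (by rw [v1, one_smul])
    · exfalso
      obtain ⟨y, hy, h1, h2⟩ := dens hw hw' hk hk' hw2.le le_rfl
      have h1 := h1 hw2
      rw [hsl] at h1
      exact absurd (hmax y hy) (not_le.2 h1)
  · intro x hx hmin
    obtain ⟨hx1, hx2⟩ := (memX _).1 hx
    obtain ⟨s, w, hV, hw, hw2, hsl⟩ := unit_pos hx2
    have hw' : ip ((-1, 0) : ℝ × ℝ) (-1, 0) = 1 := by simp [ip]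
    have hk : 0 < dt w (-1, 0) := by simpa [dt] using hw2
    by_cases hk' : dt w (-1, 0) ≤ ε
    · exact core (s := -1) r4 hx1 hw' hw hk hk' (by rw [v1]; simp) hV
    · exfalso
      obtain ⟨y, hy, h1, h2⟩ := dens hw' hw hk hk' le_rfl hw2.le
      have h2 := h2 hw2
      rw [hsl] at h2
      exact absurd (hmin y hy) (not_le.2 h2)

end
end Hit

namespace Hit
open Filter Topology

lemma irr_conj {n : ℕ} {j : SL 2 ℝ →* SL n ℝ} (hj : IsIrreducibleEmbedding n j) (m : SL 2 ℝ) :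
    IsIrreducibleEmbedding n (j.comp (MulAut.conj m).toMonoidHom) := by
  have e : ∀ A, (j.comp (MulAut.conj m).toMonoidHom) A = j (m * A * m⁻¹) := fun A => by simp
  refine ⟨?_, fun W hW => hj.2 W fun A v hv => ?_⟩
  · rw [continuous_induced_rng]
    have hc : Continuous fun A : SL 2 ℝ => (j A : Matrix (Fin n) (Fin n) ℝ) := continuous_induced_dom.comp hj.1
    have h2 : Continuous fun A : SL 2 ℝ => (j m : Matrix (Fin n) (Fin n) ℝ) * (j A : Matrix (Fin n) (Fin n) ℝ) * (j m⁻¹ : Matrix (Fin n) (Fin n) ℝ) :=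
      (continuous_const.matrix_mul hc).matrix_mul continuous_const
    refine h2.congr fun A => ?_
    show _ = (((j.comp (MulAut.conj m).toMonoidHom) A : SL n ℝ) : Matrix (Fin n) (Fin n) ℝ)
    rw [e, map_mul, map_mul]
    rfl
  · have := hW (m⁻¹ * A * m) v hv
    rw [e] at this
    have e2 : m * (m⁻¹ * A * m) * m⁻¹ = A := by group
    rwa [e2] at this

theorem main (g n : ℕ) (hg : 2 ≤ g) (hn : 2 ≤ n)
    (T : (Fin g × Bool) → Matrix (Fin n) (Fin n) ℝ) (hT : IsTeichmuller g n T)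
    (ρ : SurfaceGroup g →* SL n ℝ) (hρ : repTuple ρ ∈ HIT g n T)
    (ξ : SL n ℝ) (hξ : ∀ γ : SurfaceGroup g, ξ * ρ γ = ρ γ * ξ) :
    (ξ : Matrix (Fin n) (Fin n) ℝ) = 1 ∨ (ξ : Matrix (Fin n) (Fin n) ℝ) = -1 := by
  obtain ⟨ρ₀, j, ⟨hi, hd⟩, hj, rfl⟩ := hT
  obtain ⟨m, γ0, B, t, N⟩ := exists_norm hg ρ₀ hi (finite_balls ρ₀ hi hd)
  obtain ⟨D, hc, mp⟩ := exists_data N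
  have hP := posRep_teich hc (by omega) (irr_conj hj m)
  have e : (j.comp (MulAut.conj m).toMonoidHom).comp (cj m ρ₀) = j.comp ρ₀ := by
    refine MonoidHom.ext fun γ => ?_
    show j (MulAut.conj m (cj m ρ₀ γ)) = j (ρ₀ γ)
    rw [cj_apply, MulAut.conj_apply]
    congr 1
    group
  rw [e] at hP
  exact (posRep_of_HIT hn D mp _ ρ hP hρ).centralizer ξ hξ

end Hit

/-- For a Hitchin representation `ρ`, any element of `SL_n(ℝ)` commuting with every
`ρ(γ)` is `I` or `−I`: the centralizer of `ρ(Γ_g)` is contained in `{I, −I}`. -/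
theorem centralizer_of_Hitchin_eq_pm_one (g n : ℕ) (hg : 2 ≤ g) (hn : 2 ≤ n)
    (T : (Fin g × Bool) → Matrix (Fin n) (Fin n) ℝ) (hT : IsTeichmuller g n T)
    (ρ : SurfaceGroup g →* SL n ℝ) (hρ : repTuple ρ ∈ HIT g n T)
    (ξ : SL n ℝ) (hξ : ∀ γ : SurfaceGroup g, ξ * ρ γ = ρ γ * ξ) :
    (ξ : Matrix (Fin n) (Fin n) ℝ) = 1 ∨ (ξ : Matrix (Fin n) (Fin n) ℝ) = -1 := by
  exact Hit.main g n hg hn T hT ρ hρ ξ hξ
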